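/- For all integers n ≥ 1, g ≥ 0 and k ≥ 1, Ganea's equality holds for symmetric products of orientable surfaces: cat(SP^n(M_g) × S^k) = cat(SP^n(M_g)) + 1; explicitly, cat(SP^n(M_g) × S^k) = 2n + 1 if n ≤ g, and = n + g + 1 if n > g. -/

import Mathlib

open scoped unitInterval Topology
open MeasureTheory
noncomputable section

/-- The `n`-th symmetric product relation on `X^n`: two tuples are related iff they
differ by a permutation of coordinates. -/
def spRel (n : ℕ) (X : Type*) (s t : Fin n → X) : Prop :=
  ∃ e : Equiv.Perm (Fin n), s ∘ e = t

/-- The `n`-th symmetric product of a topological space `X`: the quotient of the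
product space `X^n` by the permutation action of the symmetric group `S_n`,
equipped with the quotient topology. -/
def SP (n : ℕ) (X : Type*) [TopologicalSpace X] : Type _ :=
  Quot (spRel n X)

instance (n : ℕ) (X : Type*) [TopologicalSpace X] : TopologicalSpace (SP n X) :=
  inferInstanceAs (TopologicalSpace (Quot (spRel n X)))

/-- The inclusion of a subset, as a continuous map. -/
def inclMap {X : Type*} [TopologicalSpace X] (U : Set X) : C(U, X) :=
  ⟨Subtype.val, continuous_subtype_val⟩

/-- `catLE X r` : `X` is covered by `r+1` open sets, each of whose inclusion maps
into `X` is null-homotopic. -/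
def catLE (X : Type*) [TopologicalSpace X] (r : ℕ) : Prop :=
  ∃ U : Fin (r + 1) → Set X, (∀ i, IsOpen (U i)) ∧ (⋃ i, U i) = Set.univ ∧
    ∀ i, (inclMap (U i)).Nullhomotopic

/-- The Lusternik–Schnirelmann category of `X`, valued in `ℕ∞`. -/
def LScat (X : Type*) [TopologicalSpace X] : ℕ∞ :=
  sInf {c : ℕ∞ | ∃ r : ℕ, catLE X r ∧ c = r}

/-- The closed unit disc (a topological model for a polygon). -/
abbrev Disc : Type := {z : ℂ // ‖z‖ ≤ 1}

/-- The point at parameter `t ∈ [0,1]` on the `k`-th of the `N` boundary edges of an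
`N`-gon, realized as the closed unit disc whose boundary circle is divided into `N` arcs. -/
def polyBP (N k : ℕ) (t : ℝ) : ℂ :=
  Complex.exp (2 * Real.pi * Complex.I * (((k : ℝ) + t) / (N : ℝ)))

/-- Boundary identifications of the `4g`-gon for the edge word
`[a₁,b₁]⋯[a_g,b_g] = a₁b₁a₁⁻¹b₁⁻¹⋯a_gb_ga_g⁻¹b_g⁻¹` : the point at parameter `t`
on edge `4j+r` (`r = 0,1`) is glued to the point at parameter `1-t` on edge `4j+r+2`. -/
def orientRel (g : ℕ) (z w : Disc) : Prop :=
  ∃ j : Fin g, ∃ r : Fin 2, ∃ t : ℝ, 0 ≤ t ∧ t ≤ 1 ∧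
    (z : ℂ) = polyBP (4 * g) (4 * (j : ℕ) + (r : ℕ)) t ∧
    (w : ℂ) = polyBP (4 * g) (4 * (j : ℕ) + (r : ℕ) + 2) (1 - t)

/-- The closed orientable surface of genus `g` : the `2`-sphere for `g = 0`, and for
`g ≥ 1` the quotient of the `4g`-gon by the boundary edge word `[a₁,b₁]⋯[a_g,b_g]`. -/
def Mg : ℕ → Type
  | 0 => Metric.sphere (0 : EuclideanSpace ℝ (Fin 3)) 1
  | (g + 1) => Quot (orientRel (g + 1))

instance (g : ℕ) : TopologicalSpace (Mg g) := by
  cases g with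
  | zero =>
      exact inferInstanceAs (TopologicalSpace (Metric.sphere (0 : EuclideanSpace ℝ (Fin 3)) 1))
  | succ g => exact inferInstanceAs (TopologicalSpace (Quot (orientRel (g + 1))))

set_option linter.all false

section

/-! ### Cochains as functions on lists -/

/-- coboundary -/
def dl {T : Type*} : (List T → ℝ) → List T → ℝ
  | _, [] => 0
  | Φ, (a :: l) => Φ l - dl (fun m => Φ (a :: m)) l

def cup0 {T : Type*} (b : T → ℝ) (Ψ : List T → ℝ) : List T → ℝ
  | [] => 0
  | (a :: l) => b a * Ψ (a :: l)

def cup1 {T : Type*} (h : T → T → ℝ) (Ψ : List T → ℝ) : List T → ℝ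
  | (a :: b :: l) => h a b * Ψ (b :: l)
  | _ => 0

def cup2 {T : Type*} (c : T → T → T → ℝ) (Ψ : List T → ℝ) : List T → ℝ
  | (x :: y :: z :: l) => c x y z * Ψ (z :: l)
  | _ => 0

def cup3 {T : Type*} (c : T → T → T → T → ℝ) (Ψ : List T → ℝ) : List T → ℝ
  | (x :: y :: z :: w :: l) => c x y z w * Ψ (w :: l)
  | _ => 0

section basic
variable {T T' T'' : Type*}

@[simp] lemma dl_nil (Φ : List T → ℝ) : dl Φ [] = 0 := by simp [dl]
lemma dl_cons (Φ : List T → ℝ) (a : T) (l : List T) :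
    dl Φ (a :: l) = Φ l - dl (fun m => Φ (a :: m)) l := by simp [dl]

lemma dl_zero (l : List T) : dl (fun _ => 0) l = 0 := by
  induction l with
  | nil => simp
  | cons a l ih => simp [dl_cons, ih]

lemma dl_add (Φ Ψ : List T → ℝ) (l : List T) :
    dl (fun m => Φ m + Ψ m) l = dl Φ l + dl Ψ l := by
  induction l generalizing Φ Ψ with
  | nil => simp
  | cons a l ih => rw [dl_cons, dl_cons, dl_cons, ih]; ring

lemma dl_smul (c : ℝ) (Φ : List T → ℝ) (l : List T) :
    dl (fun m => c * Φ m) l = c * dl Φ l := by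
  induction l generalizing Φ with
  | nil => simp
  | cons a l ih => rw [dl_cons, dl_cons, ih]; ring

lemma dl_neg (Φ : List T → ℝ) (l : List T) :
    dl (fun m => - Φ m) l = - dl Φ l := by
  have := dl_smul (-1) Φ l
  simpa using this

lemma dl_sub (Φ Ψ : List T → ℝ) (l : List T) :
    dl (fun m => Φ m - Ψ m) l = dl Φ l - dl Ψ l := by
  have := dl_add Φ (fun m => - Ψ m) l
  rw [dl_neg] at this
  simpa [sub_eq_add_neg] using this

lemma dl_sum {ι : Type*} (s : Finset ι) (Φ : ι → List T → ℝ) (l : List T) :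
    dl (fun m => ∑ i ∈ s, Φ i m) l = ∑ i ∈ s, dl (Φ i) l := by
  classical
  induction s using Finset.induction_on with
  | empty => simp [dl_zero]
  | insert a s ha ih => simp [Finset.sum_insert ha, dl_add, ih]

/-- the coboundary is natural -/
lemma dl_map (f : T → T') (Φ : List T' → ℝ) (l : List T) :
    dl (fun m => Φ (m.map f)) l = dl Φ (l.map f) := by
  induction l generalizing Φ with
  | nil => simp
  | cons a l ih =>
    rw [dl_cons, List.map_cons, dl_cons, ← ih (fun m => Φ (f a :: m))]
    simp

/-- value of `dl` depends only on sublists -/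
lemma dl_congr (Φ Ψ : List T → ℝ) (l : List T)
    (h : ∀ m, List.Sublist m l → m.length + 1 = l.length → Φ m = Ψ m) : dl Φ l = dl Ψ l := by
  induction l generalizing Φ Ψ with
  | nil => simp
  | cons a l ih =>
    rw [dl_cons, dl_cons, h l (List.sublist_cons_self a l) (by simp),
      ih (fun m => Φ (a :: m)) (fun m => Ψ (a :: m))]
    intro m hm hl
    exact h _ (hm.cons_cons a) (by simp [hl])

def d0 (b : T → ℝ) : T → T → ℝ := fun x y => b y - b x
def d1 (h : T → T → ℝ) : T → T → T → ℝ := fun x y z => h y z - h x z + h x y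
def d2 (c : T → T → T → ℝ) : T → T → T → T → ℝ :=
  fun x y z w => c y z w - c x z w + c x y w - c x y z

lemma dl_two (Φ : List T → ℝ) (a b : T) : dl Φ [a, b] = Φ [b] - Φ [a] := by
  simp [dl_cons]
lemma dl_three (Φ : List T → ℝ) (a b c : T) :
    dl Φ [a, b, c] = Φ [b, c] - Φ [a, c] + Φ [a, b] := by
  simp [dl_cons]; ring
lemma dl_four (Φ : List T → ℝ) (a b c e : T) :
    dl Φ [a, b, c, e] = Φ [b, c, e] - Φ [a, c, e] + Φ [a, b, e] - Φ [a, b, c] := by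
  simp [dl_cons]; ring

lemma leib0 (b : T → ℝ) (Ψ : List T → ℝ) (h0 : Ψ [] = 0) (l : List T) :
    dl (cup0 b Ψ) l = cup1 (d0 b) Ψ l + cup0 b (dl Ψ) l := by
  rcases l with _ | ⟨x, _ | ⟨y, l⟩⟩
  · simp [cup0, cup1]
  · simp [cup0, cup1, dl_cons, h0]
  · have : (fun m => cup0 b Ψ (x :: m)) = fun m => b x * Ψ (x :: m) := by
      funext m; simp [cup0]
    rw [dl_cons, this, dl_smul]
    simp only [cup0, cup1, dl_cons Ψ x, d0]
    ring

lemma leib1 (h : T → T → ℝ) (Ψ : List T → ℝ) (h0 : Ψ [] = 0) (l : List T) :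
    dl (cup1 h Ψ) l = cup2 (d1 h) Ψ l - cup1 h (dl Ψ) l := by
  rcases l with _ | ⟨x, _ | ⟨y, l⟩⟩
  · simp [cup2, cup1]
  · simp [cup2, cup1, dl_cons]
  · have : (fun m => (fun m => cup1 h Ψ (x :: m)) (y :: m)) = fun m => h x y * Ψ (y :: m) := by
      funext m; simp [cup1]
    rw [dl_cons, dl_cons, this, dl_smul]
    rcases l with _ | ⟨z, l⟩
    · simp [cup1, cup2, dl_cons, h0]
    · simp only [cup1, cup2, dl_cons Ψ y, d1]
      ring

lemma leib2 (c : T → T → T → ℝ) (Ψ : List T → ℝ) (h0 : Ψ [] = 0) (l : List T) :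
    dl (cup2 c Ψ) l = cup3 (d2 c) Ψ l + cup2 c (dl Ψ) l := by
  rcases l with _ | ⟨x, _ | ⟨y, l⟩⟩
  · simp [cup2, cup3]
  · simp [cup2, cup3, dl_cons]
  · have h1 : (fun m => cup2 c Ψ (x :: m)) = cup1 (c x) Ψ := by
      funext m
      rcases m with _ | ⟨u, _ | ⟨v, m⟩⟩ <;> simp [cup1, cup2]
    rw [dl_cons, h1, leib1 _ _ h0]
    rcases l with _ | ⟨z, _ | ⟨w, l⟩⟩
    · simp [cup1, cup2, cup3, dl_cons, h0]
    · simp [cup1, cup2, cup3, d1, dl_cons, h0]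
    · simp only [cup1, cup2, cup3, d1, d2, dl_cons Ψ]
      ring

/-- prism operator between two maps -/
def pr (f g : T → T') : (List T' → ℝ) → List T → ℝ
  | _, [] => 0
  | Φ, (a :: l) => Φ (f a :: g a :: l.map g) - pr f g (fun m => Φ (f a :: m)) l

@[simp] lemma pr_nil (f g : T → T') (Φ : List T' → ℝ) : pr f g Φ [] = 0 := by simp [pr]
lemma pr_cons (f g : T → T') (Φ : List T' → ℝ) (a : T) (l : List T) :
    pr f g Φ (a :: l) = Φ (f a :: g a :: l.map g) - pr f g (fun m => Φ (f a :: m)) l := by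
  simp [pr]

lemma pr_zero (f g : T → T') (l : List T) : pr f g (fun _ => 0) l = 0 := by
  induction l with
  | nil => simp
  | cons a l ih => simp [pr_cons, ih]

lemma pr_add (f g : T → T') (Φ Ψ : List T' → ℝ) (l : List T) :
    pr f g (fun m => Φ m + Ψ m) l = pr f g Φ l + pr f g Ψ l := by
  induction l generalizing Φ Ψ with
  | nil => simp
  | cons a l ih => rw [pr_cons, pr_cons, pr_cons, ih]; ring

lemma pr_smul (f g : T → T') (c : ℝ) (Φ : List T' → ℝ) (l : List T) :
    pr f g (fun m => c * Φ m) l = c * pr f g Φ l := by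
  induction l generalizing Φ with
  | nil => simp
  | cons a l ih => rw [pr_cons, pr_cons, ih]; ring

lemma pr_neg (f g : T → T') (Φ : List T' → ℝ) (l : List T) :
    pr f g (fun m => - Φ m) l = - pr f g Φ l := by
  have := pr_smul f g (-1) Φ l
  simpa using this

lemma pr_sub (f g : T → T') (Φ Ψ : List T' → ℝ) (l : List T) :
    pr f g (fun m => Φ m - Ψ m) l = pr f g Φ l - pr f g Ψ l := by
  have := pr_add f g Φ (fun m => - Ψ m) l
  rw [pr_neg] at this
  simpa [sub_eq_add_neg] using this

lemma pr_sum {ι : Type*} (f g : T → T') (s : Finset ι) (Φ : ι → List T' → ℝ) (l : List T) :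
    pr f g (fun m => ∑ i ∈ s, Φ i m) l = ∑ i ∈ s, pr f g (Φ i) l := by
  classical
  induction s using Finset.induction_on with
  | empty => simp [pr_zero]
  | insert a s ha ih => simp [Finset.sum_insert ha, pr_add, ih]

lemma pr_map (k : T' → T'') (f g : T → T') (Φ : List T'' → ℝ) (l : List T) :
    pr f g (fun m => Φ (m.map k)) l = pr (k ∘ f) (k ∘ g) Φ l := by
  induction l generalizing Φ with
  | nil => simp
  | cons a l ih =>
    rw [pr_cons, pr_cons]
    have := ih (fun m => Φ (k (f a) :: m))
    simp only [List.map_cons, List.map_map, Function.comp_apply]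
    rw [this]

lemma pr_premap (k : T'' → T) (f g : T → T') (Φ : List T' → ℝ) (l : List T'') :
    pr f g Φ (l.map k) = pr (f ∘ k) (g ∘ k) Φ l := by
  induction l generalizing Φ with
  | nil => simp
  | cons a l ih =>
    rw [List.map_cons, pr_cons, pr_cons, ih]
    simp

/-- prism identity -/
lemma dl_pr (f g : T → T') (Φ : List T' → ℝ) (l : List T) :
    dl (pr f g Φ) l + pr f g (dl Φ) l = Φ (l.map g) - Φ (l.map f) := by
  induction l generalizing Φ with
  | nil => simp
  | cons a l ih =>
    have h1 : (fun m => pr f g Φ (a :: m)) =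
        fun m => Φ (f a :: g a :: m.map g) - pr f g (fun m => Φ (f a :: m)) m := by
      funext m; rw [pr_cons]
    have h2 : (fun m => dl Φ (f a :: m)) = fun m => Φ m - dl (fun m => Φ (f a :: m)) m := by
      funext m; rw [dl_cons]
    have h3 : dl (fun m => Φ (f a :: g a :: m.map g)) l
        = dl (fun m => Φ (f a :: g a :: m)) (l.map g) := by
      rw [← dl_map g (fun m => Φ (f a :: g a :: m))]
    rw [dl_cons, pr_cons, h1, h2, dl_sub, pr_sub, dl_cons, dl_cons, h3]
    have := ih (fun m => Φ (f a :: m))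
    simp only [List.map_cons]
    linarith

lemma pr_cup0 (f g : T → T') (b : T' → ℝ) (Ψ : List T' → ℝ) (l : List T) :
    pr f g (cup0 b Ψ) l = cup0 (fun a => b (f a)) (pr f g Ψ) l := by
  rcases l with _ | ⟨a, l⟩
  · simp [cup0]
  · have : (fun m => cup0 b Ψ (f a :: m)) = fun m => b (f a) * Ψ (f a :: m) := by
      funext m; simp [cup0]
    rw [pr_cons, this, pr_smul]
    simp only [cup0, pr_cons]
    ring

lemma pr_cup1 (f g : T → T') (h : T' → T' → ℝ) (Ψ : List T' → ℝ) (l : List T) :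
    pr f g (cup1 h Ψ) l = cup0 (fun a => h (f a) (g a)) (fun m => Ψ (m.map g)) l
      - cup1 (fun a b => h (f a) (f b)) (pr f g Ψ) l := by
  rcases l with _ | ⟨a, _ | ⟨b, l⟩⟩
  · simp [cup0, cup1]
  · simp [cup0, cup1, pr_cons]
  · have h1 : (fun m => (fun m => cup1 h Ψ (f a :: m)) (f b :: m)) =
        fun m => h (f a) (f b) * Ψ (f b :: m) := by
      funext m; simp [cup1]
    rw [pr_cons, pr_cons, h1, pr_smul]
    simp only [cup0, cup1, pr_cons, List.map_cons]
    ring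

lemma pr_cup2 (f g : T → T') (c : T' → T' → T' → ℝ) (Ψ : List T' → ℝ) (l : List T) :
    pr f g (cup2 c Ψ) l =
      cup1 (fun a b => c (f a) (g a) (g b) - c (f a) (f b) (g b)) (fun m => Ψ (m.map g)) l
      + cup2 (fun a b e => c (f a) (f b) (f e)) (pr f g Ψ) l := by
  rcases l with _ | ⟨a, l⟩
  · simp [cup2, cup1]
  · have h1 : (fun m => cup2 c Ψ (f a :: m)) = cup1 (c (f a)) Ψ := by
      funext m
      rcases m with _ | ⟨u, _ | ⟨v, m⟩⟩ <;> simp [cup1, cup2]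
    rw [pr_cons, h1, pr_cup1]
    rcases l with _ | ⟨b, _ | ⟨e, l⟩⟩
    · simp [cup2, cup1, cup0]
    · simp [cup2, cup1, cup0]
      ring
    · simp [cup2, cup1, cup0]
      ring

lemma cup0_map (f : T → T') (b : T' → ℝ) (Ψ : List T' → ℝ) (l : List T) :
    cup0 b Ψ (l.map f) = cup0 (fun a => b (f a)) (fun m => Ψ (m.map f)) l := by
  rcases l with _ | ⟨a, l⟩ <;> simp [cup0]
lemma cup1_map (f : T → T') (h : T' → T' → ℝ) (Ψ : List T' → ℝ) (l : List T) :
    cup1 h Ψ (l.map f) = cup1 (fun a b => h (f a) (f b)) (fun m => Ψ (m.map f)) l := by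
  rcases l with _ | ⟨a, _ | ⟨b, l⟩⟩ <;> simp [cup1]
lemma cup2_map (f : T → T') (c : T' → T' → T' → ℝ) (Ψ : List T' → ℝ) (l : List T) :
    cup2 c Ψ (l.map f) = cup2 (fun a b e => c (f a) (f b) (f e)) (fun m => Ψ (m.map f)) l := by
  rcases l with _ | ⟨a, _ | ⟨b, _ | ⟨e, l⟩⟩⟩ <;> simp [cup2]

/-- alternating (parity oriented) sum of prisms along a discrete interval -/
def sl (N : ℕ) (Φ : List (T × ℕ) → ℝ) (l : List T) : ℝ :=
  ∑ j ∈ Finset.range N, if Even j then pr (fun a => (a, j)) (fun a => (a, j + 1)) Φ l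
    else - pr (fun a => (a, j + 1)) (fun a => (a, j)) Φ l

lemma dl_sl (N : ℕ) (Φ : List (T × ℕ) → ℝ) (l : List T) :
    dl (sl N Φ) l + sl N (dl Φ) l =
      Φ (l.map fun a => (a, N)) - Φ (l.map fun a => (a, 0)) := by
  have h1 : dl (sl N Φ) l = ∑ j ∈ Finset.range N, dl (fun l =>
      if Even j then pr (fun a => (a, j)) (fun a => (a, j + 1)) Φ l
      else - pr (fun a => (a, j + 1)) (fun a => (a, j)) Φ l) l := by
    rw [← dl_sum]; rfl
  have h2 : Φ (l.map fun a => (a, N)) - Φ (l.map fun a => (a, 0)) =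
      ∑ j ∈ Finset.range N, (Φ (l.map fun a => (a, j + 1)) - Φ (l.map fun a => (a, j))) := by
    rw [Finset.sum_range_sub (fun j => Φ (l.map fun a => (a, j)))]
  rw [h1, h2, sl, ← Finset.sum_add_distrib]
  refine Finset.sum_congr rfl fun j _ => ?_
  split_ifs with h
  · exact dl_pr _ _ _ _
  · rw [dl_neg]
    have := dl_pr (fun a : T => (a, j + 1)) (fun a => (a, j)) Φ l
    linarith

lemma sl_add (N : ℕ) (Φ Ψ : List (T × ℕ) → ℝ) (l : List T) :
    sl N (fun m => Φ m + Ψ m) l = sl N Φ l + sl N Ψ l := by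
  simp only [sl, ← Finset.sum_add_distrib]
  refine Finset.sum_congr rfl fun j _ => ?_
  split_ifs <;> rw [pr_add]; ring

lemma sl_smul (N : ℕ) (c : ℝ) (Φ : List (T × ℕ) → ℝ) (l : List T) :
    sl N (fun m => c * Φ m) l = c * sl N Φ l := by
  simp only [sl, Finset.mul_sum]
  refine Finset.sum_congr rfl fun j _ => ?_
  split_ifs <;> rw [pr_smul]; ring

lemma sl_sub (N : ℕ) (Φ Ψ : List (T × ℕ) → ℝ) (l : List T) :
    sl N (fun m => Φ m - Ψ m) l = sl N Φ l - sl N Ψ l := by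
  have h1 := sl_add N Φ (fun m => (-1) * Ψ m) l
  rw [sl_smul] at h1
  simpa [sub_eq_add_neg] using h1

lemma pr_congr (f g : T → T') (Φ Ψ : List T' → ℝ) (l : List T)
    (h : ∀ l₁ a l₂, l = l₁ ++ a :: l₂ →
      Φ (l₁.map f ++ f a :: g a :: l₂.map g) = Ψ (l₁.map f ++ f a :: g a :: l₂.map g)) :
    pr f g Φ l = pr f g Ψ l := by
  induction l generalizing Φ Ψ with
  | nil => simp
  | cons a l ih =>
    rw [pr_cons, pr_cons]
    have h1 := h [] a l rfl
    simp only [List.map_nil, List.nil_append] at h1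
    rw [h1, ih (fun m => Φ (f a :: m)) (fun m => Ψ (f a :: m))]
    intro l₁ b l₂ hl
    have := h (a :: l₁) b l₂ (by simp [hl])
    simpa using this

end basic
end

section

/-! ### Products of classes of degree one and two -/

inductive Cls (T : Type*) where
  | one (h : T → T → ℝ) : Cls T
  | two (c : T → T → T → ℝ) : Cls T

section prods
variable {T T' : Type*}

def Cls.cup : Cls T → (List T → ℝ) → List T → ℝ
  | Cls.one h => cup1 h
  | Cls.two c => cup2 c

def prodR (L : List (Cls T)) (Ω : List T → ℝ) : List T → ℝ := L.foldr Cls.cup Ω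

@[simp] lemma prodR_nil (Ω : List T → ℝ) : prodR [] Ω = Ω := rfl
@[simp] lemma prodR_cons (C : Cls T) (L : List (Cls T)) (Ω : List T → ℝ) :
    prodR (C :: L) Ω = C.cup (prodR L Ω) := rfl

/-- the value of a class on a list -/
def Cls.val : Cls T → List T → ℝ
  | Cls.one h => fun l => match l with
    | [x, y] => h x y
    | _ => 0
  | Cls.two c => fun l => match l with
    | [x, y, z] => c x y z
    | _ => 0

def Cls.cocyc (Fi : List T → Prop) : Cls T → Prop
  | Cls.one h => ∀ x y z, Fi [x, y, z] → d1 h x y z = 0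
  | Cls.two c => ∀ x y z w, Fi [x, y, z, w] → d2 c x y z w = 0

def Cls.coh (Fi : List T → Prop) : Cls T → Cls T → Prop
  | Cls.one h, Cls.one h' => ∃ b : T → ℝ, ∀ x y, Fi [x, y] → h x y - h' x y = d0 b x y
  | Cls.two c, Cls.two c' => ∃ b : T → T → ℝ, ∀ x y z, Fi [x, y, z] →
      c x y z - c' x y z = d1 b x y z
  | _, _ => False

def Coh (Fi : List T → Prop) (Φ Φ' : List T → ℝ) : Prop :=
  ∃ Ψ : List T → ℝ, Ψ [] = 0 ∧ ∀ l, Fi l → Φ l - Φ' l = dl Ψ l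

lemma Coh.refl (Fi : List T → Prop) (Φ : List T → ℝ) : Coh Fi Φ Φ :=
  ⟨fun _ => 0, rfl, fun l _ => by simp [dl_zero]⟩

lemma Coh.trans {Fi : List T → Prop} {Φ Φ' Φ'' : List T → ℝ} (h : Coh Fi Φ Φ')
    (h' : Coh Fi Φ' Φ'') : Coh Fi Φ Φ'' := by
  obtain ⟨A, hA, hA'⟩ := h
  obtain ⟨B, hB, hB'⟩ := h'
  refine ⟨fun m => A m + B m, by simp [hA, hB], fun l hl => ?_⟩
  rw [dl_add, ← hA' l hl, ← hB' l hl]; ring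

lemma Cls.cup_nil (C : Cls T) (Φ : List T → ℝ) : C.cup Φ [] = 0 := by
  cases C <;> simp [Cls.cup, cup1, cup2]

lemma prodR_nil_val (L : List (Cls T)) (Ω : List T → ℝ) (h : Ω [] = 0) : prodR L Ω [] = 0 := by
  cases L with
  | nil => simpa using h
  | cons C L => simp [Cls.cup_nil]

variable {Fi : List T → Prop}

lemma cup1_eqOn (hFi : ∀ m l, List.Sublist m l → Fi l → Fi m) {h : T → T → ℝ}
    {Φ Φ' : List T → ℝ} (H : ∀ l, Fi l → Φ l = Φ' l) (l : List T) (hl : Fi l) :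
    cup1 h Φ l = cup1 h Φ' l := by
  rcases l with _ | ⟨a, _ | ⟨b, l⟩⟩
  · simp [cup1]
  · simp [cup1]
  · simp only [cup1]
    rw [H _ (hFi _ _ (List.sublist_cons_self _ _) hl)]

lemma cup0_eqOn {h : T → ℝ}
    {Φ Φ' : List T → ℝ} (H : ∀ l, Fi l → Φ l = Φ' l) (l : List T) (hl : Fi l) :
    cup0 h Φ l = cup0 h Φ' l := by
  rcases l with _ | ⟨a, l⟩
  · simp [cup0]
  · simp only [cup0]
    rw [H _ hl]

lemma cup2_eqOn (hFi : ∀ m l, List.Sublist m l → Fi l → Fi m) {c : T → T → T → ℝ}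
    {Φ Φ' : List T → ℝ} (H : ∀ l, Fi l → Φ l = Φ' l) (l : List T) (hl : Fi l) :
    cup2 c Φ l = cup2 c Φ' l := by
  rcases l with _ | ⟨a, _ | ⟨b, _ | ⟨e, l⟩⟩⟩
  · simp [cup2]
  · simp [cup2]
  · simp [cup2]
  · simp only [cup2]
    rw [H _ (hFi _ _ ((List.sublist_cons_self b _).trans (List.sublist_cons_self a _)) hl)]

lemma cup1_zero (h : T → T → ℝ) (l : List T) : cup1 h (fun _ => 0) l = 0 := by
  rcases l with _ | ⟨a, _ | ⟨b, l⟩⟩ <;> simp [cup1]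
lemma cup0_zero (h : T → ℝ) (l : List T) : cup0 h (fun _ => 0) l = 0 := by
  rcases l with _ | ⟨a, l⟩ <;> simp [cup0]
lemma cup2_zero (h : T → T → T → ℝ) (l : List T) : cup2 h (fun _ => 0) l = 0 := by
  rcases l with _ | ⟨a, _ | ⟨b, _ | ⟨e, l⟩⟩⟩ <;> simp [cup2]

lemma sub3 (a b c : T) (l : List T) : List.Sublist [a, b, c] (a :: b :: c :: l) := by
  simp
lemma sub4 (a b c e : T) (l : List T) : List.Sublist [a, b, c, e] (a :: b :: c :: e :: l) := by
  simp

lemma Cls.dl_cup (hFi : ∀ m l, List.Sublist m l → Fi l → Fi m) (C : Cls T) (hC : C.cocyc Fi)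
    (Ψ : List T → ℝ) (h0 : Ψ [] = 0) :
    ∃ e : ℝ, e * e = 1 ∧ ∀ l, Fi l → dl (C.cup Ψ) l = e * C.cup (dl Ψ) l := by
  cases C with
  | one h =>
    refine ⟨-1, by norm_num, fun l hl => ?_⟩
    simp only [Cls.cup]
    rw [leib1 _ _ h0]
    have : cup2 (d1 h) Ψ l = 0 := by
      rcases l with _ | ⟨a, _ | ⟨b, _ | ⟨e, l⟩⟩⟩
      · simp [cup2]
      · simp [cup2]
      · simp [cup2]
      · simp only [cup2]
        rw [hC a b e (hFi _ _ (sub3 _ _ _ _) hl)]; ring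
    rw [this]; ring
  | two c =>
    refine ⟨1, by norm_num, fun l hl => ?_⟩
    simp only [Cls.cup]
    rw [leib2 _ _ h0]
    have : cup3 (d2 c) Ψ l = 0 := by
      rcases l with _ | ⟨a, _ | ⟨b, _ | ⟨e, _ | ⟨f, l⟩⟩⟩⟩
      · simp [cup3]
      · simp [cup3]
      · simp [cup3]
      · simp [cup3]
      · simp only [cup3]
        rw [hC a b e f (hFi _ _ (sub4 _ _ _ _ _) hl)]; ring
    rw [this]; ring

lemma Cls.cup_eqOn (hFi : ∀ m l, List.Sublist m l → Fi l → Fi m) (C : Cls T)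
    {Φ Φ' : List T → ℝ} (H : ∀ l, Fi l → Φ l = Φ' l) (l : List T) (hl : Fi l) :
    C.cup Φ l = C.cup Φ' l := by
  cases C with
  | one h => exact cup1_eqOn hFi H l hl
  | two c => exact cup2_eqOn hFi H l hl

lemma Cls.cup_zero (C : Cls T) (l : List T) : C.cup (fun _ => 0) l = 0 := by
  cases C with
  | one h => exact cup1_zero h l
  | two c => exact cup2_zero c l

lemma Cls.cup_sub (C : Cls T) (Φ Φ' : List T → ℝ) (l : List T) :
    C.cup (fun m => Φ m - Φ' m) l = C.cup Φ l - C.cup Φ' l := by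
  cases C with
  | one h => rcases l with _ | ⟨a, _ | ⟨b, l⟩⟩ <;> simp [Cls.cup, cup1]; ring
  | two c => rcases l with _ | ⟨a, _ | ⟨b, _ | ⟨e, l⟩⟩⟩ <;> simp [Cls.cup, cup2]; ring

lemma dl_prodR (hFi : ∀ m l, List.Sublist m l → Fi l → Fi m) (L : List (Cls T))
    (hL : ∀ C ∈ L, C.cocyc Fi) (Ω : List T → ℝ) (h0 : Ω [] = 0)
    (hΩ : ∀ l, Fi l → dl Ω l = 0) (l : List T) (hl : Fi l) : dl (prodR L Ω) l = 0 := by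
  induction L generalizing l with
  | nil => exact hΩ l hl
  | cons C L ih =>
    obtain ⟨e, -, he⟩ := C.dl_cup hFi (hL C (by simp)) (prodR L Ω) (prodR_nil_val L Ω h0)
    rw [prodR_cons, he l hl, C.cup_eqOn hFi (Φ' := fun _ => 0) _ l hl, C.cup_zero, mul_zero]
    exact fun l hl => ih (fun C hC => hL C (by simp [hC])) l hl

lemma Coh.cup_congr (hFi : ∀ m l, List.Sublist m l → Fi l → Fi m) (C : Cls T) (hC : C.cocyc Fi)
    {Φ Φ' : List T → ℝ} (h : Coh Fi Φ Φ') : Coh Fi (C.cup Φ) (C.cup Φ') := by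
  obtain ⟨Ψ, h0, hΨ⟩ := h
  obtain ⟨e, hee, he⟩ := C.dl_cup hFi hC Ψ h0
  refine ⟨fun m => e * C.cup Ψ m, by simp [Cls.cup_nil], fun l hl => ?_⟩
  rw [dl_smul, he l hl, ← mul_assoc, hee, one_mul, ← C.cup_sub]
  exact C.cup_eqOn hFi hΨ l hl

lemma Coh.cup_cls (hFi : ∀ m l, List.Sublist m l → Fi l → Fi m) (C C' : Cls T)
    (hC : C.coh Fi C') {Φ : List T → ℝ} (h0 : Φ [] = 0) (hΦ : ∀ l, Fi l → dl Φ l = 0) :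
    Coh Fi (C.cup Φ) (C'.cup Φ) := by
  cases C with
  | one h =>
    cases C' with
    | one h' =>
      obtain ⟨b, hb⟩ := hC
      refine ⟨cup0 b Φ, by simp [cup0], fun l hl => ?_⟩
      rw [leib0 _ _ h0, cup0_eqOn (Φ' := fun _ => 0) hΦ l hl, cup0_zero, add_zero]
      rcases l with _ | ⟨a, _ | ⟨e, l⟩⟩
      · simp [Cls.cup, cup1]
      · simp [Cls.cup, cup1]
      · simp only [Cls.cup, cup1]
        rw [← hb a e (hFi _ _ (by simp) hl)]; ring
    | two c => exact hC.elim
  | two c =>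
    cases C' with
    | one h' => exact hC.elim
    | two c' =>
      obtain ⟨b, hb⟩ := hC
      refine ⟨cup1 b Φ, by simp [cup1], fun l hl => ?_⟩
      rw [leib1 _ _ h0, cup1_eqOn hFi (Φ' := fun _ => 0) hΦ l hl, cup1_zero, sub_zero]
      rcases l with _ | ⟨a, _ | ⟨e, _ | ⟨f, l⟩⟩⟩
      · simp [Cls.cup, cup2]
      · simp [Cls.cup, cup2]
      · simp [Cls.cup, cup2]
      · simp only [Cls.cup, cup2]
        rw [← hb a e f (hFi _ _ (sub3 _ _ _ _) hl)]; ring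

lemma Coh.prodR (hFi : ∀ m l, List.Sublist m l → Fi l → Fi m) (L L' : List (Cls T))
    (hLL : List.Forall₂ (Cls.coh Fi) L L')
    (hL : ∀ C ∈ L, C.cocyc Fi) (hL' : ∀ C ∈ L', C.cocyc Fi) (Ω Ω' : List T → ℝ) (h0 : Ω' [] = 0)
    (hΩ : ∀ l, Fi l → dl Ω' l = 0) (hc : Coh Fi Ω Ω') : Coh Fi (prodR L Ω) (prodR L' Ω') := by
  induction hLL with
  | nil => exact hc
  | @cons C C' L L' h1 h2 ih =>
    simp only [prodR_cons]
    refine Coh.trans (Coh.cup_congr hFi C (hL C (by simp)) (ih (fun C hC => hL C (by simp [hC]))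
      (fun C hC => hL' C (by simp [hC])))) ?_
    exact Coh.cup_cls hFi _ _ h1 (prodR_nil_val _ _ h0)
      (dl_prodR hFi _ (fun C hC => hL' C (by simp [hC])) _ h0 hΩ)

lemma prodR_vanish (L : List (Cls T)) (Ω : List T → ℝ) (l : List T)
    (h : (∃ C ∈ L, ∀ m, List.Sublist m l → C.val m = 0) ∨ ∀ m, List.Sublist m l → Ω m = 0) :
    prodR L Ω l = 0 := by
  induction L generalizing l with
  | nil =>
    rcases h with ⟨C, hC, _⟩ | h
    · simp at hC
    · exact h l (List.Sublist.refl l)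
  | cons C L ih =>
    rw [prodR_cons]
    have key : (∀ m, List.Sublist m l → C.val m = 0) ∨
        ((∃ C ∈ L, ∀ m, List.Sublist m l → C.val m = 0) ∨ ∀ m, List.Sublist m l → Ω m = 0) := by
      rcases h with ⟨D, hD, hD'⟩ | h
      · rcases List.mem_cons.1 hD with rfl | hD
        · exact Or.inl hD'
        · exact Or.inr (Or.inl ⟨D, hD, hD'⟩)
      · exact Or.inr (Or.inr h)
    have key2 : (∀ m, List.Sublist m l → C.val m = 0) ∨
        (∀ m, List.Sublist m l → prodR L Ω m = 0) := by
      rcases key with h | h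
      · exact Or.inl h
      · refine Or.inr fun m hm => ih m ?_
        rcases h with ⟨D, hD, hD'⟩ | h
        · exact Or.inl ⟨D, hD, fun k hk => hD' k (hk.trans hm)⟩
        · exact Or.inr fun k hk => h k (hk.trans hm)
    cases C with
    | one h =>
      rcases l with _ | ⟨a, _ | ⟨b, l⟩⟩
      · simp [Cls.cup, cup1]
      · simp [Cls.cup, cup1]
      · simp only [Cls.cup, cup1]
        rcases key2 with h1 | h1
        · have := h1 [a, b] (by simp)
          simp only [Cls.val] at this
          rw [this, zero_mul]
        · rw [h1 _ (List.sublist_cons_self _ _), mul_zero]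
    | two c =>
      rcases l with _ | ⟨a, _ | ⟨b, _ | ⟨e, l⟩⟩⟩
      · simp [Cls.cup, cup2]
      · simp [Cls.cup, cup2]
      · simp [Cls.cup, cup2]
      · simp only [Cls.cup, cup2]
        rcases key2 with h1 | h1
        · have := h1 [a, b, e] (sub3 _ _ _ _)
          simp only [Cls.val] at this
          rw [this, zero_mul]
        · rw [h1 _ ((List.sublist_cons_self b _).trans (List.sublist_cons_self a _)), mul_zero]

end prods

/-! ### Cochains and categorical open sets -/

section lb
variable {X Z : Type*} [TopologicalSpace X] [MetricSpace Z] [CompactSpace Z]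

/-- a cochain which is locally a cocycle and normalised on constant lists -/
structure LocCo (φ : List X → ℝ) : Prop where
  loc : ∀ y : X, ∃ N ∈ 𝓝 y, ∀ l : List X, (∀ a ∈ l, a ∈ N) → dl φ l = 0
  const : ∀ (y : X) (l : List X), (∀ a ∈ l, a = y) → φ l = 0

def FineL (ε : ℝ) (l : List Z) : Prop := ∀ a ∈ l, ∀ b ∈ l, dist a b < ε

lemma lb_single (P : Z → X) (hP : Continuous P) (U : Set X)
    (hnull : (inclMap U).Nullhomotopic) (K : Set Z) (hK : IsCompact K) (hKU : ∀ z ∈ K, P z ∈ U)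
    (φ : List X → ℝ) (hφ : LocCo φ) :
    ∃ ε > 0, ∃ β : List X → ℝ, β [] = 0 ∧ ∀ l : List Z, FineL ε l → (∀ a ∈ l, a ∈ K) →
      φ (l.map P) = dl β (l.map P) := by
  classical
  obtain ⟨y0, ⟨H⟩⟩ := hnull
  haveI : CompactSpace K := isCompact_iff_compactSpace.1 hK
  choose N hN hN' using hφ.loc
  let G : K × I → X := fun p => H (p.2, ⟨P p.1, hKU _ p.1.2⟩)
  have hG : Continuous G := by
    refine H.continuous.comp (Continuous.prodMk continuous_snd ?_)
    exact Continuous.subtype_mk (hP.comp (continuous_subtype_val.comp continuous_fst)) _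
  obtain ⟨δ, hδ, hδ'⟩ := lebesgue_number_lemma_of_metric (s := (Set.univ : Set (K × I)))
    (c := fun y : X => G ⁻¹' (interior (N y))) isCompact_univ
    (fun y => isOpen_interior.preimage hG)
    (fun p _ => Set.mem_iUnion.2 ⟨G p, mem_interior_iff_mem_nhds.2 (hN (G p))⟩)
  obtain ⟨J, hJ⟩ := exists_nat_gt (1 / δ)
  have hJ0 : 0 < (J : ℝ) := lt_trans (by positivity) hJ
  have hJ1 : 1 / (J : ℝ) < δ := by
    rw [div_lt_iff₀ hJ0]; rw [div_lt_iff₀ hδ] at hJ; linarith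
  have ht : ∀ j : ℕ, j ≤ J → (j : ℝ) / J ∈ I := fun j hj =>
    ⟨by positivity, by rw [div_le_one hJ0]; exact_mod_cast hj⟩
  let tt : ℕ → I := fun j => if hj : j ≤ J then ⟨(j : ℝ) / J, ht j hj⟩ else 0
  have htt : ∀ j (hj : j ≤ J), ((tt j : I) : ℝ) = (j : ℝ) / J := fun j hj => by simp [tt, hj]
  let h : ℕ → X → X := fun j x => if hx : x ∈ U then H (tt j, ⟨x, hx⟩) else y0
  refine ⟨δ, hδ, fun l => - ∑ j ∈ Finset.range J, pr (h j) (h (j + 1)) φ l, by simp, ?_⟩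
  intro l hl hlK
  rw [dl_neg, dl_sum]
  have hx : ∀ j ∈ Finset.range J, dl (pr (h j) (h (j + 1)) φ) (l.map P) =
      φ ((l.map P).map (h (j + 1))) - φ ((l.map P).map (h j)) := by
    intro j hj
    have hj' : j < J := Finset.mem_range.1 hj
    rw [← dl_pr, left_eq_add]
    rw [pr_congr _ _ _ (fun _ => 0), pr_zero]
    intro l₁ a l₂ hla
    have hmem : ∀ b ∈ l₁ ++ a :: l₂, ∃ z ∈ l, P z = b := by
      rw [← hla]; intro b hb; simpa using hb
    obtain ⟨z0, hz0, hz0'⟩ := hmem a (by simp)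
    obtain ⟨y, hy⟩ := hδ' (⟨z0, hlK _ hz0⟩, tt j) (Set.mem_univ _)
    refine hN' y _ ?_
    have main : ∀ z ∈ l, ∀ i, i = j ∨ i = j + 1 → h i (P z) ∈ N y := by
      intro z hz i hi
      have hb : ((⟨z, hlK _ hz⟩ : K), tt i) ∈ Metric.ball ((⟨z0, hlK _ hz0⟩ : K), tt j) δ := by
        rw [Metric.mem_ball, Prod.dist_eq, max_lt_iff]
        refine ⟨hl z hz z0 hz0, ?_⟩
        rw [Subtype.dist_eq, htt j hj'.le, Real.dist_eq]
        rcases hi with rfl | rfl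
        · rw [htt _ hj'.le]; simpa using hδ
        · rw [htt _ hj', ← sub_div]
          push_cast
          rw [add_sub_cancel_left, abs_of_pos (by positivity)]
          exact hJ1
      have := interior_subset (hy hb)
      simpa [h, G, hKU _ (hlK _ hz)] using this
    intro b hb
    simp only [List.mem_append, List.mem_map, List.mem_cons] at hb
    rcases hb with ⟨c, hc, rfl⟩ | rfl | rfl | ⟨c, hc, rfl⟩
    · obtain ⟨z, hz, rfl⟩ := hmem c (by simp [hc])
      exact main z hz j (Or.inl rfl)
    · rw [← hz0']; exact main z0 hz0 j (Or.inl rfl)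
    · rw [← hz0']; exact main z0 hz0 (j + 1) (Or.inr rfl)
    · obtain ⟨z, hz, rfl⟩ := hmem c (by simp [hc])
      exact main z hz (j + 1) (Or.inr rfl)
  rw [Finset.sum_congr rfl hx, Finset.sum_range_sub (fun j => φ ((l.map P).map (h j)))]
  have e0 : (l.map P).map (h 0) = l.map P := by
    rw [List.map_map]
    refine List.map_congr_left fun z hz => ?_
    have h00 : tt 0 = 0 := by
      apply Subtype.ext; rw [htt 0 (Nat.zero_le _)]; simp
    simp only [Function.comp_apply, h, hKU _ (hlK _ hz), dif_pos, h00]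
    rw [H.apply_zero]; rfl
  have e1 : φ ((l.map P).map (h J)) = 0 := by
    refine hφ.const y0 _ ?_
    intro a ha
    simp only [List.mem_map] at ha
    obtain ⟨b, ⟨z, hz, rfl⟩, rfl⟩ := ha
    have h00 : tt J = 1 := by
      apply Subtype.ext; rw [htt J le_rfl]; simp [hJ0.ne']
    simp only [h, hKU _ (hlK _ hz), dif_pos, h00]
    rw [H.apply_one]; rfl
  rw [e0, e1]; ring

lemma lb_cover (P : Z → X) (hP : Continuous P) {r : ℕ} (U : Fin (r + 1) → Set X)
    (hU : ∀ i, IsOpen (U i)) (hcov : (⋃ i, U i) = Set.univ)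
    (hnull : ∀ i, (inclMap (U i)).Nullhomotopic)
    (φ : Fin (r + 1) → List X → ℝ) (hφ : ∀ i, LocCo (φ i)) :
    ∃ ε > 0, ∃ β : Fin (r + 1) → List X → ℝ, (∀ i, β i [] = 0) ∧ ∀ l : List Z, FineL ε l →
      ∃ i, ∀ m, List.Sublist m l → φ i (m.map P) = dl (β i) (m.map P) := by
  obtain ⟨δ, hδ, hδ'⟩ := lebesgue_number_lemma_of_metric (s := (Set.univ : Set Z))
    (c := fun i => P ⁻¹' (U i)) isCompact_univ (fun i => (hU i).preimage hP)
    (fun z _ => by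
      have : P z ∈ ⋃ i, U i := by rw [hcov]; trivial
      simpa using this)
  let K : Fin (r + 1) → Set Z := fun i => (Metric.thickening (δ / 2) (P ⁻¹' (U i))ᶜ)ᶜ
  have hK : ∀ i, IsCompact (K i) := fun i =>
    (Metric.isOpen_thickening.isClosed_compl).isCompact
  have hKU : ∀ i, ∀ z ∈ K i, P z ∈ U i := by
    intro i z hz
    by_contra hcon
    exact hz (Metric.self_subset_thickening (by positivity) _ hcon)
  choose ε hε β hβ0 hβ using fun i => lb_single P hP (U i) (hnull i) (K i) (hK i) (hKU i) (φ i) (hφ i)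
  let ε0 : ℝ := Finset.univ.inf' Finset.univ_nonempty ε
  have hε0 : 0 < ε0 := (Finset.lt_inf'_iff _).2 fun i _ => hε i
  have hε1 : ∀ i, ε0 ≤ ε i := fun i => Finset.inf'_le _ (Finset.mem_univ i)
  refine ⟨min ε0 (δ / 2), by positivity, β, hβ0, fun l hl => ?_⟩
  rcases l with _ | ⟨z0, l⟩
  · refine ⟨0, fun m hm => ?_⟩
    have : m = [] := by simpa using hm
    subst this
    exact hβ 0 [] (fun a ha => by simp at ha) (fun a ha => by simp at ha)
  · obtain ⟨i, hi⟩ := hδ' z0 (Set.mem_univ _)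
    refine ⟨i, fun m hm => hβ i m (fun a ha b hb => ?_) fun a ha => ?_⟩
    · exact lt_of_lt_of_le (hl a (hm.subset ha) b (hm.subset hb))
        ((min_le_left _ _).trans (hε1 i))
    · intro hcon
      rw [Metric.mem_thickening_iff] at hcon
      obtain ⟨w, hw, hw'⟩ := hcon
      apply hw
      apply hi
      rw [Metric.mem_ball]
      have h1 := hl a (hm.subset ha) z0 (by simp)
      have h2 := lt_of_lt_of_le h1 (min_le_right _ _)
      rw [dist_comm a w] at hw'
      linarith [dist_triangle w a z0]

end lb
end

section

/-! ### Slant along a discrete square -/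

def sg (j : ℕ) : ℝ := if Even j then 1 else -1
def lo (j : ℕ) : ℕ := if Even j then j else j + 1
def hi (j : ℕ) : ℕ := if Even j then j + 1 else j

section slant
variable {T T' M : Type*}

lemma sl_eq (N : ℕ) (Φ : List (T × ℕ) → ℝ) (l : List T) :
    sl N Φ l = ∑ j ∈ Finset.range N, sg j * pr (fun a => (a, lo j)) (fun a => (a, hi j)) Φ l := by
  refine Finset.sum_congr rfl fun j _ => ?_
  by_cases h : Even j <;> simp [sg, lo, hi, h]

def sqF (sq : ℕ → ℕ → M) (p : (T × ℕ) × ℕ) : T × M := (p.1.1, sq p.1.2 p.2)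

def Jg (R Θ : ℕ) (sq : ℕ → ℕ → M) (Φ : List (T × M) → ℝ) : List T → ℝ :=
  sl R (sl Θ (fun l => Φ (l.map (sqF sq))))

def cell (sq : ℕ → ℕ → M) (i i' j j' : ℕ) (Φ : List (T × M) → ℝ) : List T → ℝ :=
  pr (fun a => (a, i)) (fun a => (a, i'))
    (pr (fun a => (a, sq a.2 j)) (fun a => (a, sq a.2 j')) (fun l => Φ (l.map fun q => (q.1.1, q.2))))

lemma Jg_eq (R Θ : ℕ) (sq : ℕ → ℕ → M) (Φ : List (T × M) → ℝ) (l : List T) :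
    Jg R Θ sq Φ l = ∑ i ∈ Finset.range R, ∑ j ∈ Finset.range Θ,
      sg i * sg j * cell sq (lo i) (hi i) (lo j) (hi j) Φ l := by
  unfold Jg
  rw [sl_eq]
  refine Finset.sum_congr rfl fun i _ => ?_
  have : sl Θ (fun l => Φ (l.map (sqF sq))) = fun l => ∑ j ∈ Finset.range Θ, sg j *
      pr (fun a : T × ℕ => (a, sq a.2 (lo j))) (fun a => (a, sq a.2 (hi j)))
        (fun l => Φ (l.map fun q => (q.1.1, q.2))) l := by
    funext l
    rw [sl_eq]
    refine Finset.sum_congr rfl fun j _ => ?_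
    rw [pr_map, pr_map]
    rfl
  rw [this, pr_sum, Finset.mul_sum]
  refine Finset.sum_congr rfl fun j _ => ?_
  rw [pr_smul, mul_assoc]; rfl

/-- pairs of cells of a closed discrete curve cancel -/
structure Cancel (N : ℕ) (c : ℕ → M) : Prop where
  ex : ∃ τ : ℕ → ℕ, ∀ j < N, τ j < N ∧ τ (τ j) = j ∧ (Even (τ j) ↔ ¬ Even j) ∧
    c (τ j) = c (j + 1) ∧ c (τ j + 1) = c j

lemma Cancel.sum_zero {N : ℕ} {c : ℕ → M} (h : Cancel N c) (Φ : List (T × M) → ℝ) (l : List T) :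
    ∑ j ∈ Finset.range N, sg j * pr (fun a => (a, c (lo j))) (fun a => (a, c (hi j))) Φ l = 0 := by
  obtain ⟨τ, hτ⟩ := h.ex
  refine Finset.sum_involution (fun j _ => τ j) ?_ ?_ ?_ ?_
  · intro j hj
    obtain ⟨h1, h2, h3, h4, h5⟩ := hτ j (Finset.mem_range.1 hj)
    by_cases he : Even j
    · have : ¬ Even (τ j) := by rw [h3]; simpa using he
      simp [sg, lo, hi, he, this, h4, h5]
    · have : Even (τ j) := by rw [h3]; exact he
      simp [sg, lo, hi, he, this, h4, h5]
  · intro j hj _ he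
    obtain ⟨h1, h2, h3, h4, h5⟩ := hτ j (Finset.mem_range.1 hj)
    rw [he] at h3; tauto
  · intro j hj
    exact Finset.mem_range.2 (hτ j (Finset.mem_range.1 hj)).1
  · intro j hj
    exact (hτ j (Finset.mem_range.1 hj)).2.1

lemma Cancel.const {N : ℕ} (hN : Even N) {c : ℕ → M} (h : ∀ j, c j = c 0) : Cancel N c := by
  refine ⟨fun j => if Even j then j + 1 else j - 1, fun j hj => ?_⟩
  obtain ⟨m, rfl⟩ := hN
  by_cases he : Even j
  · have h1 : ¬ Even (j + 1) := by rw [Nat.even_add_one]; simpa using he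
    obtain ⟨q, rfl⟩ := he
    simp only [h1, if_false, Even.add_self, if_true]
    refine ⟨by omega, by omega, by simp, ?_, ?_⟩ <;> first | trivial | exact (h _).trans (h _).symm
  · rw [Nat.not_even_iff_odd] at he
    obtain ⟨q, rfl⟩ := he
    simp only [add_tsub_cancel_right]
    have h1 : ¬ Even (2 * q + 1) := by simp
    have h2 : Even (2 * q) := by simp
    simp only [h1, h2, if_true, if_false]
    refine ⟨by omega, by trivial, by simp, ?_, ?_⟩ <;>
      first | trivial | exact (h _).trans (h _).symm

lemma dl_Jg {R Θ : ℕ} {sq : ℕ → ℕ → M} (h1 : ∀ i, sq i Θ = sq i 0)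
    (h0 : Cancel Θ (sq 0)) (hR : Cancel Θ (sq R)) (Φ : List (T × M) → ℝ) (l : List T) :
    dl (Jg R Θ sq Φ) l = Jg R Θ sq (dl Φ) l := by
  unfold Jg
  have e1 := dl_sl R (sl Θ (fun l => Φ (l.map (sqF sq)))) l
  have e2 : ∀ i, Cancel Θ (sq i) → sl Θ (fun l => Φ (l.map (sqF sq))) (l.map fun a => (a, i)) = 0 := by
    intro i hi
    rw [sl_eq, ← hi.sum_zero Φ l]
    refine Finset.sum_congr rfl fun j _ => ?_
    rw [pr_map, pr_premap]; rfl
  rw [e2 _ h0, e2 _ hR] at e1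
  have e3 : dl (sl Θ (fun l => Φ (l.map (sqF sq)))) =
      fun l : List (T × ℕ) => (-1) * sl Θ (fun l => dl Φ (l.map (sqF sq))) l := by
    funext m
    have := dl_sl Θ (fun l => Φ (l.map (sqF sq))) m
    have e4 : (List.map (sqF sq) (List.map (fun a => (a, Θ)) m)) =
      (List.map (sqF sq) (List.map (fun a => (a, 0)) m)) := by
      simp [sqF, h1]
    rw [e4, sub_self] at this
    have e5 : dl (fun l : List ((T × ℕ) × ℕ) => Φ (l.map (sqF sq))) =
      fun l => dl Φ (l.map (sqF sq)) := by
      funext q; exact dl_map _ _ _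
    rw [e5] at this
    linarith
  rw [e3, sl_smul] at e1
  linarith

/-- locality of the slant -/
lemma pr_local (f g : T → T') (Φ Ψ : List T' → ℝ) (l : List T)
    (h : ∀ m, (∀ a ∈ m, ∃ b ∈ l, a = f b ∨ a = g b) → Φ m = Ψ m) : pr f g Φ l = pr f g Ψ l := by
  refine pr_congr _ _ _ _ _ fun l₁ a l₂ hl => h _ fun b hb => ?_
  subst hl
  simp only [List.mem_append, List.mem_map, List.mem_cons] at hb
  rcases hb with ⟨c, hc, rfl⟩ | rfl | rfl | ⟨c, hc, rfl⟩
  · exact ⟨c, by simp [hc], Or.inl rfl⟩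
  · exact ⟨a, by simp, Or.inl rfl⟩
  · exact ⟨a, by simp, Or.inr rfl⟩
  · exact ⟨c, by simp [hc], Or.inr rfl⟩

lemma lohi (j k : ℕ) (h : k = lo j ∨ k = hi j) : k = j ∨ k = j + 1 := by
  unfold lo hi at h
  split_ifs at h <;> omega

lemma Jg_local (R Θ : ℕ) (sq : ℕ → ℕ → M) (Φ Ψ : List (T × M) → ℝ) (l : List T)
    (h : ∀ i < R, ∀ j < Θ, ∀ m : List (T × M), (∀ a ∈ m, a.1 ∈ l ∧ ∃ i' j', (i' = i ∨ i' = i + 1) ∧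
      (j' = j ∨ j' = j + 1) ∧ a.2 = sq i' j') → Φ m = Ψ m) :
    Jg R Θ sq Φ l = Jg R Θ sq Ψ l := by
  rw [Jg_eq, Jg_eq]
  refine Finset.sum_congr rfl fun i hi => Finset.sum_congr rfl fun j hj => ?_
  congr 1
  refine pr_local _ _ _ _ _ fun m hm => pr_local _ _ _ _ _ fun m' hm' => ?_
  refine h i (Finset.mem_range.1 hi) j (Finset.mem_range.1 hj) _ fun a ha => ?_
  obtain ⟨c, hc, rfl⟩ := List.mem_map.1 ha
  obtain ⟨b, hb, hb'⟩ := hm' c hc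
  obtain ⟨e, he, he'⟩ := hm b hb
  rcases hb' with rfl | rfl <;> rcases he' with rfl | rfl
  · exact ⟨he, _, _, lohi i _ (Or.inl rfl), lohi j _ (Or.inl rfl), rfl⟩
  · exact ⟨he, _, _, lohi i _ (Or.inr rfl), lohi j _ (Or.inl rfl), rfl⟩
  · exact ⟨he, _, _, lohi i _ (Or.inl rfl), lohi j _ (Or.inr rfl), rfl⟩
  · exact ⟨he, _, _, lohi i _ (Or.inr rfl), lohi j _ (Or.inr rfl), rfl⟩

/-! cell formulas -/
def Bp (p q : M) (Φ : List (T × M) → ℝ) : List T → ℝ := pr (fun a => (a, p)) (fun a => (a, q)) Φ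

lemma cup0_const (r : ℝ) (Ψ : List T → ℝ) (h : Ψ [] = 0) (l : List T) :
    cup0 (fun _ => r) Ψ l = r * Ψ l := by
  rcases l with _ | ⟨a, l⟩ <;> simp [cup0, h]

lemma Bp_cup1 (p q : M) (h' : T → T → ℝ) (h0 : M → M → ℝ) (n' : ∀ x, h' x x = 0)
    (n0 : ∀ x, h0 x x = 0) (Ψ : List (T × M) → ℝ) (hΨ : Ψ [] = 0) (l : List T) :
    Bp p q (cup1 (fun x y => h' x.1 y.1 + h0 x.2 y.2) Ψ) l =
      h0 p q * Ψ (l.map fun a => (a, q)) - cup1 h' (Bp p q Ψ) l := by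
  unfold Bp
  rw [pr_cup1]
  simp only [n', n0, zero_add, add_zero]
  rw [cup0_const]
  simpa using hΨ

lemma cup1_zero' (Ψ : List T → ℝ) (l : List T) : cup1 (fun _ _ => 0) Ψ l = 0 := by
  rcases l with _ | ⟨a, _ | ⟨b, l⟩⟩ <;> simp [cup1]

lemma Bp_cup2 (p q : M) (h' : T → T → T → ℝ) (h0 : M → M → M → ℝ)
    (n1 : ∀ x y, h' x x y = 0) (n2 : ∀ x y, h' x y y = 0)
    (m1 : ∀ x y, h0 x x y = 0) (m2 : ∀ x y, h0 x y y = 0) (Ψ : List (T × M) → ℝ)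
    (l : List T) :
    Bp p q (cup2 (fun x y z => h' x.1 y.1 z.1 + h0 x.2 y.2 z.2) Ψ) l =
      cup2 h' (Bp p q Ψ) l := by
  unfold Bp
  rw [pr_cup2]
  simp only [n1, n2, m1, m2, zero_add, add_zero, sub_self, cup1_zero']

lemma cell_cup1 (sq : ℕ → ℕ → M) (i i' j j' : ℕ) (h' : T → T → ℝ) (h0 : M → M → ℝ)
    (n' : ∀ x, h' x x = 0)
    (n0 : ∀ x, h0 x x = 0) (Ψ : List (T × M) → ℝ) (hΨ : Ψ [] = 0) (l : List T) :
    cell sq i i' j j' (cup1 (fun x y => h' x.1 y.1 + h0 x.2 y.2) Ψ) l =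
      h0 (sq i j) (sq i j') * Bp (sq i j') (sq i' j') Ψ l
      - h0 (sq i j) (sq i' j) * Bp (sq i' j) (sq i' j') Ψ l
      + cup1 h' (cell sq i i' j j' Ψ) l := by
  unfold cell Bp
  have e1 : (fun l : List ((T × ℕ) × M) => cup1 (fun x y : T × M => h' x.1 y.1 + h0 x.2 y.2) Ψ
      (l.map fun q => (q.1.1, q.2))) = cup1 (fun x y => h' x.1.1 y.1.1 + h0 x.2 y.2)
        (fun l => Ψ (l.map fun q => (q.1.1, q.2))) := by
    funext m; rw [cup1_map]
  have e2 : ∀ (Φ : List ((T × ℕ) × M) → ℝ), pr (fun a : T × ℕ => (a, sq a.2 j))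
      (fun a => (a, sq a.2 j')) (cup1 (fun x y => h' x.1.1 y.1.1 + h0 x.2 y.2) Φ) = fun l =>
      cup0 (fun a => h0 (sq a.2 j) (sq a.2 j')) (fun m => Φ (m.map fun a => (a, sq a.2 j'))) l
      - cup1 (fun a b => h' a.1 b.1 + h0 (sq a.2 j) (sq b.2 j)) (pr (fun a : T × ℕ => (a, sq a.2 j))
      (fun a => (a, sq a.2 j')) Φ) l := by
    intro Φ
    funext m
    rw [pr_cup1]
    simp [n']
  rw [e1, e2, pr_sub, pr_cup0, pr_cup1]
  simp only [n', n0, zero_add, add_zero]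
  rw [cup0_const _ _ (by simp), cup0_const _ _ (by simp [hΨ])]
  have e5 : pr (fun a : T => (a, i)) (fun a => (a, i'))
          (fun m => Ψ (List.map (fun q => (q.1.1, q.2)) (List.map (fun a => (a, sq a.2 j')) m))) l
      = pr (fun a => (a, sq i j')) (fun a => (a, sq i' j')) Ψ l := by
    simp only [List.map_map]
    rw [pr_map]; rfl
  rw [e5]
  have e3 : (pr (fun a : T × ℕ => (a, sq a.2 j)) (fun a => (a, sq a.2 j'))
      (fun l => Ψ (List.map (fun q => (q.1.1, q.2)) l)) (l.map (fun a => (a, i')))) =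
      pr (fun a => (a, sq i' j)) (fun a => (a, sq i' j')) Ψ l := by
    rw [pr_map, pr_premap]; rfl
  rw [e3]
  have e4 : ∀ a b c : ℝ, a - (b - c) = a - b + c := fun a b c => by ring
  rw [e4]
lemma cell_cup2 (sq : ℕ → ℕ → M) (i i' j j' : ℕ) (h' : T → T → T → ℝ) (h0 : M → M → M → ℝ)
    (n1 : ∀ x y, h' x x y = 0) (n2 : ∀ x y, h' x y y = 0)
    (m1 : ∀ x y, h0 x x y = 0) (m2 : ∀ x y, h0 x y y = 0)
    (Ψ : List (T × M) → ℝ) (hΨ : Ψ [] = 0) (l : List T) :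
    cell sq i i' j j' (cup2 (fun x y z => h' x.1 y.1 z.1 + h0 x.2 y.2 z.2) Ψ) l =
      (h0 (sq i j) (sq i j') (sq i' j') - h0 (sq i j) (sq i' j) (sq i' j')) *
        Ψ (l.map fun a => (a, sq i' j'))
      + cup2 h' (cell sq i i' j j' Ψ) l := by
  unfold cell
  have e1 : (fun l : List ((T × ℕ) × M) => cup2 (fun x y z : T × M => h' x.1 y.1 z.1
      + h0 x.2 y.2 z.2) Ψ
      (l.map fun q => (q.1.1, q.2))) = cup2 (fun x y z => h' x.1.1 y.1.1 z.1.1 + h0 x.2 y.2 z.2)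
        (fun l => Ψ (l.map fun q => (q.1.1, q.2))) := by
    funext m; rw [cup2_map]
  have e2 : ∀ (Φ : List ((T × ℕ) × M) → ℝ), pr (fun a : T × ℕ => (a, sq a.2 j))
      (fun a => (a, sq a.2 j')) (cup2 (fun x y z => h' x.1.1 y.1.1 z.1.1 + h0 x.2 y.2 z.2) Φ)
      = fun l =>
      cup1 (fun a b => h0 (sq a.2 j) (sq a.2 j') (sq b.2 j') - h0 (sq a.2 j) (sq b.2 j) (sq b.2 j'))
        (fun m => Φ (m.map fun a => (a, sq a.2 j'))) l
      + cup2 (fun a b c => h' a.1 b.1 c.1 + h0 (sq a.2 j) (sq b.2 j) (sq c.2 j))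
        (pr (fun a : T × ℕ => (a, sq a.2 j))
      (fun a => (a, sq a.2 j')) Φ) l := by
    intro Φ
    funext m
    rw [pr_cup2]
    simp [n1, n2]
  rw [e1, e2, pr_add, pr_cup1, pr_cup2]
  simp only [n1, n2, m1, m2, zero_add, add_zero, sub_self, cup1_zero', sub_zero]
  rw [cup0_const _ _ (by simp [hΨ])]
  congr 3
  all_goals (try (rw [List.map_map, List.map_map]; rfl))

end slant

/-! ### Block algebra -/
section blocks
variable {M B : Type*}

abbrev TT (M B : Type*) := (ℕ → M) × B

def Cls.nrm : Cls M → Prop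
  | Cls.one h => ∀ x, h x x = 0
  | Cls.two c => (∀ x y, c x x y = 0) ∧ ∀ x y, c x y y = 0

def sumC (m : ℕ) : Cls M → Cls (TT M B)
  | Cls.one h => Cls.one fun x y => ∑ s ∈ Finset.range m, h (x.1 s) (y.1 s)
  | Cls.two c => Cls.two fun x y z => ∑ s ∈ Finset.range m, c (x.1 s) (y.1 s) (z.1 s)

def extC (m : ℕ) : Cls M → Cls (TT M B × M)
  | Cls.one h => Cls.one fun x y => (∑ s ∈ Finset.range m, h (x.1.1 s) (y.1.1 s)) + h x.2 y.2
  | Cls.two c => Cls.two fun x y z => (∑ s ∈ Finset.range m, c (x.1.1 s) (y.1.1 s) (z.1.1 s))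
      + c x.2 y.2 z.2

def upd (s : ℕ) (p : TT M B × M) : TT M B := (Function.update p.1.1 s p.2, p.1.2)

def lastΩ (ΩB : List B → ℝ) : List (TT M B) → ℝ := fun l => ΩB (l.map Prod.snd)

def Rs (m : ℕ) (L : List (Cls M)) (ΩB : List B → ℝ) : List (TT M B) → ℝ :=
  prodR (L.map (sumC m)) (lastΩ ΩB)
def Rx (m : ℕ) (L : List (Cls M)) (ΩB : List B → ℝ) : List (TT M B × M) → ℝ :=
  prodR (L.map (extC m)) (fun l => lastΩ ΩB (l.map Prod.fst))

lemma Rs_upd (m : ℕ) (L : List (Cls M)) (ΩB : List B → ℝ) (l : List (TT M B × M)) :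
    Rs (m + 1) L ΩB (l.map (upd m)) = Rx m L ΩB l := by
  induction L generalizing l with
  | nil => simp only [Rs, Rx, lastΩ, List.map_nil, prodR_nil, List.map_map]; rfl
  | cons C L ih =>
    have ih' : (fun l => Rs (m + 1) L ΩB (l.map (upd m))) = Rx m L ΩB := funext ih
    have key : ∀ (x : TT M B × M) s, s ∈ Finset.range m → (upd m x).1 s = x.1.1 s := by
      intro x s hs
      have : s ≠ m := (Finset.mem_range.1 hs).ne
      simp [upd, this]
    cases C with
    | one h =>
      simp only [Rs, Rx, List.map_cons, prodR_cons, sumC, extC, Cls.cup]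
      rw [cup1_map]
      change cup1 _ (fun l => Rs (m + 1) L ΩB (l.map (upd m))) l = _
      rw [ih']
      congr 1
      funext x y
      rw [Finset.sum_range_succ]
      congr 1
      · exact Finset.sum_congr rfl fun s hs => by rw [key x s hs, key y s hs]
      · simp [upd]
    | two h =>
      simp only [Rs, Rx, List.map_cons, prodR_cons, sumC, extC, Cls.cup]
      rw [cup2_map]
      change cup2 _ (fun l => Rs (m + 1) L ΩB (l.map (upd m))) l = _
      rw [ih']
      congr 1
      funext x y z
      rw [Finset.sum_range_succ]
      congr 1
      · exact Finset.sum_congr rfl fun s hs => by rw [key x s hs, key y s hs, key z s hs]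
      · simp [upd]

lemma Rx_pt (m : ℕ) (L : List (Cls M)) (hL : ∀ C ∈ L, C.nrm) (ΩB : List B → ℝ)
    (l : List (TT M B)) (p : M) : Rx m L ΩB (l.map fun a => (a, p)) = Rs m L ΩB l := by
  induction L generalizing l with
  | nil => simp only [Rs, Rx, lastΩ, List.map_nil, prodR_nil, List.map_map]; rfl
  | cons C L ih =>
    have ih' : (fun l => Rx m L ΩB (l.map fun a => (a, p))) = Rs m L ΩB :=
      funext (ih (fun C hC => hL C (by simp [hC])))
    have hC := hL C (by simp)
    cases C with
    | one h =>
      simp only [Rs, Rx, List.map_cons, prodR_cons, sumC, extC, Cls.cup]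
      rw [cup1_map]
      change cup1 _ (fun l => Rx m L ΩB (l.map fun a => (a, p))) l = _
      rw [ih']
      simp only [Cls.nrm] at hC
      simp [hC, Rs]
    | two h =>
      simp only [Rs, Rx, List.map_cons, prodR_cons, sumC, extC, Cls.cup]
      rw [cup2_map]
      change cup2 _ (fun l => Rx m L ΩB (l.map fun a => (a, p))) l = _
      rw [ih']
      simp only [Cls.nrm] at hC
      simp [hC.1, hC.2, Rs]

lemma Rx_nil (m : ℕ) (L : List (Cls M)) (ΩB : List B → ℝ) (h : ΩB [] = 0) :
    Rx m L ΩB [] = 0 := prodR_nil_val _ _ (by simpa [lastΩ] using h)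

/-- vanishing on lists with two equal consecutive entries -/
def Degen (ΩB : List B → ℝ) : Prop := ∀ l₁ a l₂, ΩB (l₁ ++ a :: a :: l₂) = 0

lemma Bp_last (ΩB : List B → ℝ) (hΩ : Degen ΩB) (p q : M) (l : List (TT M B)) :
    Bp p q (fun l => lastΩ ΩB (l.map Prod.fst)) l = 0 := by
  unfold Bp
  rw [pr_congr _ _ _ (fun _ => 0), pr_zero]
  intro l₁ a l₂ _
  simp only [lastΩ, List.map_append, List.map_cons, List.map_map]
  exact hΩ _ _ _

lemma cell_last (sq : ℕ → ℕ → M) (i i' j j' : ℕ) (ΩB : List B → ℝ) (hΩ : Degen ΩB)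
    (l : List (TT M B)) :
    cell sq i i' j j' (fun l => lastΩ ΩB (l.map Prod.fst)) l = 0 := by
  unfold cell
  rw [pr_congr _ _ _ (fun _ => 0), pr_zero]
  intro l₁ a l₂ _
  rw [pr_congr _ _ _ (fun _ => 0), pr_zero]
  intro l₁ a l₂ _
  simp only [lastΩ, List.map_append, List.map_cons, List.map_map]
  exact hΩ _ _ _

section J
variable (R Θ : ℕ) (sq : ℕ → ℕ → M)

def pair11 (a b : M → M → ℝ) : ℝ := ∑ i ∈ Finset.range R, ∑ j ∈ Finset.range Θ, sg i * sg j *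
  (a (sq (lo i) (lo j)) (sq (lo i) (hi j)) * b (sq (lo i) (hi j)) (sq (hi i) (hi j))
   - a (sq (lo i) (lo j)) (sq (hi i) (lo j)) * b (sq (hi i) (lo j)) (sq (hi i) (hi j)))

def pair2 (c : M → M → M → ℝ) : ℝ := ∑ i ∈ Finset.range R, ∑ j ∈ Finset.range Θ, sg i * sg j *
  (c (sq (lo i) (lo j)) (sq (lo i) (hi j)) (sq (hi i) (hi j))
   - c (sq (lo i) (lo j)) (sq (hi i) (lo j)) (sq (hi i) (hi j)))

def Ka (a : M → M → ℝ) (Ψ : List (TT M B × M) → ℝ) (l : List (TT M B)) : ℝ :=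
  ∑ i ∈ Finset.range R, ∑ j ∈ Finset.range Θ, sg i * sg j *
  (a (sq (lo i) (lo j)) (sq (lo i) (hi j)) * Bp (sq (lo i) (hi j)) (sq (hi i) (hi j)) Ψ l
   - a (sq (lo i) (lo j)) (sq (hi i) (lo j)) * Bp (sq (hi i) (lo j)) (sq (hi i) (hi j)) Ψ l)

lemma cup1_sum {ι : Type*} {T : Type*} (s : Finset ι) (h : T → T → ℝ) (Φ : ι → List T → ℝ)
    (l : List T) : cup1 h (fun m => ∑ i ∈ s, Φ i m) l = ∑ i ∈ s, cup1 h (Φ i) l := by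
  rcases l with _ | ⟨a, _ | ⟨b, l⟩⟩ <;> simp [cup1, Finset.mul_sum]
lemma cup2_sum {ι : Type*} {T : Type*} (s : Finset ι) (h : T → T → T → ℝ) (Φ : ι → List T → ℝ)
    (l : List T) : cup2 h (fun m => ∑ i ∈ s, Φ i m) l = ∑ i ∈ s, cup2 h (Φ i) l := by
  rcases l with _ | ⟨a, _ | ⟨b, _ | ⟨e, l⟩⟩⟩ <;> simp [cup2, Finset.mul_sum]
lemma cup1_smul {T : Type*} (h : T → T → ℝ) (r : ℝ) (Φ : List T → ℝ)
    (l : List T) : cup1 h (fun m => r * Φ m) l = r * cup1 h Φ l := by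
  rcases l with _ | ⟨a, _ | ⟨b, l⟩⟩ <;> simp [cup1]; ring
lemma cup2_smul {T : Type*} (h : T → T → T → ℝ) (r : ℝ) (Φ : List T → ℝ)
    (l : List T) : cup2 h (fun m => r * Φ m) l = r * cup2 h Φ l := by
  rcases l with _ | ⟨a, _ | ⟨b, _ | ⟨e, l⟩⟩⟩ <;> simp [cup2]; ring
lemma cup1_sub {T : Type*} (h : T → T → ℝ) (Φ Ψ : List T → ℝ)
    (l : List T) : cup1 h (fun m => Φ m - Ψ m) l = cup1 h Φ l - cup1 h Ψ l :=
  Cls.cup_sub (Cls.one h) Φ Ψ l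
lemma cup2_sub {T : Type*} (h : T → T → T → ℝ) (Φ Ψ : List T → ℝ)
    (l : List T) : cup2 h (fun m => Φ m - Ψ m) l = cup2 h Φ l - cup2 h Ψ l :=
  Cls.cup_sub (Cls.two h) Φ Ψ l

lemma cup1_Ka (h : TT M B → TT M B → ℝ) (a : M → M → ℝ) (Ψ : List (TT M B × M) → ℝ)
    (l : List (TT M B)) : cup1 h (Ka R Θ sq a Ψ) l =
  ∑ i ∈ Finset.range R, ∑ j ∈ Finset.range Θ, sg i * sg j *
  (a (sq (lo i) (lo j)) (sq (lo i) (hi j)) * cup1 h (Bp (sq (lo i) (hi j)) (sq (hi i) (hi j)) Ψ) l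
   - a (sq (lo i) (lo j)) (sq (hi i) (lo j)) *
     cup1 h (Bp (sq (hi i) (lo j)) (sq (hi i) (hi j)) Ψ) l) := by
  unfold Ka
  rw [cup1_sum]
  refine Finset.sum_congr rfl fun i _ => ?_
  rw [cup1_sum]
  refine Finset.sum_congr rfl fun j _ => ?_
  rw [cup1_smul, cup1_sub, cup1_smul, cup1_smul]

lemma cup2_Ka (h : TT M B → TT M B → TT M B → ℝ) (a : M → M → ℝ) (Ψ : List (TT M B × M) → ℝ)
    (l : List (TT M B)) : cup2 h (Ka R Θ sq a Ψ) l =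
  ∑ i ∈ Finset.range R, ∑ j ∈ Finset.range Θ, sg i * sg j *
  (a (sq (lo i) (lo j)) (sq (lo i) (hi j)) * cup2 h (Bp (sq (lo i) (hi j)) (sq (hi i) (hi j)) Ψ) l
   - a (sq (lo i) (lo j)) (sq (hi i) (lo j)) *
     cup2 h (Bp (sq (hi i) (lo j)) (sq (hi i) (hi j)) Ψ) l) := by
  unfold Ka
  rw [cup2_sum]
  refine Finset.sum_congr rfl fun i _ => ?_
  rw [cup2_sum]
  refine Finset.sum_congr rfl fun j _ => ?_
  rw [cup2_smul, cup2_sub, cup2_smul, cup2_smul]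

lemma Ka_one (a b : M → M → ℝ) (hb : ∀ x, b x x = 0) (m : ℕ) (L : List (Cls M))
    (hL : ∀ C ∈ L, C.nrm) (ΩB : List B → ℝ) (h0 : ΩB [] = 0) (l : List (TT M B)) :
    Ka R Θ sq a (Rx m (Cls.one b :: L) ΩB) l = pair11 R Θ sq a b * Rs m L ΩB l
      - (sumC m (Cls.one b)).cup (Ka R Θ sq a (Rx m L ΩB)) l := by
  simp only [sumC, Cls.cup]
  rw [cup1_Ka]
  simp only [Ka, pair11, Finset.sum_mul, ← Finset.sum_sub_distrib]
  refine Finset.sum_congr rfl fun i _ => Finset.sum_congr rfl fun j _ => ?_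
  have e : ∀ p q : M, Bp p q (Rx m (Cls.one b :: L) ΩB) l = b p q * Rs m L ΩB l -
      cup1 (fun x y => ∑ s ∈ Finset.range m, b (x.1 s) (y.1 s)) (Bp p q (Rx m L ΩB)) l := by
    intro p q
    have := Bp_cup1 p q (fun x y : TT M B => ∑ s ∈ Finset.range m, b (x.1 s) (y.1 s)) b
      (by simp [hb]) hb (Rx m L ΩB) (Rx_nil m L ΩB h0) l
    rw [Rx_pt m L hL] at this
    exact this
  rw [e, e]; ring

lemma Ka_two (a : M → M → ℝ) (c : M → M → M → ℝ) (h1 : ∀ x y, c x x y = 0)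
    (h2 : ∀ x y, c x y y = 0) (m : ℕ) (L : List (Cls M))
    (ΩB : List B → ℝ) (l : List (TT M B)) :
    Ka R Θ sq a (Rx m (Cls.two c :: L) ΩB) l = 
      (sumC m (Cls.two c)).cup (Ka R Θ sq a (Rx m L ΩB)) l := by
  simp only [sumC, Cls.cup]
  rw [cup2_Ka]
  simp only [Ka]
  refine Finset.sum_congr rfl fun i _ => Finset.sum_congr rfl fun j _ => ?_
  have e : ∀ p q : M, Bp p q (Rx m (Cls.two c :: L) ΩB) l = 
      cup2 (fun x y z => ∑ s ∈ Finset.range m, c (x.1 s) (y.1 s) (z.1 s)) (Bp p q (Rx m L ΩB)) l := by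
    intro p q
    exact Bp_cup2 p q (fun x y z : TT M B => ∑ s ∈ Finset.range m, c (x.1 s) (y.1 s) (z.1 s)) c
      (by simp [h1]) (by simp [h2]) h1 h2 (Rx m L ΩB) l
  rw [e, e]

/-- `a` pairs trivially with `C` -/
def orthC (a : M → M → ℝ) : Cls M → Prop
  | Cls.one b => pair11 R Θ sq a b = 0
  | Cls.two _ => True

lemma Ka_zero (a : M → M → ℝ) (m : ℕ) (L : List (Cls M)) (hL : ∀ C ∈ L, C.nrm)
    (ho : ∀ C ∈ L, orthC R Θ sq a C) (ΩB : List B → ℝ) (h0 : ΩB [] = 0) (hΩ : Degen ΩB)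
    (l : List (TT M B)) : Ka R Θ sq a (Rx m L ΩB) l = 0 := by
  induction L generalizing l with
  | nil =>
    unfold Ka Rx
    simp [Bp_last ΩB hΩ]
  | cons C L ih =>
    have ih' : Ka R Θ sq a (Rx m L ΩB) = fun _ => 0 :=
      funext (ih (fun C hC => hL C (by simp [hC])) (fun C hC => ho C (by simp [hC])))
    have hC := hL C (by simp)
    have hoC := ho C (by simp)
    cases C with
    | one b =>
      rw [Ka_one R Θ sq a b hC m L (fun C hC => hL C (by simp [hC])) ΩB h0, ih', Cls.cup_zero]
      simp only [orthC] at hoC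
      rw [hoC]; ring
    | two c =>
      rw [Ka_two R Θ sq a c hC.1 hC.2, ih', Cls.cup_zero]

lemma Jg_one (a : M → M → ℝ) (ha : ∀ x, a x x = 0) (m : ℕ) (L : List (Cls M))
    (ΩB : List B → ℝ) (h0 : ΩB [] = 0) (l : List (TT M B)) :
    Jg R Θ sq (Rx m (Cls.one a :: L) ΩB) l = Ka R Θ sq a (Rx m L ΩB) l +
      (sumC m (Cls.one a)).cup (Jg R Θ sq (Rx m L ΩB)) l := by
  have : Jg R Θ sq (Rx m L ΩB) = fun l => _ := funext (Jg_eq R Θ sq (Rx m L ΩB))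
  rw [this, Jg_eq]
  simp only [sumC, Cls.cup]
  rw [cup1_sum, Ka, ← Finset.sum_add_distrib]
  refine Finset.sum_congr rfl fun i _ => ?_
  rw [cup1_sum, ← Finset.sum_add_distrib]
  refine Finset.sum_congr rfl fun j _ => ?_
  have := cell_cup1 sq (lo i) (hi i) (lo j) (hi j)
    (fun x y : TT M B => ∑ s ∈ Finset.range m, a (x.1 s) (y.1 s)) a
      (by simp [ha]) ha (Rx m L ΩB) (Rx_nil m L ΩB h0) l
  rw [cup1_smul, ← mul_add, ← this]
  rfl

lemma Jg_two (c : M → M → M → ℝ) (h1 : ∀ x y, c x x y = 0)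
    (h2 : ∀ x y, c x y y = 0) (m : ℕ) (L : List (Cls M)) (hL : ∀ C ∈ L, C.nrm)
    (ΩB : List B → ℝ) (h0 : ΩB [] = 0) (l : List (TT M B)) :
    Jg R Θ sq (Rx m (Cls.two c :: L) ΩB) l = pair2 R Θ sq c * Rs m L ΩB l +
      (sumC m (Cls.two c)).cup (Jg R Θ sq (Rx m L ΩB)) l := by
  have : Jg R Θ sq (Rx m L ΩB) = fun l => _ := funext (Jg_eq R Θ sq (Rx m L ΩB))
  rw [this, Jg_eq]
  simp only [sumC, Cls.cup]
  rw [cup2_sum, pair2, Finset.sum_mul, ← Finset.sum_add_distrib]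
  refine Finset.sum_congr rfl fun i _ => ?_
  rw [cup2_sum, Finset.sum_mul, ← Finset.sum_add_distrib]
  refine Finset.sum_congr rfl fun j _ => ?_
  have := cell_cup2 sq (lo i) (hi i) (lo j) (hi j)
    (fun x y z : TT M B => ∑ s ∈ Finset.range m, c (x.1 s) (y.1 s) (z.1 s)) c
      (by simp [h1]) (by simp [h2]) h1 h2 (Rx m L ΩB) (Rx_nil m L ΩB h0) l
  rw [Rx_pt m L hL] at this
  rw [cup2_smul, mul_assoc (sg i * sg j), ← mul_add, ← this]
  rfl

/-! blocks -/
inductive Blk (M : Type*) where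
  | pair (a b : M → M → ℝ) : Blk M
  | sing (c : M → M → M → ℝ) : Blk M

def Blk.cls : Blk M → List (Cls M)
  | Blk.pair a b => [Cls.one a, Cls.one b]
  | Blk.sing c => [Cls.two c]

def Blk.num : Blk M → ℝ
  | Blk.pair a b => pair11 R Θ sq a b
  | Blk.sing c => pair2 R Θ sq c

def Blk.orth : Blk M → Blk M → Prop
  | Blk.pair a b, y => ∀ C ∈ y.cls, orthC R Θ sq a C ∧ orthC R Θ sq b C
  | Blk.sing _, _ => True

def flat (𝓛 : List (Blk M)) : List (Cls M) := 𝓛.flatMap Blk.cls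

@[simp] lemma flat_nil : flat ([] : List (Blk M)) = [] := rfl
@[simp] lemma flat_cons (b : Blk M) (𝓛 : List (Blk M)) : flat (b :: 𝓛) = b.cls ++ flat 𝓛 := by
  simp [flat]

lemma Jg_blk (b : Blk M) (hb : ∀ C ∈ b.cls, C.nrm) (m : ℕ) (𝓛 : List (Blk M))
    (hL : ∀ C ∈ flat 𝓛, C.nrm) (ho : ∀ y ∈ 𝓛, b.orth R Θ sq y)
    (ΩB : List B → ℝ) (h0 : ΩB [] = 0) (hΩ : Degen ΩB) (l : List (TT M B)) :
    Jg R Θ sq (Rx m (flat (b :: 𝓛)) ΩB) l = b.num R Θ sq * Rs m (flat 𝓛) ΩB l +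
      prodR (b.cls.map (sumC m)) (Jg R Θ sq (Rx m (flat 𝓛) ΩB)) l := by
  cases b with
  | pair a b =>
    have ha : (Cls.one a).nrm := hb _ (by simp [Blk.cls])
    have hb' : (Cls.one b).nrm := hb _ (by simp [Blk.cls])
    have oa : ∀ C ∈ flat 𝓛, orthC R Θ sq a C := by
      intro C hC
      obtain ⟨y, hy, hC⟩ := List.mem_flatMap.1 hC
      exact (ho y hy C hC).1
    have ob : ∀ C ∈ flat 𝓛, orthC R Θ sq b C := by
      intro C hC
      obtain ⟨y, hy, hC⟩ := List.mem_flatMap.1 hC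
      exact (ho y hy C hC).2
    simp only [flat_cons, Blk.cls, List.cons_append, List.nil_append, List.map_cons, List.map_nil,
      prodR_cons, prodR_nil, Blk.num]
    rw [Jg_one R Θ sq a ha m _ ΩB h0, Ka_one R Θ sq a b hb' m _ hL ΩB h0]
    have e1 : Ka R Θ sq a (Rx m (flat 𝓛) ΩB) = fun _ => 0 :=
      funext (Ka_zero R Θ sq a m _ hL oa ΩB h0 hΩ)
    have e2 : Jg R Θ sq (Rx m (Cls.one b :: flat 𝓛) ΩB) =
        (sumC m (Cls.one b)).cup (Jg R Θ sq (Rx m (flat 𝓛) ΩB)) := by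
      funext l
      rw [Jg_one R Θ sq b hb' m _ ΩB h0, Ka_zero R Θ sq b m _ hL ob ΩB h0 hΩ, zero_add]
    rw [e1, Cls.cup_zero, e2]; ring
  | sing c =>
    have hc : (Cls.two c).nrm := hb _ (by simp [Blk.cls])
    simp only [flat_cons, Blk.cls, List.cons_append, List.nil_append, List.map_cons, List.map_nil,
      prodR_cons, prodR_nil, Blk.num]
    exact Jg_two R Θ sq c hc.1 hc.2 m _ hL ΩB h0 l

def remB : List (Blk M) → List (ℝ × List (Blk M))
  | [] => []
  | b :: 𝓛 => (b.num R Θ sq, 𝓛) :: (remB 𝓛).map fun q => (q.1, b :: q.2)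

lemma remB_len (𝓛 : List (Blk M)) : (remB R Θ sq 𝓛).length = 𝓛.length := by
  induction 𝓛 with
  | nil => simp [remB]
  | cons b 𝓛 ih => simp [remB, ih]

lemma remB_spec (𝓛 : List (Blk M)) : ∀ q ∈ remB R Θ sq 𝓛, List.Sublist q.2 𝓛 ∧
    q.2.length + 1 = 𝓛.length ∧
    q.1 * (q.2.map (Blk.num R Θ sq)).prod = (𝓛.map (Blk.num R Θ sq)).prod := by
  induction 𝓛 with
  | nil => simp [remB]
  | cons b 𝓛 ih =>
    intro q hq
    simp only [remB, List.mem_cons, List.mem_map] at hq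
    rcases hq with rfl | ⟨q, hq, rfl⟩
    · simp
    · obtain ⟨h1, h2, h3⟩ := ih q hq
      refine ⟨h1.cons_cons b, by simp [h2], ?_⟩
      simp only [List.map_cons, List.prod_cons, ← h3]; ring

lemma prodR_append {T : Type*} (L L' : List (Cls T)) (Ω : List T → ℝ) :
    prodR (L ++ L') Ω = prodR L (prodR L' Ω) := by
  simp [prodR, List.foldr_append]

lemma Cls.cup_smul {T : Type*} (C : Cls T) (r : ℝ) (Φ : List T → ℝ) (l : List T) :
    C.cup (fun m => r * Φ m) l = r * C.cup Φ l := by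
  cases C with
  | one h => exact cup1_smul h r Φ l
  | two h => exact cup2_smul h r Φ l

lemma Cls.cup_add {T : Type*} (C : Cls T) (Φ Ψ : List T → ℝ) (l : List T) :
    C.cup (fun m => Φ m + Ψ m) l = C.cup Φ l + C.cup Ψ l := by
  have := C.cup_sub Φ (fun m => (-1) * Ψ m) l
  rw [C.cup_smul] at this
  simpa [sub_eq_add_neg] using this

lemma prodR_lin {T : Type*} (L : List (Cls T)) {ι : Type*} (s : List ι) (r : ι → ℝ)
    (Φ : ι → List T → ℝ) :
    prodR L (fun m => (s.map fun i => r i * Φ i m).sum) =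
      fun l => (s.map fun i => r i * prodR L (Φ i) l).sum := by
  induction L with
  | nil => rfl
  | cons C L ih =>
    simp only [prodR_cons]
    rw [ih]
    funext l
    induction s with
    | nil => simpa using C.cup_zero l
    | cons i s ihs =>
      simp only [List.map_cons, List.sum_cons]
      rw [C.cup_add, C.cup_smul]
      congr 1
      apply ihs
      have := ih
      funext l
      clear ihs ih this
      induction L generalizing l with
      | nil => rfl
      | cons C L ih =>
        simp only [prodR_cons]
        have : prodR L (fun m => (s.map fun i => r i * Φ i m).sum) =
          fun l => (s.map fun i => r i * prodR L (Φ i) l).sum := funext ih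
        rw [this]
        clear this ih
        induction s with
        | nil => simpa using C.cup_zero l
        | cons i s ihs =>
          simp only [List.map_cons, List.sum_cons]
          rw [C.cup_add, C.cup_smul, ihs]

lemma Jg_flat (m : ℕ) (𝓛 : List (Blk M))
    (hL : ∀ C ∈ flat 𝓛, C.nrm) (ho : 𝓛.Pairwise (Blk.orth R Θ sq))
    (ΩB : List B → ℝ) (h0 : ΩB [] = 0) (hΩ : Degen ΩB) (l : List (TT M B)) :
    Jg R Θ sq (Rx m (flat 𝓛) ΩB) l =
      ((remB R Θ sq 𝓛).map fun q => q.1 * Rs m (flat q.2) ΩB l).sum := by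
  induction 𝓛 generalizing l with
  | nil =>
    simp only [remB, flat_nil, List.map_nil, List.sum_nil]
    rw [Jg_eq]
    simp only [Rx, List.map_nil, prodR_nil, cell_last _ _ _ _ _ ΩB hΩ]
    simp
  | cons b 𝓛 ih =>
    rw [List.pairwise_cons] at ho
    have hL' : ∀ C ∈ flat 𝓛, C.nrm := fun C hC => hL C (by simp [hC])
    rw [Jg_blk R Θ sq b (fun C hC => hL C (by simp [hC])) m 𝓛 hL' ho.1 ΩB h0 hΩ]
    have ih' := funext (ih hL' ho.2)
    rw [ih', prodR_lin]
    simp only [remB, List.map_cons, List.sum_cons, List.map_map]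
    congr 2
    refine List.map_congr_left fun q _ => ?_
    simp only [Function.comp_apply, flat_cons, Rs, List.map_append, prodR_append]

/-- iterated slants -/
def ev : ℕ → (List (TT M B) → ℝ) → List (TT M B) → ℝ
  | 0, Φ => Φ
  | m + 1, Φ => ev m (Jg R Θ sq (fun l => Φ (l.map (upd m))))

lemma sl_zero {T : Type*} (N : ℕ) (l : List T) : sl N (fun _ => 0) l = 0 := by
  rw [sl_eq]; simp [pr_zero]

lemma Jg_add {T : Type*} (Φ Ψ : List (T × M) → ℝ) (l : List T) :
    Jg R Θ sq (fun m => Φ m + Ψ m) l = Jg R Θ sq Φ l + Jg R Θ sq Ψ l := by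
  unfold Jg
  rw [← sl_add]
  congr 1
  funext m
  rw [← sl_add]

lemma Jg_smul {T : Type*} (r : ℝ) (Φ : List (T × M) → ℝ) (l : List T) :
    Jg R Θ sq (fun m => r * Φ m) l = r * Jg R Θ sq Φ l := by
  unfold Jg
  rw [← sl_smul]
  congr 1
  funext m
  rw [← sl_smul]

lemma ev_add (m : ℕ) (Φ Ψ : List (TT M B) → ℝ) (l : List (TT M B)) :
    ev R Θ sq m (fun l => Φ l + Ψ l) l = ev R Θ sq m Φ l + ev R Θ sq m Ψ l := by
  induction m generalizing Φ Ψ with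
  | zero => rfl
  | succ m ih =>
    simp only [ev]
    rw [← ih]
    congr 1
    funext l
    rw [← Jg_add]

lemma ev_smul (m : ℕ) (r : ℝ) (Φ : List (TT M B) → ℝ) (l : List (TT M B)) :
    ev R Θ sq m (fun l => r * Φ l) l = r * ev R Θ sq m Φ l := by
  induction m generalizing Φ with
  | zero => rfl
  | succ m ih =>
    simp only [ev]
    rw [← ih]
    congr 1
    funext l
    rw [← Jg_smul]

lemma ev_lin (m : ℕ) {ι : Type*} (s : List ι) (r : ι → ℝ)
    (Φ : ι → List (TT M B) → ℝ) (l : List (TT M B)) :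
    ev R Θ sq m (fun m => (s.map fun i => r i * Φ i m).sum) l =
      (s.map fun i => r i * ev R Θ sq m (Φ i) l).sum := by
  induction s with
  | nil =>
    have := ev_smul R Θ sq m 0 (fun _ => 0) l
    simpa using this
  | cons i s ihs =>
    simp only [List.map_cons, List.sum_cons]
    rw [ev_add, ev_smul, ihs]

theorem ev_flat (m : ℕ) (𝓛 : List (Blk M)) (hlen : 𝓛.length = m)
    (hL : ∀ C ∈ flat 𝓛, C.nrm) (ho : 𝓛.Pairwise (Blk.orth R Θ sq))
    (ΩB : List B → ℝ) (h0 : ΩB [] = 0) (hΩ : Degen ΩB) (l : List (TT M B)) :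
    ev R Θ sq m (Rs m (flat 𝓛) ΩB) l =
      m.factorial * (𝓛.map (Blk.num R Θ sq)).prod * lastΩ ΩB l := by
  induction m generalizing 𝓛 with
  | zero =>
    have : 𝓛 = [] := List.length_eq_zero_iff.1 hlen
    subst this
    simp [ev, Rs]
  | succ m ih =>
    simp only [ev]
    have e1 : (fun l => Rs (m + 1) (flat 𝓛) ΩB (l.map (upd m))) = Rx m (flat 𝓛) ΩB :=
      funext (Rs_upd m _ ΩB)
    rw [e1, funext (Jg_flat R Θ sq m 𝓛 hL ho ΩB h0 hΩ), ev_lin]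
    have e2 : ((remB R Θ sq 𝓛).map fun q => q.1 * ev R Θ sq m (Rs m (flat q.2) ΩB) l) =
        (remB R Θ sq 𝓛).map fun q =>
          (m.factorial * (𝓛.map (Blk.num R Θ sq)).prod * lastΩ ΩB l) := by
      refine List.map_congr_left fun q hq => ?_
      obtain ⟨h1, h2, h3⟩ := remB_spec R Θ sq 𝓛 q hq
      rw [ih q.2 (by omega) ?_ (ho.sublist h1), ← h3]
      · ring
      · intro C hC
        apply hL C
        obtain ⟨y, hy, hC⟩ := List.mem_flatMap.1 hC
        exact List.mem_flatMap.2 ⟨y, h1.subset hy, hC⟩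
    rw [e2, List.map_const', List.sum_replicate, remB_len, hlen, Nat.factorial_succ]
    push_cast
    simp; ring

lemma dl_ev (h1 : ∀ i, sq i Θ = sq i 0)
    (h0 : Cancel Θ (sq 0)) (hR : Cancel Θ (sq R)) (m : ℕ) (Φ : List (TT M B) → ℝ)
    (l : List (TT M B)) : ev R Θ sq m (dl Φ) l = dl (ev R Θ sq m Φ) l := by
  induction m generalizing Φ with
  | zero => rfl
  | succ m ih =>
    simp only [ev]
    rw [← ih]
    congr 1
    funext l
    rw [dl_Jg h1 h0 hR]
    congr 1
    funext l
    rw [dl_map]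

lemma ev_nil (m : ℕ) (Φ : List (TT M B) → ℝ) (h : Φ [] = 0) : ev R Θ sq m Φ [] = 0 := by
  induction m generalizing Φ with
  | zero => exact h
  | succ m ih =>
    simp only [ev]
    apply ih
    rw [Jg_eq]; simp [cell]

lemma ev_local (m : ℕ) (Fi : List (TT M B) → Prop)
    (hFi : ∀ s < m, ∀ l, Fi l → ∀ i < R, ∀ j < Θ, ∀ q : List (TT M B × M),
      (∀ a ∈ q, a.1 ∈ l ∧ ∃ i' j', (i' = i ∨ i' = i + 1) ∧
      (j' = j ∨ j' = j + 1) ∧ a.2 = sq i' j') → Fi (q.map (upd s)))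
    (Φ Ψ : List (TT M B) → ℝ) (h : ∀ l, Fi l → Φ l = Ψ l) (l : List (TT M B)) (hl : Fi l) :
    ev R Θ sq m Φ l = ev R Θ sq m Ψ l := by
  induction m generalizing Φ Ψ with
  | zero => exact h l hl
  | succ m ih =>
    simp only [ev]
    refine ih (fun s hs => hFi s (by omega)) _ _ fun l hl => ?_
    refine Jg_local _ _ _ _ _ _ fun i hi j hj q hq => h _ ?_
    exact hFi m (by omega) l hl i hi j hj q hq

end J
end blocks
end

section

/-! ### The abstract lower bound -/
section lbabs
variable {X Z M B : Type*} [TopologicalSpace X] [MetricSpace Z] [CompactSpace Z]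

def FiT (Pt : Z → TT M B) (ε : ℝ) (l : List (TT M B)) : Prop :=
  ∃ lz : List Z, FineL ε lz ∧ l = lz.map Pt

lemma FiT.sub {Pt : Z → TT M B} {ε : ℝ} (m l : List (TT M B)) (h : List.Sublist m l)
    (hl : FiT Pt ε l) : FiT Pt ε m := by
  obtain ⟨lz, h1, rfl⟩ := hl
  obtain ⟨mz, h2, rfl⟩ := List.sublist_map_iff.1 h
  exact ⟨mz, fun a ha b hb => h1 a (h2.subset ha) b (h2.subset hb), rfl⟩

lemma FiT.mono {Pt : Z → TT M B} {ε ε' : ℝ} (h : ε ≤ ε') (l : List (TT M B))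
    (hl : FiT Pt ε l) : FiT Pt ε' l := by
  obtain ⟨lz, h1, rfl⟩ := hl
  exact ⟨lz, fun a ha b hb => lt_of_lt_of_le (h1 a ha b hb) h, rfl⟩

def Cls.pull {T T' : Type*} (Q : T → T') : Cls T' → Cls T
  | Cls.one h => Cls.one fun x y => h (Q x) (Q y)
  | Cls.two c => Cls.two fun x y z => c (Q x) (Q y) (Q z)

def Cls.modi {T T' : Type*} (Q : T → T') (β : List T' → ℝ) : Cls T' → Cls T
  | Cls.one h => Cls.one fun x y => h (Q x) (Q y) - dl β [Q x, Q y]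
  | Cls.two c => Cls.two fun x y z => c (Q x) (Q y) (Q z) - dl β [Q x, Q y, Q z]

lemma Cls.coh_modi {T T' : Type*} (Q : T → T') (β : List T' → ℝ) (Fi : List T → Prop)
    (C : Cls T') (D : Cls T) (h : (C.pull Q).coh Fi D) : (C.modi Q β).coh Fi D := by
  cases C with
  | one h' =>
    cases D with
    | one k =>
      obtain ⟨b, hb⟩ := h
      refine ⟨fun x => b x - β [Q x], fun x y hxy => ?_⟩
      have := hb x y hxy
      simp only [dl_two, d0] at this ⊢
      linarith
    | two k => exact h.elim
  | two h' =>
    cases D with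
    | one k => exact h.elim
    | two k =>
      obtain ⟨b, hb⟩ := h
      refine ⟨fun x y => b x y - β [Q x, Q y], fun x y z hxy => ?_⟩
      have := hb x y z hxy
      simp only [dl_three, d1] at this ⊢
      linarith

lemma Cls.coh_cocyc {T : Type*} (Fi : List T → Prop)
    (hFi : ∀ m l, List.Sublist m l → Fi l → Fi m) (C D : Cls T) (h : C.coh Fi D)
    (hD : D.cocyc Fi) : C.cocyc Fi := by
  cases C with
  | one h' =>
    cases D with
    | one k =>
      obtain ⟨b, hb⟩ := h
      intro x y z hx
      have h1 := hb x y (hFi _ _ (by simp) hx)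
      have h2 := hb y z (hFi _ _ (by simp) hx)
      have h3 := hb x z (hFi _ _ (by simp) hx)
      have h4 := hD x y z hx
      simp only [d0, d1] at h1 h2 h3 h4 ⊢
      linarith
    | two k => exact h.elim
  | two h' =>
    cases D with
    | one k => exact h.elim
    | two k =>
      obtain ⟨b, hb⟩ := h
      intro x y z w hx
      have h1 := hb x y z (hFi _ _ (by simp) hx)
      have h2 := hb y z w (hFi _ _ (by simp) hx)
      have h3 := hb x z w (hFi _ _ (by simp) hx)
      have h5 := hb x y w (hFi _ _ (by simp) hx)
      have h4 := hD x y z w hx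
      simp only [d2, d1] at h1 h2 h3 h4 h5 ⊢
      linarith

lemma Cls.val_modi {T T' : Type*} (Q : T → T') (β : List T' → ℝ) (C : Cls T') (m : List T)
    (h : C.val (m.map Q) = dl β (m.map Q)) : (C.modi Q β).val m = 0 := by
  cases C with
  | one h' =>
    rcases m with _ | ⟨a, _ | ⟨b, _ | ⟨c, m⟩⟩⟩ <;> simp [Cls.modi, Cls.val] at h ⊢
    linarith
  | two h' =>
    rcases m with _ | ⟨a, _ | ⟨b, _ | ⟨c, _ | ⟨e, m⟩⟩⟩⟩ <;> simp [Cls.modi, Cls.val] at h ⊢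
    linarith

theorem lb_abstract (Q : TT M B → X) (Pt : Z → TT M B) (hQ : Continuous (Q ∘ Pt))
    (CX : List (Cls X)) (𝓛 : List (Blk M)) (n : ℕ) (hlen : 𝓛.length = n)
    (hnrm : ∀ C ∈ flat 𝓛, C.nrm)
    (ΩX : List X → ℝ) (ΩB : List B → ℝ) (hΩ : ∀ l, ΩX (l.map Q) = lastΩ ΩB l) (h0 : ΩB [] = 0)
    (hdeg : Degen ΩB) (hloc : ∀ C ∈ CX, LocCo C.val) (e0 : ℝ) (he0 : 0 < e0)
    (hcoc : ∀ C ∈ flat 𝓛, (sumC n C).cocyc (FiT Pt e0))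
    (hcoh : List.Forall₂ (Cls.coh (FiT Pt e0)) (CX.map (Cls.pull Q)) ((flat 𝓛).map (sumC n)))
    (hΩd : ∀ l, FiT Pt e0 l → dl (lastΩ ΩB) l = 0)
    (hev : ∀ ε > 0, ∃ (R Θ : ℕ) (sq : ℕ → ℕ → M) (evB : (List B → ℝ) → ℝ) (x0 : ℕ → M),
      (∀ i, sq i Θ = sq i 0) ∧ Cancel Θ (sq 0) ∧ Cancel Θ (sq R) ∧
      𝓛.Pairwise (Blk.orth R Θ sq) ∧ (∀ b ∈ 𝓛, b.num R Θ sq ≠ 0) ∧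
      (∀ s < n, ∀ l, FiT Pt ε l → ∀ i < R, ∀ j < Θ, ∀ q : List (TT M B × M),
        (∀ a ∈ q, a.1 ∈ l ∧ ∃ i' j', (i' = i ∨ i' = i + 1) ∧
          (j' = j ∨ j' = j + 1) ∧ a.2 = sq i' j') → FiT Pt ε (q.map (upd s))) ∧
      (∀ f f' : List B → ℝ, (∀ lB : List B, FiT Pt ε (lB.map fun b => (x0, b)) → f lB = f' lB) →
        evB f = evB f') ∧
      (∀ f f', evB (fun l => f l + f' l) = evB f + evB f') ∧
      (∀ (r : ℝ) f, evB (fun l => r * f l) = r * evB f) ∧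
      (∀ f : List B → ℝ, f [] = 0 → evB (dl f) = 0) ∧ evB ΩB ≠ 0)
    (r : ℕ) (hr : r + 1 = CX.length ∨ (r = CX.length ∧ LocCo ΩX)) : ¬ catLE X r := by
  rintro ⟨U, hU, hcov, hnull⟩
  have hCr : CX.length ≤ r + 1 := by rcases hr with h | h <;> omega
  let φ : Fin (r + 1) → List X → ℝ := fun i =>
    if h : (i : ℕ) < CX.length then (CX.get ⟨i, h⟩).val else ΩX
  have hφ : ∀ i, LocCo (φ i) := by
    intro i
    by_cases h : (i : ℕ) < CX.length
    · simp only [φ, h, dif_pos]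
      exact hloc _ (List.get_mem _ _)
    · simp only [φ, h, dif_neg, not_false_eq_true]
      rcases hr with h' | h'
      · omega
      · exact h'.2
  obtain ⟨ε1, hε1, β, hβ0, hβ⟩ := lb_cover (Q ∘ Pt) hQ U hU hcov hnull φ hφ
  obtain ⟨R, Θ, sq, evB, x0, k1, k2, k3, k4, k5, k6, k7, k8, k9, k10, k11⟩ :=
    hev (min ε1 e0) (by positivity)
  let Lmod : List (Cls (TT M B)) :=
    List.ofFn fun i : Fin CX.length => (CX.get i).modi Q (β ⟨i, by omega⟩)
  let βΩ : List X → ℝ := if h : r = CX.length then β ⟨r, by omega⟩ else fun _ => 0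
  have hβΩ : βΩ [] = 0 := by
    simp only [βΩ]; split_ifs
    · exact hβ0 _
    · rfl
  let Ωmod : List (TT M B) → ℝ := fun l => lastΩ ΩB l - dl (fun m => βΩ (m.map Q)) l
  have hsub := FiT.sub (Pt := Pt) (ε := min ε1 e0)
  have m0 : ∀ l, FiT Pt (min ε1 e0) l → FiT Pt e0 l := FiT.mono (min_le_right _ _)
  have hvan : ∀ l, FiT Pt (min ε1 e0) l → prodR Lmod Ωmod l = 0 := by
    intro l hl
    obtain ⟨lz, hlz, rfl⟩ := hl
    obtain ⟨i, hi⟩ := hβ lz (fun a ha b hb => lt_of_lt_of_le (hlz a ha b hb) (min_le_left _ _))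
    apply prodR_vanish
    by_cases h : (i : ℕ) < CX.length
    · left
      refine ⟨(CX.get ⟨i, h⟩).modi Q (β i), ?_, ?_⟩
      · simp only [Lmod, List.mem_ofFn]
        exact ⟨⟨i, h⟩, rfl⟩
      · intro m hm
        obtain ⟨mz, h2, rfl⟩ := List.sublist_map_iff.1 hm
        apply Cls.val_modi
        have := hi mz h2
        simp only [φ, h, dif_pos] at this
        rw [List.map_map]; exact this
    · right
      intro m hm
      obtain ⟨mz, h2, rfl⟩ := List.sublist_map_iff.1 hm
      have := hi mz h2
      have hrC : r = CX.length := by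
        rcases hr with h' | h'
        · omega
        · exact h'.1
      have hii : i = ⟨r, by omega⟩ := by
        apply Fin.ext; simp only; omega
      simp only [φ, h, dif_neg, not_false_eq_true] at this
      simp only [Ωmod, βΩ, hrC, dif_pos]
      rw [dl_map, ← hΩ, List.map_map, this, hii]
      simp [hrC]
  have hcohM : List.Forall₂ (Cls.coh (FiT Pt (min ε1 e0))) Lmod ((flat 𝓛).map (sumC n)) := by
    rw [List.forall₂_iff_get] at hcoh ⊢
    obtain ⟨hl, hcoh⟩ := hcoh
    refine ⟨by simpa [Lmod] using hl, fun i h1 h2 => ?_⟩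
    have hi : i < CX.length := by simpa [Lmod] using h1
    have := hcoh i (by simpa using hi) h2
    simp only [Lmod, List.get_ofFn]
    apply Cls.coh_modi
    have e : (CX.map (Cls.pull Q)).get ⟨i, by simpa using hi⟩ = (CX.get ⟨i, hi⟩).pull Q := by simp
    rw [e] at this
    revert this
    simp only [Fin.cast_mk]
    generalize (CX.get ⟨i, hi⟩).pull Q = C
    generalize ((flat 𝓛).map (sumC n)).get ⟨i, h2⟩ = D
    intro this
    cases C with
    | one h => cases D with
      | one k => obtain ⟨b, hb⟩ := this; exact ⟨b, fun x y h => hb x y (m0 _ h)⟩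
      | two k => exact this.elim
    | two h => cases D with
      | one k => exact this.elim
      | two k => obtain ⟨b, hb⟩ := this; exact ⟨b, fun x y z h => hb x y z (m0 _ h)⟩
  have hcoc' : ∀ C ∈ (flat 𝓛).map (sumC n), Cls.cocyc (FiT Pt (min ε1 e0)) C := by
    intro C hC
    obtain ⟨D, hD, rfl⟩ := List.mem_map.1 hC
    have := hcoc D hD
    revert this
    generalize (sumC n D : Cls (TT M B)) = C
    intro this
    cases C with
    | one h => exact fun x y z h => this x y z (m0 _ h)
    | two h => exact fun x y z w h => this x y z w (m0 _ h)
  have hcocM : ∀ C ∈ Lmod, Cls.cocyc (FiT Pt (min ε1 e0)) C := by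
    intro C hC
    obtain ⟨i, hi, rfl⟩ := List.mem_iff_getElem.1 hC
    have h2 := hcohM.length_eq
    have h3 := (List.forall₂_iff_get.1 hcohM).2 i hi (by omega)
    exact Cls.coh_cocyc _ hsub _ _ h3 (hcoc' _ (List.get_mem _ _))
  obtain ⟨Ψ, hΨ0, hΨ⟩ := Coh.prodR hsub Lmod _ hcohM hcocM hcoc' Ωmod (lastΩ ΩB)
    (by simpa [lastΩ] using h0) (fun l hl => hΩd l (m0 _ hl))
    ⟨fun l => - βΩ (l.map Q), by simp [hβΩ], fun l hl => by rw [dl_neg]; simp only [Ωmod]; ring⟩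
  let EV : (List (TT M B) → ℝ) → ℝ := fun Φ => evB fun lB => ev R Θ sq n Φ (lB.map fun b => (x0, b))
  have hEVlocal : ∀ Φ Φ', (∀ l, FiT Pt (min ε1 e0) l → Φ l = Φ' l) → EV Φ = EV Φ' := by
    intro Φ Φ' h
    exact k7 _ _ fun lB hlB => ev_local R Θ sq n _ k6 _ _ h _ hlB
  have e1 : EV (fun l => Rs n (flat 𝓛) ΩB l + dl Ψ l) = 0 := by
    have : EV (fun l => Rs n (flat 𝓛) ΩB l + dl Ψ l) = EV (fun l => 0 * prodR Lmod Ωmod l) := by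
      apply hEVlocal
      intro l hl
      show Rs n (flat 𝓛) ΩB l + dl Ψ l = 0 * prodR Lmod Ωmod l
      have h1 := hΨ l hl
      rw [hvan l hl] at h1
      simp only [Rs]
      linarith
    rw [this]
    have : EV (fun l => 0 * prodR Lmod Ωmod l) = 0 * EV (prodR Lmod Ωmod) := by
      simp only [EV]
      rw [← k9]
      congr 1
      funext l
      rw [ev_smul]
    rw [this, zero_mul]
  have e2 : EV (fun l => Rs n (flat 𝓛) ΩB l + dl Ψ l) = EV (Rs n (flat 𝓛) ΩB) + EV (dl Ψ) := by
    simp only [EV]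
    rw [← k8]
    congr 1
    funext l
    rw [ev_add]
  have e3 : EV (dl Ψ) = 0 := by
    simp only [EV]
    have : (fun lB : List B => ev R Θ sq n (dl Ψ) (lB.map fun b => (x0, b))) =
        dl (fun lB => ev R Θ sq n Ψ (lB.map fun b => (x0, b))) := by
      funext lB
      rw [dl_ev R Θ sq k1 k2 k3, dl_map]
    rw [this]
    apply k10
    simpa using ev_nil R Θ sq n Ψ hΨ0
  have e4 : EV (Rs n (flat 𝓛) ΩB) = (n.factorial * (𝓛.map (Blk.num R Θ sq)).prod) * evB ΩB := by
    simp only [EV]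
    rw [← k9]
    congr 1
    funext l
    rw [ev_flat R Θ sq n 𝓛 hlen hnrm k4 ΩB h0 hdeg]
    simp only [lastΩ, List.map_map]
    congr 2
    simp [Function.comp_def]
  rw [e2, e3, e4, add_zero] at e1
  have : (𝓛.map (Blk.num R Θ sq)).prod ≠ 0 := by
    intro h
    rw [List.prod_eq_zero_iff] at h
    obtain ⟨b, hb, hb'⟩ := List.mem_map.1 h
    exact k5 b hb hb'
  have hf : (n.factorial : ℝ) ≠ 0 := by exact_mod_cast n.factorial_ne_zero
  rcases mul_eq_zero.1 e1 with h | h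
  · rcases mul_eq_zero.1 h with h | h
    · exact hf h
    · exact this h
  · exact k11 h

end lbabs
end

section

/-! ### The fundamental cocycle of a sphere -/
section sph

abbrev Sp (k : ℕ) : Type := Metric.sphere (0 : EuclideanSpace ℝ (Fin (k + 1))) 1

lemma Sp_sum {k : ℕ} (y : Sp k) : ∑ i, (y.1 i) ^ 2 = 1 := by
  have h : ‖y.1‖ = 1 := by simpa using y.2
  have := EuclideanSpace.norm_sq_eq y.1
  rw [h] at this
  simpa using this.symm

def SpMk {k : ℕ} (f : Fin (k + 1) → ℝ) (h : ∑ i, (f i) ^ 2 = 1) : Sp k :=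
  ⟨WithLp.toLp 2 f, by simp [EuclideanSpace.norm_eq, h]⟩

def sF {k : ℕ} (y : Sp k) (t : ℝ) : Sp (k + 1) :=
  SpMk (Fin.cons (Real.cos t) (fun i => Real.sin t * y.1 i)) (by
    rw [Fin.sum_univ_succ]
    simp only [Fin.cons_zero, Fin.cons_succ, mul_pow, ← Finset.mul_sum, Sp_sum]
    nlinarith [Real.sin_sq_add_cos_sq t])

lemma sF_zero {k : ℕ} (y : Sp k) (t : ℝ) : (sF y t).1 0 = Real.cos t := rfl
lemma sF_succ {k : ℕ} (y : Sp k) (t : ℝ) (i : Fin (k + 1)) :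
    (sF y t).1 i.succ = Real.sin t * y.1 i := rfl

lemma Sp_dist_sq {k : ℕ} (y z : Sp k) : dist y z ^ 2 = ∑ i, (y.1 i - z.1 i) ^ 2 := by
  rw [Subtype.dist_eq, EuclideanSpace.dist_eq, Real.sq_sqrt (by positivity)]
  simp [Real.dist_eq]

lemma sF_dist {k : ℕ} (y z : Sp k) (t u : ℝ) :
    dist (sF y t) (sF z u) ≤ dist y z + 2 * |t - u| := by
  have h1 : dist (sF y t) (sF z t) ≤ dist y z := by
    apply le_of_sq_le_sq _ dist_nonneg
    rw [Sp_dist_sq, Sp_dist_sq, Fin.sum_univ_succ]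
    simp only [sF_zero, sF_succ, ← mul_sub, mul_pow, ← Finset.mul_sum]
    have : 0 ≤ ∑ i, (y.1 i - z.1 i) ^ 2 := by positivity
    nlinarith [Real.sin_sq_add_cos_sq t, sq_nonneg (Real.cos t)]
  have h2 : dist (sF z t) (sF z u) ≤ 2 * |t - u| := by
    apply le_of_sq_le_sq _ (by positivity)
    rw [Sp_dist_sq, Fin.sum_univ_succ]
    simp only [sF_zero, sF_succ, ← sub_mul, mul_pow, ← Finset.sum_mul, Sp_sum, ← Finset.mul_sum]
    have a1 : |Real.cos t - Real.cos u| ≤ |t - u| := by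
      have := Real.abs_cos_sub_cos_le t u; exact this
    have a2 : |Real.sin t - Real.sin u| ≤ |t - u| := by
      have := Real.abs_sin_sub_sin_le t u; exact this
    have b1 := sq_le_sq' (neg_le_of_abs_le a1) (le_of_abs_le a1)
    have b2 := sq_le_sq' (neg_le_of_abs_le a2) (le_of_abs_le a2)
    nlinarith [sq_nonneg |t - u|]
  linarith [dist_triangle (sF y t) (sF z t) (sF z u)]

def sP : Sp 0 := SpMk (fun _ => 1) (by simp)
def sM : Sp 0 := SpMk (fun _ => -1) (by simp)

def evS (N : ℕ) : (k : ℕ) → (List (Sp k) → ℝ) → ℝ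
  | 0, Φ => Φ [sP] - Φ [sM]
  | k + 1, Φ => evS N k (sl N fun l => Φ (l.map fun p => sF p.1 (Real.pi * p.2 / N)))

lemma evS_add (N k : ℕ) (f f' : List (Sp k) → ℝ) :
    evS N k (fun l => f l + f' l) = evS N k f + evS N k f' := by
  induction k with
  | zero => simp only [evS]; ring
  | succ k ih =>
    simp only [evS]
    rw [← ih]
    congr 1; funext l; rw [sl_add]

lemma evS_smul (N k : ℕ) (r : ℝ) (f : List (Sp k) → ℝ) :
    evS N k (fun l => r * f l) = r * evS N k f := by
  induction k with
  | zero => simp only [evS]; ring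
  | succ k ih =>
    simp only [evS]
    rw [← ih]
    congr 1; funext l; rw [sl_smul]

lemma pr_len {T T' T'' : Type*} (f g : T → T') (f' g' : T → T'') (φ : ℕ → ℝ) (l : List T) :
    pr f g (fun m => φ m.length) l = pr f' g' (fun m => φ m.length) l := by
  have h1 := pr_map (fun _ : T' => ()) f g (fun m => φ m.length) l
  have h2 := pr_map (fun _ : T'' => ()) f' g' (fun m => φ m.length) l
  simp only [List.length_map] at h1 h2
  rw [h1, h2]; rfl

lemma sum_sg {N : ℕ} (hN : Even N) : ∑ j ∈ Finset.range N, sg j = 0 := by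
  obtain ⟨m, rfl⟩ := hN
  induction m with
  | zero => simp
  | succ m ih =>
    rw [show m + 1 + (m + 1) = (m + m) + 1 + 1 by ring, Finset.sum_range_succ, Finset.sum_range_succ, ih]
    have : Even (m + m) := ⟨m, rfl⟩
    have h2 : ¬ Even (m + m + 1) := by rw [Nat.even_add_one]; simpa using this
    simp [sg, this, h2]

lemma sl_len {T : Type*} {N : ℕ} (hN : Even N) (φ : ℕ → ℝ) (l : List T) :
    sl N (fun m => φ m.length) l = 0 := by
  rw [sl_eq]
  have : ∀ j ∈ Finset.range N, sg j * pr (fun a : T => (a, lo j)) (fun a => (a, hi j)) (fun m => φ m.length) l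
     = sg j * pr (fun a : T => a) (fun a => a) (fun m => φ m.length) l := by
    intro j _
    rw [pr_len]
  rw [Finset.sum_congr rfl this, ← Finset.sum_mul, sum_sg hN, zero_mul]

lemma evS_len {N : ℕ} (hN : Even N) (k : ℕ) (φ : ℕ → ℝ) : evS N k (fun l => φ l.length) = 0 := by
  cases k with
  | zero => simp [evS]
  | succ k =>
    simp only [evS, List.length_map]
    have : (sl N fun l : List (Sp k × ℕ) => φ l.length) = fun l => 0 * 0 := by
      funext l; rw [sl_len hN]; simp
    rw [this, evS_smul, zero_mul]

lemma evS_dl {N : ℕ} (hN : Even N) (hN0 : 0 < N) (k : ℕ) (f : List (Sp k) → ℝ) :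
    evS N k (dl f) = 0 := by
  induction k with
  | zero => simp [evS, dl_cons]
  | succ k ih =>
    simp only [evS]
    set F : Sp k × ℕ → Sp (k + 1) := fun p => sF p.1 (Real.pi * p.2 / N) with hF
    have h1 : ∀ l, sl N (fun l => dl f (l.map F)) l = ((fun l => f (l.map fun a => F (a, N))) l
        + (-1) * (fun l => f (l.map fun a => F (a, 0))) l) +
        (-1) * dl (sl N fun l => f (l.map F)) l := by
      intro l
      have := dl_sl N (fun l => f (l.map F)) l
      have h2 : (fun l => dl f (l.map F)) = dl (fun l => f (l.map F)) := by
        funext l; rw [dl_map]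
      rw [h2]
      simp only [List.map_map, Function.comp_def] at this
      simp only
      linarith
    have h2 : (sl N fun l => dl f (l.map F)) = _ := funext h1
    rw [h2, evS_add, evS_add, evS_smul, evS_smul, ih]
    have c1 : ∀ a a' : Sp k, F (a, N) = F (a', N) := by
      intro a a'
      have : Real.pi * N / N = Real.pi := by field_simp
      simp only [hF, this]
      apply Subtype.ext; ext i
      refine Fin.cases ?_ (fun i => ?_) i
      · simp [sF_zero]
      · simp [sF_succ]
    have c2 : ∀ a a' : Sp k, F (a, 0) = F (a', 0) := by
      intro a a'
      simp only [hF]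
      apply Subtype.ext; ext i
      refine Fin.cases ?_ (fun i => ?_) i
      · simp [sF_zero]
      · simp [sF_succ]
    have d1 : ∀ (G : Sp k → Sp (k+1)), (∀ a a', G a = G a') → evS N k (fun l => f (l.map G)) = 0 := by
      intro G hG
      rcases isEmpty_or_nonempty (Sp k) with h | ⟨⟨a0⟩⟩
      · have : (fun l : List (Sp k) => f (l.map G)) = fun l => (fun _ => f []) l.length := by
          funext l
          rcases l with _ | ⟨a, l⟩
          · rfl
          · exact (h.false a).elim
        rw [this]
        exact evS_len hN k (fun _ => f [])
      · have : (fun l : List (Sp k) => f (l.map G)) = fun l => (fun m => f (List.replicate m (G a0))) l.length := by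
          funext l
          simp only
          congr 1
          rw [List.eq_replicate_iff]
          simp only [List.length_map, List.mem_map, true_and]
          rintro b ⟨a, _, rfl⟩
          exact hG _ _
        rw [this]
        exact evS_len hN k (fun m => f (List.replicate m (G a0)))
    rw [d1 _ c1, d1 _ c2]
    simp

lemma evS_local {N : ℕ} (hN0 : 0 < N) (k : ℕ) (δ : ℝ) (hδ : 0 < δ) (hk : k * (2 * (Real.pi / N)) < δ)
    (f f' : List (Sp k) → ℝ)
    (h : ∀ l, FineL δ l → f l = f' l) : evS N k f = evS N k f' := by
  have aux : ∀ (k : ℕ) (η : ℝ), 0 < η → ∀ (f f' : List (Sp k) → ℝ),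
      (∀ l, FineL (η + k * (2 * (Real.pi / N))) l → f l = f' l) → evS N k f = evS N k f' := by
    intro k η hη
    induction k with
    | zero =>
      intro f f' h
      simp only [evS]
      rw [h [sP] (by intro a ha b hb; simp at ha hb; subst ha hb; simp [hη]),
        h [sM] (by intro a ha b hb; simp at ha hb; subst ha hb; simp [hη])]
    | succ k ih =>
      intro f f' h
      simp only [evS]
      apply ih
      intro l hl
      rw [sl_eq, sl_eq]
      refine Finset.sum_congr rfl fun j hj => ?_
      congr 1
      refine pr_local _ _ _ _ _ fun m hm => h _ ?_
      intro a ha b hb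
      obtain ⟨a, ha0, rfl⟩ := List.mem_map.1 ha
      obtain ⟨b, hb0, rfl⟩ := List.mem_map.1 hb
      have key : ∀ c ∈ m, c.1 ∈ l ∧ (c.2 = j ∨ c.2 = j + 1) := by
        intro c hc
        obtain ⟨e, he, h | h⟩ := hm c hc
        · subst h; exact ⟨he, lohi j _ (Or.inl rfl)⟩
        · subst h; exact ⟨he, lohi j _ (Or.inr rfl)⟩
      obtain ⟨ha1, ha2⟩ := key a ha0
      obtain ⟨hb1, hb2⟩ := key b hb0
      have h3 := sF_dist a.1 b.1 (Real.pi * a.2 / N) (Real.pi * b.2 / N)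
      have h4 := hl _ ha1 _ hb1
      have h5 : |Real.pi * a.2 / N - Real.pi * b.2 / N| ≤ Real.pi / N := by
        rw [← sub_div, ← mul_sub, abs_div, abs_mul, abs_of_pos Real.pi_pos,
          abs_of_pos (show (0:ℝ) < N by exact_mod_cast hN0)]
        gcongr
        have : |(a.2 : ℝ) - b.2| ≤ 1 := by
          rcases ha2 with e | e <;> rcases hb2 with e' | e' <;> rw [e, e'] <;> simp
        nlinarith [Real.pi_pos]
      push_cast
      nlinarith
  refine aux k (δ - k * (2 * (Real.pi / N))) (by linarith) f f' fun l hl => h l ?_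
  simpa using hl

/-- sign cochain -/
def chi (t : ℝ) : ℝ := if 0 ≤ t then 1 else 0

def Om : (k : ℕ) → List (ℕ → ℝ) → ℝ
  | 0 => fun l => match l with
    | [x] => chi (x 0)
    | _ => 0
  | k + 1 => cup1 (fun x y => chi (y 0) - chi (x 0)) (fun l => Om k (l.map fun x i => x (i + 1)))

lemma Om_nil (k : ℕ) : Om k [] = 0 := by cases k <;> simp [Om, cup1]

lemma Om_len (k : ℕ) (l : List (ℕ → ℝ)) (h : l.length ≠ k + 1) : Om k l = 0 := by
  induction k generalizing l with
  | zero =>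
    rcases l with _ | ⟨a, _ | ⟨b, l⟩⟩ <;> simp [Om] at h ⊢
  | succ k ih =>
    rcases l with _ | ⟨a, _ | ⟨b, l⟩⟩
    · simp [Om, cup1]
    · simp [Om, cup1]
    · simp only [Om, cup1]
      rw [ih]
      · simp
      · simp at h ⊢; omega

lemma Om_deg (k : ℕ) (l₁ : List (ℕ → ℝ)) (a : ℕ → ℝ) (l₂ : List (ℕ → ℝ)) :
    Om k (l₁ ++ a :: a :: l₂) = 0 := by
  induction k generalizing l₁ a l₂ with
  | zero => apply Om_len; simp; omega
  | succ k ih =>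
    rcases l₁ with _ | ⟨b, l₁⟩
    · simp [Om, cup1]
    · rcases l₁ with _ | ⟨c, l₁⟩
      · simp only [List.cons_append, List.nil_append, Om, cup1, List.map_cons]
        have := ih [] (fun i => a (i+1)) (l₂.map fun x i => x (i + 1))
        simp only [List.nil_append] at this
        rw [this, mul_zero]
      · simp only [List.cons_append, Om, cup1, List.map_cons, List.map_append]
        have := ih (((c :: l₁)).map fun x i => x (i + 1)) (fun i => a (i+1)) (l₂.map fun x i => x (i + 1))
        simp only [List.map_cons, List.cons_append] at this
        rw [this, mul_zero]

lemma dl_Om (k : ℕ) (l : List (ℕ → ℝ)) (i : ℕ) (hi : i ≤ k)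
    (h : ∀ a ∈ l, ∀ b ∈ l, chi (a i) = chi (b i)) : dl (Om k) l = 0 := by
  induction k generalizing l i with
  | zero =>
    obtain rfl : i = 0 := by omega
    rcases l with _ | ⟨a, _ | ⟨b, _ | ⟨c, l⟩⟩⟩
    · simp [dl]
    · simp [dl, Om]
    · rw [dl_two]; simp only [Om]; rw [h a (by simp) b (by simp)]; ring
    · have : dl (Om 0) (a :: b :: c :: l) = dl (fun _ => 0) (a :: b :: c :: l) := by
        rw [dl_cons, dl_cons, dl_cons, dl_zero]
        have : (fun m => Om 0 (a :: b :: c :: m)) = fun m => 0 := by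
          funext m; simp [Om]
        rw [this, dl_zero]; simp [Om]
      rw [this, dl_zero]
  | succ k ih =>
    rw [Om, leib1 _ _ (by simp [Om_nil])]
    have h1 : cup2 (d1 fun x y : ℕ → ℝ => chi (y 0) - chi (x 0)) (fun l => Om k (l.map fun x i => x (i + 1))) l = 0 := by
      rcases l with _ | ⟨a, _ | ⟨b, _ | ⟨c, l⟩⟩⟩ <;> simp [cup2, d1]
    rw [h1]
    rcases l with _ | ⟨a, _ | ⟨b, l⟩⟩
    · simp [cup1]
    · simp [cup1]
    · simp only [cup1]
      rcases i with _ | i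
      · rw [h a (by simp) b (by simp)]; simp
      · rw [dl_map, ih _ i (by omega)]
        · simp
        · intro u hu v hv
          obtain ⟨u, hu0, rfl⟩ := List.mem_map.1 hu
          obtain ⟨v, hv0, rfl⟩ := List.mem_map.1 hv
          exact h u (List.mem_cons_of_mem _ hu0) v (List.mem_cons_of_mem _ hv0)

lemma Om_scale (k : ℕ) (s : ℝ) (hs : 0 < s) (l : List (ℕ → ℝ)) :
    Om k (l.map fun x i => s * x i) = Om k l := by
  have hc : ∀ t, chi (s * t) = chi t := by
    intro t; simp only [chi, mul_nonneg_iff_of_pos_left hs]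
  induction k generalizing l with
  | zero => rcases l with _ | ⟨a, _ | ⟨b, l⟩⟩ <;> simp [Om, hc]
  | succ k ih =>
    rcases l with _ | ⟨a, _ | ⟨b, l⟩⟩
    · simp [Om, cup1]
    · simp [Om, cup1]
    · simp only [Om, cup1, List.map_cons, hc]
      congr 1
      have := ih ((b :: l).map fun x i => x (i + 1))
      simp only [List.map_cons, List.map_map, Function.comp_def] at this ⊢
      exact this

def co {k : ℕ} (y : Sp k) (i : ℕ) : ℝ := if h : i < k + 1 then y.1 ⟨i, h⟩ else 0

def OmS (k : ℕ) (l : List (Sp k)) : ℝ := Om k (l.map co)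

lemma co_sF_zero {k : ℕ} (y : Sp k) (t : ℝ) : co (sF y t) 0 = Real.cos t := by
  simp [co]; exact sF_zero y t
lemma co_sF_succ {k : ℕ} (y : Sp k) (t : ℝ) : (fun i => co (sF y t) (i + 1)) = fun i => Real.sin t * co y i := by
  funext i
  simp only [co, Nat.add_lt_add_iff_right]
  split_ifs with h
  · exact sF_succ y t ⟨i, h⟩
  · simp

lemma evS_Om {m : ℕ} (hm : 2 ≤ m) (k : ℕ) : evS (m + m) k (OmS k) ≠ 0 := by
  induction k with
  | zero => simp [evS, OmS, Om, co, sP, sM, SpMk, chi]; norm_num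
  | succ k ih =>
    simp only [evS]
    have key : (sl (m + m) fun l : List (Sp k × ℕ) => OmS (k + 1) (l.map fun p => sF p.1 (Real.pi * p.2 / ((m + m : ℕ) : ℝ))))
        = fun l => (-1) * OmS k l := by
      have hmp : (0 : ℝ) < m := by exact_mod_cast (by omega : 0 < m)
      funext l
      set T : ℕ → ℝ := fun j => Real.pi * j / ((m + m : ℕ) : ℝ) with hT
      have hT1 : ∀ j : ℕ, T j = (j / m) * (Real.pi / 2) := by
        intro j; simp only [hT]; push_cast; field_simp; ring
      have hpi := Real.pi_pos
      have hcos : ∀ j < m + m + 1, chi (Real.cos (T j)) = if j ≤ m then 1 else 0 := by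
        intro j hj
        rw [chi, hT1]
        have hj' : (j : ℝ) ≤ 2 * m := by exact_mod_cast (by omega : j ≤ 2 * m)
        have hq : (j : ℝ) / m ≤ 2 := by rw [div_le_iff₀ hmp]; linarith
        have hq0 : 0 ≤ (j : ℝ) / m := by positivity
        by_cases h : j ≤ m
        · have h1 : (j : ℝ) / m ≤ 1 := by rw [div_le_one hmp]; exact_mod_cast h
          rw [if_pos, if_pos h]
          apply Real.cos_nonneg_of_mem_Icc
          constructor <;> nlinarith
        · have h1 : 1 < (j : ℝ) / m := by
            rw [one_lt_div hmp]; exact_mod_cast (by omega : m < j)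
          rw [if_neg, if_neg h]
          rw [not_le]
          apply Real.cos_neg_of_pi_div_two_lt_of_lt <;> nlinarith
      have hsin : ∀ j, j = m ∨ j = m + 1 → 0 < Real.sin (T j) := by
        intro j hj
        rw [hT1]
        have h1 : (0:ℝ) < (j : ℝ) / m := by
          have : (0:ℝ) < j := by exact_mod_cast (by omega : 0 < j)
          positivity
        have h2 : (j : ℝ) / m < 2 := by
          rw [div_lt_iff₀ hmp]
          exact_mod_cast (by omega : j < 2 * m)
        apply Real.sin_pos_of_pos_of_lt_pi <;> nlinarith
      rw [sl_eq]
      have hterm : ∀ j ∈ Finset.range (m + m), sg j * pr (fun a : Sp k => (a, lo j)) (fun a => (a, hi j))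
          (fun l => OmS (k + 1) (l.map fun p => sF p.1 (Real.pi * p.2 / ((m + m : ℕ) : ℝ)))) l =
          if j = m then (-1) * OmS k l else 0 := by
        intro j hj
        have hj' := Finset.mem_range.1 hj
        rw [pr_map (fun p : Sp k × ℕ => sF p.1 (T p.2))]
        have eO : OmS (k + 1) = fun l : List (Sp (k + 1)) => Om (k + 1) (l.map co) := rfl
        rw [eO, pr_map (co : Sp (k + 1) → ℕ → ℝ), Om, pr_cup1]
        have z1 : cup1 (fun a b => chi ((co ∘ (fun p : Sp k × ℕ => sF p.1 (T p.2)) ∘ fun a : Sp k => (a, lo j)) b 0)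
            - chi ((co ∘ (fun p : Sp k × ℕ => sF p.1 (T p.2)) ∘ fun a : Sp k => (a, lo j)) a 0))
            (pr (co ∘ (fun p : Sp k × ℕ => sF p.1 (T p.2)) ∘ fun a => (a, lo j)) (co ∘ (fun p : Sp k × ℕ => sF p.1 (T p.2)) ∘ fun a => (a, hi j))
              fun l => Om k (l.map fun x i => x (i + 1))) l = 0 := by
          rcases l with _ | ⟨a, _ | ⟨b, l⟩⟩
          · simp [cup1]
          · simp [cup1]
          · simp [cup1, co_sF_zero]
        rw [z1, sub_zero]
        rcases l with _ | ⟨a, l⟩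
        · simp [cup0, Om_nil, OmS]
        · simp only [cup0, Function.comp_apply, co_sF_zero]
          have hl := lohi j _ (Or.inl rfl)
          have hh := lohi j _ (Or.inr rfl)
          rw [hcos _ (by omega), hcos _ (by omega)]
          by_cases hjm : j = m
          · rw [if_pos hjm]
            have e1 : ((List.map (co ∘ (fun p : Sp k × ℕ => sF p.1 (T p.2)) ∘ fun a => (a, hi j)) (a :: l)).map fun x i => x (i + 1))
                = ((a :: l).map co).map fun x i => Real.sin (T (hi j)) * x i := by
              rw [List.map_map, List.map_map]
              apply List.map_congr_left
              intro y _
              simp only [Function.comp_apply]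
              exact co_sF_succ _ _
            rw [e1, Om_scale _ _ (hsin _ (by omega))]
            by_cases he : Even j
            · simp [sg, lo, hi, he, hjm]
              have : Even m := hjm ▸ he
              simp [this, OmS]
            · have : ¬ Even m := hjm ▸ he
              simp [sg, lo, hi, hjm, this, OmS]
          · rw [if_neg hjm]
            have : (lo j ≤ m) ↔ (hi j ≤ m) := by omega
            simp [this]
      rw [Finset.sum_congr rfl hterm]
      simp [hm]
      intro h
      omega
    rw [key, evS_smul]
    simpa using ih

lemma Sp_coord {k : ℕ} (y : Sp k) : ∃ i : Fin (k + 1), 1 / ((k : ℝ) + 1) ≤ |y.1 i| := by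
  by_contra! h
  have h1 := Sp_sum y
  have hk : (0 : ℝ) < (k : ℝ) + 1 := by positivity
  have : ∑ i, (y.1 i) ^ 2 < ∑ _i : Fin (k + 1), 1 / ((k : ℝ) + 1) := by
    apply Finset.sum_lt_sum_of_nonempty Finset.univ_nonempty
    intro i _
    have h2 := h i
    have h3 : 1 / ((k : ℝ) + 1) ≤ 1 := by rw [div_le_one hk]; linarith [Nat.cast_nonneg (α := ℝ) k]
    rw [← sq_abs]
    nlinarith [abs_nonneg (y.1 i)]
  rw [h1] at this
  simp at this
  rw [mul_inv_cancel₀ hk.ne'] at this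
  exact lt_irrefl _ this

lemma OmS_dl {k : ℕ} (l : List (Sp k)) (h : FineL (1 / ((k : ℝ) + 1)) l) : dl (OmS k) l = 0 := by
  rcases l with _ | ⟨y, l⟩
  · simp [dl]
  obtain ⟨i, hi⟩ := Sp_coord y
  have : OmS k = fun l : List (Sp k) => Om k (l.map co) := rfl
  rw [this, dl_map co]
  apply dl_Om k _ i (by omega)
  have key : ∀ b ∈ y :: l, chi (co b i) = chi (co y i) := by
    intro b hb
    have h1 := h b hb y (by simp)
    have h2 : |b.1 i - y.1 i| ≤ dist b y := by
      apply abs_le_of_sq_le_sq _ dist_nonneg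
      rw [Sp_dist_sq]
      exact Finset.single_le_sum (f := fun i => (b.1 i - y.1 i) ^ 2) (fun _ _ => sq_nonneg _) (Finset.mem_univ i)
    have h3 : |b.1 i - y.1 i| < |y.1 i| := by linarith
    simp only [co, i.2, dif_pos, Fin.eta, chi]
    have : (0 ≤ b.1 i) ↔ (0 ≤ y.1 i) := by
      have h4 := abs_lt.1 h3
      rcases abs_cases (y.1 i) with ⟨e, e'⟩ | ⟨e, e'⟩ <;> rw [e] at h4 <;> constructor <;> intro <;> linarith
    simp [this]
  intro a ha b hb
  obtain ⟨a, ha0, rfl⟩ := List.mem_map.1 ha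
  obtain ⟨b, hb0, rfl⟩ := List.mem_map.1 hb
  rw [key a ha0, key b hb0]

lemma OmS_degen (k : ℕ) : Degen (OmS k) := by
  intro l₁ a l₂
  simp only [OmS, List.map_append, List.map_cons]
  exact Om_deg _ _ _ _

lemma OmS_locCo {k : ℕ} (hk : 1 ≤ k) {X : Type*} [TopologicalSpace X] (p : X → Sp k) (hp : Continuous p) :
    LocCo (fun l : List X => OmS k (l.map p)) := by
  refine ⟨fun y => ⟨p ⁻¹' (Metric.ball (p y) (1 / ((k : ℝ) + 1) / 2)), ?_, fun l hl => ?_⟩, fun y l hl => ?_⟩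
  · exact (Metric.isOpen_ball.preimage hp).mem_nhds (by simp; positivity)
  · rw [dl_map p]
    apply OmS_dl
    intro a ha b hb
    obtain ⟨a, ha0, rfl⟩ := List.mem_map.1 ha
    obtain ⟨b, hb0, rfl⟩ := List.mem_map.1 hb
    have h1 := hl a ha0
    have h2 := hl b hb0
    simp only [Set.mem_preimage, Metric.mem_ball] at h1 h2
    have := dist_triangle_right (p a) (p b) (p y)
    linarith
  · rcases l with _ | ⟨a, _ | ⟨b, l⟩⟩
    · simp [OmS, Om_nil]
    · apply Om_len; simp; omega
    · have h1 := hl a (by simp)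
      have h2 := hl b (by simp)
      subst h1; subst h2
      exact OmS_degen k [] (p b) (l.map p)

end sph
end

section

/-! ### The disc, the surface and its coordinate functions -/
section disc

lemma tpI (x : ℝ) : (2 * Real.pi * Complex.I * x : ℂ) = ((2 * Real.pi * x : ℝ) : ℂ) * Complex.I := by
  push_cast; ring

/-- `e^{2πix}` -/
def ex (x : ℝ) : ℂ := Complex.exp (2 * Real.pi * Complex.I * x)

lemma ex_norm (x : ℝ) : ‖ex x‖ = 1 := by rw [ex, tpI, Complex.norm_exp_ofReal_mul_I]
lemma ex_add (x y : ℝ) : ex (x + y) = ex x * ex y := by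
  rw [ex, ex, ex, ← Complex.exp_add]; push_cast; ring_nf
lemma ex_zero : ex 0 = 1 := by simp [ex]
lemma ex_int (n : ℤ) : ex n = 1 := by
  rw [ex, Complex.exp_eq_one_iff]; exact ⟨n, by push_cast; ring⟩
lemma ex_neg (x : ℝ) : ex (-x) = (starRingEnd ℂ) (ex x) := by
  rw [ex, ex, ← Complex.exp_conj]; congr 1; simp [Complex.conj_ofNat]
lemma ex_ne (x : ℝ) : ex x ≠ 0 := Complex.exp_ne_zero _
lemma ex_cont : Continuous ex := by unfold ex; fun_prop
lemma ex_eq_iff (x y : ℝ) : ex x = ex y ↔ ∃ n : ℤ, x = y + n := by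
  rw [ex, ex, Complex.exp_eq_exp_iff_exists_int]
  constructor
  · rintro ⟨n, h⟩
    refine ⟨n, ?_⟩
    have h2 : (2 * Real.pi * Complex.I : ℂ) ≠ 0 := Complex.two_pi_I_ne_zero
    have : (2 * Real.pi * Complex.I : ℂ) * x = (2 * Real.pi * Complex.I) * ((y + n : ℝ) : ℂ) := by
      rw [h]; push_cast; ring
    exact_mod_cast mul_left_cancel₀ h2 this
  · rintro ⟨n, h⟩
    exact ⟨n, by rw [h]; push_cast; ring⟩
lemma ex_sum {ι : Type*} (s : Finset ι) (f : ι → ℝ) : ex (∑ i ∈ s, f i) = ∏ i ∈ s, ex (f i) := by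
  classical
  induction s using Finset.induction_on with
  | empty => simp [ex_zero]
  | insert a s ha ih => rw [Finset.sum_insert ha, Finset.prod_insert ha, ex_add, ih]

lemma arg_ex (r : ℝ) (hr : 0 < r) (x : ℝ) (h : |x| < 1 / 2) : Complex.arg (r * ex x) = 2 * Real.pi * x := by
  rw [ex, tpI]
  rw [Complex.arg_real_mul _ hr]
  obtain ⟨h1, h2⟩ := abs_lt.1 h
  have hp := Real.pi_pos
  rw [Complex.arg_exp_mul_I, toIocMod_eq_self]
  constructor <;> nlinarith

lemma arg_ex' (x : ℝ) (h : |x| < 1 / 2) : Complex.arg (ex x) = 2 * Real.pi * x := by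
  simpa using arg_ex 1 one_pos x h

lemma eq_ex (z : ℂ) : z = ‖z‖ * ex (Complex.arg z / (2 * Real.pi)) := by
  conv_lhs => rw [← Complex.norm_mul_exp_arg_mul_I z]
  rw [ex, tpI]
  have : 2 * Real.pi * (Complex.arg z / (2 * Real.pi)) = Complex.arg z := by
    field_simp
  rw [this]

lemma polyBP_eq (N k : ℕ) (t : ℝ) : polyBP N k t = ex ((k + t) / N) := by
  simp [polyBP, ex]

/-- polar coordinates -/
def polar (p : I × I) : Disc := ⟨(p.1 : ℝ) * ex p.2, by
  rw [norm_mul, ex_norm, mul_one, Complex.norm_real, Real.norm_of_nonneg p.1.2.1]; exact p.1.2.2⟩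

lemma polar_cont : Continuous polar := by
  unfold polar
  apply Continuous.subtype_mk
  exact (Complex.continuous_ofReal.comp (continuous_subtype_val.comp continuous_fst)).mul
    (ex_cont.comp (continuous_subtype_val.comp continuous_snd))

lemma ex_fract (x : ℝ) : ex (Int.fract x) = ex x := by
  rw [ex_eq_iff]; exact ⟨-⌊x⌋, by rw [Int.fract]; push_cast; ring⟩

def angD (z : Disc) : ℝ := Int.fract (Complex.arg z.1 / (2 * Real.pi))

lemma angD_mem (z : Disc) : angD z ∈ Set.Ico (0 : ℝ) 1 := ⟨Int.fract_nonneg _, Int.fract_lt_one _⟩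

lemma eq_angD (z : Disc) : z.1 = ‖z.1‖ * ex (angD z) := by
  rw [angD, ex_fract]; exact eq_ex z.1

lemma polar_surj : Function.Surjective polar := by
  intro z
  refine ⟨⟨⟨‖z.1‖, norm_nonneg _, z.2⟩, ⟨angD z, (angD_mem z).1, (angD_mem z).2.le⟩⟩, ?_⟩
  apply Subtype.ext
  exact (eq_angD z).symm

instance : CompactSpace Disc := by
  have : IsCompact {z : ℂ | ‖z‖ ≤ 1} := by
    have := isCompact_closedBall (0 : ℂ) 1
    convert this using 1
    ext z; simp
  exact isCompact_iff_compactSpace.1 this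

lemma polar_quot : Topology.IsQuotientMap polar :=
  polar_cont.isClosedMap.isQuotientMap polar_cont polar_surj

/-- clamp to `[0,1]` -/
def cl (x : ℝ) : ℝ := max 0 (min x 1)
lemma cl_cont : Continuous cl := by unfold cl; fun_prop
lemma cl_le0 {x : ℝ} (h : x ≤ 0) : cl x = 0 := by
  rw [cl, max_eq_left]; exact (min_le_left _ _).trans h
lemma cl_ge1 {x : ℝ} (h : 1 ≤ x) : cl x = 1 := by
  rw [cl, min_eq_right h]; simp
lemma cl_mid {x : ℝ} (h0 : 0 ≤ x) (h : x ≤ 1) : cl x = x := by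
  rw [cl, min_eq_left h, max_eq_right h0]

def pw (c : ℕ) (t : ℝ) : ℝ := cl (t - c) - cl (t - c - 2)
lemma pw_cont (c : ℕ) : Continuous (pw c) := by
  unfold pw
  exact (cl_cont.comp (by fun_prop)).sub (cl_cont.comp (by fun_prop))
lemma pw_le {c : ℕ} {t : ℝ} (h : t ≤ c) : pw c t = 0 := by
  rw [pw, cl_le0 (by linarith), cl_le0 (by linarith)]; ring
lemma pw_ge {c : ℕ} {t : ℝ} (h : (c : ℝ) + 3 ≤ t) : pw c t = 0 := by
  rw [pw, cl_ge1 (by linarith), cl_ge1 (by linarith)]; ring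
lemma pw_up {c : ℕ} {t : ℝ} (h : (c : ℝ) ≤ t) (h' : t ≤ c + 1) : pw c t = t - c := by
  rw [pw, cl_mid (by linarith) (by linarith), cl_le0 (by linarith)]; ring
lemma pw_one {c : ℕ} {t : ℝ} (h : (c : ℝ) + 1 ≤ t) (h' : t ≤ c + 2) : pw c t = 1 := by
  rw [pw, cl_ge1 (by linarith), cl_le0 (by linarith)]; ring
lemma pw_down {c : ℕ} {t : ℝ} (h : (c : ℝ) + 2 ≤ t) (h' : t ≤ c + 3) : pw c t = c + 3 - t := by
  rw [pw, cl_ge1 (by linarith), cl_mid (by linarith) (by linarith)]; ring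

/-- lifts of the standard classes to the disc -/
def al (g k : ℕ) (r : Fin 2) (z : Disc) : ℝ := ‖z.1‖ * pw (4 * k + r) (4 * g * angD z)

lemma pw_end (g k : ℕ) (r : Fin 2) : pw (4 * k + r) (4 * g : ℝ) = 0 := by
  by_cases h : g ≤ k
  · apply pw_le
    push_cast
    have : (g : ℝ) ≤ k := by exact_mod_cast h
    have : (0:ℝ) ≤ ((r : ℕ) : ℝ) := by positivity
    linarith
  · apply pw_ge
    have : (k : ℝ) + 1 ≤ g := by exact_mod_cast (by omega : k + 1 ≤ g)
    have : ((r : ℕ) : ℝ) ≤ 1 := by exact_mod_cast (by omega : (r : ℕ) ≤ 1)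
    push_cast
    linarith

lemma al_polar (g k : ℕ) (r : Fin 2) (s t : I) :
    al g k r (polar (s, t)) = s * pw (4 * k + r) (4 * g * t) := by
  have hn : ‖(polar (s, t)).1‖ = s := by
    show ‖((s : ℝ) : ℂ) * ex t‖ = _
    rw [norm_mul, ex_norm, mul_one, Complex.norm_real, Real.norm_of_nonneg s.2.1]
  rw [al, hn]
  by_cases hs : (s : ℝ) = 0
  · rw [hs]; ring
  congr 1
  have h := eq_angD (polar (s, t))
  rw [hn] at h
  have h1 : ex t = ex (angD (polar (s, t))) := by
    have h2 : ((s : ℝ) : ℂ) ≠ 0 := by exact_mod_cast hs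
    exact mul_left_cancel₀ h2 h
  obtain ⟨m, hm⟩ := (ex_eq_iff _ _).1 h1
  obtain ⟨ha, hb⟩ := angD_mem (polar (s, t))
  have t0 := t.2.1
  have t1 := t.2.2
  have hm0 : m = 0 ∨ m = 1 := by
    have : (-1 : ℝ) < m := by linarith
    have : (m : ℝ) < 2 := by linarith
    have : -1 < m := by exact_mod_cast ‹(-1 : ℝ) < m›
    have : m < 2 := by exact_mod_cast ‹(m : ℝ) < 2›
    omega
  rcases hm0 with rfl | rfl
  · rw [hm]; simp
  · push_cast at hm
    have e1 : (t : ℝ) = 1 := by linarith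
    have e2 : angD (polar (s, t)) = 0 := by linarith
    rw [e1, e2, mul_one, mul_zero, pw_end, pw_le]
    positivity

lemma al_cont (g k : ℕ) (r : Fin 2) : Continuous (al g k r) := by
  rw [polar_quot.continuous_iff]
  have : al g k r ∘ polar = fun p => (p.1 : ℝ) * pw (4 * k + r) (4 * g * (p.2 : ℝ)) := by
    funext p; exact al_polar g k r p.1 p.2
  rw [this]
  exact (continuous_subtype_val.comp continuous_fst).mul ((pw_cont _).comp
    (continuous_const.mul (continuous_subtype_val.comp continuous_snd)))

/-- value at a rim point -/
lemma al_rim (g k : ℕ) (r : Fin 2) (z : Disc) (t : ℝ) (h0 : 0 ≤ t) (h1 : t ≤ 1) (h : z.1 = ex t) :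
    al g k r z = pw (4 * k + r) (4 * g * t) := by
  have : z = polar (1, ⟨t, h0, h1⟩) := by
    apply Subtype.ext; rw [h]; simp [polar]
  rw [this, al_polar]; simp

lemma al_node (g k : ℕ) (r : Fin 2) (z : Disc) (s t : ℝ) (hs : 0 ≤ s) (hs1 : s ≤ 1) (h0 : 0 ≤ t) (h1 : t ≤ 1) (h : z.1 = s * ex t) :
    al g k r z = s * pw (4 * k + r) (4 * g * t) := by
  have : z = polar (⟨s, hs, hs1⟩, ⟨t, h0, h1⟩) := by
    apply Subtype.ext; rw [h]; simp [polar]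
  rw [this, al_polar]

/-- rim values and the gluing -/
lemma al_glue (g k : ℕ) (r : Fin 2) (z w : Disc) (h : orientRel g z w) :
    ∃ m : ℤ, al g k r z = al g k r w + m := by
  obtain ⟨j, r', t, h0, h1, hz, hw⟩ := h
  rw [polyBP_eq] at hz hw
  have hg : (1 : ℝ) ≤ g := by
    have := j.2
    exact_mod_cast (by omega : 1 ≤ g)
  have hjg : ((j : ℕ) : ℝ) + 1 ≤ g := by exact_mod_cast j.2
  have hr' : ((r' : ℕ) : ℝ) = 0 ∨ ((r' : ℕ) : ℝ) = 1 := by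
    have := r'.2
    rcases (show (r' : ℕ) = 0 ∨ (r' : ℕ) = 1 by omega) with h | h <;> simp [h]
  have hr'0 : (0 : ℝ) ≤ ((r' : ℕ) : ℝ) := by positivity
  have hj0 : (0 : ℝ) ≤ ((j : ℕ) : ℝ) := by positivity
  have hr'1 : ((r' : ℕ) : ℝ) ≤ 1 := by rcases hr' with h | h <;> rw [h]; norm_num
  have g4 : (0 : ℝ) < ((4 * g : ℕ) : ℝ) := by push_cast; linarith
  rw [al_rim g k r z _ (by positivity) (by rw [div_le_one g4]; push_cast; linarith) hz,
    al_rim g k r w _ (by apply div_nonneg _ g4.le; push_cast; linarith)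
      (by rw [div_le_one g4]; push_cast; linarith) hw]
  have e1 : (4 * g : ℝ) * (((4 * (j:ℕ) + (r' : ℕ) : ℕ) + t) / ((4 * g : ℕ) : ℝ)) = 4 * (j : ℕ) + (r' : ℕ) + t := by
    push_cast; field_simp
  have e2 : (4 * g : ℝ) * (((4 * (j:ℕ) + (r' : ℕ) + 2 : ℕ) + (1 - t)) / ((4 * g : ℕ) : ℝ)) = 4 * (j : ℕ) + (r' : ℕ) + 3 - t := by
    push_cast; field_simp; ring
  rw [e1, e2]
  have hr : ((r : ℕ) : ℝ) = 0 ∨ ((r : ℕ) : ℝ) = 1 := by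
    have := r.2
    rcases (show (r : ℕ) = 0 ∨ (r : ℕ) = 1 by omega) with h | h <;> simp [h]
  have hc : ((4 * k + (r : ℕ) : ℕ) : ℝ) = 4 * k + (r : ℕ) := by push_cast; ring
  rcases lt_trichotomy (j : ℕ) k with hjk | hjk | hjk
  · have : ((j : ℕ) : ℝ) + 1 ≤ k := by exact_mod_cast hjk
    refine ⟨0, ?_⟩
    rw [pw_le, pw_le]; · simp
    all_goals rw [hc]; rcases hr with h | h <;> rw [h] <;> linarith
  · rw [hjk]
    rcases hr with h | h <;> rcases hr' with h' | h' <;> rw [h'] <;> rw [h] at hc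
    · refine ⟨0, ?_⟩
      rw [pw_up (by linarith) (by linarith), pw_down (by linarith) (by linarith), hc]; push_cast; ring
    · refine ⟨1, ?_⟩
      rw [pw_one (by linarith) (by linarith), pw_ge (by linarith)]; simp
    · refine ⟨-1, ?_⟩
      rw [pw_le (by linarith), pw_one (by linarith) (by linarith)]; simp
    · refine ⟨0, ?_⟩
      rw [pw_up (by linarith) (by linarith), pw_down (by linarith) (by linarith), hc]; push_cast; ring
  · have : (k : ℝ) + 1 ≤ ((j : ℕ) : ℝ) := by exact_mod_cast hjk
    refine ⟨0, ?_⟩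
    rw [pw_ge, pw_ge]; · simp
    all_goals rw [hc]; rcases hr with h | h <;> rw [h] <;> linarith

lemma orientRel_norm {g : ℕ} {z w : Disc} (h : orientRel g z w) : ‖z.1‖ = 1 ∧ ‖w.1‖ = 1 := by
  obtain ⟨j, r', t, h0, h1, hz, hw⟩ := h
  rw [hz, hw, polyBP_eq, polyBP_eq, ex_norm, ex_norm]; simp

/-! the projection -/
def mu (z : Disc) : ℝ := Real.sqrt (1 - ‖z.1‖ ^ 2)
lemma mu_cont : Continuous mu := by unfold mu; fun_prop
lemma mu_sq (z : Disc) : mu z ^ 2 = 1 - ‖z.1‖ ^ 2 := by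
  rw [mu, Real.sq_sqrt]
  nlinarith [z.2, norm_nonneg z.1]
lemma mu_nonneg (z : Disc) : 0 ≤ mu z := Real.sqrt_nonneg _

def prj0 (z : Disc) : Sp 2 := SpMk ![2 * (z.1.re * mu z), 2 * (z.1.im * mu z), 2 * ‖z.1‖ ^ 2 - 1] (by
  simp [Fin.sum_univ_three]
  have h := mu_sq z
  have h2 : ‖z.1‖ ^ 2 = z.1.re ^ 2 + z.1.im ^ 2 := by
    rw [← Complex.normSq_eq_norm_sq, Complex.normSq_apply]; ring
  rw [h2] at h ⊢
  linear_combination (4 * (z.1.re ^ 2 + z.1.im ^ 2)) * h)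

lemma prj0_cont : Continuous prj0 := by
  unfold prj0 SpMk
  apply Continuous.subtype_mk
  apply (PiLp.continuous_toLp 2 _).comp
  have := mu_cont
  refine continuous_pi fun i => ?_
  fin_cases i <;> simp <;> fun_prop

lemma prj0_surj : Function.Surjective prj0 := by
  intro x
  have hs := Sp_sum x
  rw [Fin.sum_univ_three] at hs
  by_cases h3 : x.1 2 = 1
  · have h0 : x.1 0 = 0 := by rw [h3] at hs; nlinarith [sq_nonneg (x.1 0), sq_nonneg (x.1 1)]
    have h1 : x.1 1 = 0 := by rw [h3] at hs; nlinarith [sq_nonneg (x.1 0), sq_nonneg (x.1 1)]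
    refine ⟨⟨1, by simp⟩, ?_⟩
    apply Subtype.ext; ext i
    fin_cases i
    · simp [prj0, SpMk, mu, h0]
    · simp [prj0, SpMk, h1]
    · simp [prj0, SpMk, h3]; norm_num
  · have hlt : x.1 2 < 1 := by
      rcases lt_or_gt_of_ne h3 with h | h
      · exact h
      · nlinarith [sq_nonneg (x.1 0), sq_nonneg (x.1 1)]
    set m := Real.sqrt ((1 - x.1 2) / 2) with hm
    have hm2 : m ^ 2 = (1 - x.1 2) / 2 := Real.sq_sqrt (by linarith)
    have hmp : 0 < m := Real.sqrt_pos.2 (by linarith)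
    have hnorm : ‖(⟨x.1 0 / (2 * m), x.1 1 / (2 * m)⟩ : ℂ)‖ ^ 2 = (1 + x.1 2) / 2 := by
      rw [← Complex.normSq_eq_norm_sq, Complex.normSq_apply]
      have : x.1 0 / (2 * m) * (x.1 0 / (2 * m)) + x.1 1 / (2 * m) * (x.1 1 / (2 * m)) =
        ((x.1 0) ^ 2 + (x.1 1) ^ 2) / (4 * m ^ 2) := by field_simp; ring
      show x.1 0 / (2 * m) * (x.1 0 / (2 * m)) + x.1 1 / (2 * m) * (x.1 1 / (2 * m)) = _
      rw [this, hm2, div_eq_iff (by linarith)]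
      nlinarith
    refine ⟨⟨⟨x.1 0 / (2 * m), x.1 1 / (2 * m)⟩, ?_⟩, ?_⟩
    · rw [← abs_norm, ← sq_le_one_iff_abs_le_one, hnorm]; linarith
    · have hmu : mu ⟨⟨x.1 0 / (2 * m), x.1 1 / (2 * m)⟩, by
          rw [← abs_norm, ← sq_le_one_iff_abs_le_one, hnorm]; linarith⟩ = m := by
        rw [mu, hnorm, hm]; congr 1; ring
      apply Subtype.ext; ext i
      fin_cases i
      · simp [prj0, SpMk, hmu]; field_simp
      · simp [prj0, SpMk, hmu]; field_simp
      · simp only [prj0, SpMk, hnorm]; simp; ring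

def prj : (g : ℕ) → Disc → Mg g
  | 0 => prj0
  | g + 1 => Quot.mk _

lemma prj_cont (g : ℕ) : Continuous (prj g) := by
  cases g with
  | zero => exact prj0_cont
  | succ g => exact continuous_quot_mk

lemma prj_surj (g : ℕ) : Function.Surjective (prj g) := by
  cases g with
  | zero => exact prj0_surj
  | succ g => exact Quot.mk_surjective

def uM : (g k : ℕ) → (r : Fin 2) → Mg g → ℂ
  | 0, _, _ => fun _ => 1
  | g + 1, k, r => Quot.lift (fun z => ex (al (g + 1) k r z)) (fun z w h =>
      (ex_eq_iff _ _).2 (al_glue _ _ _ _ _ h))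

lemma uM_prj (g k : ℕ) (r : Fin 2) (z : Disc) : uM g k r (prj g z) = ex (al g k r z) := by
  cases g with
  | zero =>
    have : al 0 k r z = 0 := by
      rw [al, pw_le, mul_zero]
      simp; positivity
    rw [this, ex_zero]; rfl
  | succ g => rfl

lemma uM_cont (g k : ℕ) (r : Fin 2) : Continuous (uM g k r) := by
  cases g with
  | zero => exact continuous_const
  | succ g => exact continuous_quot_lift _ (ex_cont.comp (al_cont _ _ _))

def AM : (g : ℕ) → Mg g → ℝ
  | 0 => fun x => (1 + (show Sp 2 from x).1 2) / 2
  | g + 1 => Quot.lift (fun z => ‖z.1‖ ^ 2) (fun z w h => by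
      simp only [(orientRel_norm h).1, (orientRel_norm h).2])

def CM : (g : ℕ) → Mg g → ℂ
  | 0 => fun x => ⟨(show Sp 2 from x).1 0 / 2, (show Sp 2 from x).1 1 / 2⟩
  | g + 1 => Quot.lift (fun z => z.1 * mu z) (fun z w h => by
      simp only [mu, (orientRel_norm h).1, (orientRel_norm h).2]; simp)

lemma AM_prj (g : ℕ) (z : Disc) : AM g (prj g z) = ‖z.1‖ ^ 2 := by
  cases g with
  | zero =>
    show (1 + (prj0 z).1 2) / 2 = _
    simp [prj0, SpMk]
  | succ g => rfl

lemma CM_prj (g : ℕ) (z : Disc) : CM g (prj g z) = z.1 * mu z := by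
  cases g with
  | zero =>
    show (⟨(prj0 z).1 0 / 2, (prj0 z).1 1 / 2⟩ : ℂ) = _
    apply Complex.ext <;> simp [prj0, SpMk]
  | succ g => rfl

lemma Sp_coord_cont {k : ℕ} (i : Fin (k + 1)) : Continuous fun x : Sp k => x.1 i :=
  (PiLp.continuous_apply 2 _ i).comp continuous_subtype_val

lemma AM_cont (g : ℕ) : Continuous (AM g) := by
  cases g with
  | zero =>
    show Continuous fun x : Sp 2 => (1 + x.1 2) / 2
    have := Sp_coord_cont (k := 2) 2
    fun_prop
  | succ g =>
    refine continuous_quot_lift _ ?_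
    fun_prop

lemma CM_cont (g : ℕ) : Continuous (CM g) := by
  cases g with
  | zero =>
    show Continuous fun x : Sp 2 => (⟨x.1 0 / 2, x.1 1 / 2⟩ : ℂ)
    have h0 := Sp_coord_cont (k := 2) 0
    have h1 := Sp_coord_cont (k := 2) 1
    have : (fun x : Sp 2 => (⟨x.1 0 / 2, x.1 1 / 2⟩ : ℂ)) = fun x : Sp 2 => ((x.1 0 / 2 : ℝ) : ℂ) + ((x.1 1 / 2 : ℝ) : ℂ) * Complex.I := by
      funext x; apply Complex.ext <;> simp
    rw [this]
    exact (Complex.continuous_ofReal.comp (h0.div_const _)).add ((Complex.continuous_ofReal.comp (h1.div_const _)).mul continuous_const)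
  | succ g =>
    refine continuous_quot_lift _ ?_
    have := mu_cont
    fun_prop

lemma prj_eq {g : ℕ} {z w : Disc} (h : prj g z = prj g w) : z = w ∨ (‖z.1‖ = 1 ∧ ‖w.1‖ = 1) := by
  have h1 : ‖z.1‖ ^ 2 = ‖w.1‖ ^ 2 := by rw [← AM_prj g, ← AM_prj g, h]
  have h2 : z.1 * mu z = w.1 * mu w := by rw [← CM_prj g, ← CM_prj g, h]
  have h3 : mu z = mu w := by rw [mu, mu, h1]
  have h4 : ‖z.1‖ = ‖w.1‖ := by
    have := (sq_eq_sq₀ (norm_nonneg _) (norm_nonneg _)).1 h1; exact this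
  by_cases hm : mu z = 0
  · right
    have := mu_sq z
    rw [hm] at this
    have h5 : ‖z.1‖ = 1 := by
      have : ‖z.1‖ ^ 2 = 1 ^ 2 := by linarith
      exact (sq_eq_sq₀ (norm_nonneg _) zero_le_one).1 this
    exact ⟨h5, h4 ▸ h5⟩
  · left
    rw [← h3] at h2
    apply Subtype.ext
    exact mul_right_cancel₀ (by exact_mod_cast hm) h2

end disc
end

section

/-! ### Concrete classes -/
section angles

def an (z : ℂ) : ℝ := Complex.arg z / (2 * Real.pi)

lemma an_ex (r : ℝ) (hr : 0 < r) (x : ℝ) (h : |x| < 1 / 2) : an (r * ex x) = x := by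
  rw [an, arg_ex r hr x h]; field_simp

lemma an_pos (r : ℝ) (hr : 0 < r) : an r = 0 := by
  rw [an, Complex.arg_ofReal_of_nonneg hr.le]; simp

lemma eq_an (z : ℂ) : z = ‖z‖ * ex (an z) := eq_ex z

lemma an_smul (r : ℝ) (hr : 0 < r) (z : ℂ) : an (r * z) = an z := by
  rw [an, Complex.arg_real_mul _ hr, an]

lemma an_prod {ι : Type*} (s : Finset ι) (z : ι → ℂ) (h0 : ∀ i ∈ s, z i ≠ 0)
    (h : |∑ i ∈ s, an (z i)| < 1 / 2) : an (∏ i ∈ s, z i) = ∑ i ∈ s, an (z i) := by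
  have : ∏ i ∈ s, z i = ((∏ i ∈ s, ‖z i‖ : ℝ) : ℂ) * ex (∑ i ∈ s, an (z i)) := by
    rw [ex_sum, Complex.ofReal_prod, ← Finset.prod_mul_distrib]
    exact Finset.prod_congr rfl fun i _ => eq_an _
  rw [this, an_ex _ (Finset.prod_pos fun i hi => norm_pos_iff.2 (h0 i hi)) _ h]

lemma an_mul (z w : ℂ) (hz : z ≠ 0) (hw : w ≠ 0) (h : |an z + an w| < 1 / 2) :
    an (z * w) = an z + an w := by
  have : z * w = ((‖z‖ * ‖w‖ : ℝ) : ℂ) * ex (an z + an w) := by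
    rw [ex_add]; conv_lhs => rw [eq_an z, eq_an w]
    push_cast; ring
  rw [this, an_ex _ (mul_pos (norm_pos_iff.2 hz) (norm_pos_iff.2 hw)) _ h]

lemma an_conj (z : ℂ) (hz : z ≠ 0) (h : |an z| < 1 / 2) : an ((starRingEnd ℂ) z) = - an z := by
  have : (starRingEnd ℂ) z = (‖z‖ : ℂ) * ex (- an z) := by
    rw [ex_neg]; conv_lhs => rw [eq_an z]
    simp
  rw [this, an_ex _ (norm_pos_iff.2 hz) _ (by rwa [abs_neg])]

lemma an_mul3 (a b c : ℂ) (ha : a ≠ 0) (hb : b ≠ 0) (hc : c ≠ 0) (η : ℝ) (hη : η ≤ 1 / 6)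
    (h1 : |an a| < η) (h2 : |an b| < η) (h3 : |an c| < η) :
    an (a * b * c) = an a + an b + an c := by
  rw [abs_lt] at h1 h2 h3
  have e : an (a * b) = an a + an b := an_mul _ _ ha hb (by rw [abs_lt]; constructor <;> linarith)
  rw [an_mul _ _ (mul_ne_zero ha hb) hc, e]
  rw [e, abs_lt]; constructor <;> linarith

/-- near a positive value, arguments are small -/
lemma an_near {Y : Type*} [TopologicalSpace Y] (F : Y → ℂ) (hF : Continuous F) (y : Y) (r : ℝ) (hr : 0 < r)
    (hy : F y = r) (η : ℝ) (hη : 0 < η) : ∀ᶠ x in 𝓝 y, F x ≠ 0 ∧ |an (F x)| < η := by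
  have h1 : ContinuousAt an (F y) := by
    have : ContinuousAt Complex.arg (F y) := Complex.continuousAt_arg (by
      rw [hy]; left; simpa using hr)
    unfold an
    exact this.div_const _
  have h2 : ContinuousAt (fun x => an (F x)) y := ContinuousAt.comp (f := F) h1 hF.continuousAt
  have h3 : an (F y) = 0 := by rw [hy, an_pos r hr]
  have h4 : ∀ᶠ x in 𝓝 y, |an (F x)| < η := by
    have := (continuous_abs.continuousAt.comp h2).eventually (Iio_mem_nhds (show |an (F y)| < η by rw [h3]; simpa using hη))
    exact this
  have h5 : ∀ᶠ x in 𝓝 y, F x ≠ 0 := hF.continuousAt.eventually (IsOpen.mem_nhds isOpen_ne (by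
    rw [hy]; simpa using hr.ne'))
  exact h5.and h4

lemma an_unif {K : Type*} [MetricSpace K] [CompactSpace K] (F : K → K → ℂ)
    (hF : Continuous (Function.uncurry F)) (h : ∀ x, ∃ r : ℝ, 0 < r ∧ F x x = r) (η : ℝ) (hη : 0 < η) :
    ∃ δ > 0, ∀ x y, dist x y < δ → F x y ≠ 0 ∧ |an (F x y)| < η := by
  have : {p : K × K | F p.1 p.2 ≠ 0 ∧ |an (F p.1 p.2)| < η} ∈ uniformity K := by
    rw [← nhdsSet_diagonal_eq_uniformity, mem_nhdsSet_iff_forall]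
    rintro ⟨x, y⟩ hxy
    obtain rfl : x = y := hxy
    obtain ⟨r, hr, h'⟩ := h x
    exact an_near (Function.uncurry F) hF (x, x) r hr h' η hη
  obtain ⟨δ, hδ, h'⟩ := Metric.mem_uniformity_dist.1 this
  exact ⟨δ, hδ, fun x y hxy => h' hxy⟩

end angles

section classes

def sec (g : ℕ) : Mg g → Disc := Function.surjInv (prj_surj g)
lemma prj_sec (g : ℕ) (x : Mg g) : prj g (sec g x) = x := Function.surjInv_eq _ _

local notation "cj" => starRingEnd ℂ

def ip (z w : Disc) : ℂ := cj z.1 * w.1 + mu z * mu w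
def vv (j : ℕ) (z : Disc) : ℂ := z.1 + j * mu z

lemma ip_cont : Continuous (Function.uncurry ip) := by
  have := mu_cont
  unfold Function.uncurry ip; fun_prop
lemma vv_cont (j : ℕ) : Continuous (vv j) := by
  have := mu_cont
  unfold vv; fun_prop
lemma ip_conj (z w : Disc) : cj (ip z w) = ip w z := by
  simp [ip]; ring
lemma ip_self (z : Disc) : ip z z = (1 : ℝ) := by
  have := mu_sq z
  rw [ip, ← Complex.normSq_eq_conj_mul_self, Complex.normSq_eq_norm_sq, ← Complex.ofReal_mul, ← Complex.ofReal_add]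
  congr 1; linarith

lemma phase {g : ℕ} {z z' : Disc} (h : prj g z = prj g z') : ∃ e : ℂ, cj e * e = 1 ∧
    (∀ w, ip z' w = cj e * ip z w ∧ ip w z' = e * ip w z) ∧ ∀ j, vv j z' = e * vv j z := by
  rcases prj_eq h with rfl | ⟨h1, h2⟩
  · exact ⟨1, by simp⟩
  · have m1 : mu z = 0 := by rw [mu, h1]; simp
    have m2 : mu z' = 0 := by rw [mu, h2]; simp
    have n1 : cj z.1 * z.1 = 1 := by
      rw [← Complex.normSq_eq_conj_mul_self, Complex.normSq_eq_norm_sq, h1]; simp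
    have n2 : cj z'.1 * z'.1 = 1 := by
      rw [← Complex.normSq_eq_conj_mul_self, Complex.normSq_eq_norm_sq, h2]; simp
    refine ⟨z'.1 * cj z.1, ?_, fun w => ⟨?_, ?_⟩, fun j => ?_⟩
    · simp only [map_mul, Complex.conj_conj]; linear_combination (cj z.1 * z.1) * n2 + n1
    · simp only [ip, m1, m2, map_mul, Complex.conj_conj]; simp; linear_combination (-cj z'.1 * w.1) * n1
    · simp only [ip, m1, m2]; simp; linear_combination (-cj w.1 * z'.1) * n1
    · simp only [vv, m1, m2]; simp; linear_combination (-z'.1) * n1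

def T3 (x y z : Disc) : ℂ := ip x y * ip y z * ip z x

def c2M (g : ℕ) (x y z : Mg g) : ℝ := an (T3 (sec g x) (sec g y) (sec g z))

lemma T3_inv {g : ℕ} {x y z x' y' z' : Disc} (hx : prj g x = prj g x') (hy : prj g y = prj g y')
    (hz : prj g z = prj g z') : T3 x' y' z' = T3 x y z := by
  obtain ⟨e, he, h1, -⟩ := phase hx
  obtain ⟨f, hf, h2, -⟩ := phase hy
  obtain ⟨k, hk, h3, -⟩ := phase hz
  unfold T3
  rw [(h1 y').1, (h2 x).2, (h2 z').1, (h3 y).2, (h3 x').1, (h1 z).2]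
  linear_combination (ip x y * ip y z * ip z x) * ((cj f * f * cj k * k) * he + cj k * k * hf + hk)

lemma c2M_prj (g : ℕ) (x y z : Disc) : c2M g (prj g x) (prj g y) (prj g z) = an (T3 x y z) := by
  unfold c2M
  rw [T3_inv (prj_sec g _).symm (prj_sec g _).symm (prj_sec g _).symm]

def a1M (g k : ℕ) (r : Fin 2) (x y : Mg g) : ℝ := an (cj (uM g k r x) * uM g k r y)

lemma a1M_prj (g k : ℕ) (r : Fin 2) (x y : Disc) :
    a1M g k r (prj g x) (prj g y) = an (ex (al g k r y - al g k r x)) := by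
  rw [a1M, uM_prj, uM_prj, ← ex_neg, ← ex_add]; congr 2; ring

lemma a1M_nrm (g k : ℕ) (r : Fin 2) : (Cls.one (a1M g k r)).nrm := by
  intro x
  obtain ⟨x, rfl⟩ := prj_surj g x
  rw [a1M_prj]; simp only [sub_self, ex_zero]; simpa using an_pos 1 one_pos

lemma an_normSq (z w : ℂ) (hw : w = cj z) : an (z * w) = 0 := by
  rw [hw, Complex.mul_conj]
  rcases (Complex.normSq_nonneg z).eq_or_lt with h | h
  · rw [← h]; simp [an]
  · exact an_pos _ h

lemma c2M_nrm (g : ℕ) : (Cls.two (c2M g)).nrm := by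
  constructor
  · intro x y
    unfold c2M T3
    rw [ip_self, Complex.ofReal_one, one_mul]
    exact an_normSq _ _ (ip_conj _ _).symm
  · intro x y
    unfold c2M T3
    rw [ip_self, Complex.ofReal_one, mul_one]
    exact an_normSq _ _ (ip_conj _ _).symm

end classes
end

section

section Xclasses
local notation "cj" => starRingEnd ℂ

def qn (n g : ℕ) (x : Fin n → Mg g) : SP n (Mg g) := Quot.mk _ x
lemma qn_cont (n g : ℕ) : Continuous (qn n g) := continuous_quot_mk
lemma qn_surj (n g : ℕ) : Function.Surjective (qn n g) := Quot.mk_surjective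

/-- multiplicative functions on the symmetric product -/
def SPprod (n g : ℕ) (f : Mg g → ℂ) : SP n (Mg g) → ℂ :=
  Quot.lift (fun x => ∏ s, f (x s)) (by
    rintro x y ⟨e, rfl⟩
    exact (Equiv.prod_comp e (fun s => f (x s))).symm)

lemma SPprod_qn (n g : ℕ) (f : Mg g → ℂ) (x : Fin n → Mg g) : SPprod n g f (qn n g x) = ∏ s, f (x s) := rfl
lemma SPprod_cont (n g : ℕ) (f : Mg g → ℂ) (hf : Continuous f) : Continuous (SPprod n g f) :=
  continuous_quot_lift _ (by fun_prop)

def Vp {n : ℕ} (j : ℕ) (z : Fin n → Disc) : ℂ := ∏ s, vv j (z s)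
lemma Vp_cont {n : ℕ} (j : ℕ) : Continuous (Vp (n := n) j) := by
  have := vv_cont j
  unfold Vp; fun_prop

def HZ {n : ℕ} (z w : Fin n → Disc) : ℂ := ∑ j ∈ Finset.range (n + 1), cj (Vp j z) * Vp j w
lemma HZ_cont {n : ℕ} : Continuous (Function.uncurry (HZ (n := n))) := by
  unfold Function.uncurry HZ
  refine continuous_finset_sum _ fun j _ => ?_
  have := Vp_cont (n := n) j
  fun_prop
lemma HZ_conj {n : ℕ} (z w : Fin n → Disc) : cj (HZ z w) = HZ w z := by
  simp only [HZ, map_sum, map_mul, Complex.conj_conj]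
  exact Finset.sum_congr rfl fun j _ => mul_comm _ _

lemma vv_zero {z : Disc} {j j' : ℕ} (h : vv j z = 0) (h' : vv j' z = 0) : j = j' := by
  by_contra hne
  have h1 : ((j : ℂ) - j') * mu z = 0 := by
    unfold vv at h h'; linear_combination h - h'
  rcases mul_eq_zero.1 h1 with h2 | h2
  · exact hne (by exact_mod_cast sub_eq_zero.1 h2)
  · have h3 : z.1 = 0 := by unfold vv at h; rw [h2] at h; simpa using h
    have := mu_sq z
    rw [h3] at this
    have h4 : mu z = 0 := by exact_mod_cast h2
    rw [h4] at this; simp at this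

lemma Vp_ne {n : ℕ} (z : Fin n → Disc) : ∃ j ∈ Finset.range (n + 1), Vp j z ≠ 0 := by
  by_contra hcon
  push Not at hcon
  have : ∀ j : Fin (n + 1), ∃ s : Fin n, vv j (z s) = 0 := by
    intro j
    have := hcon j (Finset.mem_range.2 j.2)
    unfold Vp at this
    obtain ⟨s, -, hs⟩ := Finset.prod_eq_zero_iff.1 this
    exact ⟨s, hs⟩
  choose f hf using this
  have : Function.Injective f := by
    intro a b hab
    exact Fin.ext (vv_zero (hf a) (by rw [hab]; exact hf b))
  have := Fintype.card_le_of_injective f this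
  simp at this

lemma HZ_self {n : ℕ} (z : Fin n → Disc) : ∃ r : ℝ, 0 < r ∧ HZ z z = r := by
  refine ⟨∑ j ∈ Finset.range (n + 1), Complex.normSq (Vp j z), ?_, ?_⟩
  · obtain ⟨j, hj, h⟩ := Vp_ne z
    exact Finset.sum_pos' (fun _ _ => Complex.normSq_nonneg _) ⟨j, hj, Complex.normSq_pos.2 h⟩
  · unfold HZ; push_cast
    exact Finset.sum_congr rfl fun j _ => (Complex.normSq_eq_conj_mul_self).symm

def pM (g j j' : ℕ) (x : Mg g) : ℂ := AM g x + j' * CM g x + j * cj (CM g x) + j * j' * (1 - AM g x)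
lemma pM_cont (g j j' : ℕ) : Continuous (pM g j j') := by
  have := AM_cont g
  have := CM_cont g
  unfold pM; fun_prop
lemma pM_prj (g j j' : ℕ) (z : Disc) : pM g j j' (prj g z) = vv j z * cj (vv j' z) := by
  rw [pM, AM_prj, CM_prj]
  have h1 : (z.1 * cj z.1) = ((‖z.1‖ ^ 2 : ℝ) : ℂ) := by
    rw [Complex.mul_conj, Complex.normSq_eq_norm_sq]
  have h2 : ((mu z : ℂ)) ^ 2 = 1 - ((‖z.1‖ ^ 2 : ℝ) : ℂ) := by exact_mod_cast mu_sq z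
  simp only [vv, map_add, map_mul, Complex.conj_ofReal, map_natCast]
  linear_combination (-1 : ℂ) * h1 - j * j' * h2

def PX (n g j j' : ℕ) : SP n (Mg g) → ℂ := SPprod n g (pM g j j')
lemma PX_cont (n g j j' : ℕ) : Continuous (PX n g j j') := SPprod_cont _ _ _ (pM_cont _ _ _)

def qz (n g : ℕ) (z : Fin n → Disc) : SP n (Mg g) := qn n g (fun s => prj g (z s))
lemma qz_cont (n g : ℕ) : Continuous (qz n g) := by
  have := prj_cont g
  exact (qn_cont n g).comp (by fun_prop)
lemma qz_surj (n g : ℕ) (x : SP n (Mg g)) : ∃ z, qz n g z = x := by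
  obtain ⟨y, rfl⟩ := qn_surj n g x
  refine ⟨fun s => sec g (y s), ?_⟩
  simp [qz, prj_sec]

lemma PX_qz (n g j j' : ℕ) (z : Fin n → Disc) : PX n g j j' (qz n g z) = Vp j z * cj (Vp j' z) := by
  rw [PX, qz, SPprod_qn]
  simp only [pM_prj, Finset.prod_mul_distrib, Vp, map_prod]

def c2X (n g : ℕ) (x y z : SP n (Mg g)) : ℝ :=
  an (∑ j ∈ Finset.range (n + 1), ∑ k ∈ Finset.range (n + 1), ∑ l ∈ Finset.range (n + 1),
    PX n g j l x * PX n g l k y * PX n g k j z)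

lemma c2X_qz (n g : ℕ) (x y z : Fin n → Disc) :
    c2X n g (qz n g x) (qz n g y) (qz n g z) = an (HZ x y * HZ y z * HZ z x) := by
  unfold c2X; congr 1
  simp only [HZ, PX_qz, Finset.sum_mul_sum, Finset.sum_mul, Finset.mul_sum]
  refine Finset.sum_congr rfl fun j _ => ?_
  refine Finset.sum_congr rfl fun k _ => ?_
  refine Finset.sum_congr rfl fun l _ => ?_
  ring

lemma dl_val_two {T : Type*} (c : T → T → T → ℝ) (N : T → Prop)
    (h : ∀ x y z w, N x → N y → N z → N w → d2 c x y z w = 0) (l : List T) (hl : ∀ a ∈ l, N a) :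
    dl (Cls.two c).val l = 0 := by
  rcases l with _ | ⟨a, _ | ⟨b, _ | ⟨e, _ | ⟨f, _ | ⟨k, l⟩⟩⟩⟩⟩
  · simp [dl]
  · simp [dl, Cls.val]
  · simp [dl, Cls.val]
  · simp [dl, Cls.val]
  · rw [dl_four]
    exact h a b e f (hl _ (by simp)) (hl _ (by simp)) (hl _ (by simp)) (hl _ (by simp))
  · have : ∀ (Φ : List T → ℝ) (m : ℕ) (l : List T), (∀ l', l'.length + 1 = l.length → Φ l' = 0) → dl Φ l = 0 := by
      intro Φ m l
      induction l generalizing Φ with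
      | nil => intro _; rfl
      | cons a l ih =>
        intro h
        rw [dl_cons, h l (by simp), ih (fun m => Φ (a :: m)) (fun l' hl' => h _ (by simp [hl'])), sub_zero]
    apply this _ 0
    intro l' hl'
    rcases l' with _ | ⟨a, _ | ⟨b, _ | ⟨e, _ | ⟨f, l'⟩⟩⟩⟩ <;> simp_all [Cls.val]

lemma dl_val_one {T : Type*} (c : T → T → ℝ) (N : T → Prop)
    (h : ∀ x y z, N x → N y → N z → d1 c x y z = 0) (l : List T) (hl : ∀ a ∈ l, N a) :
    dl (Cls.one c).val l = 0 := by
  rcases l with _ | ⟨a, _ | ⟨b, _ | ⟨e, _ | ⟨f, l⟩⟩⟩⟩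
  · simp [dl]
  · simp [dl, Cls.val]
  · simp [dl, Cls.val]
  · rw [dl_three]
    exact h a b e (hl _ (by simp)) (hl _ (by simp)) (hl _ (by simp))
  · have : ∀ (Φ : List T → ℝ) (m : ℕ) (l : List T), (∀ l', l'.length + 1 = l.length → Φ l' = 0) → dl Φ l = 0 := by
      intro Φ m l
      induction l generalizing Φ with
      | nil => intro _; rfl
      | cons a l ih =>
        intro h
        rw [dl_cons, h l (by simp), ih (fun m => Φ (a :: m)) (fun l' hl' => h _ (by simp [hl'])), sub_zero]
    apply this _ 0
    intro l' hl'
    rcases l' with _ | ⟨a, _ | ⟨b, _ | ⟨e, l'⟩⟩⟩ <;> simp_all [Cls.val]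

lemma c2X_loc (n g : ℕ) {W : Type*} [TopologicalSpace W] (p : W → SP n (Mg g)) (hp : Continuous p) :
    LocCo ((Cls.two (c2X n g)).pull p).val := by
  constructor
  · intro y
    obtain ⟨z0, hz0⟩ := qz_surj n g (p y)
    obtain ⟨j0, -, hj0⟩ := Vp_ne z0
    let H' : W → W → ℂ := fun x w => ∑ k ∈ Finset.range (n + 1), cj (PX n g k j0 (p x)) * PX n g k j0 (p w)
    have hH'c : Continuous (Function.uncurry H') := by
      unfold Function.uncurry
      refine continuous_finset_sum _ fun k _ => ?_
      have := PX_cont n g k j0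
      fun_prop
    have hH' : ∀ x w z z', qz n g z = p x → qz n g z' = p w →
        H' x w = HZ z z' * Vp j0 z * cj (Vp j0 z') := by
      intro x w z z' h h'
      simp only [H', ← h, ← h', PX_qz, HZ, Finset.sum_mul, map_mul, Complex.conj_conj]
      refine Finset.sum_congr rfl fun j _ => ?_
      ring
    have hconj : ∀ x w, cj (H' x w) = H' w x := by
      intro x w
      simp only [H', map_sum, map_mul, Complex.conj_conj]
      exact Finset.sum_congr rfl fun j _ => mul_comm _ _
    have e1 : ∀ᶠ q : W × W in 𝓝 (y, y), Function.uncurry H' q ≠ 0 ∧ |an (Function.uncurry H' q)| < 1 / 6 := by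
      obtain ⟨r, hr, hr'⟩ := HZ_self z0
      refine an_near _ hH'c (y, y) (r * Complex.normSq (Vp j0 z0)) (mul_pos hr (Complex.normSq_pos.2 hj0)) ?_ _ (by norm_num)
      simp only [Function.uncurry]
      rw [hH' y y z0 z0 hz0 hz0, hr', mul_assoc, Complex.mul_conj]; push_cast; rfl
    rw [nhds_prod_eq] at e1
    obtain ⟨N, hN, hN'⟩ := Filter.eventually_prod_self_iff'.1 e1
    have e2 : ∀ᶠ x in 𝓝 y, PX n g j0 j0 (p x) ≠ 0 := by
      refine ((PX_cont n g j0 j0).comp hp).continuousAt.eventually (IsOpen.mem_nhds isOpen_ne ?_)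
      simp only [Function.comp, ← hz0, PX_qz]
      exact mul_ne_zero hj0 (by simpa using hj0)
    have hNW : ∀ᶠ x in 𝓝 y, x ∈ N := hN
    refine ⟨{x | x ∈ N ∧ PX n g j0 j0 (p x) ≠ 0}, hNW.and e2, fun l hl => ?_⟩
    refine dl_val_two _ (fun x => x ∈ N ∧ PX n g j0 j0 (p x) ≠ 0) ?_ l hl
    have key : ∀ x y z, (x ∈ N ∧ PX n g j0 j0 (p x) ≠ 0) → (y ∈ N ∧ PX n g j0 j0 (p y) ≠ 0) →
        (z ∈ N ∧ PX n g j0 j0 (p z) ≠ 0) → c2X n g (p x) (p y) (p z) = an (H' x y) + an (H' y z) - an (H' x z) := by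
      rintro x y z ⟨hx, hx'⟩ ⟨hy, hy'⟩ ⟨hz, hz'⟩
      have k1 := hN' x hx y hy
      have k2 := hN' y hy z hz
      have k3 := hN' x hx z hz
      have k4 := hN' z hz x hx
      simp only [Function.uncurry] at k1 k2 k3 k4
      have k5 : an (H' z x) = - an (H' x z) := by
        rw [← hconj x z]; exact an_conj _ k3.1 (by linarith [k3.2])
      rw [sub_eq_add_neg, ← k5, ← an_mul3 _ _ _ k1.1 k2.1 k4.1 (1 / 6) le_rfl k1.2 k2.2 k4.2]
      obtain ⟨zx, hzx⟩ := qz_surj n g (p x)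
      obtain ⟨zy, hzy⟩ := qz_surj n g (p y)
      obtain ⟨zz, hzz⟩ := qz_surj n g (p z)
      rw [hH' x y zx zy hzx hzy, hH' y z zy zz hzy hzz, hH' z x zz zx hzz hzx]
      rw [← hzx, PX_qz] at hx'
      rw [← hzy, PX_qz] at hy'
      rw [← hzz, PX_qz] at hz'
      rw [← hzx, ← hzy, ← hzz, c2X_qz]
      have : HZ zx zy * Vp j0 zx * cj (Vp j0 zy) * (HZ zy zz * Vp j0 zy * cj (Vp j0 zz)) * (HZ zz zx * Vp j0 zz * cj (Vp j0 zx))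
          = ((Complex.normSq (Vp j0 zx) * Complex.normSq (Vp j0 zy) * Complex.normSq (Vp j0 zz) : ℝ) : ℂ) * (HZ zx zy * HZ zy zz * HZ zz zx) := by
        push_cast
        rw [← Complex.mul_conj, ← Complex.mul_conj, ← Complex.mul_conj]; ring
      rw [this, an_smul]
      have q1 := Complex.normSq_pos.2 (left_ne_zero_of_mul hx')
      have q2 := Complex.normSq_pos.2 (left_ne_zero_of_mul hy')
      have q3 := Complex.normSq_pos.2 (left_ne_zero_of_mul hz')
      positivity
    intro x y z w hx hy hz hw
    simp only [d2]
    rw [key y z w hy hz hw, key x z w hx hz hw, key x y w hx hy hw, key x y z hx hy hz]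
    ring
  · intro y l hl
    rcases l with _ | ⟨a, _ | ⟨b, _ | ⟨e, _ | ⟨f, l⟩⟩⟩⟩
    · rfl
    · rfl
    · rfl
    · have h1 := hl a (by simp)
      have h2 := hl b (by simp)
      have h3 := hl e (by simp)
      subst h1; subst h2; subst h3
      show c2X n g (p e) (p e) (p e) = 0
      obtain ⟨z, hz⟩ := qz_surj n g (p e)
      obtain ⟨r, hr, hr'⟩ := HZ_self z
      rw [← hz, c2X_qz, hr', ← Complex.ofReal_mul, ← Complex.ofReal_mul]
      exact an_pos _ (by positivity)
    · rfl

def a1X (n g k : ℕ) (r : Fin 2) (x y : SP n (Mg g)) : ℝ :=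
  an (cj (SPprod n g (uM g k r) x) * SPprod n g (uM g k r) y)

lemma a1X_qz (n g k : ℕ) (r : Fin 2) (x y : Fin n → Disc) :
    a1X n g k r (qz n g x) (qz n g y) = an (∏ s, ex (al g k r (y s) - al g k r (x s))) := by
  rw [a1X, qz, qz, SPprod_qn, SPprod_qn, map_prod, ← Finset.prod_mul_distrib]
  congr 1
  refine Finset.prod_congr rfl fun s _ => ?_
  rw [uM_prj, uM_prj, ← ex_neg, ← ex_add]; congr 1; ring

lemma uX_norm (n g k : ℕ) (r : Fin 2) (x : SP n (Mg g)) :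
    SPprod n g (uM g k r) x * cj (SPprod n g (uM g k r) x) = 1 := by
  obtain ⟨z, rfl⟩ := qz_surj n g x
  rw [Complex.mul_conj, Complex.normSq_eq_norm_sq, qz, SPprod_qn, norm_prod]
  simp [uM_prj, ex_norm]

lemma a1X_loc (n g k : ℕ) (r : Fin 2) {W : Type*} [TopologicalSpace W] (p : W → SP n (Mg g)) (hp : Continuous p) :
    LocCo ((Cls.one (a1X n g k r)).pull p).val := by
  have huc := (SPprod_cont n g _ (uM_cont g k r)).comp hp
  set u : W → ℂ := SPprod n g (uM g k r) ∘ p with hu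
  have hn : ∀ x, u x * cj (u x) = 1 := fun x => uX_norm n g k r (p x)
  constructor
  · intro y
    let F : W → ℂ := fun x => cj (u y) * u x
    have hF : Continuous F := by fun_prop
    have e1 := an_near F hF y 1 one_pos (by simp only [F]; rw [mul_comm, hn]; simp) (1 / 6) (by norm_num)
    refine ⟨_, e1, fun l hl => dl_val_one _ (fun x => F x ≠ 0 ∧ |an (F x)| < 1 / 6) ?_ l hl⟩
    have key : ∀ x z, (F x ≠ 0 ∧ |an (F x)| < 1 / 6) → (F z ≠ 0 ∧ |an (F z)| < 1 / 6) →
        a1X n g k r (p x) (p z) = an (F z) - an (F x) := by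
      rintro x z ⟨h1, h2⟩ ⟨h3, h4⟩
      have : a1X n g k r (p x) (p z) = an (cj (F x) * F z) := by
        show an (cj (u x) * u z) = _
        congr 1
        simp only [F, map_mul, Complex.conj_conj]
        linear_combination (-cj (u x) * u z) * hn y
      have h5 := an_conj _ h1 (by linarith)
      rw [this, an_mul _ _ (by simpa using h1) h3, h5]
      · ring
      · rw [h5]; rw [abs_lt] at *; constructor <;> linarith
    intro x y z hx hy hz
    simp only [d1]
    rw [key y z hy hz, key x z hx hz, key x y hx hy]; ring
  · intro y l hl
    rcases l with _ | ⟨a, _ | ⟨b, _ | ⟨e, l⟩⟩⟩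
    · rfl
    · rfl
    · have h1 := hl a (by simp)
      have h2 := hl b (by simp)
      subst h1; subst h2
      show an (cj (u b) * u b) = 0
      rw [mul_comm, hn]; simpa using an_pos 1 one_pos
    · rfl

end Xclasses
end

section

section coh
local notation "cj" => starRingEnd ℂ
variable {B : Type*} [MetricSpace B] [CompactSpace B]

def PtZ (n g : ℕ) (B : Type*) (p : (Fin n → Disc) × B) : TT (Mg g) B :=
  (fun s => if h : s < n then prj g (p.1 ⟨s, h⟩) else prj g ⟨0, by simp⟩, p.2)
def QZ (n g : ℕ) (B : Type*) (x : TT (Mg g) B) : SP n (Mg g) × B := (qn n g (fun s => x.1 s), x.2)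

lemma QPt (n g : ℕ) (p : (Fin n → Disc) × B) : QZ n g B (PtZ n g B p) = (qz n g p.1, p.2) := by
  simp [QZ, PtZ, qz]

lemma QPt_cont (n g : ℕ) : Continuous (QZ n g B ∘ PtZ n g B) := by
  have : (QZ n g B ∘ PtZ n g B) = fun p => (qz n g p.1, p.2) := funext fun p => QPt n g p
  rw [this]
  have := qz_cont n g
  fun_prop

lemma PtZ_fst (n g : ℕ) (p : (Fin n → Disc) × B) (s : Fin n) : (PtZ n g B p).1 s = prj g (p.1 s) := by
  simp [PtZ]

lemma FiT_two {Z M : Type*} [MetricSpace Z] {Pt : Z → TT M B} {e : ℝ} {x y : TT M B} (h : FiT Pt e [x, y]) :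
    ∃ z w, x = Pt z ∧ y = Pt w ∧ dist z w < e := by
  obtain ⟨lz, h, e⟩ := h
  rcases lz with _ | ⟨a, _ | ⟨b, _ | ⟨c, l⟩⟩⟩ <;> simp at e
  exact ⟨a, b, e.1, e.2, h a (by simp) b (by simp)⟩
lemma FiT_three {Z M : Type*} [MetricSpace Z] {Pt : Z → TT M B} {e : ℝ} {x y t : TT M B} (h : FiT Pt e [x, y, t]) :
    ∃ z w u, x = Pt z ∧ y = Pt w ∧ t = Pt u ∧ dist z w < e ∧ dist w u < e ∧ dist z u < e := by
  obtain ⟨lz, h, e⟩ := h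
  rcases lz with _ | ⟨a, _ | ⟨b, _ | ⟨c, _ | ⟨d, l⟩⟩⟩⟩ <;> simp at e
  exact ⟨a, b, c, e.1, e.2.1, e.2.2, h a (by simp) b (by simp), h b (by simp) c (by simp), h a (by simp) c (by simp)⟩
lemma FiT_four {Z M : Type*} [MetricSpace Z] {Pt : Z → TT M B} {e : ℝ} {x y t r : TT M B} (h : FiT Pt e [x, y, t, r]) :
    ∃ z w u v, x = Pt z ∧ y = Pt w ∧ t = Pt u ∧ r = Pt v ∧ dist z w < e ∧ dist z u < e ∧ dist z v < e
      ∧ dist w u < e ∧ dist w v < e ∧ dist u v < e := by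
  obtain ⟨lz, h, e⟩ := h
  rcases lz with _ | ⟨a, _ | ⟨b, _ | ⟨c, _ | ⟨d, _ | ⟨d', l⟩⟩⟩⟩⟩ <;> simp at e
  refine ⟨a, b, c, d, e.1, e.2.1, e.2.2.1, e.2.2.2, ?_, ?_, ?_, ?_, ?_, ?_⟩ <;> exact h _ (by simp) _ (by simp)

structure Good (n g : ℕ) (δ : ℝ) : Prop where
  pos : 0 < δ
  ip : ∀ x y : Disc, dist x y < δ → ip x y ≠ 0 ∧ |an (ip x y)| < 1 / (12 * (n + 1))
  HZ : ∀ x y : Fin n → Disc, dist x y < δ → HZ x y ≠ 0 ∧ |an (HZ x y)| < 1 / 12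
  al : ∀ (k : Fin g) (r : Fin 2) (x y : Disc), dist x y < δ → |al g k r y - al g k r x| < 1 / (12 * (n + 1))

lemma ev_of {K : Type*} [MetricSpace K] {R : K → K → Prop} (h : ∃ δ > 0, ∀ x y, dist x y < δ → R x y) :
    ∀ᶠ δ in 𝓝[>] (0 : ℝ), ∀ x y, dist x y < δ → R x y := by
  obtain ⟨δ, hδ, h⟩ := h
  filter_upwards [Ioo_mem_nhdsGT hδ] with e he x y hxy
  exact h x y (hxy.trans he.2)

lemma exists_good (n g : ℕ) : ∃ δ, Good n g δ := by
  have hη : (0 : ℝ) < 1 / (12 * (n + 1)) := by positivity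
  have e1 := ev_of (an_unif ip ip_cont (fun x => ⟨1, one_pos, ip_self x⟩) _ hη)
  have e2 := ev_of (an_unif (HZ (n := n)) HZ_cont HZ_self (1 / 12) (by norm_num))
  have e3 : ∀ k : Fin g, ∀ᶠ δ in 𝓝[>] (0 : ℝ), ∀ r : Fin 2, ∀ x y, dist x y < δ → |al g k r y - al g k r x| < 1 / (12 * (n + 1)) := by
    intro k
    rw [Filter.eventually_all]
    intro r
    apply ev_of
    have := CompactSpace.uniformContinuous_of_continuous (al_cont g k r)
    obtain ⟨δ, hδ, h⟩ := Metric.uniformContinuous_iff.1 this _ hη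
    refine ⟨δ, hδ, fun x y hxy => ?_⟩
    have := h hxy
    rwa [dist_comm, Real.dist_eq] at this
  rw [← Filter.eventually_all] at e3
  obtain ⟨δ, h1, h2, h3, h4⟩ := (e1.and (e2.and (e3.and self_mem_nhdsWithin))).exists
  exact ⟨δ, h4, h1, h2, h3⟩

lemma dist_coord {n : ℕ} {z w : (Fin n → Disc) × B} {δ : ℝ} (h : dist z w < δ) (s : Fin n) : dist (z.1 s) (w.1 s) < δ :=
  (dist_le_pi_dist _ _ s).trans_lt ((le_max_left _ _).trans_lt h)
lemma dist_fst {n : ℕ} {z w : (Fin n → Disc) × B} {δ : ℝ} (h : dist z w < δ) : dist z.1 w.1 < δ :=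
  (le_max_left _ _).trans_lt h

lemma ip_symm {x y : Disc} (h : ip x y ≠ 0 ∧ |an (ip x y)| < 1 / 6) : an (ip y x) = - an (ip x y) := by
  rw [← ip_conj, an_conj _ h.1 (by linarith [h.2])]

lemma small_le (n : ℕ) : (1 : ℝ) / (12 * (n + 1)) ≤ 1 / 12 := by
  apply one_div_le_one_div_of_le (by norm_num)
  have : (0 : ℝ) ≤ n := by positivity
  linarith

lemma an_T3 {n g : ℕ} {δ : ℝ} (G : Good n g δ) {x y z : Disc} (h1 : dist x y < δ) (h2 : dist y z < δ) (h3 : dist x z < δ) :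
    an (T3 x y z) = an (ip x y) + an (ip y z) - an (ip x z) := by
  have hs := small_le n
  have k1 := G.ip _ _ h1
  have k2 := G.ip _ _ h2
  have k3 := G.ip _ _ h3
  have k4 := G.ip z x (by rwa [dist_comm])
  rw [T3, an_mul3 _ _ _ k1.1 k2.1 k4.1 _ (by linarith) k1.2 k2.2 k4.2, ip_symm ⟨k3.1, by linarith [k3.2]⟩]
  ring

lemma cocyc2 {n g : ℕ} {δ : ℝ} (G : Good n g δ) : (sumC n (Cls.two (c2M g))).cocyc (FiT (PtZ n g B) δ) := by
  intro x y t r h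
  obtain ⟨z, w, u, v, rfl, rfl, rfl, rfl, h1, h2, h3, h4, h5, h6⟩ := FiT_four h
  simp only [d2]
  simp only [Finset.sum_range, PtZ_fst, c2M_prj]
  rw [← Finset.sum_sub_distrib, ← Finset.sum_add_distrib, ← Finset.sum_sub_distrib]
  apply Finset.sum_eq_zero
  intro s _
  rw [an_T3 G (dist_coord h4 s) (dist_coord h6 s) (dist_coord h5 s), an_T3 G (dist_coord h2 s) (dist_coord h6 s) (dist_coord h3 s),
   an_T3 G (dist_coord h1 s) (dist_coord h5 s) (dist_coord h3 s), an_T3 G (dist_coord h1 s) (dist_coord h4 s) (dist_coord h2 s)]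
  ring

lemma a1M_good {n g : ℕ} {δ : ℝ} (G : Good n g δ) (k : Fin g) (r : Fin 2) {x y : Disc} (h : dist x y < δ) :
    a1M g k r (prj g x) (prj g y) = al g k r y - al g k r x := by
  have := G.al k r x y h
  have hs := small_le n
  rw [a1M_prj]
  have := an_ex 1 one_pos (al g k r y - al g k r x) (by linarith)
  simpa using this

lemma cocyc1 {n g : ℕ} {δ : ℝ} (G : Good n g δ) (k : Fin g) (r : Fin 2) :
    (sumC n (Cls.one (a1M g k r))).cocyc (FiT (PtZ n g B) δ) := by
  intro x y t h
  obtain ⟨z, w, u, rfl, rfl, rfl, h1, h2, h3⟩ := FiT_three h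
  simp only [d1]
  simp only [Finset.sum_range, PtZ_fst]
  rw [← Finset.sum_sub_distrib, ← Finset.sum_add_distrib]
  apply Finset.sum_eq_zero
  intro s _
  rw [a1M_good G k r (dist_coord h1 s), a1M_good G k r (dist_coord h2 s), a1M_good G k r (dist_coord h3 s)]
  ring

lemma sum_small {n : ℕ} (f : Fin n → ℝ) (h : ∀ s, |f s| < 1 / (12 * (n + 1))) : |∑ s, f s| < 1 / 12 := by
  calc |∑ s, f s| ≤ ∑ s, |f s| := Finset.abs_sum_le_sum_abs _ _
    _ ≤ ∑ s : Fin n, (1 : ℝ) / (12 * (n + 1)) := Finset.sum_le_sum fun s _ => (h s).le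
    _ = n * (1 / (12 * (n + 1))) := by simp
    _ < 1 / 12 := by
      have : (0 : ℝ) ≤ n := by positivity
      rw [mul_one_div, div_lt_div_iff₀ (by positivity) (by norm_num)]; linarith

lemma coh1 {n g : ℕ} {δ : ℝ} (G : Good n g δ) (k : Fin g) (r : Fin 2) :
    Cls.coh (FiT (PtZ n g B) δ) (((Cls.one (a1X n g k r)).pull Prod.fst).pull (QZ n g B)) (sumC n (Cls.one (a1M g k r))) := by
  refine ⟨fun _ => 0, fun x y h => ?_⟩
  obtain ⟨z, w, rfl, rfl, h1⟩ := FiT_two h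
  simp only [d0, QPt, a1X_qz, Finset.sum_range, PtZ_fst]
  rw [← ex_sum]
  have h2 : ∀ s, |al g k r (w.1 s) - al g k r (z.1 s)| < 1 / (12 * (n + 1)) := fun s => G.al k r _ _ (dist_coord h1 s)
  have h3 := sum_small _ h2
  have h4 := an_ex 1 one_pos _ (h3.trans (by norm_num))
  simp only [Complex.ofReal_one, one_mul] at h4
  rw [h4]
  simp only [a1M_good G k r (dist_coord h1 _)]
  simp

def alph (n g : ℕ) (x y : TT (Mg g) B) : ℝ :=
  an (HZ (fun s : Fin n => sec g (x.1 s)) (fun s => sec g (y.1 s)) * cj (∏ s : Fin n, ip (sec g (x.1 s)) (sec g (y.1 s))))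

lemma alph_PtZ (n g : ℕ) (z w : (Fin n → Disc) × B) :
    alph n g (PtZ n g B z) (PtZ n g B w) = an (HZ z.1 w.1 * cj (∏ s, ip (z.1 s) (w.1 s))) := by
  unfold alph
  simp only [PtZ_fst]
  have hz : ∀ s, prj g (z.1 s) = prj g (sec g (prj g (z.1 s))) := fun s => (prj_sec _ _).symm
  have hw : ∀ s, prj g (w.1 s) = prj g (sec g (prj g (w.1 s))) := fun s => (prj_sec _ _).symm
  choose e he1 he2 he3 using fun s => phase (hz s)
  choose f hf1 hf2 hf3 using fun s => phase (hw s)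
  congr 1
  have a1 : (∏ s, cj (e s) * e s) = 1 := Finset.prod_eq_one fun s _ => he1 s
  have a2 : (∏ s, cj (f s) * f s) = 1 := Finset.prod_eq_one fun s _ => hf1 s
  rw [Finset.prod_mul_distrib] at a1 a2
  simp only [HZ, Vp, he3, hf3, (he2 _ _).1, (hf2 _ _).2, Finset.prod_mul_distrib, map_mul, map_prod, Complex.conj_conj, Finset.sum_mul]
  refine Finset.sum_congr rfl fun j _ => ?_
  linear_combination (∏ s, cj (vv j (z.1 s))) * (∏ s, vv j (w.1 s)) * (∏ s, cj (ip (z.1 s) (w.1 s))) * ((∏ s, cj (e s)) * (∏ s, e s) * a2 + a1)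

lemma alph_good {n g : ℕ} {δ : ℝ} (G : Good n g δ) {z w : (Fin n → Disc) × B} (h : dist z w < δ) :
    alph n g (PtZ n g B z) (PtZ n g B w) = an (HZ z.1 w.1) - ∑ s, an (ip (z.1 s) (w.1 s)) := by
  have k1 := G.HZ _ _ (dist_fst h)
  have k2 := fun s => G.ip _ _ (dist_coord h s)
  have k3 := sum_small _ fun s => (k2 s).2
  have k4 := an_prod Finset.univ (fun s => ip (z.1 s) (w.1 s)) (fun s _ => (k2 s).1) (k3.trans (by norm_num))
  have k5 : ∏ s, ip (z.1 s) (w.1 s) ≠ 0 := Finset.prod_ne_zero_iff.2 fun s _ => (k2 s).1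
  have k6 := an_conj _ k5 (by rw [k4]; exact k3.trans (by norm_num))
  rw [alph_PtZ, an_mul _ _ k1.1 ((map_ne_zero (starRingEnd ℂ)).2 k5), k6, k4]
  · ring
  · rw [k6, k4]
    have := k1.2
    rw [abs_lt] at *; constructor <;> linarith

lemma coh2 {n g : ℕ} {δ : ℝ} (G : Good n g δ) :
    Cls.coh (FiT (PtZ n g B) δ) (((Cls.two (c2X n g)).pull Prod.fst).pull (QZ n g B)) (sumC n (Cls.two (c2M g))) := by
  refine ⟨alph n g, fun x y t h => ?_⟩
  obtain ⟨z, w, u, rfl, rfl, rfl, h1, h2, h3⟩ := FiT_three h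
  simp only [d1, QPt, c2X_qz, Finset.sum_range, PtZ_fst, c2M_prj]
  rw [alph_good G h1, alph_good G h2, alph_good G h3]
  have k1 := G.HZ _ _ (dist_fst h1)
  have k2 := G.HZ _ _ (dist_fst h2)
  have k3 := G.HZ _ _ (dist_fst h3)
  have k4 := G.HZ u.1 z.1 (by rw [dist_comm]; exact dist_fst h3)
  rw [an_mul3 _ _ _ k1.1 k2.1 k4.1 (1 / 12) (by norm_num) k1.2 k2.2 k4.2]
  have k5 : an (HZ u.1 z.1) = - an (HZ z.1 u.1) := by
    rw [← HZ_conj, an_conj _ k3.1 (by linarith [k3.2])]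
  rw [k5]
  simp only [an_T3 G (dist_coord h1 _) (dist_coord h2 _) (dist_coord h3 _), Finset.sum_sub_distrib, Finset.sum_add_distrib]
  ring

end coh
end

section

section grid
local notation "cj" => starRingEnd ℂ

lemma ex_lip (t t' : ℝ) : ‖ex t - ex t'‖ ≤ 2 * Real.pi * |t - t'| := by
  have h1 : ex t - ex t' = ex t' * (ex (t - t') - 1) := by
    rw [mul_sub, ← ex_add]; simp
  rw [h1, norm_mul, ex_norm, one_mul, ex, tpI, mul_comm]
  refine (Real.norm_exp_I_mul_ofReal_sub_one_le).trans ?_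
  rw [Real.norm_eq_abs, abs_mul, abs_of_pos (by positivity)]

def gp (R Θ i j : ℕ) : Disc := ⟨(min ((i : ℝ) / R) 1 : ℝ) * ex (j / Θ), by
  rw [norm_mul, ex_norm, mul_one, Complex.norm_real, Real.norm_eq_abs, abs_of_nonneg (by positivity)]
  exact min_le_right _ _⟩

lemma gp_dist (R Θ : ℕ) (i i' j j' a b : ℕ) (h1 : i = a ∨ i = a + 1) (h2 : i' = a ∨ i' = a + 1)
    (h3 : j = b ∨ j = b + 1) (h4 : j' = b ∨ j' = b + 1) :
    dist (gp R Θ i j) (gp R Θ i' j') ≤ 1 / R + 2 * Real.pi / Θ := by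
  rw [Subtype.dist_eq, dist_eq_norm]
  simp only [gp]
  set s : ℝ := min ((i : ℝ) / R) 1
  set s' : ℝ := min ((i' : ℝ) / R) 1
  have hs0 : 0 ≤ s := by positivity
  have hs1 : s ≤ 1 := min_le_right _ _
  have hss : |s - s'| ≤ 1 / R := by
    refine (abs_min_sub_min_le_max _ _ _ _).trans ?_
    simp only [sub_self, abs_zero]
    apply max_le _ (by positivity)
    rw [← sub_div, abs_div, Nat.abs_cast]
    gcongr
    rcases h1 with rfl | rfl <;> rcases h2 with rfl | rfl <;> simp
  have htt : |(j : ℝ) / Θ - j' / Θ| ≤ 1 / Θ := by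
    rw [← sub_div, abs_div, Nat.abs_cast]
    gcongr
    rcases h3 with rfl | rfl <;> rcases h4 with rfl | rfl <;> simp
  have e : (s : ℂ) * ex (j / Θ) - s' * ex (j' / Θ) = ((s - s' : ℝ) : ℂ) * ex (j' / Θ) + s * (ex (j / Θ) - ex (j' / Θ)) := by
    push_cast; ring
  rw [e]
  refine (norm_add_le _ _).trans ?_
  rw [norm_mul, norm_mul, ex_norm, mul_one, Complex.norm_real, Complex.norm_real, Real.norm_eq_abs, Real.norm_eq_abs, abs_of_nonneg hs0]
  have h5 := ex_lip (j / Θ) (j' / Θ)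
  have h6 : s * ‖ex (j / Θ) - ex (j' / Θ)‖ ≤ 1 * (2 * Real.pi * (1 / Θ)) := by
    apply mul_le_mul hs1 (h5.trans (by gcongr)) (norm_nonneg _) zero_le_one
  calc _ ≤ 1 / (R : ℝ) + 1 * (2 * Real.pi * (1 / Θ)) := add_le_add hss h6
    _ = _ := by ring

lemma gp_per (R Θ i : ℕ) (hΘ : 0 < Θ) : gp R Θ i Θ = gp R Θ i 0 := by
  apply Subtype.ext
  simp only [gp]
  rw [div_self (by positivity)]
  have := ex_int 1
  simp at this
  simp [this, ex_zero]

lemma gp_zero (R Θ j : ℕ) : gp R Θ 0 j = gp R Θ 0 0 := by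
  apply Subtype.ext; simp [gp]

lemma gp_rim (R Θ j : ℕ) (hR : 0 < R) : (gp R Θ R j).1 = ex (j / Θ) := by
  simp only [gp]
  rw [div_self (by positivity)]; simp

lemma sg_tele (N : ℕ) (h : ℕ → ℝ) : ∑ j ∈ Finset.range N, sg j * (h (hi j) - h (lo j)) = h N - h 0 := by
  rw [← Finset.sum_range_sub]
  refine Finset.sum_congr rfl fun j _ => ?_
  by_cases e : Even j <;> simp [sg, lo, hi, e]

lemma lohi_cases (j : ℕ) : (lo j = j ∧ hi j = j + 1 ∧ sg j = 1) ∨ (lo j = j + 1 ∧ hi j = j ∧ sg j = -1) := by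
  by_cases e : Even j <;> simp [sg, lo, hi, e]

lemma stokes (R Θ : ℕ) (f : ℕ × ℕ → ℕ × ℕ → ℝ) (hper : ∀ i i', f (i, Θ) (i', Θ) = f (i, 0) (i', 0)) :
    ∑ i ∈ Finset.range R, ∑ j ∈ Finset.range Θ, sg i * sg j *
      (d1 f (lo i, lo j) (lo i, hi j) (hi i, hi j) - d1 f (lo i, lo j) (hi i, lo j) (hi i, hi j))
    = (∑ j ∈ Finset.range Θ, sg j * f (0, lo j) (0, hi j)) - ∑ j ∈ Finset.range Θ, sg j * f (R, lo j) (R, hi j) := by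
  set A : ℕ → ℝ := fun i => ∑ j ∈ Finset.range Θ, sg j * f (i, lo j) (i, hi j) with hA
  have h2 : ∑ i ∈ Finset.range R, sg i * (A (hi i) - A (lo i)) = A R - A 0 := sg_tele R A
  have h3 : A 0 - A R = ∑ i ∈ Finset.range R, (sg i * (A (lo i) - A (hi i))) := by
    have : ∑ i ∈ Finset.range R, (sg i * (A (lo i) - A (hi i))) = - ∑ i ∈ Finset.range R, sg i * (A (hi i) - A (lo i)) := by
      rw [← Finset.sum_neg_distrib]; exact Finset.sum_congr rfl fun i _ => by ring
    rw [this, h2]; ring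
  show _ = A 0 - A R
  rw [h3]
  refine Finset.sum_congr rfl fun i _ => ?_
  have h4 := sg_tele Θ (fun j => f (lo i, j) (hi i, j))
  simp only [hper, sub_self] at h4
  have : ∑ j ∈ Finset.range Θ, sg i * sg j *
      (d1 f (lo i, lo j) (lo i, hi j) (hi i, hi j) - d1 f (lo i, lo j) (hi i, lo j) (hi i, hi j))
      = sg i * ∑ j ∈ Finset.range Θ, sg j * (f (lo i, hi j) (hi i, hi j) - f (lo i, lo j) (hi i, lo j))
        + sg i * (A (lo i) - A (hi i)) := by
    simp only [hA]
    rw [← Finset.sum_sub_distrib, ← mul_add, ← Finset.sum_add_distrib, Finset.mul_sum]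
    refine Finset.sum_congr rfl fun j _ => ?_
    simp only [d1]; ring
  rw [this, h4]; ring

section fine
variable {n g : ℕ} {δ : ℝ}

lemma nb (G : Good n g δ) (R Θ : ℕ) (hR : 0 < R) (hΘ : 2 < Θ)
    (hfine : 1 / (R : ℝ) + 2 * Real.pi / Θ < δ) (i j : ℕ) {a a' b b' : ℕ} (h1 : a = lo i ∨ a = hi i) (h2 : a' = lo i ∨ a' = hi i)
    (h3 : b = lo j ∨ b = hi j) (h4 : b' = lo j ∨ b' = hi j) : dist (gp R Θ a b) (gp R Θ a' b') < δ := by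
  refine (gp_dist R Θ a a' b b' i j ?_ ?_ ?_ ?_).trans_lt hfine
  all_goals
    rcases lohi_cases i with ⟨e1, e2, -⟩ | ⟨e1, e2, -⟩ <;> rcases lohi_cases j with ⟨e3, e4, -⟩ | ⟨e3, e4, -⟩ <;> omega

lemma pair2_val (G : Good n g δ) (R Θ : ℕ) (hR : 0 < R) (hΘ : 2 < Θ)
    (hfine : 1 / (R : ℝ) + 2 * Real.pi / Θ < δ) : pair2 R Θ (fun i j => prj g (gp R Θ i j)) (c2M g) = -1 := by
  have hΘ' : (2 : ℝ) < Θ := by exact_mod_cast hΘ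
  have h := stokes R Θ (fun x y => an (ip (gp R Θ x.1 x.2) (gp R Θ y.1 y.2)))
    (fun i i' => by simp only [gp_per R Θ _ (by omega : 0 < Θ)])
  have e1 : pair2 R Θ (fun i j => prj g (gp R Θ i j)) (c2M g) = ∑ i ∈ Finset.range R, ∑ j ∈ Finset.range Θ, sg i * sg j *
      (d1 (fun x y : ℕ × ℕ => an (ip (gp R Θ x.1 x.2) (gp R Θ y.1 y.2))) (lo i, lo j) (lo i, hi j) (hi i, hi j)
       - d1 (fun x y : ℕ × ℕ => an (ip (gp R Θ x.1 x.2) (gp R Θ y.1 y.2))) (lo i, lo j) (hi i, lo j) (hi i, hi j)) := by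
    unfold pair2
    refine Finset.sum_congr rfl fun i _ => Finset.sum_congr rfl fun j _ => ?_
    rw [c2M_prj, c2M_prj, an_T3 G, an_T3 G]
    · simp only [d1]; ring
    all_goals exact nb G R Θ hR hΘ hfine i j (by simp) (by simp) (by simp) (by simp)
  rw [e1, h]
  have e2 : ∑ j ∈ Finset.range Θ, sg j * an (ip (gp R Θ 0 (lo j)) (gp R Θ 0 (hi j))) = 0 := by
    apply Finset.sum_eq_zero
    intro j _
    rw [gp_zero R Θ (lo j), gp_zero R Θ (hi j), ip_self, an_pos 1 one_pos, mul_zero]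
  have e3 : ∑ j ∈ Finset.range Θ, sg j * an (ip (gp R Θ R (lo j)) (gp R Θ R (hi j))) = 1 := by
    have : ∀ j, sg j * an (ip (gp R Θ R (lo j)) (gp R Θ R (hi j))) = 1 / Θ := by
      intro j
      have m : ∀ i, mu (gp R Θ R i) = 0 := by
        intro i; rw [mu, gp_rim R Θ i hR, ex_norm]; simp
      have e4 : ip (gp R Θ R (lo j)) (gp R Θ R (hi j)) = ((1 : ℝ) : ℂ) * ex (sg j / Θ) := by
        rw [ip, m, m, gp_rim R Θ _ hR, gp_rim R Θ _ hR, ← ex_neg, ← ex_add]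
        simp only [Complex.ofReal_zero, mul_zero, add_zero, Complex.ofReal_one, one_mul]
        congr 1
        rcases lohi_cases j with ⟨e1, e2, e3⟩ | ⟨e1, e2, e3⟩ <;> rw [e1, e2, e3] <;> push_cast <;> ring
      have e5 : sg j * sg j = 1 := by rcases lohi_cases j with ⟨e1, e2, e3⟩ | ⟨e1, e2, e3⟩ <;> rw [e3] <;> ring
      have e6 : |sg j| = 1 := by rcases lohi_cases j with ⟨e1, e2, e3⟩ | ⟨e1, e2, e3⟩ <;> rw [e3] <;> simp
      rw [e4, an_ex 1 one_pos, ← mul_div_assoc, e5]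
      rw [abs_div, e6, Nat.abs_cast]
      exact one_div_lt_one_div_of_lt (by norm_num) hΘ'
    rw [Finset.sum_congr rfl fun j _ => this j]
    simp
    field_simp
  rw [e2, e3]; ring

lemma pair11_val (G : Good n g δ) (R Θ : ℕ) (hR : 0 < R) (hΘ : 2 < Θ)
    (hfine : 1 / (R : ℝ) + 2 * Real.pi / Θ < δ) (k k' : Fin g) (r r' : Fin 2) : pair11 R Θ (fun i j => prj g (gp R Θ i j)) (a1M g k r) (a1M g k' r') =
    - ∑ j ∈ Finset.range Θ, sg j * (al g k r (gp R Θ R (lo j)) * (al g k' r' (gp R Θ R (hi j)) - al g k' r' (gp R Θ R (lo j)))) := by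
  have h := stokes R Θ (fun x y => al g k r (gp R Θ x.1 x.2) * (al g k' r' (gp R Θ y.1 y.2) - al g k' r' (gp R Θ x.1 x.2)))
    (fun i i' => by simp only [gp_per R Θ _ (by omega : 0 < Θ)])
  have e1 : pair11 R Θ (fun i j => prj g (gp R Θ i j)) (a1M g k r) (a1M g k' r') = ∑ i ∈ Finset.range R, ∑ j ∈ Finset.range Θ, sg i * sg j *
      (d1 (fun x y : ℕ × ℕ => al g k r (gp R Θ x.1 x.2) * (al g k' r' (gp R Θ y.1 y.2) - al g k' r' (gp R Θ x.1 x.2))) (lo i, lo j) (lo i, hi j) (hi i, hi j)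
       - d1 (fun x y : ℕ × ℕ => al g k r (gp R Θ x.1 x.2) * (al g k' r' (gp R Θ y.1 y.2) - al g k' r' (gp R Θ x.1 x.2))) (lo i, lo j) (hi i, lo j) (hi i, hi j)) := by
    unfold pair11
    refine Finset.sum_congr rfl fun i _ => Finset.sum_congr rfl fun j _ => ?_
    rw [a1M_good G, a1M_good G, a1M_good G, a1M_good G]
    · simp only [d1]; ring
    all_goals exact nb G R Θ hR hΘ hfine i j (by simp) (by simp) (by simp) (by simp)
  rw [e1, h]
  have e2 : ∑ j ∈ Finset.range Θ, sg j * (al g k r (gp R Θ 0 (lo j)) * (al g k' r' (gp R Θ 0 (hi j)) - al g k' r' (gp R Θ 0 (lo j)))) = 0 := by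
    apply Finset.sum_eq_zero
    intro j _
    rw [gp_zero R Θ (lo j), gp_zero R Θ (hi j), sub_self, mul_zero, mul_zero]
  rw [e2, zero_sub]
end fine

lemma al_gp (g k : ℕ) (r : Fin 2) (R L j : ℕ) (hR : 0 < R) (hL : 0 < L) (hg : 0 < g) (hj : j ≤ 4 * g * L) :
    al g k r (gp R (4 * g * L) R j) = pw (4 * k + r) (j / L) := by
  have h := al_node g k r (gp R (4 * g * L) R j) 1 (j / (4 * g * L : ℕ)) zero_le_one le_rfl (by positivity)
    (by rw [div_le_one (by positivity)]; exact_mod_cast hj) (by rw [gp_rim _ _ _ hR]; simp)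
  rw [h, one_mul]; congr 1; push_cast; field_simp

/-- two adjacent nodes lie in a common unit cell -/
lemma cell_of (L j : ℕ) (hL : 0 < L) : ∃ m : ℕ, (m : ℝ) ≤ (j : ℝ) / L ∧ ((j + 1 : ℕ) : ℝ) / L ≤ m + 1 := by
  refine ⟨j / L, ?_, ?_⟩
  · rw [le_div_iff₀ (by positivity)]; exact_mod_cast Nat.div_mul_le_self j L
  · rw [div_le_iff₀ (by positivity)]
    have := Nat.lt_div_mul_add hL (a := j)
    have h2 : j + 1 ≤ (j / L + 1) * L := by rw [add_mul, one_mul]; exact this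
    exact_mod_cast h2

lemma pw_orth {k k' m : ℕ} (hk : k ≠ k') (r r' : Fin 2) {t t' : ℝ} (h1 : (m : ℝ) ≤ t) (h2 : t ≤ m + 1) (h3 : (m : ℝ) ≤ t') (h4 : t' ≤ m + 1) :
    pw (4 * k + r) t * (pw (4 * k' + r') t' - pw (4 * k' + r') t) = 0 := by
  have hr := r.2
  have hr' := r'.2
  by_cases hm : m / 4 = k
  · have : pw (4 * k' + r') t' = 0 ∧ pw (4 * k' + r') t = 0 := by
      rcases lt_or_gt_of_ne hk with h | h
      · have : (m : ℝ) + 1 ≤ ((4 * k' + r' : ℕ) : ℝ) := by exact_mod_cast (by omega : m + 1 ≤ 4 * k' + r')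
        exact ⟨pw_le (by linarith), pw_le (by linarith)⟩
      · have : ((4 * k' + r' : ℕ) : ℝ) + 3 ≤ m := by exact_mod_cast (by omega : 4 * k' + r' + 3 ≤ m)
        exact ⟨pw_ge (by linarith), pw_ge (by linarith)⟩
    rw [this.1, this.2]; ring
  · have : pw (4 * k + r) t = 0 := by
      rcases lt_or_ge (m / 4) k with h | h
      · have : (m : ℝ) + 1 ≤ ((4 * k + r : ℕ) : ℝ) := by exact_mod_cast (by omega : m + 1 ≤ 4 * k + r)
        exact pw_le (by linarith)
      · have : ((4 * k + r : ℕ) : ℝ) + 3 ≤ m := by exact_mod_cast (by omega : 4 * k + r + 3 ≤ m)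
        exact pw_ge (by linarith)
    rw [this]; ring

lemma pw_same {k m : ℕ} {t t' : ℝ} (h1 : (m : ℝ) ≤ t) (h2 : t ≤ m + 1) (h3 : (m : ℝ) ≤ t') (h4 : t' ≤ m + 1) :
    pw (4 * k) t * (pw (4 * k + 1) t' - pw (4 * k + 1) t) = cl (t' - 4 * k - 1) - cl (t - 4 * k - 1) := by
  have c : m + 1 ≤ 4 * k + 1 ∨ m = 4 * k + 1 ∨ m = 4 * k + 2 ∨ 4 * k + 3 ≤ m := by omega
  rcases c with c | c | c | c
  · have : (m : ℝ) + 1 ≤ ((4 * k + 1 : ℕ) : ℝ) := by exact_mod_cast c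
    rw [pw_le (c := 4 * k + 1) (by linarith), pw_le (c := 4 * k + 1) (by linarith)]
    push_cast at this
    rw [cl_le0 (by linarith), cl_le0 (by linarith)]; ring
  · have : (m : ℝ) = 4 * k + 1 := by exact_mod_cast c
    rw [pw_one (by push_cast; linarith) (by push_cast; linarith), pw_up (by push_cast; linarith) (by push_cast; linarith),
      pw_up (by push_cast; linarith) (by push_cast; linarith), cl_mid (by linarith) (by linarith), cl_mid (by linarith) (by linarith)]
    push_cast; ring
  · have : (m : ℝ) = 4 * k + 2 := by exact_mod_cast c
    rw [pw_one (c := 4 * k + 1) (by push_cast; linarith) (by push_cast; linarith), pw_one (c := 4 * k + 1) (by push_cast; linarith) (by push_cast; linarith), cl_ge1 (by linarith), cl_ge1 (by linarith)]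
    ring
  · have : (4 * k : ℝ) + 3 ≤ m := by exact_mod_cast c
    rw [pw_ge (c := 4 * k) (by push_cast; linarith), cl_ge1 (by linarith), cl_ge1 (by linarith)]; ring

lemma lohi_cell (L j : ℕ) (hL : 0 < L) : ∃ m : ℕ, (m : ℝ) ≤ (lo j : ℝ) / L ∧ (lo j : ℝ) / L ≤ m + 1 ∧
    (m : ℝ) ≤ (hi j : ℝ) / L ∧ (hi j : ℝ) / L ≤ m + 1 := by
  obtain ⟨m, h1, h2⟩ := cell_of L j hL
  have h3 : (j : ℝ) / L ≤ ((j + 1 : ℕ) : ℝ) / L := by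
    gcongr; omega
  refine ⟨m, ?_⟩
  rcases lohi_cases j with ⟨e1, e2, e3⟩ | ⟨e1, e2, e3⟩ <;> rw [e1, e2] <;> refine ⟨?_, ?_, ?_, ?_⟩ <;> linarith

lemma lohi_le {j N : ℕ} (h : j < N) : lo j ≤ N ∧ hi j ≤ N := by
  rcases lohi_cases j with ⟨e1, e2, e3⟩ | ⟨e1, e2, e3⟩ <;> omega

lemma rim_orth (g R L : ℕ) (hR : 0 < R) (hL : 0 < L) (hg : 0 < g) {k k' : Fin g} (hk : k ≠ k') (r r' : Fin 2) :
    ∑ j ∈ Finset.range (4 * g * L), sg j * (al g k r (gp R (4 * g * L) R (lo j)) * (al g k' r' (gp R (4 * g * L) R (hi j)) - al g k' r' (gp R (4 * g * L) R (lo j)))) = 0 := by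
  apply Finset.sum_eq_zero
  intro j hj
  have hj := lohi_le (Finset.mem_range.1 hj)
  rw [al_gp _ _ _ _ _ _ hR hL hg hj.1, al_gp _ _ _ _ _ _ hR hL hg hj.1, al_gp _ _ _ _ _ _ hR hL hg hj.2]
  obtain ⟨m, h1, h2, h3, h4⟩ := lohi_cell L j hL
  rw [pw_orth (fun h => hk (Fin.ext h)) r r' h1 h2 h3 h4, mul_zero]

lemma rim_same (g R L : ℕ) (hR : 0 < R) (hL : 0 < L) (hg : 0 < g) (k : Fin g) :
    ∑ j ∈ Finset.range (4 * g * L), sg j * (al g k 0 (gp R (4 * g * L) R (lo j)) * (al g k 1 (gp R (4 * g * L) R (hi j)) - al g k 1 (gp R (4 * g * L) R (lo j)))) = 1 := by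
  have := sg_tele (4 * g * L) (fun j => cl ((j : ℝ) / L - 4 * k - 1))
  have e : (4 * g : ℝ) - 4 * k - 1 ≥ 1 := by
    have : ((k : ℕ) : ℝ) + 1 ≤ g := by exact_mod_cast k.2
    linarith
  have e' : ((4 * g * L : ℕ) : ℝ) / L = 4 * g := by push_cast; field_simp
  rw [e', cl_ge1 e, Nat.cast_zero, zero_div, cl_le0 (by linarith [(Nat.cast_nonneg (k : ℕ) : (0 : ℝ) ≤ (k : ℕ))]), sub_zero] at this
  rw [← this]
  refine Finset.sum_congr rfl fun j hj => ?_
  have hj := lohi_le (Finset.mem_range.1 hj)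
  rw [al_gp _ _ _ _ _ _ hR hL hg hj.1, al_gp _ _ _ _ _ _ hR hL hg hj.1, al_gp _ _ _ _ _ _ hR hL hg hj.2]
  obtain ⟨m, h1, h2, h3, h4⟩ := lohi_cell L j hL
  have := pw_same (k := (k : ℕ)) h1 h2 h3 h4
  simp only [Fin.val_zero, Fin.val_one, add_zero] at this ⊢
  rw [this]

lemma node_glue (g R L E i : ℕ) (hR : 0 < R) (hL : 0 < L) (hg : 0 < g) (hE : E < 4 * g) (hE4 : E % 4 < 2) (hi : i ≤ L) :
    prj g (gp R (4 * g * L) R (E * L + i)) = prj g (gp R (4 * g * L) R ((E + 2) * L + (L - i))) := by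
  obtain ⟨g, rfl⟩ : ∃ h, g = h + 1 := ⟨g - 1, by omega⟩
  refine Quot.sound ⟨⟨E / 4, by omega⟩, ⟨E % 4, hE4⟩, (i : ℝ) / L, by positivity, by
    rw [div_le_one (by positivity)]; exact_mod_cast hi, ?_, ?_⟩
  · rw [gp_rim _ _ _ hR, polyBP_eq]
    have : 4 * (E / 4) + E % 4 = E := by omega
    simp only [this]
    congr 1
    push_cast; field_simp
  · rw [gp_rim _ _ _ hR, polyBP_eq]
    have : 4 * (E / 4) + E % 4 = E := by omega
    simp only [this]
    congr 1
    push_cast [Nat.cast_sub hi]; field_simp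

lemma rim_cancel (g R L : ℕ) (hR : 0 < R) (hL : 0 < L) (hLe : Even L) (hg : 0 < g) :
    Cancel (4 * g * L) (fun j => prj g (gp R (4 * g * L) R j)) := by
  let opp : ℕ → ℕ := fun E => if E % 4 < 2 then E + 2 else E - 2
  refine ⟨fun j => opp (j / L) * L + (L - 1 - j % L), fun j hj => ?_⟩
  have hdm : ∀ E i, i < L → (E * L + i) / L = E ∧ (E * L + i) % L = i := by
    intro E i hi
    constructor
    · rw [mul_comm, Nat.mul_add_div hL, Nat.div_eq_of_lt hi, add_zero]
    · rw [mul_comm, Nat.mul_add_mod, Nat.mod_eq_of_lt hi]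
  obtain ⟨E, i, hi, rfl⟩ : ∃ E i, i < L ∧ j = E * L + i := ⟨j / L, j % L, Nat.mod_lt _ hL, (Nat.div_add_mod' j L).symm⟩
  have hE : E < 4 * g := by
    by_contra h
    push Not at h
    have := Nat.mul_le_mul_right L h
    omega
  have hopp : opp E < 4 * g ∧ opp (opp E) = E := by
    simp only [opp]; split_ifs <;> omega
  simp only [(hdm E i hi).1, (hdm E i hi).2]
  have h3 := hdm (opp E) (L - 1 - i) (by omega)
  rw [h3.1, h3.2, hopp.2]
  refine ⟨?_, by congr 1; omega, ?_, ?_, ?_⟩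
  · have : (opp E + 1) * L ≤ 4 * g * L := Nat.mul_le_mul_right L hopp.1
    rw [add_mul] at this; omega
  · have h1 : Even (opp E * L) := hLe.mul_left _
    have h2 : Even (E * L) := hLe.mul_left _
    rw [Nat.even_add, Nat.even_add]
    simp only [h1, h2, true_iff]
    obtain ⟨m, rfl⟩ := hLe
    simp only [Nat.even_iff]; omega
  · by_cases h : E % 4 < 2
    · have := node_glue g R L E (i + 1) hR hL hg hE h (by omega)
      simp only [opp, h, if_true]
      rw [add_assoc, this]; congr 3; omega
    · have := node_glue g R L (E - 2) (L - 1 - i) hR hL hg (by omega) (by omega) (by omega)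
      simp only [opp, h, if_false]
      rw [this]; congr 2
      have e1 : E - 2 + 2 = E := by omega
      rw [e1]; omega
  · by_cases h : E % 4 < 2
    · have := node_glue g R L E i hR hL hg hE h (by omega)
      simp only [opp, h, if_true]
      rw [this]; congr 2; omega
    · have := node_glue g R L (E - 2) (L - i) hR hL hg (by omega) (by omega) (by omega)
      simp only [opp, h, if_false]
      have e1 : E - 2 + 2 = E := by omega
      rw [e1] at this
      have e2 : L - (L - i) = i := by omega
      rw [e2] at this
      rw [← this]; congr 2; omega

lemma rim0 (R Θ : ℕ) (hR : 0 < R) (j j' : ℕ) : prj 0 (gp R Θ R j) = prj 0 (gp R Θ R j') := by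
  have h : ∀ j, (prj0 (gp R Θ R j)) = SpMk (k := 2) ![0, 0, 1] (by simp [Fin.sum_univ_succ]) := by
    intro j
    have m : mu (gp R Θ R j) = 0 := by rw [mu, gp_rim R Θ j hR, ex_norm]; simp
    have e : ‖(gp R Θ R j).1‖ = 1 := by rw [gp_rim R Θ j hR, ex_norm]
    simp only [prj0, m, e]
    congr 1
    norm_num
  show prj0 _ = prj0 _
  rw [h, h]

lemma fine_exists (g : ℕ) (δ : ℝ) (hδ : 0 < δ) : ∃ R L : ℕ, 0 < R ∧ Even R ∧ 0 < L ∧ Even L ∧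
    1 / (R : ℝ) + 2 * Real.pi / ((4 * max g 1 * L : ℕ) : ℝ) < δ := by
  obtain ⟨N, hN⟩ := exists_nat_gt ((1 + 2 * Real.pi) / δ)
  have hN0 : (0 : ℝ) < N := lt_of_le_of_lt (by positivity) hN
  have hN1 : 0 < N := by exact_mod_cast hN0
  refine ⟨N + N, N + N, by omega, ⟨N, rfl⟩, by omega, ⟨N, rfl⟩, ?_⟩
  rw [div_lt_iff₀ hδ] at hN
  have h1 : (N : ℝ) ≤ ((N + N : ℕ) : ℝ) := by push_cast; linarith
  have h2 : (N : ℝ) ≤ ((4 * max g 1 * (N + N) : ℕ) : ℝ) := by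
    have : 1 * N ≤ 4 * max g 1 * (N + N) := Nat.mul_le_mul (by have := le_max_right g 1; omega) (by omega)
    rw [one_mul] at this
    exact_mod_cast this
  calc _ ≤ 1 / (N : ℝ) + 2 * Real.pi / N := by gcongr
    _ = (1 + 2 * Real.pi) / N := by ring
    _ < δ := by rw [div_lt_iff₀ hN0]; linarith

end grid
end

section

section lbfinal

def DL (n g : ℕ) : List (Option (Fin g × Fin 2)) :=
  (List.finRange (min n g)).flatMap (fun i => [some (Fin.castLE (min_le_right n g) i, 0), some (Fin.castLE (min_le_right n g) i, 1)])
    ++ List.replicate (n - min n g) none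

lemma DL_length (n g : ℕ) : (DL n g).length = n + min n g := by
  simp [DL, List.length_flatMap]; omega

def BL (n g : ℕ) : List (Blk (Mg g)) :=
  (List.finRange (min n g)).map (fun i => Blk.pair (a1M g (Fin.castLE (min_le_right n g) i) 0) (a1M g (Fin.castLE (min_le_right n g) i) 1))
    ++ List.replicate (n - min n g) (Blk.sing (c2M g))

lemma BL_length (n g : ℕ) : (BL n g).length = n := by
  simp [BL]

def fM (g : ℕ) : Option (Fin g × Fin 2) → Cls (Mg g)
  | none => Cls.two (c2M g)
  | some q => Cls.one (a1M g q.1 q.2)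
def fX (n g : ℕ) (B : Type*) : Option (Fin g × Fin 2) → Cls (SP n (Mg g) × B)
  | none => (Cls.two (c2X n g)).pull Prod.fst
  | some q => (Cls.one (a1X n g q.1 q.2)).pull Prod.fst

lemma flat_BL (n g : ℕ) : flat (BL n g) = (DL n g).map (fM g) := by
  simp only [flat, BL, DL, List.flatMap_append, List.map_append, List.flatMap_map, List.map_flatMap, List.map_replicate]
  congr 1
  have : ∀ k, (List.replicate k (Blk.sing (c2M g))).flatMap Blk.cls = List.replicate k (Cls.two (c2M g)) := by
    intro k
    induction k with
    | zero => rfl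
    | succ k ih => rw [List.replicate_succ, List.replicate_succ, List.flatMap_cons, ih]; rfl
  rw [this]; rfl

lemma BL_orth (n g R Θ : ℕ) (sq : ℕ → ℕ → Mg g)
    (horth : ∀ k k' : Fin g, k ≠ k' → ∀ r r', pair11 R Θ sq (a1M g k r) (a1M g k' r') = 0) :
    (BL n g).Pairwise (Blk.orth R Θ sq) := by
  unfold BL
  rw [List.pairwise_append]
  refine ⟨?_, ?_, ?_⟩
  · rw [List.pairwise_map]
    refine (List.nodup_finRange _).imp ?_
    intro a b hab C hC
    have hab' : Fin.castLE (min_le_right n g) a ≠ Fin.castLE (min_le_right n g) b := fun h => hab (Fin.castLE_injective _ h)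
    simp only [Blk.cls, List.mem_cons, List.not_mem_nil, or_false] at hC
    rcases hC with rfl | rfl
    · exact ⟨horth _ _ hab' _ _, horth _ _ hab' _ _⟩
    · exact ⟨horth _ _ hab' _ _, horth _ _ hab' _ _⟩
  · rw [List.pairwise_replicate]; right; trivial
  · intro x hx y hy
    obtain rfl := List.eq_of_mem_replicate hy
    obtain ⟨i, -, rfl⟩ := List.mem_map.1 hx
    intro C hC
    simp only [Blk.cls, List.mem_cons, List.not_mem_nil, or_false] at hC
    subst hC
    exact ⟨trivial, trivial⟩

lemma BL_num (n g R Θ : ℕ) (sq : ℕ → ℕ → Mg g) (h1 : ∀ k : Fin g, pair11 R Θ sq (a1M g k 0) (a1M g k 1) ≠ 0)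
    (h2 : pair2 R Θ sq (c2M g) ≠ 0) : ∀ b ∈ BL n g, b.num R Θ sq ≠ 0 := by
  intro b hb
  unfold BL at hb
  rcases List.mem_append.1 hb with hb | hb
  · obtain ⟨i, -, rfl⟩ := List.mem_map.1 hb
    exact h1 _
  · obtain rfl := List.eq_of_mem_replicate hb
    exact h2

lemma upd_fine {n g : ℕ} {B : Type*} [MetricSpace B] [CompactSpace B] [Nonempty B] {ε : ℝ} (hε : 0 < ε) (R Θ : ℕ) (hfε : 1 / (R : ℝ) + 2 * Real.pi / (Θ : ℝ) < ε)
    (s : ℕ) (hs : s < n) (l : List (TT (Mg g) B)) (hl : FiT (PtZ n g B) ε l) (i j : ℕ) (q : List (TT (Mg g) B × Mg g))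
    (hq : ∀ a ∈ q, a.1 ∈ l ∧ ∃ i' j', (i' = i ∨ i' = i + 1) ∧
          (j' = j ∨ j' = j + 1) ∧ a.2 = prj g (gp R Θ i' j')) : FiT (PtZ n g B) ε (q.map (upd s)) := by
  obtain ⟨lz, hlz, rfl⟩ := hl
  have hthis : ∀ a : TT (Mg g) B × Mg g, a ∈ q → ∃ z' : (Fin n → Disc) × B, upd s a = PtZ n g B z' ∧ ∃ z ∈ lz, ∃ i' j',
      (i' = i ∨ i' = i + 1) ∧ (j' = j ∨ j' = j + 1) ∧ z' = (Function.update z.1 ⟨s, hs⟩ (gp R Θ i' j'), z.2) := by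
    rintro ⟨a1, a2⟩ ha
    obtain ⟨h1, i', j', hi', hj', h2⟩ := hq _ ha
    obtain ⟨z, hz, h3⟩ := List.mem_map.1 h1
    simp only at h2 h3
    refine ⟨(Function.update z.1 ⟨s, hs⟩ (gp R Θ i' j'), z.2), ?_, z, hz, i', j', hi', hj', rfl⟩
    rw [← h3, h2]
    simp only [upd, PtZ]
    congr 1
    funext t
    by_cases hts : t = s
    · subst hts; simp [hs]
    · rw [Function.update_of_ne hts]
      by_cases ht : t < n
      · simp only [ht, dif_pos]
        rw [Function.update_of_ne (by simpa using hts)]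
      · simp [ht]
  haveI : Nonempty ((Fin n → Disc) × B) := ⟨(fun _ => ⟨0, by simp⟩, Classical.arbitrary B)⟩
  choose! F hF1 hF2 using hthis
  refine ⟨q.map F, ?_, ?_⟩
  · intro a ha b hb
    obtain ⟨a, ha0, rfl⟩ := List.mem_map.1 ha
    obtain ⟨b, hb0, rfl⟩ := List.mem_map.1 hb
    obtain ⟨z, hz, i1, j1, hi1, hj1, h1⟩ := hF2 a ha0
    obtain ⟨w, hw, i2, j2, hi2, hj2, h2⟩ := hF2 b hb0
    rw [h1, h2]
    have hd := hlz z hz w hw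
    apply max_lt
    · rw [dist_pi_lt_iff hε]
      intro t
      by_cases ht : t = ⟨s, hs⟩
      · subst ht
        simp only [Function.update_self]
        exact (gp_dist R Θ i1 i2 j1 j2 i j hi1 hi2 hj1 hj2).trans_lt hfε
      · simp only [Function.update_of_ne ht]
        exact dist_coord hd t
    · exact (le_max_right _ _).trans_lt hd
  · rw [List.map_map]
    exact List.map_congr_left fun a ha => hF1 a ha

theorem lb_gen (n g : ℕ) (B : Type*) [MetricSpace B] [CompactSpace B] [Nonempty B]
    (ΩB : List B → ℝ) (h0 : ΩB [] = 0) (hdeg : Degen ΩB) (e1 : ℝ) (he1 : 0 < e1)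
    (hΩd : ∀ l, FineL e1 l → dl ΩB l = 0)
    (hev : ∀ ε > 0, ∃ evB : (List B → ℝ) → ℝ,
      (∀ f f' : List B → ℝ, (∀ lB : List B, FineL ε lB → f lB = f' lB) → evB f = evB f') ∧
      (∀ f f', evB (fun l => f l + f' l) = evB f + evB f') ∧
      (∀ (r : ℝ) f, evB (fun l => r * f l) = r * evB f) ∧
      (∀ f : List B → ℝ, f [] = 0 → evB (dl f) = 0) ∧ evB ΩB ≠ 0)
    (r : ℕ) (hr : r + 1 = n + min n g ∨ (r = n + min n g ∧ LocCo (fun l : List (SP n (Mg g) × B) => ΩB (l.map Prod.snd)))) :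
    ¬ catLE (SP n (Mg g) × B) r := by
  obtain ⟨δ, G⟩ := exists_good n g
  refine lb_abstract (QZ n g B) (PtZ n g B) (QPt_cont n g) ((DL n g).map (fX n g B)) (BL n g) n (BL_length n g)
    ?_ (fun l => ΩB (l.map Prod.snd)) ΩB ?_ h0 hdeg ?_ (min δ e1) (lt_min G.pos he1) ?_ ?_ ?_ ?_ r
    (by simpa [DL_length] using hr)
  · intro C hC
    rw [flat_BL] at hC
    obtain ⟨d, -, rfl⟩ := List.mem_map.1 hC
    cases d with
    | none => exact c2M_nrm g
    | some q => exact a1M_nrm g _ _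
  · intro l
    simp only [lastΩ, List.map_map]; rfl
  · intro C hC
    obtain ⟨d, -, rfl⟩ := List.mem_map.1 hC
    cases d with
    | none => exact c2X_loc n g Prod.fst continuous_fst
    | some q => exact a1X_loc n g _ _ Prod.fst continuous_fst
  · intro C hC
    rw [flat_BL] at hC
    obtain ⟨d, -, rfl⟩ := List.mem_map.1 hC
    have hm := FiT.mono (Pt := PtZ n g B) (min_le_left δ e1)
    cases d with
    | none => exact fun x y z w h => cocyc2 G x y z w (hm _ h)
    | some q => exact fun x y z h => cocyc1 G q.1 q.2 x y z (hm _ h)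
  · rw [flat_BL, List.map_map, List.map_map, List.forall₂_map_left_iff, List.forall₂_map_right_iff, List.forall₂_same]
    intro d _
    have hm := FiT.mono (Pt := PtZ n g B) (min_le_left δ e1)
    cases d with
    | none =>
      obtain ⟨b, hb⟩ := coh2 (B := B) G
      exact ⟨b, fun x y z h => hb x y z (hm _ h)⟩
    | some q =>
      obtain ⟨b, hb⟩ := coh1 (B := B) G q.1 q.2
      exact ⟨b, fun x y h => hb x y (hm _ h)⟩
  · rintro l ⟨lz, hlz, rfl⟩
    have : dl (lastΩ ΩB) (lz.map (PtZ n g B)) = dl ΩB ((lz.map (PtZ n g B)).map Prod.snd) := dl_map Prod.snd ΩB _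
    rw [this, List.map_map]
    apply hΩd
    intro a ha b hb
    obtain ⟨z, hz, rfl⟩ := List.mem_map.1 ha
    obtain ⟨w, hw, rfl⟩ := List.mem_map.1 hb
    exact (le_max_right _ _).trans_lt ((hlz z hz w hw).trans_le (min_le_right _ _))
  · intro ε hε
    obtain ⟨evB, v1, v2, v3, v4, v5⟩ := hev ε hε
    obtain ⟨R, L, hR, hRe, hL, hLe, hf⟩ := fine_exists g (min ε δ) (lt_min hε G.pos)
    obtain ⟨Θ, hΘdef⟩ : ∃ Θ, Θ = 4 * max g 1 * L := ⟨_, rfl⟩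
    rw [← hΘdef] at hf
    have hΘe : Even Θ := hΘdef ▸ hLe.mul_left _
    have hΘ2 : 2 < Θ := by
      have : 4 * 1 * 1 ≤ Θ := hΘdef ▸ Nat.mul_le_mul (Nat.mul_le_mul_left 4 (le_max_right g 1)) hL
      omega
    have hfδ := hf.trans_le (min_le_right _ _)
    have hfε := hf.trans_le (min_le_left _ _)
    have hpg : ∀ k : Fin g, Θ = 4 * g * L := by
      intro k
      have := k.2
      rw [hΘdef, max_eq_left (by omega)]
    refine ⟨R, Θ, fun i j => prj g (gp R Θ i j), evB, fun _ => prj g ⟨0, by simp⟩, fun i => ?_, ?_, ?_, ?_, ?_, ?_, ?_, v2, v3, v4, v5⟩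
    · simp only [gp_per R Θ i (by omega)]
    · exact Cancel.const hΘe fun j => by
        show prj g (gp R Θ 0 j) = prj g (gp R Θ 0 0)
        rw [gp_zero R Θ j]
    · rcases Nat.eq_zero_or_pos g with hg | hg
      · subst hg
        exact Cancel.const hΘe fun j => rim0 R Θ hR _ _
      · rw [hpg ⟨0, hg⟩]
        exact rim_cancel g R L hR hL hLe hg
    · exact BL_orth n g R Θ _ fun k k' hk r r' => by
        rw [pair11_val G R Θ hR hΘ2 hfδ, hpg k, rim_orth g R L hR hL (by have := k.2; omega) hk, neg_zero]
    · refine BL_num n g R Θ _ (fun k => ?_) ?_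
      · rw [pair11_val G R Θ hR hΘ2 hfδ, hpg k, rim_same g R L hR hL (by have := k.2; omega)]
        norm_num
      · rw [pair2_val G R Θ hR hΘ2 hfδ]; norm_num
    · exact fun s hs l hl i _ j _ q hq => upd_fine hε R Θ hfε s hs l hl i j q hq
    · intro f f' h
      apply v1
      intro lB hlB
      apply h
      refine ⟨lB.map fun b => (fun _ => ⟨0, by simp⟩, b), ?_, ?_⟩
      · intro a ha b hb
        obtain ⟨a, ha0, rfl⟩ := List.mem_map.1 ha
        obtain ⟨b, hb0, rfl⟩ := List.mem_map.1 hb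
        have := hlB a ha0 b hb0
        apply max_lt
        · rw [dist_self]; exact hε
        · exact this
      · rw [List.map_map]
        apply List.map_congr_left
        intro b _
        simp only [PtZ, Function.comp]
        congr 1
        funext t
        split_ifs <;> rfl

theorem lb_sphere (n g k : ℕ) (hk : 1 ≤ k) : ¬ catLE (SP n (Mg g) × Sp k) (n + min n g) := by
  haveI : Nonempty (Sp k) := (NormedSpace.sphere_nonempty.2 zero_le_one).to_subtype
  refine lb_gen n g (Sp k) (OmS k) (Om_nil _) (OmS_degen k) (1 / (k + 1)) (by positivity) (fun l h => OmS_dl l h) ?_ _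
    (Or.inr ⟨rfl, OmS_locCo hk Prod.snd continuous_snd⟩)
  intro ε hε
  obtain ⟨m, hm⟩ := exists_nat_gt (k * Real.pi / ε + 2)
  have hk0 : (0 : ℝ) ≤ k * Real.pi / ε := by positivity
  have hm2 : (2 : ℝ) < m := by linarith
  have hm2' : 2 < m := by exact_mod_cast hm2
  refine ⟨evS (m + m) k, fun f f' h => ?_, evS_add _ _, fun r f => evS_smul _ _ r f, fun f _ => evS_dl ⟨m, rfl⟩ (by omega) k f, evS_Om (by omega) k⟩
  refine evS_local (by omega) k ε hε ?_ f f' h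
  have : k * Real.pi / ε < m := by linarith
  rw [div_lt_iff₀ hε] at this
  push_cast
  have hm0 : (0 : ℝ) < m := by linarith
  have e : (k : ℝ) * (2 * (Real.pi / (m + m))) = k * Real.pi / m := by field_simp; ring
  rw [e, div_lt_iff₀ hm0]; linarith

lemma catLE_homeo {X Y : Type*} [TopologicalSpace X] [TopologicalSpace Y] (e : X ≃ₜ Y) {r : ℕ} (h : catLE X r) : catLE Y r := by
  obtain ⟨U, h1, h2, h3⟩ := h
  refine ⟨fun i => e.symm ⁻¹' U i, fun i => (h1 i).preimage e.symm.continuous, ?_, fun i => ?_⟩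
  · rw [← Set.preimage_iUnion, h2, Set.preimage_univ]
  · obtain ⟨x, hx⟩ := h3 i
    let j : C(e.symm ⁻¹' U i, U i) := ⟨fun y => ⟨e.symm y.1, y.2⟩, by fun_prop⟩
    have := ((ContinuousMap.Nullhomotopic.comp_left ⟨x, hx⟩ j).comp_right (⟨e, e.continuous⟩ : C(X, Y)))
    convert this using 1
    ext y
    simp [inclMap, j]

theorem lb_plain (n g r : ℕ) (hr : r + 1 = n + min n g) : ¬ catLE (SP n (Mg g)) r := by
  intro h
  refine lb_gen n g Unit (fun l => if l.length = 1 then 1 else 0) (by simp) ?_ 1 one_pos ?_ ?_ r (Or.inl hr)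
    (catLE_homeo (Homeomorph.prodPUnit (SP n (Mg g))).symm h)
  · intro l₁ a l₂
    show (if (l₁ ++ a :: a :: l₂).length = 1 then (1:ℝ) else 0) = 0
    rw [if_neg]; simp; omega
  · intro l _
    rcases l with _ | ⟨a, _ | ⟨b, _ | ⟨c, l⟩⟩⟩
    · rfl
    · simp [dl]
    · simp [dl]
    · have : ∀ (Φ : List Unit → ℝ) (l : List Unit), (∀ l', l'.length + 1 = l.length → Φ l' = 0) → dl Φ l = 0 := by
        intro Φ l
        induction l generalizing Φ with
        | nil => intro _; rfl
        | cons a l ih =>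
          intro h
          rw [dl_cons, h l (by simp), ih (fun m => Φ (a :: m)) (fun l' hl' => h _ (by simp [hl'])), sub_zero]
      apply this
      intro l' hl'
      show (if l'.length = 1 then (1:ℝ) else 0) = 0
      rw [if_neg]; simp at hl'; omega
  · intro ε hε
    refine ⟨fun f => f [()], fun f f' h => h _ (fun a _ b _ => by simpa using hε), fun _ _ => rfl, fun _ _ => rfl, fun f hf => ?_, by simp⟩
    simp [dl, hf]

end lbfinal
end

section

section ubgen
variable {X : Type*} [TopologicalSpace X]

def NullOn (x0 : X) (U : Set X) : Prop :=
  ∃ H : X → ℝ → X, ContinuousOn (fun p : X × ℝ => H p.1 p.2) (U ×ˢ Set.univ) ∧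
    (∀ x ∈ U, H x 0 = x) ∧ ∀ x ∈ U, H x 1 = x0

lemma NullOn.null {x0 : X} {U : Set X} (h : NullOn x0 U) : (inclMap U).Nullhomotopic := by
  obtain ⟨H, h1, h2, h3⟩ := h
  refine ⟨x0, ⟨⟨⟨fun p => H p.2.1 p.1, ?_⟩, fun x => h2 _ x.2, fun x => h3 _ x.2⟩⟩⟩
  exact h1.comp_continuous (f := fun p : I × U => (p.2.1, (p.1 : ℝ))) (by fun_prop) (fun p => ⟨p.2.2, trivial⟩)

lemma NullOn.union {x0 : X} {U V : Set X} (hU : NullOn x0 U) (hV : NullOn x0 V) (oU : IsOpen U) (oV : IsOpen V)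
    (hd : ∀ x ∈ U, x ∉ V) : NullOn x0 (U ∪ V) := by
  classical
  obtain ⟨H, h1, h2, h3⟩ := hU
  obtain ⟨H', h1', h2', h3'⟩ := hV
  refine ⟨fun x t => if x ∈ U then H x t else H' x t, ?_, ?_, ?_⟩
  · rintro ⟨x, t⟩ ⟨hx, -⟩
    apply ContinuousAt.continuousWithinAt
    rcases hx with hx | hx
    · have hn : U ×ˢ (Set.univ : Set ℝ) ∈ 𝓝 (x, t) := (oU.prod isOpen_univ).mem_nhds ⟨hx, trivial⟩
      refine (h1.continuousAt hn).congr ?_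
      filter_upwards [hn] with p hp
      simp [hp.1]
    · have hn : V ×ˢ (Set.univ : Set ℝ) ∈ 𝓝 (x, t) := (oV.prod isOpen_univ).mem_nhds ⟨hx, trivial⟩
      refine (h1'.continuousAt hn).congr ?_
      filter_upwards [hn] with p hp
      have : p.1 ∉ U := fun h => hd _ h hp.1
      simp [this]
  · rintro x (hx | hx)
    · simp [hx, h2 x hx]
    · have : x ∉ U := fun h => hd _ h hx
      simp [this, h2' x hx]
  · rintro x (hx | hx)
    · simp [hx, h3 x hx]
    · have : x ∉ U := fun h => hd _ h hx
      simp [this, h3' x hx]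

lemma cont_trans {Z W : Type*} [TopologicalSpace Z] [TopologicalSpace W] {S : Set Z} {A B : Z → ℝ → W}
    (hA : ContinuousOn (fun p : Z × ℝ => A p.1 p.2) (S ×ˢ Set.univ))
    (hB : ContinuousOn (fun p : Z × ℝ => B p.1 p.2) (S ×ˢ Set.univ)) (hAB : ∀ z ∈ S, A z 1 = B z 0) :
    ContinuousOn (fun p : Z × ℝ => if p.2 ≤ 1 / 2 then A p.1 (2 * p.2) else B p.1 (2 * p.2 - 1)) (S ×ˢ Set.univ) := by
  rw [continuousOn_iff_continuous_restrict] at *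
  have hA' : Continuous fun p : (S ×ˢ (Set.univ : Set ℝ) : Set (Z × ℝ)) => A p.1.1 (2 * p.1.2) :=
    hA.comp (f := fun p : (S ×ˢ (Set.univ : Set ℝ) : Set (Z × ℝ)) => (⟨(p.1.1, 2 * p.1.2), ⟨p.2.1, trivial⟩⟩ : (S ×ˢ (Set.univ : Set ℝ) : Set (Z × ℝ)))) (by fun_prop)
  have hB' : Continuous fun p : (S ×ˢ (Set.univ : Set ℝ) : Set (Z × ℝ)) => B p.1.1 (2 * p.1.2 - 1) :=
    hB.comp (f := fun p : (S ×ˢ (Set.univ : Set ℝ) : Set (Z × ℝ)) => (⟨(p.1.1, 2 * p.1.2 - 1), ⟨p.2.1, trivial⟩⟩ : (S ×ˢ (Set.univ : Set ℝ) : Set (Z × ℝ)))) (by fun_prop)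
  refine Continuous.if_le hA' hB' (by fun_prop) continuous_const ?_
  intro p hp
  have e1 : 2 * p.1.2 = 1 := by linarith
  rw [e1, sub_self]
  exact hAB _ p.2.1

lemma NullOn.move {x0 x1 : X} {U : Set X} (h : NullOn x0 U) (γ : ℝ → X) (hγ : Continuous γ) (h0 : γ 0 = x0) (h1 : γ 1 = x1) :
    NullOn x1 U := by
  obtain ⟨H, k1, k2, k3⟩ := h
  refine ⟨fun x t => if t ≤ 1 / 2 then H x (2 * t) else γ (2 * t - 1), ?_, fun x hx => ?_, fun x hx => ?_⟩
  · exact cont_trans (B := fun _ t => γ t) k1 (by fun_prop) (fun z hz => by rw [k3 z hz, h0])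
  · simp [k2 x hx]
  · norm_num [h1]

lemma NullOn.prod {Y : Type*} [TopologicalSpace Y] {x0 : X} {y0 : Y} {U : Set X} {V : Set Y} (h : NullOn x0 U) (h' : NullOn y0 V) :
    NullOn (x0, y0) (U ×ˢ V) := by
  obtain ⟨H, k1, k2, k3⟩ := h
  obtain ⟨H', k1', k2', k3'⟩ := h'
  refine ⟨fun x t => (H x.1 t, H' x.2 t), ?_, fun x hx => ?_, fun x hx => ?_⟩
  · apply ContinuousOn.prodMk
    · exact k1.comp (f := fun p : (X × Y) × ℝ => (p.1.1, p.2)) (by fun_prop) (fun p hp => ⟨hp.1.1, trivial⟩)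
    · exact k1'.comp (f := fun p : (X × Y) × ℝ => (p.1.2, p.2)) (by fun_prop) (fun p hp => ⟨hp.1.2, trivial⟩)
  · simp only [k2 _ hx.1, k2' _ hx.2]
  · simp only [k3 _ hx.1, k3' _ hx.2]

lemma NullOn.mono {x0 : X} {U V : Set X} (h : NullOn x0 U) (hVU : V ⊆ U) : NullOn x0 V := by
  obtain ⟨H, k1, k2, k3⟩ := h
  exact ⟨H, k1.mono (Set.prod_mono_left hVU), fun x hx => k2 x (hVU hx), fun x hx => k3 x (hVU hx)⟩

/-- weighted categorical cover -/
def NW (x0 : X) (m : ℕ) : Prop := ∃ u : ℕ → X → ℝ, (∀ i, Continuous (u i)) ∧ (∀ i x, 0 ≤ u i x) ∧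
  (∀ x, ∃ i ≤ m, 0 < u i x) ∧ ∀ i ≤ m, NullOn x0 {x | 0 < u i x}

lemma NW.catLE {x0 : X} {m : ℕ} (h : NW x0 m) : catLE X m := by
  obtain ⟨u, h1, h2, h3, h4⟩ := h
  refine ⟨fun i => {x | 0 < u i x}, fun i => isOpen_lt continuous_const (h1 i), ?_, fun i => (h4 i (by omega)).null⟩
  rw [Set.eq_univ_iff_forall]
  intro x
  obtain ⟨i, hi, hx⟩ := h3 x
  exact Set.mem_iUnion.2 ⟨⟨i, by omega⟩, hx⟩

lemma NW.prod {Y : Type*} [TopologicalSpace Y] {x0 : X} {m : ℕ} (h : NW x0 m) (c : Y → ℝ) (hc : Continuous c)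
    (hc0 : ∀ y, 0 ≤ c y) (hc1 : ∀ y, c y ≤ 1) (y0 : Y) (hN : NullOn y0 {y | 0 < c y}) (hS : NullOn y0 {y | c y < 1}) :
    _root_.catLE (X × Y) (m + 1) := by
  obtain ⟨u, h1, h2, h3, h4⟩ := h
  have hsum : ∀ x, 0 < ∑ i ∈ Finset.range (m + 1), u i x := by
    intro x
    obtain ⟨i, hi, hx⟩ := h3 x
    exact Finset.sum_pos' (fun i _ => h2 i x) ⟨i, Finset.mem_range.2 (by omega), hx⟩
  let tot : X → ℝ := fun x => ∑ i ∈ Finset.range (m + 1), u i x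
  let s : ℕ → X → ℝ := fun l x => ∑ i ∈ Finset.range l, u i x
  have htc : Continuous tot := continuous_finsetSum _ fun i _ => h1 i
  have hsc : ∀ l, Continuous (s l) := fun l => continuous_finsetSum _ fun i _ => h1 i
  have hs0 : ∀ l x, 0 ≤ s l x := fun l x => Finset.sum_nonneg fun i _ => h2 i x
  have hs1 : ∀ l ≤ m + 1, ∀ x, s l x ≤ tot x := fun l hl x =>
    Finset.sum_le_sum_of_subset_of_nonneg (Finset.range_mono hl) fun i _ _ => h2 i x
  let A : ℕ → Set (X × Y) := fun l => {p | l ≤ m ∧ 0 < u l p.1 ∧ s l p.1 < c p.2 * tot p.1}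
  let B : ℕ → Set (X × Y) := fun l => {p | 1 ≤ l ∧ l ≤ m + 1 ∧ 0 < u (l - 1) p.1 ∧ c p.2 * tot p.1 < s l p.1}
  have oA : ∀ l, IsOpen (A l) := by
    intro l
    by_cases hl : l ≤ m
    · have : A l = {p | 0 < u l p.1} ∩ {p | s l p.1 < c p.2 * tot p.1} := by ext p; simp [A, hl]
      rw [this]
      exact (isOpen_lt continuous_const ((h1 l).comp continuous_fst)).inter
        (isOpen_lt ((hsc l).comp continuous_fst) ((hc.comp continuous_snd).mul (htc.comp continuous_fst)))
    · have : A l = ∅ := by ext p; simp [A, hl]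
      rw [this]; exact isOpen_empty
  have oB : ∀ l, IsOpen (B l) := by
    intro l
    by_cases hl : 1 ≤ l ∧ l ≤ m + 1
    · have : B l = {p | 0 < u (l - 1) p.1} ∩ {p | c p.2 * tot p.1 < s l p.1} := by ext p; simp [B, hl.1, hl.2]
      rw [this]
      exact (isOpen_lt continuous_const ((h1 _).comp continuous_fst)).inter
        (isOpen_lt ((hc.comp continuous_snd).mul (htc.comp continuous_fst)) ((hsc l).comp continuous_fst))
    · have : B l = ∅ := by ext p; simp only [B, Set.mem_setOf_eq, Set.mem_empty_iff_false]; tauto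
      rw [this]; exact isOpen_empty
  have nA : ∀ l, NullOn (x0, y0) (A l) := by
    intro l
    by_cases hl : l ≤ m
    · refine ((h4 l hl).prod hN).mono ?_
      rintro p ⟨-, h5, h6⟩
      refine ⟨h5, ?_⟩
      have := (hs0 l p.1).trans_lt h6
      exact pos_of_mul_pos_left this (hsum p.1).le
    · refine ((h4 0 (by omega)).prod hN).mono ?_
      rintro p ⟨h5, -⟩
      exact absurd h5 hl
  have nB : ∀ l, NullOn (x0, y0) (B l) := by
    intro l
    by_cases hl : 1 ≤ l ∧ l ≤ m + 1
    · refine ((h4 (l - 1) (by omega)).prod hS).mono ?_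
      rintro p ⟨-, -, h5, h6⟩
      refine ⟨h5, ?_⟩
      have := h6.trans_le (hs1 l hl.2 p.1)
      exact (mul_lt_iff_lt_one_left (hsum p.1)).1 this
    · refine ((h4 0 (by omega)).prod hN).mono ?_
      rintro p ⟨h5, h6, -⟩
      exact absurd ⟨h5, h6⟩ hl
  refine ⟨fun l => A l ∪ B l, fun l => (oA l).union (oB l), ?_, fun l => ((nA l).union (nB l) (oA l) (oB l) ?_).null⟩
  · rw [Set.eq_univ_iff_forall]
    intro p
    obtain ⟨i, hi, hx⟩ := h3 p.1
    rcases lt_or_ge (s i p.1) (c p.2 * tot p.1) with h | h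
    · exact Set.mem_iUnion.2 ⟨⟨i, by omega⟩, Or.inl ⟨hi, hx, h⟩⟩
    · refine Set.mem_iUnion.2 ⟨⟨i + 1, by omega⟩, Or.inr ⟨by simp, by simpa using hi, by simpa using hx, ?_⟩⟩
      have : s (i + 1) p.1 = s i p.1 + u i p.1 := Finset.sum_range_succ _ _
      show _ < s (i + 1) p.1
      linarith
  · rintro p ⟨_, _, h⟩ ⟨_, _, _, h'⟩
    exact lt_asymm h h'


def nz {k : ℕ} (v : Sp k) (w : EuclideanSpace ℝ (Fin (k + 1))) : Sp k :=
  if h : w = 0 then v else ⟨‖w‖⁻¹ • w, by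
    rw [mem_sphere_zero_iff_norm, norm_smul, norm_inv, norm_norm, inv_mul_cancel₀ (norm_ne_zero_iff.2 h)]⟩

lemma sphere_null {k : ℕ} (v : Sp k) : NullOn v {y : Sp k | -1 < inner ℝ y.1 v.1} := by
  have hn : ∀ y : Sp k, ‖y.1‖ = 1 := fun y => mem_sphere_zero_iff_norm.1 y.2
  have hne : ∀ y : Sp k, -1 < inner ℝ y.1 v.1 → ∀ t : ℝ, 0 ≤ t → t ≤ 1 → (1 - t) • y.1 + t • v.1 ≠ 0 := by
    intro y hy t h0 h1 h
    have e : ‖(1 - t) • y.1 + t • v.1‖ ^ 2 = (1 - t) ^ 2 + 2 * ((1 - t) * t * inner ℝ y.1 v.1) + t ^ 2 := by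
      rw [norm_add_sq_real, norm_smul, norm_smul, hn, hn, real_inner_smul_left, real_inner_smul_right]
      simp only [Real.norm_eq_abs, mul_one, sq_abs]; ring
    rw [h, norm_zero] at e
    have h2 : 0 ≤ (1 - t) * t := mul_nonneg (by linarith) h0
    rcases h2.lt_or_eq with h3 | h3
    · nlinarith [sq_nonneg (1 - 2 * t), mul_lt_mul_of_pos_left hy h3]
    · rw [← h3] at e
      nlinarith [sq_nonneg (1 - 2 * t)]
  refine ⟨fun y t => nz v ((1 - max 0 (min 1 t)) • y.1 + max 0 (min 1 t) • v.1), ?_, fun y hy => ?_, fun y hy => ?_⟩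
  · rw [Topology.IsInducing.subtypeVal.continuousOn_iff]
    have : ContinuousOn (fun p : Sp k × ℝ => ‖(1 - max 0 (min 1 p.2)) • p.1.1 + max 0 (min 1 p.2) • v.1‖⁻¹ •
        ((1 - max 0 (min 1 p.2)) • p.1.1 + max 0 (min 1 p.2) • v.1)) ({y : Sp k | -1 < inner ℝ y.1 v.1} ×ˢ Set.univ) := by
      refine ContinuousOn.fun_smul (ContinuousOn.inv₀ (by fun_prop) ?_) ?_
      · skip
        intro p hp
        exact norm_ne_zero_iff.2 (hne p.1 hp.1 _ (le_max_left _ _) (max_le zero_le_one (min_le_left _ _)))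
      · fun_prop
    refine this.congr ?_
    intro p hp
    have := hne p.1 hp.1 (max 0 (min 1 p.2)) (le_max_left _ _) (max_le zero_le_one (min_le_left _ _))
    simp only [Function.comp, nz, this, dif_neg, not_false_eq_true]
  · have h0 : y.1 ≠ 0 := by
      intro h
      have := hn y
      rw [h] at this; simp at this
    apply Subtype.ext
    simp [nz, h0, hn y]
  · have h0 : v.1 ≠ 0 := by
      intro h
      have := hn v
      rw [h] at this; simp at this
    apply Subtype.ext
    simp [nz, h0, hn v]

lemma NW.sphere {x0 : X} {m : ℕ} (h : NW x0 m) (k : ℕ) (hk : 1 ≤ k) : _root_.catLE (X × Sp k) (m + 1) := by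
  obtain ⟨v⟩ : Nonempty (Sp k) := (NormedSpace.sphere_nonempty.2 zero_le_one).to_subtype
  have hn : ∀ y : Sp k, ‖y.1‖ = 1 := fun y => mem_sphere_zero_iff_norm.1 y.2
  let w : Sp k := ⟨-v.1, by rw [mem_sphere_zero_iff_norm, norm_neg, hn]⟩
  have habs : ∀ y : Sp k, |inner ℝ y.1 v.1| ≤ 1 := by
    intro y
    have := abs_real_inner_le_norm y.1 v.1
    rwa [hn, hn, one_mul] at this
  have hpc : IsPathConnected (Metric.sphere (0 : EuclideanSpace ℝ (Fin (k + 1))) 1) := by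
    apply isPathConnected_sphere _ _ zero_le_one
    rw [← Module.finrank_eq_rank, finrank_euclideanSpace_fin]
    exact_mod_cast (by omega : 1 < k + 1)
  haveI := isPathConnected_iff_pathConnectedSpace.1 hpc
  obtain ⟨γ⟩ := PathConnectedSpace.joined w v
  refine h.prod (fun y => (1 + inner ℝ y.1 v.1) / 2) (by fun_prop) (fun y => ?_) (fun y => ?_) v ?_ ?_
  · have := (abs_le.1 (habs y)).1; linarith
  · have := (abs_le.1 (habs y)).2; linarith
  · refine (sphere_null v).mono fun y (hy : 0 < (1 + inner ℝ y.1 v.1) / 2) => ?_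
    show -1 < inner ℝ y.1 v.1
    linarith
  · refine NullOn.move ((sphere_null w).mono fun y (hy : (1 + inner ℝ y.1 v.1) / 2 < 1) => ?_) γ.extend γ.continuous_extend (by simp) (by simp)
    show -1 < inner ℝ y.1 (-v.1)
    rw [inner_neg_right]; linarith

end ubgen
end

section

section glue
variable {X Y Λ : Type*} [TopologicalSpace X] [TopologicalSpace Y] [Fintype Λ]

structure GD (q : Y → X) (x0 : X) (m : ℕ) (u : Λ → Y → ℝ) (wt : Λ → ℕ) (K : Λ → Y → ℝ → X)
    (G : Λ → Λ → Y → ℝ → ℝ → X) : Prop where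
  hq : IsOpenQuotientMap q
  ucont : ∀ L, Continuous (u L)
  unn : ∀ L y, 0 ≤ u L y
  cov : ∀ y, ∃ L, 0 < u L y ∧ wt L ≤ 2 * m + 1
  uniq : ∀ L L' y, 0 < u L y → 0 < u L' y → wt L = wt L' → L = L'
  kcont : ∀ L, ContinuousOn (fun p : Y × ℝ => K L p.1 p.2) ({y | 0 < u L y} ×ˢ Set.univ)
  k0 : ∀ L y, 0 < u L y → K L y 0 = q y
  k1 : ∀ L y, 0 < u L y → K L y 1 = x0
  gcont : ∀ L L', Even (wt L) → wt L' = wt L + 1 →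
    ContinuousOn (fun p : Y × ℝ × ℝ => G L L' p.1 p.2.1 p.2.2) ({y | 0 < u L y ∧ 0 < u L' y} ×ˢ Set.univ)
  g0 : ∀ L L', Even (wt L) → wt L' = wt L + 1 → ∀ y, 0 < u L y → 0 < u L' y → ∀ h, G L L' y h 0 = q y
  g1 : ∀ L L', Even (wt L) → wt L' = wt L + 1 → ∀ y, 0 < u L y → 0 < u L' y → ∀ h, G L L' y h 1 = x0
  gl : ∀ L L', Even (wt L) → wt L' = wt L + 1 → ∀ y, 0 < u L y → 0 < u L' y → ∀ t, G L L' y 0 t = K L y t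
  gr : ∀ L L', Even (wt L) → wt L' = wt L + 1 → ∀ y, 0 < u L y → 0 < u L' y → ∀ t, G L L' y 1 t = K L' y t
  inv : ∀ y y', q y = q y' → ∃ f : Λ ≃ Λ, (∀ L, wt (f L) = wt L) ∧ (∀ L, u (f L) y' = u L y) ∧
    (∀ L, 0 < u L y → ∀ t, K (f L) y' t = K L y t) ∧
    (∀ L L', Even (wt L) → wt L' = wt L + 1 → 0 < u L y → 0 < u L' y → ∀ h t, G (f L) (f L') y' h t = G L L' y h t)

variable {q : Y → X} {x0 : X} {m : ℕ} {u : Λ → Y → ℝ} {wt : Λ → ℕ} {K : Λ → Y → ℝ → X} {G : Λ → Λ → Y → ℝ → ℝ → X}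

open Classical in
def omg (u : Λ → Y → ℝ) (wt : Λ → ℕ) (e : ℕ) (y : Y) : ℝ := ∑ L, if wt L = e then u L y else 0

open Classical in
def sel [Nonempty Λ] (u : Λ → Y → ℝ) (wt : Λ → ℕ) (e : ℕ) (y : Y) : Λ := Classical.epsilon fun L => wt L = e ∧ 0 < u L y

def cpar (u : Λ → Y → ℝ) (wt : Λ → ℕ) (l : ℕ) (y : Y) : ℝ :=
  max 0 (min 1 (2 * (omg u wt (2 * l + 1) y / (omg u wt (2 * l) y + omg u wt (2 * l + 1) y)) - 1 / 2))

open Classical in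
def Hg [Nonempty Λ] (u : Λ → Y → ℝ) (wt : Λ → ℕ) (K : Λ → Y → ℝ → X) (G : Λ → Λ → Y → ℝ → ℝ → X) (l : ℕ) (y : Y) (t : ℝ) : X :=
  if 0 < omg u wt (2 * l) y ∧ 0 < omg u wt (2 * l + 1) y then
    G (sel u wt (2 * l) y) (sel u wt (2 * l + 1) y) y (cpar u wt l y) t
  else if 0 < omg u wt (2 * l) y then K (sel u wt (2 * l) y) y t else K (sel u wt (2 * l + 1) y) y t

namespace GD
variable [Nonempty Λ]

lemma om_cont (D : GD q x0 m u wt K G) (e : ℕ) : Continuous (omg u wt e) := by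
  unfold omg
  refine continuous_finsetSum _ fun L _ => ?_
  split_ifs
  · exact D.ucont L
  · exact continuous_const

lemma om_nn (D : GD q x0 m u wt K G) (e : ℕ) (y : Y) : 0 ≤ omg u wt e y :=
  Finset.sum_nonneg fun L _ => by split_ifs; exacts [D.unn L y, le_rfl]

lemma om_pos (D : GD q x0 m u wt K G) {e : ℕ} {y : Y} : 0 < omg u wt e y ↔ ∃ L, wt L = e ∧ 0 < u L y := by
  unfold omg
  rw [Finset.sum_pos_iff_of_nonneg (fun L _ => by split_ifs; exacts [D.unn L y, le_rfl])]
  constructor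
  · rintro ⟨L, -, h⟩
    split_ifs at h with h1
    · exact ⟨L, h1, h⟩
    · exact absurd h (lt_irrefl _)
  · rintro ⟨L, h1, h⟩
    exact ⟨L, Finset.mem_univ _, by rwa [if_pos h1]⟩

lemma sel_spec (D : GD q x0 m u wt K G) {e : ℕ} {y : Y} (h : 0 < omg u wt e y) : wt (sel u wt e y) = e ∧ 0 < u (sel u wt e y) y :=
  Classical.epsilon_spec (D.om_pos.1 h)

lemma sel_eq (D : GD q x0 m u wt K G) {L : Λ} {y : Y} (h : 0 < u L y) : sel u wt (wt L) y = L := by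
  have h1 := D.sel_spec (D.om_pos.2 ⟨L, rfl, h⟩)
  exact D.uniq _ _ y h1.2 h h1.1

lemma om_inv (D : GD q x0 m u wt K G) {e : ℕ} {y y' : Y} (h : q y = q y') : omg u wt e y = omg u wt e y' := by
  obtain ⟨f, f1, f2, -, -⟩ := D.inv y y' h
  unfold omg
  refine Eq.trans ?_ (Equiv.sum_comp f _)
  exact Finset.sum_congr rfl fun L _ => by simp only [f1, f2]

lemma Hg_inv (D : GD q x0 m u wt K G) {l : ℕ} {y y' : Y} (h : q y = q y') (hv : 0 < omg u wt (2 * l) y ∨ 0 < omg u wt (2 * l + 1) y) (t : ℝ) :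
    Hg u wt K G l y t = Hg u wt K G l y' t := by
  obtain ⟨f, f1, f2, f3, f4⟩ := D.inv y y' h
  have hs : ∀ e, 0 < omg u wt e y → sel u wt e y' = f (sel u wt e y) := by
    intro e he
    obtain ⟨h1, h2⟩ := D.sel_spec he
    have := D.sel_eq (L := f (sel u wt e y)) (y := y') (by rw [f2]; exact h2)
    rwa [f1, h1] at this
  have hc : cpar u wt l y = cpar u wt l y' := by unfold cpar; rw [D.om_inv h, D.om_inv h]
  unfold Hg
  rw [← D.om_inv h, ← D.om_inv h, ← hc]
  split_ifs with h1 h2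
  · obtain ⟨a1, a2⟩ := D.sel_spec h1.1
    obtain ⟨b1, b2⟩ := D.sel_spec h1.2
    rw [hs _ h1.1, hs _ h1.2, f4 _ _ (by rw [a1]; simp) (by rw [a1, b1]) a2 b2]
  · obtain ⟨a1, a2⟩ := D.sel_spec h2
    rw [hs _ h2, f3 _ a2]
  · have h3 := hv.resolve_left h2
    obtain ⟨a1, a2⟩ := D.sel_spec h3
    rw [hs _ h3, f3 _ a2]

lemma cpar_cont (D : GD q x0 m u wt K G) {l : ℕ} {y : Y} (hv : 0 < omg u wt (2 * l) y ∨ 0 < omg u wt (2 * l + 1) y) :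
    ContinuousAt (cpar u wt l) y := by
  have h1 := D.om_cont (2 * l)
  have h2 := D.om_cont (2 * l + 1)
  have hp : omg u wt (2 * l) y + omg u wt (2 * l + 1) y ≠ 0 := by
    have := D.om_nn (2 * l) y
    have := D.om_nn (2 * l + 1) y
    rcases hv with h | h <;> positivity
  have : ContinuousAt (fun y => omg u wt (2 * l + 1) y / (omg u wt (2 * l) y + omg u wt (2 * l + 1) y)) y :=
    h2.continuousAt.div (h1.add h2).continuousAt hp
  unfold cpar
  exact (continuous_const.max (continuous_const.min ((continuous_const.mul continuous_id).sub continuous_const))).continuousAt.comp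
    (f := fun y => omg u wt (2 * l + 1) y / (omg u wt (2 * l) y + omg u wt (2 * l + 1) y)) (x := y) this

lemma Hg_cont (D : GD q x0 m u wt K G) {l : ℕ} {y : Y} (hv : 0 < omg u wt (2 * l) y ∨ 0 < omg u wt (2 * l + 1) y) (t : ℝ) :
    ContinuousAt (fun p : Y × ℝ => Hg u wt K G l p.1 p.2) (y, t) := by
  have hsel : ∀ e, 0 < omg u wt e y → ∀ᶠ z in 𝓝 y, 0 < u (sel u wt e y) z ∧ sel u wt e z = sel u wt e y ∧ 0 < omg u wt e z := by
    intro e he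
    obtain ⟨h1, h2⟩ := D.sel_spec he
    have ho : IsOpen {z | 0 < u (sel u wt e y) z} := isOpen_lt continuous_const (D.ucont _)
    filter_upwards [ho.mem_nhds h2] with z hz
    have := D.sel_eq (L := sel u wt e y) (y := z) hz
    rw [h1] at this
    exact ⟨hz, this, D.om_pos.2 ⟨_, h1, hz⟩⟩
  have hcK : ∀ L, 0 < u L y → ContinuousAt (fun p : Y × ℝ => K L p.1 p.2) (y, t) := fun L hL =>
    (D.kcont L).continuousAt (((isOpen_lt continuous_const (D.ucont L)).prod isOpen_univ).mem_nhds ⟨hL, trivial⟩)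
  have lift : ∀ {P : Y → Prop}, (∀ᶠ z in 𝓝 y, P z) → ∀ᶠ p in 𝓝 (y, t), P p.1 := fun h =>
    Filter.Tendsto.eventually (continuousAt_fst : ContinuousAt Prod.fst (y, t)) h
  by_cases hE : 0 < omg u wt (2 * l) y
  · obtain ⟨a1, a2⟩ := D.sel_spec hE
    by_cases hO : 0 < omg u wt (2 * l + 1) y
    · obtain ⟨b1, b2⟩ := D.sel_spec hO
      have hg := D.gcont (sel u wt (2 * l) y) (sel u wt (2 * l + 1) y) (by rw [a1]; simp) (by rw [a1, b1])
      have hg' := hg.continuousAt (x := (y, cpar u wt l y, t)) ((((isOpen_lt continuous_const (D.ucont _)).inter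
        (isOpen_lt continuous_const (D.ucont _))).prod isOpen_univ).mem_nhds ⟨⟨a2, b2⟩, trivial⟩)
      have hc := D.cpar_cont hv
      have hmap : ContinuousAt (fun p : Y × ℝ => (p.1, cpar u wt l p.1, p.2)) (y, t) :=
        continuousAt_fst.prodMk ((ContinuousAt.comp (f := Prod.fst) (x := (y, t)) hc continuousAt_fst).prodMk continuousAt_snd)
      have := ContinuousAt.comp (f := fun p : Y × ℝ => (p.1, cpar u wt l p.1, p.2)) (x := (y, t)) hg' hmap
      refine this.congr ?_
      filter_upwards [lift (hsel _ hE), lift (hsel _ hO)] with p h1 h2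
      simp only [Hg, h1.2.2, h2.2.2, and_self, if_true, h1.2.1, h2.2.1, Function.comp]
    · have hO0 : omg u wt (2 * l + 1) y = 0 := le_antisymm (not_lt.1 hO) (D.om_nn _ _)
      have hsm : ∀ᶠ z in 𝓝 y, 3 * omg u wt (2 * l + 1) z < omg u wt (2 * l) z :=
        ((continuous_const.mul (D.om_cont _)).continuousAt.eventually_lt (D.om_cont _).continuousAt (by simpa [hO0] using hE))
      refine (hcK _ a2).congr ?_
      filter_upwards [lift (hsel _ hE), lift hsm] with p h1 h2
      by_cases h3 : 0 < omg u wt (2 * l + 1) p.1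
      · simp only [Hg, h1.2.2, h3, and_self, if_true, h1.2.1]
        have hc : cpar u wt l p.1 = 0 := by
          unfold cpar
          apply max_eq_left
          refine (min_le_right _ _).trans ?_
          have : omg u wt (2 * l + 1) p.1 / (omg u wt (2 * l) p.1 + omg u wt (2 * l + 1) p.1) ≤ 1 / 4 := by
            rw [div_le_iff₀ (by linarith [h1.2.2])]; linarith
          linarith
        obtain ⟨c1, c2⟩ := D.sel_spec h3
        rw [hc, D.gl _ _ (by rw [a1]; simp) (by rw [a1, c1]) _ h1.1 c2]
      · simp only [Hg, h1.2.2, h3, and_false, if_false, if_true, h1.2.1]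
  · have hO := hv.resolve_left hE
    obtain ⟨b1, b2⟩ := D.sel_spec hO
    have hE0 : omg u wt (2 * l) y = 0 := le_antisymm (not_lt.1 hE) (D.om_nn _ _)
    have hsm : ∀ᶠ z in 𝓝 y, 3 * omg u wt (2 * l) z < omg u wt (2 * l + 1) z :=
      ((continuous_const.mul (D.om_cont _)).continuousAt.eventually_lt (D.om_cont _).continuousAt (by simpa [hE0] using hO))
    refine (hcK _ b2).congr ?_
    filter_upwards [lift (hsel _ hO), lift hsm] with p h1 h2
    by_cases h3 : 0 < omg u wt (2 * l) p.1
    · simp only [Hg, h1.2.2, h3, and_self, if_true, h1.2.1]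
      have hc : cpar u wt l p.1 = 1 := by
        unfold cpar
        have : 3 / 4 ≤ omg u wt (2 * l + 1) p.1 / (omg u wt (2 * l) p.1 + omg u wt (2 * l + 1) p.1) := by
          rw [le_div_iff₀ (by linarith [h1.2.2])]; linarith
        rw [min_eq_left (by linarith), max_eq_right zero_le_one]
      obtain ⟨c1, c2⟩ := D.sel_spec h3
      rw [hc, D.gr _ _ (by rw [c1]; simp) (by rw [b1, c1]) _ c2 h1.1]
    · simp only [Hg, h3, false_and, if_false, h1.2.1]

lemma Hg_zero (D : GD q x0 m u wt K G) {l : ℕ} {y : Y} (hv : 0 < omg u wt (2 * l) y ∨ 0 < omg u wt (2 * l + 1) y) : Hg u wt K G l y 0 = q y := by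
  unfold Hg
  split_ifs with h1 h2
  · obtain ⟨a1, a2⟩ := D.sel_spec h1.1
    obtain ⟨b1, b2⟩ := D.sel_spec h1.2
    exact D.g0 _ _ (by rw [a1]; simp) (by rw [a1, b1]) _ a2 b2 _
  · exact D.k0 _ _ (D.sel_spec h2).2
  · exact D.k0 _ _ (D.sel_spec (hv.resolve_left h2)).2

lemma Hg_one (D : GD q x0 m u wt K G) {l : ℕ} {y : Y} (hv : 0 < omg u wt (2 * l) y ∨ 0 < omg u wt (2 * l + 1) y) : Hg u wt K G l y 1 = x0 := by
  unfold Hg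
  split_ifs with h1 h2
  · obtain ⟨a1, a2⟩ := D.sel_spec h1.1
    obtain ⟨b1, b2⟩ := D.sel_spec h1.2
    exact D.g1 _ _ (by rw [a1]; simp) (by rw [a1, b1]) _ a2 b2 _
  · exact D.k1 _ _ (D.sel_spec h2).2
  · exact D.k1 _ _ (D.sel_spec (hv.resolve_left h2)).2

theorem nw (D : GD q x0 m u wt K G) : NW x0 m := by
  obtain ⟨r, hr⟩ := D.hq.surjective.hasRightInverse
  let v : ℕ → X → ℝ := fun l x => omg u wt (2 * l) (r x) + omg u wt (2 * l + 1) (r x)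
  have hv : ∀ l y, v l (q y) = omg u wt (2 * l) y + omg u wt (2 * l + 1) y := by
    intro l y
    simp only [v]
    rw [D.om_inv (hr (q y)), D.om_inv (hr (q y))]
  have hpos : ∀ l x, 0 < v l x → 0 < omg u wt (2 * l) (r x) ∨ 0 < omg u wt (2 * l + 1) (r x) := by
    intro l x h
    by_contra hc
    push Not at hc
    have : v l x ≤ 0 := by simp only [v]; linarith [hc.1, hc.2]
    linarith
  refine ⟨v, fun l => ?_, fun l x => add_nonneg (D.om_nn _ _) (D.om_nn _ _), fun x => ?_, fun l hl => ?_⟩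
  · rw [D.hq.isQuotientMap.continuous_iff]
    refine Continuous.congr (f := fun y => omg u wt (2 * l) y + omg u wt (2 * l + 1) y) ((D.om_cont _).add (D.om_cont _)) ?_
    intro y
    exact (hv l y).symm
  · obtain ⟨L, h1, h2⟩ := D.cov (r x)
    refine ⟨wt L / 2, by omega, ?_⟩
    have hp := D.om_pos.2 ⟨L, rfl, h1⟩
    rcases Nat.even_or_odd (wt L) with he | he
    · have : 2 * (wt L / 2) = wt L := by obtain ⟨a, ha⟩ := he; omega
      simp only [v, this]
      exact add_pos_of_pos_of_nonneg hp (D.om_nn _ _)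
    · have : 2 * (wt L / 2) + 1 = wt L := by obtain ⟨a, ha⟩ := he; omega
      simp only [v, this]
      exact add_pos_of_nonneg_of_pos (D.om_nn _ _) hp
  · refine ⟨fun x t => Hg u wt K G l (r x) t, ?_, fun x hx => ?_, fun x hx => ?_⟩
    · rintro ⟨x, t⟩ ⟨hx, -⟩
      apply ContinuousAt.continuousWithinAt
      have hQ : IsOpenQuotientMap (Prod.map q (id : ℝ → ℝ)) := D.hq.prodMap IsOpenQuotientMap.id
      have e : (x, t) = Prod.map q (id : ℝ → ℝ) (r x, t) := by simp [hr x]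
      rw [e, ← hQ.continuousAt_comp_iff]
      have hxp := hpos l x hx
      refine (D.Hg_cont hxp t).congr ?_
      have hop : IsOpen {y | 0 < omg u wt (2 * l) y ∨ 0 < omg u wt (2 * l + 1) y} :=
        (isOpen_lt continuous_const (D.om_cont _)).union (isOpen_lt continuous_const (D.om_cont _))
      filter_upwards [(hop.prod isOpen_univ).mem_nhds (⟨hxp, trivial⟩ : (r x, t) ∈ _ ×ˢ (Set.univ : Set ℝ))] with p hp
      exact D.Hg_inv (hr (q p.1)).symm hp.1 p.2
    · show Hg u wt K G l (r x) 0 = x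
      rw [D.Hg_zero (hpos l x hx), hr x]
    · exact D.Hg_one (hpos l x hx)
end GD
end glue
end

section

section spqs
variable {M : Type*} [TopologicalSpace M] {n : ℕ}

def spq (y : Fin n → M) : SP n M := Quot.mk _ y

lemma spq_perm (y : Fin n → M) (e : Equiv.Perm (Fin n)) : spq (fun s => y (e s)) = spq y :=
  (Quot.sound ⟨e, rfl⟩ : Quot.mk (spRel n M) y = Quot.mk _ (y ∘ e)).symm

lemma spq_eq {y y' : Fin n → M} (h : spq y = spq y') : ∃ e : Equiv.Perm (Fin n), ∀ s, y' s = y (e s) := by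
  have h1 : Relation.EqvGen (spRel n M) y y' := Quot.eqvGen_exact h
  clear h
  induction h1 with
  | rel a b h => obtain ⟨e, he⟩ := h; exact ⟨e, fun s => by rw [← he]; rfl⟩
  | refl a => exact ⟨1, fun s => rfl⟩
  | symm a b _ ih => obtain ⟨e, he⟩ := ih; exact ⟨e.symm, fun s => by rw [he]; simp⟩
  | trans a b c _ _ h1 h2 =>
    obtain ⟨e, he⟩ := h1
    obtain ⟨f, hf⟩ := h2
    exact ⟨f.trans e, fun s => by rw [hf, he]; rfl⟩

lemma spq_cont : Continuous (spq : (Fin n → M) → SP n M) := continuous_quot_mk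

lemma spq_open : IsOpenQuotientMap (spq : (Fin n → M) → SP n M) := by
  refine ⟨fun x => Quot.exists_rep x, spq_cont, fun U hU => ?_⟩
  have : IsOpen ((spq : (Fin n → M) → SP n M) ⁻¹' (Set.image spq U)) := by
    have e1 : ((spq : (Fin n → M) → SP n M) ⁻¹' (Set.image spq U)) = ⋃ e : Equiv.Perm (Fin n), (fun y : Fin n → M => fun s => y (e s)) ⁻¹' U := by
      ext y
      simp only [Set.mem_preimage, Set.mem_image, Set.mem_iUnion]
      constructor
      · rintro ⟨z, hz, h⟩
        obtain ⟨e, he⟩ := spq_eq h.symm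
        exact ⟨e, by convert hz using 1; funext s; exact (he s).symm⟩
      · rintro ⟨e, he⟩
        exact ⟨_, he, spq_perm y e⟩
    rw [e1]
    exact isOpen_iUnion fun e => hU.preimage (by fun_prop)
  exact this
end spqs

section gap
variable {M : Type*} [TopologicalSpace M] {K : Type*} [Fintype K] [DecidableEq K] {n : ℕ}

def slice (L : Finset (Fin n × K)) (s : Fin n) : Finset K := Finset.univ.filter fun q => (s, q) ∈ L

lemma mem_slice {L : Finset (Fin n × K)} {s : Fin n} {q : K} : q ∈ slice L s ↔ (s, q) ∈ L := by simp [slice]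

def good (L : Finset (Fin n × K)) : Prop := ∀ s, (slice L s).Nonempty

lemma card_slice (L : Finset (Fin n × K)) : L.card = ∑ s, (slice L s).card := by
  rw [Finset.card_eq_sum_card_fiberwise (f := Prod.fst) (t := Finset.univ) (fun _ _ => Finset.mem_coe.2 (Finset.mem_univ _))]
  refine Finset.sum_congr rfl fun s _ => ?_
  symm
  refine Finset.card_bij (fun q _ => (s, q)) (fun q hq => ?_) (fun a _ b _ h => (Prod.ext_iff.1 h).2) (fun b hb => ?_)
  · simp only [Finset.mem_filter]; exact ⟨mem_slice.1 hq, trivial⟩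
  · simp only [Finset.mem_filter] at hb
    exact ⟨b.2, mem_slice.2 (by rw [← hb.2]; exact hb.1), by rw [← hb.2]⟩

open Classical in
def ugap (F : K → M → ℝ) (L : Finset (Fin n × K)) (y : Fin n → M) : ℝ :=
  if good L then (∏ i : Fin n × K, if i ∈ L then F i.2 (y i.1) else 1) *
    ∏ i : Fin n × K, ∏ j : Fin n × K, if i ∈ L ∧ j ∉ L then max 0 (F i.2 (y i.1) - F j.2 (y j.1)) else 1
  else 0

structure CD (F : K → M → ℝ) (d : ℕ) : Prop where
  cont : ∀ q, Continuous (F q)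
  nn : ∀ q x, 0 ≤ F q x
  le : ∀ q x, F q x ≤ 1
  cov : ∀ x, ∃ q, F q x = 1
  dim : ∀ x (T : Finset K), (∀ q ∈ T, 0 < F q x) → T.card ≤ d + 1

variable {F : K → M → ℝ} {d : ℕ}

namespace CD
lemma ug_cont (C : CD F d) (L : Finset (Fin n × K)) : Continuous (ugap F L) := by
  unfold ugap
  by_cases h : good L
  · simp only [h, if_true]
    have hc : ∀ i : Fin n × K, Continuous fun y : Fin n → M => F i.2 (y i.1) := fun i => (C.cont i.2).comp (continuous_apply _)
    refine Continuous.mul (continuous_finsetProd _ fun i _ => ?_) (continuous_finsetProd _ fun i _ => continuous_finsetProd _ fun j _ => ?_)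
    · split_ifs
      · exact hc i
      · exact continuous_const
    · split_ifs
      · exact continuous_const.max ((hc i).sub (hc j))
      · exact continuous_const
  · simp only [h, if_false]; exact continuous_const

lemma ug_nn (C : CD F d) (L : Finset (Fin n × K)) (y : Fin n → M) : 0 ≤ ugap F L y := by
  unfold ugap
  split_ifs
  · refine mul_nonneg (Finset.prod_nonneg fun i _ => ?_) (Finset.prod_nonneg fun i _ => Finset.prod_nonneg fun j _ => ?_)
    · split_ifs
      · exact C.nn _ _
      · exact zero_le_one
    · split_ifs
      · exact le_max_left _ _
      · exact zero_le_one
  · exact le_rfl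

lemma ug_pos (C : CD F d) {L : Finset (Fin n × K)} {y : Fin n → M} : 0 < ugap F L y ↔
    good L ∧ (∀ s q, (s, q) ∈ L → 0 < F q (y s)) ∧ ∀ i ∈ L, ∀ j ∉ L, F j.2 (y j.1) < F i.2 (y i.1) := by
  constructor
  · intro h
    by_cases hg : good L
    · unfold ugap at h
      rw [if_pos hg] at h
      have h0 := h.ne'
      rw [mul_ne_zero_iff, Finset.prod_ne_zero_iff, Finset.prod_ne_zero_iff] at h0
      refine ⟨hg, fun s q hi => ?_, fun i hi j hj => ?_⟩
      · have := h0.1 (s, q) (Finset.mem_univ _)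
        rw [if_pos hi] at this
        exact lt_of_le_of_ne (C.nn _ _) this.symm
      · have := h0.2 i (Finset.mem_univ _)
        rw [Finset.prod_ne_zero_iff] at this
        have := this j (Finset.mem_univ _)
        rw [if_pos ⟨hi, hj⟩] at this
        by_contra hc
        exact this (max_eq_left (by linarith))
    · unfold ugap at h; rw [if_neg hg] at h; exact absurd h (lt_irrefl _)
  · rintro ⟨hg, h1, h2⟩
    unfold ugap
    rw [if_pos hg]
    refine mul_pos (Finset.prod_pos fun i _ => ?_) (Finset.prod_pos fun i _ => Finset.prod_pos fun j _ => ?_)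
    · split_ifs with h
      · exact h1 _ _ h
      · exact zero_lt_one
    · split_ifs with h
      · exact lt_max_of_lt_right (by linarith [h2 i h.1 j h.2])
      · exact zero_lt_one

lemma comp (C : CD F d) {L L' : Finset (Fin n × K)} {y : Fin n → M} (h : 0 < ugap F L y) (h' : 0 < ugap F L' y) : L ⊆ L' ∨ L' ⊆ L := by
  by_contra hc
  push Not at hc
  obtain ⟨i, hi, hi'⟩ := Finset.not_subset.1 hc.1
  obtain ⟨j, hj, hj'⟩ := Finset.not_subset.1 hc.2
  have := (C.ug_pos.1 h).2.2 i hi j hj'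
  have := (C.ug_pos.1 h').2.2 j hj i hi'
  linarith

lemma exists_pos (C : CD F d) (y : Fin n → M) : ∃ L : Finset (Fin n × K), 0 < ugap F L y := by
  classical
  refine ⟨Finset.univ.filter fun i => F i.2 (y i.1) = 1, C.ug_pos.2 ⟨fun s => ?_, fun s q h => ?_, fun i hi j hj => ?_⟩⟩
  · obtain ⟨q, hq⟩ := C.cov (y s)
    exact ⟨q, mem_slice.2 (by simp [hq])⟩
  · simp at h; rw [h]; exact zero_lt_one
  · simp at hi hj
    rw [hi]; exact lt_of_le_of_ne (C.le _ _) hj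

lemma card_le (C : CD F d) {L : Finset (Fin n × K)} {y : Fin n → M} (h : 0 < ugap F L y) : n ≤ L.card ∧ L.card ≤ (d + 1) * n := by
  have h1 := C.ug_pos.1 h
  rw [card_slice]
  constructor
  · calc n = ∑ s : Fin n, 1 := by simp
      _ ≤ _ := Finset.sum_le_sum fun s _ => Finset.card_pos.2 (h1.1 s)
  · calc _ ≤ ∑ s : Fin n, (d + 1) := Finset.sum_le_sum fun s _ => C.dim (y s) _ fun q hq => h1.2.1 _ _ (mem_slice.1 hq)
      _ = _ := by simp [mul_comm]
end CD

def pL (e : Equiv.Perm (Fin n)) : Finset (Fin n × K) ≃ Finset (Fin n × K) :=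
  (Equiv.prodCongr e.symm (Equiv.refl K)).finsetCongr

lemma mem_pL {e : Equiv.Perm (Fin n)} {L : Finset (Fin n × K)} {s : Fin n} {q : K} : (s, q) ∈ pL e L ↔ (e s, q) ∈ L := by
  simp [pL, Equiv.finsetCongr_apply, Finset.mem_map_equiv]

lemma slice_pL (e : Equiv.Perm (Fin n)) (L : Finset (Fin n × K)) (s : Fin n) : slice (pL e L) s = slice L (e s) := by
  ext q; rw [mem_slice, mem_pL, mem_slice]

lemma card_pL (e : Equiv.Perm (Fin n)) (L : Finset (Fin n × K)) : (pL e L).card = L.card := by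
  simp [pL, Equiv.finsetCongr_apply]

lemma good_pL {e : Equiv.Perm (Fin n)} {L : Finset (Fin n × K)} : good (pL e L) ↔ good L := by
  unfold good
  constructor
  · intro h s
    have := h (e.symm s)
    rwa [slice_pL, Equiv.apply_symm_apply] at this
  · intro h s
    rw [slice_pL]; exact h _

lemma ug_pL (F : K → M → ℝ) {y y' : Fin n → M} {e : Equiv.Perm (Fin n)} (h : ∀ s, y' s = y (e s)) (L : Finset (Fin n × K)) :
    ugap F (pL e L) y' = ugap F L y := by
  unfold ugap
  rw [show good (pL e L) = good L from propext good_pL]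
  have e1 : ∀ f : Fin n × K → ℝ, ∏ i : Fin n × K, f (e i.1, i.2) = ∏ i, f i := fun f =>
    Equiv.prod_comp (Equiv.prodCongr e (Equiv.refl K)) f
  congr 1
  congr 1
  · refine Eq.trans ?_ (e1 _)
    refine Finset.prod_congr rfl fun i _ => ?_
    rcases i with ⟨s, q⟩
    simp only [mem_pL, h]
  · refine Eq.trans ?_ (e1 _)
    refine Finset.prod_congr rfl fun i _ => ?_
    refine Eq.trans ?_ (e1 _)
    refine Finset.prod_congr rfl fun j _ => ?_
    rcases i with ⟨s, q⟩
    rcases j with ⟨s2, q2⟩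
    simp only [mem_pL, h]

variable [Nonempty K]
def rp (L : Finset (Fin n × K)) (s : Fin n) : K := Classical.epsilon fun q => q ∈ slice L s

lemma rp_mem {L : Finset (Fin n × K)} (h : good L) (s : Fin n) : (s, rp L s) ∈ L :=
  mem_slice.1 (Classical.epsilon_spec (h s))

lemma rp_pL (e : Equiv.Perm (Fin n)) (L : Finset (Fin n × K)) (s : Fin n) : rp (pL e L) s = rp L (e s) := by
  unfold rp; rw [slice_pL]

lemma fam_cont {Z : Type*} [TopologicalSpace Z] {S : Set Z} {a : Fin n → Z → M} (h : ∀ s, ContinuousOn (a s) S) :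
    ContinuousOn (fun z => spq fun s => a s z) S :=
  spq_cont.comp_continuousOn (continuousOn_pi.2 h)

theorem U1 (C : CD F d) (b : M) (p : K → M → ℝ → M)
    (pc : ∀ q, ContinuousOn (fun z : M × ℝ => p q z.1 z.2) ({x | 0 < F q x} ×ˢ Set.univ))
    (p0 : ∀ q x, 0 < F q x → p q x 0 = x) (p1 : ∀ q x, 0 < F q x → p q x 1 = b) :
    NW (spq fun _ : Fin n => b) (d * n) := by
  refine GD.nw (q := spq) (Λ := Finset (Fin n × K)) (u := ugap F) (wt := fun L => 2 * (L.card - n))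
    (K := fun L y t => spq fun s => p (rp L s) (y s) t) (G := fun _ _ _ _ _ => spq fun _ => b) ?_
  have hrp : ∀ {L : Finset (Fin n × K)} {y : Fin n → M}, 0 < ugap F L y → ∀ s, 0 < F (rp L s) (y s) := fun h s =>
    (C.ug_pos.1 h).2.1 _ _ (rp_mem (C.ug_pos.1 h).1 s)
  refine ⟨spq_open, C.ug_cont, C.ug_nn, fun y => ?_, fun L L' y h h' hw => ?_, fun L => ?_, fun L y h => ?_, fun L y h => ?_,
    fun L L' h h' => by omega, fun L L' h h' => by omega, fun L L' h h' => by omega, fun L L' h h' => by omega, fun L L' h h' => by omega,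
    fun y y' h => ?_⟩
  · obtain ⟨L, hL⟩ := C.exists_pos y
    refine ⟨L, hL, ?_⟩
    have := C.card_le hL
    have e : (d + 1) * n = d * n + n := by ring
    omega
  · have h1 := C.card_le h
    have h2 := C.card_le h'
    rcases C.comp h h' with hs | hs
    · exact Finset.eq_of_subset_of_card_le hs (by omega)
    · exact (Finset.eq_of_subset_of_card_le hs (by omega)).symm
  · refine fam_cont fun s => ?_
    refine (pc (rp L s)).comp (f := fun z : (Fin n → M) × ℝ => (z.1 s, z.2)) (by fun_prop) ?_
    rintro ⟨y, t⟩ ⟨h, -⟩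
    exact ⟨hrp h s, trivial⟩
  · show spq _ = spq _
    congr 1; funext s; exact p0 _ _ (hrp h s)
  · show spq _ = spq _
    congr 1; funext s; exact p1 _ _ (hrp h s)
  · obtain ⟨e, he⟩ := spq_eq h
    refine ⟨pL e, fun L => by simp only [card_pL], fun L => ug_pL F he L, fun L _ t => ?_, fun L L' _ _ _ _ _ _ => rfl⟩
    simp only [rp_pL, he]
    exact spq_perm (fun s => p (rp L s) (y s) t) e
end gap
end

section

section twist
variable {M : Type*} [TopologicalSpace M] {K : Type*} [Fintype K] [DecidableEq K] [Nonempty K] {n : ℕ}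
  {E : Type*} [Fintype E]

def SLs (l : K → M → E → ℝ) (L : Finset (Fin n × K)) (y : Fin n → M) (e : E) : ℝ := ∑ s, l (rp L s) (y s) e

def DLs (F : K → M → ℝ) (L : Finset (Fin n × K)) (y : Fin n → M) : Prop := ∀ s q, (s, q) ∈ L → 0 < F q (y s)

def wEs (F : K → M → ℝ) (l : K → M → E → ℝ) (L : Finset (Fin n × K)) (e : E) : Prop :=
  ∀ y, DLs F L y → ∀ z : ℤ, SLs l L y e ≠ z

open Classical in
def aLs (F : K → M → ℝ) (l : K → M → E → ℝ) (L : Finset (Fin n × K)) (y : Fin n → M) (e : E) : ℤ :=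
  if wEs F l L e then ⌊SLs l L y e⌋ else round (SLs l L y e)

open Classical in
def wts (F : K → M → ℝ) (l : K → M → E → ℝ) (L : Finset (Fin n × K)) : ℕ :=
  (L.card - n) + (Finset.univ.filter fun e => wEs F l L e).card

def GamP {X A : Type*} [TopologicalSpace X] (Lm : A → ℝ → X) (x0 : X) (c : ℝ → X) (a a' : A) (Γ : ℝ → ℝ → X) : Prop :=
  Continuous (fun p : ℝ × ℝ => Γ p.1 p.2) ∧ (∀ h, Γ h 0 = c h) ∧ (∀ h, Γ h 1 = x0) ∧ (∀ t, Γ 0 t = Lm a t) ∧ ∀ t, Γ 1 t = Lm a' t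

open Classical in
def Gam {X A : Type*} [TopologicalSpace X] (Lm : A → ℝ → X) (x0 : X) (c : ℝ → X) (a a' : A) : ℝ → ℝ → X :=
  if h : ∃ Γ, GamP Lm x0 c a a' Γ then h.choose else fun _ _ => x0

structure UD (F : K → M → ℝ) (n : ℕ) (b : M) (p : K → M → ℝ → M) (l : K → M → E → ℝ) (Sq : K → K → M → ℝ → ℝ → M)
    (Lm : (E → ℤ) → ℝ → SP n M) : Prop where
  C : CD F 2
  pc : ∀ q, ContinuousOn (fun z : M × ℝ => p q z.1 z.2) ({x | 0 < F q x} ×ˢ Set.univ)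
  p0 : ∀ q x, 0 < F q x → p q x 0 = x
  p1 : ∀ q x, 0 < F q x → p q x 1 = b
  lc : ∀ q e, ContinuousOn (fun x => l q x e) {x | 0 < F q x}
  li : ∀ q q' x, 0 < F q x → 0 < F q' x → ∀ e, ∃ z : ℤ, l q' x e - l q x e = z
  lo : ∀ q x y, 0 < F q x → 0 < F q y → ∀ e, |l q x e - l q y e| * (2 * n) < 1
  sc : ∀ q q', ContinuousOn (fun z : M × ℝ × ℝ => Sq q q' z.1 z.2.1 z.2.2) ({x | 0 < F q x ∧ 0 < F q' x} ×ˢ Set.univ)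
  sl : ∀ q q' x, 0 < F q x → 0 < F q' x → ∀ t, Sq q q' x 0 t = p q x t
  sr : ∀ q q' x, 0 < F q x → 0 < F q' x → ∀ t, Sq q q' x 1 t = p q' x t
  s0 : ∀ q q' x, 0 < F q x → 0 < F q' x → ∀ h, Sq q q' x h 0 = x
  ss : ∀ q x, 0 < F q x → ∀ h t, Sq q q x h t = p q x t
  s1 : ∀ q q' x, 0 < F q x → 0 < F q' x → ∀ᶠ x' in 𝓝 x, ∀ h, Sq q q' x' h 1 = Sq q q' x h 1
  lmc : ∀ a, Continuous (Lm a)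
  lm0 : ∀ a, Lm a 0 = spq fun _ => b
  lm1 : ∀ a, Lm a 1 = spq fun _ => b
  gam : ∀ q q' x, 0 < F q x → 0 < F q' x → ∀ a a' : E → ℤ, (∀ e, (a' e : ℝ) - a e = l q' x e - l q x e) → ∀ s : Fin n,
    ∃ Γ, GamP Lm (spq fun _ => b) (fun h => spq (Function.update (fun _ => b) s (Sq q q' x h 1))) a a' Γ

variable {F : K → M → ℝ} {b : M} {p : K → M → ℝ → M} {l : K → M → E → ℝ} {Sq : K → K → M → ℝ → ℝ → M}
    {Lm : (E → ℤ) → ℝ → SP n M}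

namespace UD
lemma dl (U : UD F n b p l Sq Lm) {L : Finset (Fin n × K)} {y : Fin n → M} (h : 0 < ugap F L y) : DLs F L y := (U.C.ug_pos.1 h).2.1
lemma gd (U : UD F n b p l Sq Lm) {L : Finset (Fin n × K)} {y : Fin n → M} (h : 0 < ugap F L y) : good L := (U.C.ug_pos.1 h).1

lemma stn (U : UD F n b p l Sq Lm) {q : K} {x : M} (h : 0 < F q x) : {x | 0 < F q x} ∈ 𝓝 x :=
  (isOpen_lt continuous_const (U.C.cont q)).mem_nhds h

lemma S_cont (U : UD F n b p l Sq Lm) {L : Finset (Fin n × K)} (hL : good L) {y : Fin n → M} (h : DLs F L y) (e : E) :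
    ContinuousAt (fun y => SLs l L y e) y := by
  unfold SLs
  refine tendsto_finsetSum _ fun s _ => ?_
  have h1 := (U.lc (rp L s) e).continuousAt (U.stn (h s _ (rp_mem hL s)))
  exact ContinuousAt.comp (f := fun y : Fin n → M => y s) (x := y) h1 (continuous_apply s).continuousAt

lemma S_int (U : UD F n b p l Sq Lm) {L L' : Finset (Fin n × K)} (hL : good L) (hs : L ⊆ L') {y : Fin n → M}
    (h : DLs F L' y) (hL' : good L') (e : E) : ∃ z : ℤ, SLs l L' y e = SLs l L y e + z := by
  have h1 : ∀ s, ∃ z : ℤ, l (rp L' s) (y s) e - l (rp L s) (y s) e = z := fun s =>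
    U.li _ _ _ (h s _ (hs (rp_mem hL s))) (h s _ (rp_mem hL' s)) e
  choose z hz using h1
  refine ⟨∑ s, z s, ?_⟩
  push_cast
  simp only [SLs, ← hz, Finset.sum_sub_distrib]
  ring

lemma w_mono (U : UD F n b p l Sq Lm) {L L' : Finset (Fin n × K)} (hL : good L) (hL' : good L') (hs : L ⊆ L') {e : E}
    (h : wEs F l L e) : wEs F l L' e := by
  intro y hy z hz
  obtain ⟨w, hw⟩ := U.S_int hL hs hy hL' e
  refine h y (fun s q hq => hy s q (hs hq)) (z - w) ?_
  push_cast
  linarith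

open Classical in
lemma wt_mono (U : UD F n b p l Sq Lm) {L L' : Finset (Fin n × K)} (hL : good L) (hL' : good L') (hs : L ⊆ L') :
    L.card ≤ L'.card ∧ (Finset.univ.filter fun e => wEs F l L e) ⊆ (Finset.univ.filter fun e => wEs F l L' e) := by
  classical
  refine ⟨Finset.card_le_card hs, fun e he => ?_⟩
  simp only [Finset.mem_filter, Finset.mem_univ, true_and] at *
  exact U.w_mono hL hL' hs he

lemma S_osc (U : UD F n b p l Sq Lm) (hn : 1 ≤ n) {L : Finset (Fin n × K)} (hL : good L) {y y' : Fin n → M} (h : DLs F L y) (h' : DLs F L y') (e : E) :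
    |SLs l L y e - SLs l L y' e| < 1 / 2 := by
  unfold SLs
  rw [← Finset.sum_sub_distrib]
  haveI : Nonempty (Fin n) := ⟨⟨0, hn⟩⟩
  have hn' : (0 : ℝ) < n := by exact_mod_cast hn
  calc |∑ s, (l (rp L s) (y s) e - l (rp L s) (y' s) e)| ≤ ∑ s, |l (rp L s) (y s) e - l (rp L s) (y' s) e| := Finset.abs_sum_le_sum_abs _ _
    _ < ∑ s : Fin n, 1 / (2 * (n : ℝ)) := by
        refine Finset.sum_lt_sum_of_nonempty Finset.univ_nonempty fun s _ => ?_
        rw [lt_div_iff₀ (by positivity)]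
        exact U.lo _ _ _ (h s _ (rp_mem hL s)) (h' s _ (rp_mem hL s)) e
    _ = 1 / 2 := by simp; field_simp

lemma D_ev (U : UD F n b p l Sq Lm) {L : Finset (Fin n × K)} {y : Fin n → M} (h : DLs F L y) : ∀ᶠ y' in 𝓝 y, DLs F L y' := by
  unfold DLs
  rw [Filter.eventually_all]
  intro s
  rw [Filter.eventually_all]
  intro q
  by_cases hq : (s, q) ∈ L
  · have := Filter.Tendsto.eventually ((continuous_apply s).continuousAt : ContinuousAt (fun y : Fin n → M => y s) y) (U.stn (h s q hq))
    filter_upwards [this] with y' hy' _ using hy'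
  · exact Filter.Eventually.of_forall fun y' hh => absurd hh hq

lemma a_loc (U : UD F n b p l Sq Lm) (hn : 1 ≤ n) {L : Finset (Fin n × K)} (hL : good L) {y : Fin n → M} (h : DLs F L y) :
    ∀ᶠ y' in 𝓝 y, aLs F l L y' = aLs F l L y := by
  simp only [funext_iff]
  rw [Filter.eventually_all]
  intro e
  by_cases hw : wEs F l L e
  · have h1 := hw y h
    have h2 : (⌊SLs l L y e⌋ : ℝ) < SLs l L y e := lt_of_le_of_ne (Int.floor_le _) (h1 _).symm
    have h3 := Int.lt_floor_add_one (SLs l L y e)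
    have hc := U.S_cont hL h e
    filter_upwards [hc.eventually (lt_mem_nhds h2), hc.eventually (gt_mem_nhds h3)] with y' a1 a2
    simp only [aLs, hw, if_true]
    rw [Int.floor_eq_iff]
    exact ⟨a1.le, a2⟩
  · have hw0 := hw
    unfold wEs at hw
    push Not at hw
    obtain ⟨y0, hy0, z, hz⟩ := hw
    have hr : ∀ y', DLs F L y' → round (SLs l L y' e) = z := by
      intro y' hy'
      have := U.S_osc hn hL hy' hy0 e
      rw [abs_lt, hz] at this
      rw [round_eq, Int.floor_eq_iff]
      constructor <;> linarith [this.1, this.2]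
    filter_upwards [U.D_ev h] with y' hy'
    simp only [aLs, hw0, if_false]
    rw [hr _ hy', hr _ h]

lemma odd (U : UD F n b p l Sq Lm) {L L' : Finset (Fin n × K)} {y : Fin n → M} (h : 0 < ugap F L y) (h' : 0 < ugap F L' y)
    (hw : wts F l L' = wts F l L + 1) : L ⊆ L' ∧ (∀ e, wEs F l L e ↔ wEs F l L' e) ∧
      ∃ s, ∀ s', s' ≠ s → rp L s' = rp L' s' := by
  classical
  have c1 := U.C.card_le h
  have c2 := U.C.card_le h'
  unfold wts at hw
  have hs : L ⊆ L' := by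
    rcases U.C.comp h h' with hs | hs
    · exact hs
    · have := U.wt_mono (U.gd h') (U.gd h) hs
      have h3 := Finset.card_le_card this.2
      have h4 := this.1
      exfalso
      omega
  have m1 := U.wt_mono (U.gd h) (U.gd h') hs
  have m2 := Finset.card_le_card m1.2
  have hne : L.card ≠ L'.card := by
    intro hc
    have := Finset.eq_of_subset_of_card_le hs hc.ge
    subst this
    omega
  have m3 := m1.1
  have hcard : L'.card = L.card + 1 := by omega
  have hweq := Finset.eq_of_subset_of_card_le m1.2 (by omega)
  refine ⟨hs, fun e => ?_, ?_⟩
  · have := Finset.ext_iff.1 hweq e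
    simpa using this
  · have h5 : (L' \ L).card = 1 := by rw [Finset.card_sdiff_of_subset hs]; omega
    obtain ⟨⟨s, q⟩, hq⟩ := Finset.card_eq_one.1 h5
    refine ⟨s, fun s' hs' => ?_⟩
    have : slice L s' = slice L' s' := by
      ext q'
      rw [mem_slice, mem_slice]
      refine ⟨fun hh => hs hh, fun hh => ?_⟩
      by_contra hc
      have : (s', q') ∈ L' \ L := Finset.mem_sdiff.2 ⟨hh, hc⟩
      rw [hq, Finset.mem_singleton] at this
      exact hs' (Prod.ext_iff.1 this).1
    unfold rp; rw [this]

lemma gam_spec (U : UD F n b p l Sq Lm) {L L' : Finset (Fin n × K)} {y : Fin n → M} (h : 0 < ugap F L y) (h' : 0 < ugap F L' y)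
    (hw : wts F l L' = wts F l L + 1) :
    GamP Lm (spq fun _ => b) (fun h => spq fun s => Sq (rp L s) (rp L' s) (y s) h 1) (aLs F l L y) (aLs F l L' y)
      (Gam Lm (spq fun _ => b) (fun h => spq fun s => Sq (rp L s) (rp L' s) (y s) h 1) (aLs F l L y) (aLs F l L' y)) := by
  obtain ⟨hs, hwe, s, hr⟩ := U.odd h h' hw
  have hD := U.dl h
  have hD' := U.dl h'
  have hF : ∀ s, 0 < F (rp L s) (y s) := fun s => hD s _ (rp_mem (U.gd h) s)
  have hF' : ∀ s, 0 < F (rp L' s) (y s) := fun s => hD' s _ (rp_mem (U.gd h') s)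
  have hc : (fun h => spq fun s => Sq (rp L s) (rp L' s) (y s) h 1 : ℝ → SP n M) =
      fun h => spq (Function.update (fun _ => b) s (Sq (rp L s) (rp L' s) (y s) h 1)) := by
    funext h
    congr 1
    funext s'
    by_cases hs' : s' = s
    · subst hs'; simp
    · rw [Function.update_of_ne hs', ← hr s' hs', U.ss _ _ (hF s'), U.p1 _ _ (hF s')]
  have hS : ∀ e, SLs l L' y e - SLs l L y e = l (rp L' s) (y s) e - l (rp L s) (y s) e := by
    intro e
    unfold SLs
    rw [← Finset.sum_sub_distrib]
    refine Finset.sum_eq_single s (fun s' _ hs' => ?_) (fun hh => absurd (Finset.mem_univ _) hh)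
    rw [hr s' hs', sub_self]
  have ha : ∀ e, (aLs F l L' y e : ℝ) - aLs F l L y e = l (rp L' s) (y s) e - l (rp L s) (y s) e := by
    intro e
    obtain ⟨z, hz⟩ := U.li _ _ _ (hF s) (hF' s) e
    have h1 : SLs l L' y e = SLs l L y e + z := by linarith [hS e]
    have h2 : aLs F l L' y e = aLs F l L y e + z := by
      unfold aLs
      rw [show wEs F l L' e = wEs F l L e from propext (hwe e).symm, h1]
      split_ifs
      · exact Int.floor_add_intCast _ _
      · exact round_add_intCast _ _
    rw [h2, hz]; push_cast; ring
  have hex := U.gam _ _ _ (hF s) (hF' s) _ _ ha s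
  rw [← hc] at hex
  unfold Gam
  rw [dif_pos hex]
  exact hex.choose_spec

lemma a_cont (U : UD F n b p l Sq Lm) (hn : 1 ≤ n) (L : Finset (Fin n × K)) :
    ContinuousOn (fun z : (Fin n → M) × ℝ => Lm (aLs F l L z.1) z.2) ({y | 0 < ugap F L y} ×ˢ Set.univ) := by
  rintro ⟨y, t⟩ ⟨h, -⟩
  apply ContinuousAt.continuousWithinAt
  have h1 := Filter.Tendsto.eventually (continuousAt_fst : ContinuousAt Prod.fst (y, t)) (U.a_loc hn (U.gd h) (U.dl h))
  refine ContinuousAt.congr (f := fun z : (Fin n → M) × ℝ => Lm (aLs F l L y) z.2)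
    ((U.lmc _).comp continuous_snd).continuousAt ?_
  filter_upwards [h1] with z hz
  rw [hz]

lemma pL_S (e : Equiv.Perm (Fin n)) (L : Finset (Fin n × K)) {y y' : Fin n → M} (he : ∀ s, y' s = y (e s)) (i : E) :
    SLs l (pL e L) y' i = SLs l L y i := by
  unfold SLs
  simp only [rp_pL, he]
  exact Equiv.sum_comp e fun s => l (rp L s) (y s) i

lemma pL_D (e : Equiv.Perm (Fin n)) (L : Finset (Fin n × K)) {y y' : Fin n → M} (he : ∀ s, y' s = y (e s)) :
    DLs F (pL e L) y' ↔ DLs F L y := by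
  unfold DLs
  simp only [mem_pL, he]
  constructor
  · intro h s q hq
    have := h (e.symm s) q
    rw [Equiv.apply_symm_apply] at this
    exact this hq
  · intro h s q hq
    exact h _ _ hq

lemma pL_w (e : Equiv.Perm (Fin n)) (L : Finset (Fin n × K)) (i : E) : wEs F l (pL e L) i = wEs F l L i := by
  apply propext
  unfold wEs
  constructor
  · intro h y hy
    have := h (fun s => y (e s)) ((pL_D e L (y := y) fun s => rfl).2 hy)
    rwa [pL_S e L (y := y) fun s => rfl] at this
  · intro h y hy
    have he : ∀ s, y s = (fun s => y (e.symm s)) (e s) := fun s => by simp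
    have := h (fun s => y (e.symm s)) ((pL_D e L he).1 hy)
    rwa [← pL_S e L he] at this

lemma pL_a (e : Equiv.Perm (Fin n)) (L : Finset (Fin n × K)) {y y' : Fin n → M} (he : ∀ s, y' s = y (e s)) :
    aLs F l (pL e L) y' = aLs F l L y := by
  funext i
  unfold aLs
  rw [pL_w, pL_S e L he]

theorem nw (U : UD F n b p l Sq Lm) (hn : 1 ≤ n) {m : ℕ} (hm : 2 * n + Fintype.card E ≤ 2 * m + 1) : NW (spq fun _ : Fin n => b) m := by
  classical
  refine GD.nw (q := spq) (Λ := Finset (Fin n × K)) (u := ugap F) (wt := wts F l)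
    (K := fun L y t => if t ≤ 1 / 2 then spq fun s => p (rp L s) (y s) (2 * t) else Lm (aLs F l L y) (2 * t - 1))
    (G := fun L L' y h t => if t ≤ 1 / 2 then spq fun s => Sq (rp L s) (rp L' s) (y s) h (2 * t) else
      Gam Lm (spq fun _ => b) (fun h => spq fun s => Sq (rp L s) (rp L' s) (y s) h 1) (aLs F l L y) (aLs F l L' y) h (2 * t - 1)) ?_
  have hF : ∀ {L : Finset (Fin n × K)} {y : Fin n → M}, 0 < ugap F L y → ∀ s, 0 < F (rp L s) (y s) := fun h s =>
    U.dl h s _ (rp_mem (U.gd h) s)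
  refine ⟨spq_open, U.C.ug_cont, U.C.ug_nn, fun y => ?_, fun L L' y h h' hw => ?_, fun L => ?_, fun L y h => ?_, fun L y h => ?_,
    fun L L' _ hw => ?_, fun L L' _ hw y h h' r => ?_, fun L L' _ hw y h h' r => ?_, fun L L' _ hw y h h' t => ?_, fun L L' _ hw y h h' t => ?_,
    fun y y' h => ?_⟩
  · obtain ⟨L, hL⟩ := U.C.exists_pos y
    refine ⟨L, hL, ?_⟩
    have h1 := U.C.card_le hL
    have h2 : (Finset.univ.filter fun e => wEs F l L e).card ≤ Fintype.card E := Finset.card_le_univ _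
    unfold wts
    omega
  · have c1 := U.C.card_le h
    have c2 := U.C.card_le h'
    unfold wts at hw
    rcases U.C.comp h h' with hs | hs
    · have h1 := U.wt_mono (U.gd h) (U.gd h') hs
      have h2 := Finset.card_le_card h1.2
      have h3 := h1.1
      exact Finset.eq_of_subset_of_card_le hs (by omega)
    · have h1 := U.wt_mono (U.gd h') (U.gd h) hs
      have h2 := Finset.card_le_card h1.2
      have h3 := h1.1
      exact (Finset.eq_of_subset_of_card_le hs (by omega)).symm
  · refine cont_trans (A := fun y t => spq fun s => p (rp L s) (y s) t) (B := fun y t => Lm (aLs F l L y) t) ?_ (U.a_cont hn L) ?_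
    · refine fam_cont fun s => ?_
      refine (U.pc (rp L s)).comp (f := fun z : (Fin n → M) × ℝ => (z.1 s, z.2)) (by fun_prop) ?_
      rintro ⟨y, t⟩ ⟨h, -⟩
      exact ⟨hF h s, trivial⟩
    · intro y h
      simp only [U.lm0]
      congr 1; funext s; exact U.p1 _ _ (hF h s)
  · norm_num
    congr 1; funext s; exact U.p0 _ _ (hF h s)
  · norm_num [U.lm1]
  · have hk := cont_trans (Z := (Fin n → M) × ℝ) (S := {y | 0 < ugap F L y ∧ 0 < ugap F L' y} ×ˢ Set.univ)
      (A := fun z t => spq fun s => Sq (rp L s) (rp L' s) (z.1 s) z.2 t)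
      (B := fun z t => Gam Lm (spq fun _ => b) (fun h => spq fun s => Sq (rp L s) (rp L' s) (z.1 s) h 1) (aLs F l L z.1) (aLs F l L' z.1) z.2 t) ?_ ?_ ?_
    · refine hk.comp (f := fun z : (Fin n → M) × ℝ × ℝ => ((z.1, z.2.1), z.2.2)) (by fun_prop) ?_
      rintro ⟨y, h, t⟩ ⟨hh, -⟩
      exact ⟨⟨hh, trivial⟩, trivial⟩
    · refine fam_cont fun s => ?_
      refine (U.sc (rp L s) (rp L' s)).comp (f := fun z : ((Fin n → M) × ℝ) × ℝ => (z.1.1 s, z.1.2, z.2)) (by fun_prop) ?_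
      rintro ⟨⟨y, r⟩, t⟩ ⟨⟨h, -⟩, -⟩
      exact ⟨⟨hF h.1 s, hF h.2 s⟩, trivial⟩
    · rintro ⟨⟨y, r⟩, t⟩ ⟨⟨⟨h, h'⟩, -⟩, -⟩
      apply ContinuousAt.continuousWithinAt
      have hsp := U.gam_spec h h' hw
      have e1 : ∀ᶠ y' in 𝓝 y, ∀ s, ∀ r, Sq (rp L s) (rp L' s) (y' s) r 1 = Sq (rp L s) (rp L' s) (y s) r 1 := by
        rw [Filter.eventually_all]
        intro s
        exact Filter.Tendsto.eventually ((continuous_apply s).continuousAt : ContinuousAt (fun y : Fin n → M => y s) y) (U.s1 _ _ _ (hF h s) (hF h' s))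
      have e2 := (e1.and (U.a_loc hn (U.gd h) (U.dl h))).and (U.a_loc hn (U.gd h') (U.dl h'))
      have hf : ContinuousAt (fun z : ((Fin n → M) × ℝ) × ℝ => z.1.1) ((y, r), t) := by fun_prop
      refine ContinuousAt.congr (f := fun z : ((Fin n → M) × ℝ) × ℝ => Gam Lm (spq fun _ => b) (fun h => spq fun s => Sq (rp L s) (rp L' s) (y s) h 1) (aLs F l L y) (aLs F l L' y) z.1.2 z.2) (hsp.1.comp (by fun_prop : Continuous fun z : ((Fin n → M) × ℝ) × ℝ => (z.1.2, z.2))).continuousAt ?_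
      filter_upwards [hf.eventually e2] with z hz
      simp only [hz.1.1, hz.1.2, hz.2]
    · rintro ⟨y, r⟩ ⟨⟨h, h'⟩, -⟩
      exact ((U.gam_spec h h' hw).2.1 r).symm
  · norm_num
    congr 1; funext s; exact U.s0 _ _ _ (hF h s) (hF h' s) _
  · norm_num
    exact (U.gam_spec h h' hw).2.2.1 r
  · have := (U.gam_spec h h' hw).2.2.2.1
    simp only [this, U.sl _ _ _ (hF h _) (hF h' _)]
  · have := (U.gam_spec h h' hw).2.2.2.2
    simp only [this, U.sr _ _ _ (hF h _) (hF h' _)]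
  · obtain ⟨e, he⟩ := spq_eq h
    refine ⟨pL e, fun L => by simp only [wts, card_pL, pL_w], fun L => ug_pL F he L, fun L _ t => ?_, fun L L' _ _ _ _ r t => ?_⟩
    · simp only [rp_pL, he, pL_a e L he]
      rw [spq_perm (fun s => p (rp L s) (y s) (2 * t)) e]
    · simp only [rp_pL, he, pL_a e _ he]
      rw [spq_perm (fun s => Sq (rp L s) (rp L' s) (y s) r (2 * t)) e,
        funext fun r => spq_perm (fun s => Sq (rp L s) (rp L' s) (y s) r 1) e]
end UD
end twist
end

section

section gammaSec
variable {X : Type*} [TopologicalSpace X] {x0 : X}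

def gBC (c L : Path x0 x0) (h t : ℝ) : X :=
  if 2 * t - 1 + cl (3 * h - 2) * (1 - t) ≤ 0 then c.extend (max (cl (3 * h - 1)) (cl (2 * t)))
  else L.extend (2 * t - 1 + cl (3 * h - 2) * (1 - t))

lemma cl_nn (x : ℝ) : 0 ≤ cl x := le_max_left _ _
lemma cl_l1 (x : ℝ) : cl x ≤ 1 := max_le zero_le_one (min_le_right _ _)

lemma gBC_cont (c L : Path x0 x0) : Continuous (fun p : ℝ × ℝ => gBC c L p.1 p.2) := by
  unfold gBC
  have hcl := cl_cont
  have h1 : Continuous fun p : ℝ × ℝ => cl (3 * p.1 - 2) := hcl.comp (by fun_prop)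
  have h2 : Continuous fun p : ℝ × ℝ => cl (3 * p.1 - 1) := hcl.comp (by fun_prop)
  have h3 : Continuous fun p : ℝ × ℝ => cl (2 * p.2) := hcl.comp (by fun_prop)
  refine Continuous.if_le ?_ ?_ (by fun_prop) continuous_const ?_
  · exact c.continuous_extend.comp (h2.max h3)
  · exact L.continuous_extend.comp (by fun_prop)
  · rintro ⟨h, t⟩ he
    simp only at he ⊢
    rw [he, L.extend_zero]
    rcases (cl_nn (3 * h - 2)).eq_or_lt with h0 | h0
    · rw [← h0] at he
      have : cl (2 * t) = 1 := cl_ge1 (by linarith)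
      rw [this, max_eq_right (cl_l1 _), c.extend_one]
    · have : 2 / 3 < h := by
        by_contra hc
        rw [cl_le0 (by linarith)] at h0
        exact lt_irrefl _ h0
      rw [cl_ge1 (by linarith : (1 : ℝ) ≤ 3 * h - 1), max_eq_left (cl_l1 _), c.extend_one]

lemma cl_mem (x : ℝ) : cl x ∈ I := ⟨cl_nn x, cl_l1 x⟩

def clI (x : ℝ) : I := ⟨cl x, cl_mem x⟩
lemma clI_le0 {x : ℝ} (h : x ≤ 0) : clI x = 0 := Subtype.ext (cl_le0 h)
lemma clI_ge1 {x : ℝ} (h : 1 ≤ x) : clI x = 1 := Subtype.ext (cl_ge1 h)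
lemma clI_cont : Continuous clI := Continuous.subtype_mk cl_cont _
lemma clI_val (x : ℝ) : (clI x : ℝ) = cl x := rfl

lemma ext_cl (c : Path x0 x0) (t : ℝ) : c.extend (cl t) = c.extend t := by
  rcases le_total t 0 with h | h
  · rw [cl_le0 h, c.extend_of_le_zero h, c.extend_zero]
  · rcases le_total t 1 with h1 | h1
    · rw [cl_mid h h1]
    · rw [cl_ge1 h1, c.extend_of_one_le h1, c.extend_one]

lemma gam_ex (La c L : Path x0 x0) (H : Path.Homotopic La (c.trans L)) :
    ∃ Γ : ℝ → ℝ → X, Continuous (fun p : ℝ × ℝ => Γ p.1 p.2) ∧ (∀ h, Γ h 0 = c.extend (cl (3 * h - 1))) ∧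
      (∀ h, Γ h 1 = x0) ∧ (∀ t, Γ 0 t = La.extend (cl t)) ∧ ∀ t, Γ 1 t = L.extend (cl t) := by
  obtain ⟨H⟩ := H
  refine ⟨fun h t => if h ≤ 1 / 3 then H (clI (3 * h), clI t) else gBC c L h (cl t), ?_, ?_, ?_, ?_, ?_⟩
  · have hcl := cl_cont
    refine Continuous.if_le ?_ ?_ (by fun_prop) continuous_const ?_
    · refine H.continuous.comp ?_
      exact Continuous.prodMk (clI_cont.comp (by fun_prop)) (clI_cont.comp (by fun_prop))
    · exact (gBC_cont c L).comp (Continuous.prodMk (by fun_prop) (hcl.comp (by fun_prop)))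
    · rintro ⟨h, t⟩ he
      simp only at he ⊢
      subst he
      rw [clI_ge1 (by norm_num : (1:ℝ) ≤ 3 * (1 / 3)), H.apply_one]
      show (c.trans L) _ = _
      rw [Path.trans_apply]
      unfold gBC
      rw [cl_le0 (by norm_num : 3 * (1 / 3 : ℝ) - 2 ≤ 0), cl_le0 (by norm_num : 3 * (1 / 3 : ℝ) - 1 ≤ 0)]
      have ht := cl_mem t
      split_ifs with h2 h3 h3
      · simp only [clI_val] at h2
        rw [cl_mid (x := 2 * cl t) (by linarith [ht.1]) (by linarith), max_eq_right (by linarith [ht.1])]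
        rw [Path.extend_apply _ (t := 2 * cl t) ⟨by linarith [ht.1], by linarith⟩]
        rfl
      · simp only [clI_val] at h2; linarith
      · simp only [clI_val] at h2; linarith
      · simp only [clI_val] at h2
        rw [Path.extend_apply _ (t := 2 * cl t - 1 + 0 * (1 - cl t)) ⟨by linarith, by linarith [ht.2]⟩]
        congr 1
        apply Subtype.ext
        simp [clI_val]
  · intro h
    simp only
    rw [clI_le0 (le_refl 0), cl_le0 (le_refl 0)]
    split_ifs with h1
    · rw [cl_le0 (by linarith : 3 * h - 1 ≤ 0), c.extend_zero]
      exact Path.Homotopy.source _ _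
    · unfold gBC
      rw [if_pos (by have := cl_l1 (3 * h - 2); linarith), cl_le0 (by norm_num : (2 : ℝ) * 0 ≤ 0), max_eq_left (cl_nn _)]
  · intro h
    simp only
    rw [clI_ge1 (le_refl 1), cl_ge1 (le_refl 1)]
    split_ifs with h1
    · exact Path.Homotopy.target _ _
    · unfold gBC
      rw [if_neg (by norm_num)]
      exact L.extend_of_one_le (by norm_num)
  · intro t
    simp only
    rw [if_pos (by norm_num)]
    rw [clI_le0 (by norm_num : (3:ℝ) * 0 ≤ 0), H.apply_zero, Path.extend_apply _ (cl_mem t)]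
    rfl
  · intro t
    simp only
    rw [if_neg (by norm_num)]
    unfold gBC
    have ht := cl_mem t
    rw [cl_ge1 (by norm_num : (1 : ℝ) ≤ 3 * 1 - 2), cl_ge1 (by norm_num : (1 : ℝ) ≤ 3 * 1 - 1), max_eq_left (cl_l1 _), c.extend_one]
    have : 2 * cl t - 1 + 1 * (1 - cl t) = cl t := by ring
    rw [this]
    split_ifs with h
    · rw [L.extend_of_le_zero h]
    · rfl

lemma comm_loops {M : Type*} [TopologicalSpace M] {b : M} (μ : M × M → X) (hμ : Continuous μ) (hb : μ (b, b) = x0)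
    (p q : Path b b) (P Q : Path x0 x0) (hP : ∀ t, P t = μ (p t, b)) (hP' : ∀ t, P t = μ (b, p t))
    (hQ : ∀ t, Q t = μ (q t, b)) (hQ' : ∀ t, Q t = μ (b, q t)) : Path.Homotopic (P.trans Q) (Q.trans P) := by
  refine ⟨{ toFun := fun z => μ (p.extend (2 * z.2 - z.1), q.extend (2 * z.2 - 1 + z.1)), continuous_toFun := ?_, map_zero_left := ?_, map_one_left := ?_, prop' := ?_ }⟩
  · exact hμ.comp ((p.continuous_extend.comp (by fun_prop)).prodMk (q.continuous_extend.comp (by fun_prop)))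
  · intro t
    show μ (p.extend (2 * t - (0 : ℝ)), q.extend (2 * t - 1 + (0:ℝ))) = (P.trans Q) t
    rw [Path.trans_apply]
    split_ifs with h
    · rw [hP, q.extend_of_le_zero (by linarith), Path.extend_apply _ (t := 2 * t - (0 : ℝ)) ⟨by linarith [t.2.1], by linarith⟩]
      simp
    · push Not at h
      rw [hQ', p.extend_of_one_le (by linarith), Path.extend_apply _ (t := 2 * t - 1 + (0 : ℝ)) ⟨by linarith [t.2.1], by linarith [t.2.2]⟩]
      simp
  · intro t
    show μ (p.extend (2 * t - (1 : ℝ)), q.extend (2 * t - 1 + (1:ℝ))) = (Q.trans P) t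
    rw [Path.trans_apply]
    split_ifs with h
    · rw [hQ', p.extend_of_le_zero (by linarith), Path.extend_apply _ (t := 2 * t - 1 + (1 : ℝ)) ⟨by linarith [t.2.1], by linarith⟩]
      simp
    · push Not at h
      rw [hP, q.extend_of_one_le (by linarith), Path.extend_apply _ (t := 2 * t - (1 : ℝ)) ⟨by linarith [t.2.1], by linarith [t.2.2]⟩]
  · intro s t ht
    simp only [Set.mem_insert_iff, Set.mem_singleton_iff] at ht
    rcases ht with rfl | rfl
    · show μ (p.extend (2 * (0:ℝ) - s), q.extend (2 * (0:ℝ) - 1 + s)) = (P.trans Q) 0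
      rw [p.extend_of_le_zero (by linarith [s.2.1]), q.extend_of_le_zero (by linarith [s.2.2]), hb]
      simp
    · show μ (p.extend (2 * (1:ℝ) - s), q.extend (2 * (1:ℝ) - 1 + s)) = (P.trans Q) 1
      rw [p.extend_of_one_le (by linarith [s.2.2]), q.extend_of_one_le (by linarith [s.2.1]), hb]
      simp

lemma Xi_ex {G : Type*} [Group G] {ι : Type*} [Fintype ι] [DecidableEq ι] (E : ι → G) (h : ∀ i j, E i * E j = E j * E i) :
    ∃ Ξ : (ι → ℤ) → G, (∀ a b, Ξ (a + b) = Ξ a * Ξ b) ∧ ∀ i, Ξ (Pi.single i 1) = E i := by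
  have hc : Pairwise fun i j => ∀ (x y : Multiplicative ℤ), Commute (zpowersHom G (E i) x) (zpowersHom G (E j) y) := by
    intro i j _ x y
    simp only [zpowersHom_apply]
    exact Commute.zpow_zpow (h i j) _ _
  let f := MonoidHom.noncommPiCoprod (fun i => zpowersHom G (E i)) hc
  refine ⟨fun a => f (fun i => Multiplicative.ofAdd (a i)), fun a b => ?_, fun i => ?_⟩
  · rw [← map_mul]; rfl
  · have : (fun j => Multiplicative.ofAdd ((Pi.single i 1 : ι → ℤ) j)) = Pi.mulSingle i (Multiplicative.ofAdd (1 : ℤ)) := by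
      funext j
      by_cases hj : j = i
      · subst hj; simp
      · simp [hj]
    show f _ = _
    rw [this, MonoidHom.noncommPiCoprod_mulSingle]
    simp
end gammaSec

section mainSec
open Classical in
def kl {X : Type*} [TopologicalSpace X] {x0 : X} (p : Path x0 x0) : FundamentalGroup X x0 := Path.Homotopic.Quotient.mk p

lemma kl_trans {X : Type*} [TopologicalSpace X] {x0 : X} (p q : Path x0 x0) : kl (p.trans q) = kl q * kl p := rfl
lemma kl_symm {X : Type*} [TopologicalSpace X] {x0 : X} (p : Path x0 x0) : kl p.symm = (kl p)⁻¹ := rfl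
lemma kl_eq {X : Type*} [TopologicalSpace X] {x0 : X} {p q : Path x0 x0} : kl p = kl q ↔ Path.Homotopic p q :=
  ⟨fun h => Path.Homotopic.Quotient.exact h, fun h => Path.Homotopic.Quotient.eq.2 h⟩
lemma kl_surj {X : Type*} [TopologicalSpace X] {x0 : X} (a : FundamentalGroup X x0) : ∃ p : Path x0 x0, kl p = a :=
  Path.Homotopic.Quotient.mk_surjective a

instance : ContractibleSpace Disc := by
  have h : Convex ℝ {z : ℂ | ‖z‖ ≤ 1} := by
    intro x hx y hy a c ha hc hac
    simp only [Set.mem_setOf_eq] at *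
    calc ‖a • x + c • y‖ ≤ ‖a • x‖ + ‖c • y‖ := norm_add_le _ _
      _ = a * ‖x‖ + c * ‖y‖ := by rw [norm_smul, norm_smul, Real.norm_of_nonneg ha, Real.norm_of_nonneg hc]
      _ ≤ a * 1 + c * 1 := by gcongr
      _ = 1 := by linarith
  exact h.contractibleSpace ⟨0, by simp⟩

variable {X M : Type*} [TopologicalSpace X] [TopologicalSpace M]

def lpD {P : Disc → M} (hP : Continuous P) {b : M} {u v : Disc} (γ : Path u v) (hu : P u = b) (hv : P v = b) : Path b b :=
  (γ.map hP).cast hu.symm hv.symm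

def cls {P : Disc → M} (hP : Continuous P) {ι : M → X} (hι : Continuous ι) {b : M} {u v : Disc} (γ : Path u v) (hu : P u = b) (hv : P v = b) :
    FundamentalGroup X (ι b) := kl ((lpD hP γ hu hv).map hι)

lemma cls_congr {P : Disc → M} (hP : Continuous P) {ι : M → X} (hι : Continuous ι) {b : M} {u v : Disc} (γ γ' : Path u v) (hu : P u = b) (hv : P v = b) :
    cls hP hι γ hu hv = cls hP hι γ' hu hv := by
  unfold cls
  rw [kl_eq]
  refine Path.Homotopic.map (f := ⟨ι, hι⟩) ?_
  have h := SimplyConnectedSpace.paths_homotopic γ γ'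
  have h2 := h.map ⟨P, hP⟩
  exact h2.pathCast _ _

lemma cls_trans {P : Disc → M} (hP : Continuous P) {ι : M → X} (hι : Continuous ι) {b : M} {u v w : Disc} (γ : Path u v) (γ' : Path v w)
    (hu : P u = b) (hv : P v = b) (hw : P w = b) :
    cls hP hι (γ.trans γ') hu hw = cls hP hι γ' hv hw * cls hP hι γ hu hv := by
  unfold cls
  rw [← kl_trans, ← Path.map_trans]
  congr 2
  ext t
  simp only [lpD, Path.cast_coe, Path.map_coe, Function.comp, Path.trans_apply]
  split_ifs <;> rfl

def nodeD (x : ℝ) : Disc := ⟨ex x, by rw [ex_norm]⟩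
lemma nodeD_cont : Continuous nodeD := Continuous.subtype_mk ex_cont _

def arcD (N i : ℕ) : Path (nodeD (i / N)) (nodeD ((i + 1 : ℕ) / N)) where
  toFun t := nodeD ((i + t) / N)
  continuous_toFun := nodeD_cont.comp (by fun_prop)
  source' := by simp
  target' := by simp


def wv (g i : ℕ) : Fin g × Fin 2 → ℤ := fun x => if i = 4 * x.1.1 + x.2.1 then 1 else if i = 4 * x.1.1 + x.2.1 + 2 then -1 else 0

lemma pw_step (c i : ℕ) : pw c ((i + 1 : ℕ) : ℝ) - pw c i = ((if i = c then 1 else if i = c + 2 then -1 else 0 : ℤ) : ℝ) := by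
  rcases lt_trichotomy i c with h | h | h
  · have h1 : ((i + 1 : ℕ) : ℝ) ≤ c := by exact_mod_cast h
    have h2 : (i : ℝ) ≤ c := by exact_mod_cast h.le
    rw [pw_le h1, pw_le h2, if_neg (by omega), if_neg (by omega)]; simp
  · subst h
    rw [if_pos rfl, pw_le le_rfl, pw_up (by push_cast; linarith) (by push_cast; linarith)]
    push_cast; ring
  · rw [if_neg (by omega)]
    have h1 : (c : ℝ) + 1 ≤ i := by exact_mod_cast h
    by_cases h2 : i = c + 2
    · rw [if_pos h2]
      subst h2
      rw [pw_ge (by push_cast; linarith), pw_one (by push_cast; linarith) (by push_cast; linarith)]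
      norm_num
    · rw [if_neg h2]
      by_cases h3 : i = c + 1
      · subst h3
        rw [pw_one (by push_cast; linarith) (by push_cast; linarith), pw_one (by push_cast; linarith) (by push_cast; linarith)]
        norm_num
      · have h4 : (c : ℝ) + 3 ≤ i := by exact_mod_cast (show c + 3 ≤ i by omega)
        rw [pw_ge (by push_cast; linarith), pw_ge h4]; simp

lemma pw_vv (g i : ℕ) (x : Fin g × Fin 2) : pw (4 * x.1.1 + x.2.1) (i : ℝ) = ((∑ j ∈ Finset.range i, wv g j) x : ℤ) := by
  induction i with
  | zero => rw [pw_le (by push_cast; positivity)]; simp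
  | succ i ih =>
      rw [Finset.sum_range_succ, Pi.add_apply, Int.cast_add, ← ih, wv, ← pw_step]; ring

theorem main16 (g : ℕ) {P : Disc → M} (hP : Continuous P) {b : M} (hb : ∀ i : ℕ, i ≤ 4 * g → P (nodeD (i / (4 * g : ℕ))) = b)
    (harc : ∀ i : ℕ, i < 4 * g → i % 4 < 2 → ∀ t : I, P (nodeD ((i + t) / (4 * g : ℕ))) = P (nodeD (((i + 2 : ℕ) + (1 - t)) / (4 * g : ℕ))))
    {ι : M → X} (hι : Continuous ι) (μ : M × M → X) (hμ : Continuous μ) (hμ1 : ∀ m, μ (m, b) = ι m) (hμ2 : ∀ m, μ (b, m) = ι m)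
    {x0 : X} (h0 : ι b = x0) :
    ∃ Lm : (Fin g × Fin 2 → ℤ) → ℝ → X, (∀ a, Continuous (Lm a)) ∧ (∀ a, Lm a 0 = x0) ∧ (∀ a, Lm a 1 = x0) ∧
      ∀ (δ : ℝ → Disc) (hδ : Continuous δ) (i j : ℕ) (hi : i ≤ 4 * g) (hj : j ≤ 4 * g) (hδi : δ 0 = nodeD (i / (4 * g : ℕ)))
        (hδj : δ 1 = nodeD (j / (4 * g : ℕ))) (a a' : Fin g × Fin 2 → ℤ),
        (∀ x, (a' x : ℝ) - a x = pw (4 * x.1.1 + x.2.1) i - pw (4 * x.1.1 + x.2.1) j) →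
        ∃ Γ, GamP Lm x0 (fun h => ι (P (δ (cl (3 * h - 1))))) a a' Γ := by
  subst h0
  have hE : ∀ x : Fin g × Fin 2, 4 * x.1.1 + x.2.1 + 3 ≤ 4 * g ∧ (4 * x.1.1 + x.2.1) % 4 < 2 := by
    rintro ⟨k, r⟩
    have := k.2; have := r.2
    constructor <;> simp only <;> omega
  let A : (i : ℕ) → i + 1 ≤ 4 * g → FundamentalGroup X (ι b) := fun i hi =>
    cls hP hι (arcD (4 * g) i) (hb i (by omega)) (hb (i + 1) hi)
  have hcom : ∀ i hi j hj, A i hi * A j hj = A j hj * A i hi := by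
    intro i hi j hj
    refine (kl_eq.2 (comm_loops μ hμ (hμ1 b) (lpD hP (arcD (4 * g) i) (hb i (by omega)) (hb (i + 1) hi)) (lpD hP (arcD (4 * g) j) (hb j (by omega)) (hb (j + 1) hj))
      _ _ ?_ ?_ ?_ ?_)).symm
    · intro t; rw [hμ1]; rfl
    · intro t; rw [hμ2]; rfl
    · intro t; rw [hμ1]; rfl
    · intro t; rw [hμ2]; rfl
  obtain ⟨Ξ, hadd, hsing⟩ := Xi_ex (fun x : Fin g × Fin 2 => A (4 * x.1.1 + x.2.1) (by have := (hE x).1; omega)) (fun i j => hcom _ (by have := (hE i).1; omega) _ (by have := (hE j).1; omega))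
  have hz : Ξ 0 = 1 := by
    have := hadd 0 0
    rw [add_zero] at this
    exact left_eq_mul.1 this
  have hneg : ∀ a, Ξ (-a) = (Ξ a)⁻¹ := fun a => by
    rw [eq_inv_iff_mul_eq_one, ← hadd, neg_add_cancel, hz]
  have hinv : ∀ i (hi : i + 1 ≤ 4 * g) (hi2 : i + 2 + 1 ≤ 4 * g), i % 4 < 2 → A (i + 2) hi2 = (A i hi)⁻¹ := by
    intro i hi hi2 hm
    show kl _ = (kl _)⁻¹
    rw [← kl_symm]
    congr 1
    ext t
    show ι (P (nodeD (((i + 2 : ℕ) + t) / (4 * g : ℕ)))) = ι (P (nodeD ((i + (unitInterval.symm t : I)) / (4 * g : ℕ))))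
    rw [harc i (by omega) hm]
    simp
  have hA : ∀ i hi, A i hi = Ξ (wv g i) := by
    intro i hi
    by_cases hm : i % 4 < 2
    · let x : Fin g × Fin 2 := (⟨i / 4, by omega⟩, ⟨i % 4, hm⟩)
      have hx : 4 * x.1.1 + x.2.1 = i := Nat.div_add_mod i 4
      have h1 : wv g i = Pi.single x 1 := by
        funext y
        by_cases hy : y = x
        · subst hy; rw [Pi.single_eq_same]; unfold wv; rw [if_pos hx.symm]
        · rw [Pi.single_eq_of_ne hy]
          unfold wv
          have := y.2.2
          rw [if_neg, if_neg (by omega)]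
          intro h
          apply hy
          ext
          · show y.1.1 = i / 4; omega
          · show y.2.1 = i % 4; omega
      rw [h1, hsing]
      have key : ∀ j (hj : j + 1 ≤ 4 * g), j = i → A j hj = A i hi := by
        intro j hj e; subst e; rfl
      exact (key _ (by omega) hx).symm
    · let x : Fin g × Fin 2 := (⟨i / 4, by omega⟩, ⟨i % 4 - 2, by omega⟩)
      have hx : 4 * x.1.1 + x.2.1 + 2 = i := by show 4 * (i / 4) + (i % 4 - 2) + 2 = i; omega
      have h1 : wv g i = -Pi.single x 1 := by
        funext y
        by_cases hy : y = x
        · subst hy; rw [Pi.neg_apply, Pi.single_eq_same]; unfold wv; rw [if_neg (by omega), if_pos hx.symm]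
        · rw [Pi.neg_apply, Pi.single_eq_of_ne hy]
          unfold wv
          have := y.2.2
          rw [if_neg (by omega), if_neg]
          · rfl
          intro h
          apply hy
          ext
          · show y.1.1 = i / 4; omega
          · show y.2.1 = i % 4 - 2; omega
      rw [h1, hneg, hsing]
      have key : ∀ j (hj : j + 1 ≤ 4 * g), j = i → A j hj = A i hi := by
        intro j hj e; subst e; rfl
      rw [← hinv (4 * x.1.1 + x.2.1) (by omega) (by omega) (hE x).2]
      exact (key _ (by omega) hx).symm
  have hψ : ∀ i (hi : i ≤ 4 * g) (γ : Path (nodeD ((0 : ℕ) / (4 * g : ℕ))) (nodeD (i / (4 * g : ℕ)))),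
      cls hP hι γ (hb 0 (by omega)) (hb i hi) = Ξ (∑ j ∈ Finset.range i, wv g j) := by
    intro i
    induction i with
    | zero =>
        intro hi γ
        rw [cls_congr hP hι γ (Path.refl _)]
        simp only [Finset.range_zero, Finset.sum_empty, hz]
        show kl _ = kl (Path.refl _)
        congr 1
        ext t
        show ι (P (nodeD _)) = ι b
        rw [hb 0 (by omega)]
    | succ i ih =>
        intro hi γ
        have γ' : Path (nodeD ((0 : ℕ) / (4 * g : ℕ))) (nodeD (i / (4 * g : ℕ))) := PathConnectedSpace.somePath _ _
        rw [cls_congr hP hι γ (γ'.trans (arcD (4 * g) i)), cls_trans hP hι γ' (arcD (4 * g) i) _ (hb i (by omega)) _, ih (by omega) γ', Finset.sum_range_succ, add_comm (∑ x ∈ Finset.range i, wv g x), hadd, ← hA i hi]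
  have hγ : ∀ i (hi : i ≤ 4 * g) j (hj : j ≤ 4 * g) (γ : Path (nodeD (i / (4 * g : ℕ))) (nodeD (j / (4 * g : ℕ)))),
      cls hP hι γ (hb i hi) (hb j hj) = Ξ (∑ j ∈ Finset.range j, wv g j - ∑ j ∈ Finset.range i, wv g j) := by
    intro i hi j hj γ
    have γ' : Path (nodeD ((0 : ℕ) / (4 * g : ℕ))) (nodeD (i / (4 * g : ℕ))) := PathConnectedSpace.somePath _ _
    have h1 := hψ j hj (γ'.trans γ)
    rw [cls_trans hP hι γ' γ _ (hb i hi) _, hψ i hi γ'] at h1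
    rw [sub_eq_add_neg, hadd, ← h1, hneg]
    group
  choose Lp hLp using fun a => kl_surj (Ξ a)
  refine ⟨fun a t => (Lp a).extend (cl t), fun a => (Lp a).continuous_extend.comp cl_cont, fun a => ?_, fun a => ?_, ?_⟩
  · simp only; rw [ext_cl, Path.extend_zero]
  · simp only; rw [ext_cl, Path.extend_one]
  · intro δ hδ i j hi hj hδi hδj a a' ha
    let γ : Path (nodeD (i / (4 * g : ℕ))) (nodeD (j / (4 * g : ℕ))) :=
      { toFun := fun t => δ t, continuous_toFun := hδ.comp continuous_subtype_val, source' := by simpa using hδi, target' := by simpa using hδj }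
    have h1 : Path.Homotopic (Lp a) (((lpD hP γ (hb i hi) (hb j hj)).map hι).trans (Lp a')) := by
      rw [← kl_eq, kl_trans, hLp, hLp]
      have h2 := hγ i hi j hj γ
      unfold cls at h2
      rw [h2, ← hadd]
      congr 1
      funext x
      have h3 := ha x
      rw [pw_vv, pw_vv] at h3
      have h4 : a' x - a x = (∑ j ∈ Finset.range i, wv g j) x - (∑ j ∈ Finset.range j, wv g j) x := by exact_mod_cast h3
      simp only [Pi.add_apply, Pi.sub_apply]
      linarith
    obtain ⟨Γ, G1, G2, G3, G4, G5⟩ := gam_ex _ _ _ h1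
    refine ⟨Γ, G1, fun h => ?_, G3, G4, G5⟩
    rw [G2, Path.extend_apply _ (cl_mem _)]
    rfl

end mainSec
end

section

abbrev QQ : Type := I × I
def PP (g : ℕ) (z : QQ) : Mg g := prj g (polar z)
def yy (g : ℕ) (z : QQ) : ℝ := 4 * g * z.2

lemma PP_cont (g : ℕ) : Continuous (PP g) := (prj_cont g).comp polar_cont
lemma PP_surj (g : ℕ) : Function.Surjective (PP g) := (prj_surj g).comp polar_surj
lemma yy_cont (g : ℕ) : Continuous (yy g) := by unfold yy; fun_prop
lemma yy_mem (g : ℕ) (z : QQ) : 0 ≤ yy g z ∧ yy g z ≤ 4 * g := by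
  unfold yy
  have := z.2.2.1; have := z.2.2.2
  constructor
  · positivity
  · nlinarith [(Nat.cast_nonneg g : (0:ℝ) ≤ g)]

lemma PP_quot (g : ℕ) : Topology.IsQuotientMap (PP (g + 1)) :=
  (isQuotientMap_quot_mk (r := orientRel (g + 1))).comp polar_quot

def ReQ (g : ℕ) (z w : QQ) : Prop :=
  (z.1 = 0 ∧ w.1 = 0) ∨ (z.1 = w.1 ∧ z.2 = 0 ∧ w.2 = 1) ∨
  (z.1 = 1 ∧ w.1 = 1 ∧ ∃ e : ℕ, e % 4 < 2 ∧ e + 3 ≤ 4 * g ∧ (e : ℝ) ≤ yy g z ∧ yy g z ≤ e + 1 ∧ yy g w = 2 * e + 3 - yy g z)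

lemma polar_eq (g : ℕ) {z w : QQ} (h : polar z = polar w) : Relation.EqvGen (ReQ g) z w := by
  have h1 : ((z.1 : ℝ) : ℂ) * ex z.2 = ((w.1 : ℝ) : ℂ) * ex w.2 := congrArg Subtype.val h
  have h2 : (z.1 : ℝ) = w.1 := by
    have := congrArg norm h1
    rwa [norm_mul, norm_mul, ex_norm, ex_norm, Complex.norm_real, Complex.norm_real, mul_one, mul_one, Real.norm_of_nonneg z.1.2.1, Real.norm_of_nonneg w.1.2.1] at this
  have h3 : z.1 = w.1 := Subtype.ext h2
  by_cases h0 : (z.1 : ℝ) = 0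
  · exact Relation.EqvGen.rel _ _ (Or.inl ⟨Subtype.ext h0, Subtype.ext (h2 ▸ h0)⟩)
  · rw [h2] at h1 h0
    have h4 := mul_left_cancel₀ (Complex.ofReal_ne_zero.2 h0) h1
    obtain ⟨m, hm⟩ := (ex_eq_iff _ _).1 h4
    have a1 := z.2.2.1; have a2 := z.2.2.2; have a3 := w.2.2.1; have a4 := w.2.2.2
    have b1 : -1 ≤ m := by have : (-1 : ℝ) ≤ m := by linarith
                           exact_mod_cast this
    have b2 : m ≤ 1 := by have : (m : ℝ) ≤ 1 := by linarith
                          exact_mod_cast this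
    have b3 : m = -1 ∨ m = 0 ∨ m = 1 := by omega
    rcases b3 with rfl | rfl | rfl
    · push_cast at hm
      refine Relation.EqvGen.rel _ _ (Or.inr (Or.inl ⟨h3, Subtype.ext ?_, Subtype.ext ?_⟩))
      · show (z.2 : ℝ) = 0; linarith
      · show (w.2 : ℝ) = 1; linarith
    · have : z = w := Prod.ext h3 (Subtype.ext (by push_cast at hm; linarith))
      rw [this]; exact Relation.EqvGen.refl _
    · push_cast at hm
      refine Relation.EqvGen.symm _ _ (Relation.EqvGen.rel _ _ (Or.inr (Or.inl ⟨h3.symm, Subtype.ext ?_, Subtype.ext ?_⟩)))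
      · show (w.2 : ℝ) = 0; linarith
      · show (z.2 : ℝ) = 1; linarith

lemma PP_eqv {g : ℕ} (hg : 1 ≤ g) {z w : QQ} (h : PP g z = PP g w) : Relation.EqvGen (ReQ g) z w := by
  obtain ⟨g, rfl⟩ : ∃ g', g = g' + 1 := ⟨g - 1, by omega⟩
  have h1 : Relation.EqvGen (orientRel (g + 1)) (polar z) (polar w) := Quot.eqvGen_exact h
  have key : ∀ u v, Relation.EqvGen (orientRel (g + 1)) u v → ∀ z w, polar z = u → polar w = v → Relation.EqvGen (ReQ (g + 1)) z w := by
    intro u v huv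
    induction huv with
    | rel u v huv =>
        intro z w hz hw
        obtain ⟨j, r, t, t0, t1, hu, hv⟩ := huv
        rw [polyBP_eq] at hu hv
        have hG : (0 : ℝ) < (4 * (g + 1) : ℕ) := by positivity
        have hj := j.2
        have hr := r.2
        have hjr : ((4 * j.1 + r.1 : ℕ) : ℝ) + 3 ≤ (4 * (g + 1) : ℕ) := by
          exact_mod_cast (show 4 * j.1 + r.1 + 3 ≤ 4 * (g + 1) by omega)
        have hjn : (0 : ℝ) ≤ ((4 * j.1 + r.1 : ℕ) : ℝ) := Nat.cast_nonneg _
        have hjr' : (((4 * j.1 + r.1 + 2 : ℕ) : ℝ)) = ((4 * j.1 + r.1 : ℕ) : ℝ) + 2 := by push_cast; ring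
        rw [hjr'] at hv
        set E : ℝ := ((4 * j.1 + r.1 : ℕ) : ℝ) with hE
        let z0 : QQ := (1, ⟨(E + t) / (4 * (g + 1) : ℕ), by positivity, by rw [div_le_one hG]; linarith⟩)
        let w0 : QQ := (1, ⟨(E + 2 + (1 - t)) / (4 * (g + 1) : ℕ), div_nonneg (by linarith) hG.le, by rw [div_le_one hG]; linarith⟩)
        have e1 : polar z = polar z0 := by
          rw [hz]; apply Subtype.ext
          rw [hu]; simp [polar, z0]
        have e2 : polar w = polar w0 := by
          rw [hw]; apply Subtype.ext
          rw [hv]; simp [polar, w0]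
        have y1 : yy (g + 1) z0 = E + t := by
          show 4 * ((g + 1 : ℕ) : ℝ) * ((E + t) / (4 * (g + 1) : ℕ)) = E + t
          push_cast; field_simp
        have y2 : yy (g + 1) w0 = E + 2 + (1 - t) := by
          show 4 * ((g + 1 : ℕ) : ℝ) * ((E + 2 + (1 - t)) / (4 * (g + 1) : ℕ)) = _
          push_cast; field_simp
        refine (polar_eq _ e1).trans _ _ _ (Relation.EqvGen.trans _ _ _ (Relation.EqvGen.rel _ _ (Or.inr (Or.inr ⟨rfl, rfl, 4 * j.1 + r.1, ?_, ?_, ?_, ?_, ?_⟩))) (polar_eq _ e2.symm))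
        · omega
        · omega
        · rw [y1]; linarith
        · rw [y1]; linarith
        · rw [y1, y2]; linarith
    | refl u => intro z w hz hw; exact polar_eq _ (hz.trans hw.symm)
    | symm u v _ ih => intro z w hz hw; exact (ih w z hw hz).symm
    | trans u v x _ _ ih1 ih2 =>
        intro z w hz hw
        obtain ⟨y, hy⟩ := polar_surj v
        exact (ih1 z y hz hy).trans _ _ _ (ih2 y w hy hw)
  exact key _ _ h1 z w rfl rfl

lemma PP_inv {g : ℕ} (hg : 1 ≤ g) {A : Type*} (S : Set QQ) (f : QQ → A) (hS : ∀ z w, ReQ g z w → (z ∈ S ↔ w ∈ S))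
    (hf : ∀ z w, ReQ g z w → z ∈ S → f z = f w) {z w : QQ} (h : PP g z = PP g w) : (z ∈ S ↔ w ∈ S) ∧ (z ∈ S → f z = f w) := by
  have h1 := PP_eqv hg h
  clear h
  induction h1 with
  | rel u v huv => exact ⟨hS _ _ huv, hf _ _ huv⟩
  | refl u => exact ⟨Iff.rfl, fun _ => rfl⟩
  | symm u v _ ih => exact ⟨ih.1.symm, fun hv => (ih.2 (ih.1.2 hv)).symm⟩
  | trans u v x h1 h2 ih1 ih2 => exact ⟨ih1.1.trans ih2.1, fun hu => (ih1.2 hu).trans (ih2.2 (ih1.1.1 hu))⟩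

def secQ (g : ℕ) : Mg g → QQ := Function.surjInv (PP_surj g)
lemma PP_secQ (g : ℕ) (x : Mg g) : PP g (secQ g x) = x := Function.surjInv_eq _ _

def SatQ (g : ℕ) (S : Set QQ) : Prop := ∀ z w, ReQ g z w → (z ∈ S ↔ w ∈ S)
def InvQ (g : ℕ) {A : Type*} (S : Set QQ) (f : QQ → A) : Prop := ∀ z w, ReQ g z w → z ∈ S → f z = f w
def MS (g : ℕ) (S : Set QQ) : Set (Mg g) := {x | secQ g x ∈ S}

section desc
variable {g : ℕ} (hg : 1 ≤ g) {S : Set QQ} (hS : SatQ g S)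
lemma mem_MS (hg : 1 ≤ g) (hS : SatQ g S) {z : QQ} : PP g z ∈ MS g S ↔ z ∈ S := by
  exact (PP_inv hg S (fun _ => ()) hS (fun _ _ _ _ => rfl) (PP_secQ g (PP g z))).1

lemma sec_inv (hg : 1 ≤ g) (hS : SatQ g S) {A : Type*} {f : QQ → A} (hf : InvQ g S f) {z : QQ} (hz : z ∈ S) :
    f (secQ g (PP g z)) = f z :=
  ((PP_inv hg S f hS hf (PP_secQ g (PP g z)).symm).2 hz).symm

lemma PP_quot' (hg : 1 ≤ g) : Topology.IsQuotientMap (PP g) := by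
  obtain ⟨g, rfl⟩ : ∃ g', g = g' + 1 := ⟨g - 1, by omega⟩
  exact PP_quot g

lemma MS_pre (hg : 1 ≤ g) (hS : SatQ g S) : PP g ⁻¹' (MS g S) = S := Set.ext fun z => mem_MS hg hS

lemma MS_open (hg : 1 ≤ g) (hS : SatQ g S) (ho : IsOpen S) : IsOpen (MS g S) := by
  rw [← (PP_quot' hg).isOpen_preimage, MS_pre hg hS]; exact ho

lemma desc_cont (hg : 1 ≤ g) (hS : SatQ g S) (ho : IsOpen S) {Z W : Type*} [TopologicalSpace Z] [LocallyCompactSpace Z] [TopologicalSpace W]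
    (f : QQ → Z → W) (hc : ContinuousOn (fun p : QQ × Z => f p.1 p.2) (S ×ˢ Set.univ)) (hf : InvQ g S f) :
    ContinuousOn (fun p : Mg g × Z => f (secQ g p.1) p.2) (MS g S ×ˢ Set.univ) := by
  have hq := (PP_quot' hg).restrictPreimage_isOpen (MS_open hg hS ho)
  have hG : Continuous (fun p : MS g S × Z => f (secQ g p.1) p.2) := by
    refine hq.continuous_lift_prod_left ?_
    have : (fun p : (PP g ⁻¹' MS g S) × Z => f (secQ g ((MS g S).restrictPreimage (PP g) p.1).1) p.2) = fun p => f p.1.1 p.2 := by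
      funext p
      have hp : p.1.1 ∈ S := (mem_MS hg hS).1 p.1.2
      exact congrFun (sec_inv hg hS hf hp) p.2
    show Continuous (fun p : (PP g ⁻¹' MS g S) × Z => f (secQ g ((MS g S).restrictPreimage (PP g) p.1).1) p.2)
    rw [this]
    refine hc.comp_continuous (f := fun p : (PP g ⁻¹' MS g S) × Z => ((p.1.1, p.2) : QQ × Z)) (by fun_prop) ?_
    intro p
    refine ⟨?_, trivial⟩
    show p.1.1 ∈ S
    exact (mem_MS hg hS).1 p.1.2
  rintro ⟨x, y⟩ ⟨hx, -⟩
  refine ContinuousAt.continuousWithinAt ?_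
  have he : Topology.IsOpenEmbedding (fun p : MS g S × Z => ((p.1.1, p.2) : Mg g × Z)) :=
    (MS_open hg hS ho).isOpenEmbedding_subtypeVal.prodMap Topology.IsOpenEmbedding.id
  exact (he.continuousAt_iff (x := (⟨x, hx⟩, y)) (g := fun p : Mg g × Z => f (secQ g p.1) p.2)).1 hG.continuousAt

lemma desc_cont1 (hg : 1 ≤ g) (hS : SatQ g S) (ho : IsOpen S) {W : Type*} [TopologicalSpace W]
    (f : QQ → W) (hc : ContinuousOn f S) (hf : InvQ g S f) : ContinuousOn (fun x => f (secQ g x)) (MS g S) := by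
  have h := desc_cont hg hS ho (Z := Unit) (fun z _ => f z) (hc.comp continuous_fst.continuousOn fun p hp => hp.1) (fun z w h hz => by simp only; rw [hf z w h hz])
  exact h.comp (f := fun x : Mg g => (x, ())) (by fun_prop) fun x hx => ⟨hx, trivial⟩

lemma desc_const (hg : 1 ≤ g) (hS : SatQ g S) (ho : IsOpen S) {A : Type*} (f : QQ → A) (hc : ∀ z ∈ S, ∀ᶠ w in 𝓝 z, f w = f z) (hf : InvQ g S f) :
    ∀ x ∈ MS g S, ∀ᶠ x' in 𝓝 x, f (secQ g x') = f (secQ g x) := by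
  intro x hx
  have : IsOpen {x' | x' ∈ MS g S ∧ f (secQ g x') = f (secQ g x)} := by
    rw [← (PP_quot' hg).isOpen_preimage]
    have : PP g ⁻¹' {x' | x' ∈ MS g S ∧ f (secQ g x') = f (secQ g x)} = {z | z ∈ S ∧ f z = f (secQ g x)} := by
      ext z
      show PP g z ∈ MS g S ∧ f (secQ g (PP g z)) = f (secQ g x) ↔ _
      rw [mem_MS hg hS]
      constructor
      · rintro ⟨h1, h2⟩; rw [sec_inv hg hS hf h1] at h2; exact ⟨h1, h2⟩
      · rintro ⟨h1, h2⟩; refine ⟨h1, ?_⟩; rw [sec_inv hg hS hf h1]; exact h2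
    rw [this, isOpen_iff_mem_nhds]
    rintro z ⟨hz, h2⟩
    filter_upwards [ho.mem_nhds hz, hc z hz] with w h3 h4
    exact ⟨h3, h4.trans h2⟩
  filter_upwards [this.mem_nhds ⟨hx, rfl⟩] with x' h using h.2
end desc
end

section

def dp (g : ℕ) (x y : ℝ) : Disc := ⟨(cl x : ℝ) * ex (y / (4 * g)), by
  rw [norm_mul, ex_norm, Complex.norm_real, mul_one, Real.norm_of_nonneg (cl_nn x)]; exact cl_l1 x⟩
lemma dp_cont (g : ℕ) : Continuous (fun p : ℝ × ℝ => dp g p.1 p.2) := by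
  refine Continuous.subtype_mk ?_ _
  have := cl_cont
  have := ex_cont
  refine (Complex.continuous_ofReal.comp (cl_cont.comp continuous_fst)).mul (ex_cont.comp (by fun_prop))

def cv (s : ℝ) (u v : Disc) : Disc := ⟨((1 - cl s : ℝ) : ℂ) * u.1 + (cl s : ℝ) * v.1, by
  have h0 := cl_nn s
  have h1 := cl_l1 s
  calc _ ≤ ‖((1 - cl s : ℝ) : ℂ) * u.1‖ + ‖((cl s : ℝ) : ℂ) * v.1‖ := norm_add_le _ _
    _ = (1 - cl s) * ‖u.1‖ + cl s * ‖v.1‖ := by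
        rw [norm_mul, norm_mul, Complex.norm_real, Complex.norm_real, Real.norm_of_nonneg h0, Real.norm_of_nonneg (by linarith)]
    _ ≤ (1 - cl s) * 1 + cl s * 1 := by
        have := u.2; have := v.2
        have : 0 ≤ 1 - cl s := by linarith
        gcongr
    _ = 1 := by ring⟩
lemma cv_cont : Continuous (fun p : ℝ × Disc × Disc => cv p.1 p.2.1 p.2.2) := by
  refine Continuous.subtype_mk ?_ _
  have h : Continuous fun p : ℝ × Disc × Disc => cl p.1 := cl_cont.comp continuous_fst
  fun_prop
lemma cv_le0 {s : ℝ} (h : s ≤ 0) (u v : Disc) : cv s u v = u := by apply Subtype.ext; simp [cv, cl_le0 h]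
lemma cv_ge1 {s : ℝ} (h : 1 ≤ s) (u v : Disc) : cv s u v = v := by apply Subtype.ext; simp [cv, cl_ge1 h]
lemma cv_self (s : ℝ) (u : Disc) : cv s u u = u := by apply Subtype.ext; simp [cv]; ring

lemma polar_dp {g : ℕ} (hg : 1 ≤ g) (z : QQ) : polar z = dp g z.1 (yy g z) := by
  have : (g : ℝ) ≠ 0 := by positivity
  apply Subtype.ext
  show ((z.1 : ℝ) : ℂ) * ex z.2 = (cl z.1 : ℝ) * ex (yy g z / (4 * g))
  rw [cl_mid z.1.2.1 z.1.2.2, yy]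
  congr 2
  field_simp

lemma dp_one (g : ℕ) {x : ℝ} (hx : 1 ≤ x) (y : ℝ) : dp g x y = nodeD (y / (4 * g)) := by
  apply Subtype.ext; simp [dp, nodeD, cl_ge1 hx]

def mT (g : ℕ) (T : Fin 3) (z : QQ) : ℤ :=
  if T = 0 then 0 else if T = 1 then round (yy g z) else if ⌊yy g z⌋ % 4 < 2 then ⌊yy g z⌋ else ⌊yy g z⌋ + 1

def STy (g : ℕ) (T : Fin 3) : Set QQ :=
  {z | if T = 0 then (z.1 : ℝ) < 1 else (0 : ℝ) < z.1 ∧ if T = 1 then ∃ m : ℤ, |yy g z - m| < 1 / 2 else ∀ m : ℤ, yy g z ≠ m}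

lemma T3c (T : Fin 3) : T = 0 ∨ T = 1 ∨ T = 2 := by fin_cases T <;> simp

lemma STy0 (g : ℕ) (z : QQ) : z ∈ STy g 0 ↔ (z.1 : ℝ) < 1 := by simp [STy]
lemma STy1 (g : ℕ) (z : QQ) : z ∈ STy g 1 ↔ (0 : ℝ) < z.1 ∧ ∃ m : ℤ, |yy g z - m| < 1 / 2 := by simp [STy]
lemma STy2 (g : ℕ) (z : QQ) : z ∈ STy g 2 ↔ (0 : ℝ) < z.1 ∧ ∀ m : ℤ, yy g z ≠ m := by simp [STy]
lemma mT0 (g : ℕ) (z : QQ) : mT g 0 z = 0 := by simp [mT]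
lemma mT1 (g : ℕ) (z : QQ) : mT g 1 z = round (yy g z) := by simp [mT]
lemma mT2 (g : ℕ) (z : QQ) : mT g 2 z = if ⌊yy g z⌋ % 4 < 2 then ⌊yy g z⌋ else ⌊yy g z⌋ + 1 := by
  unfold mT; rw [if_neg (by decide), if_neg (by decide)]

lemma round_eq' {x : ℝ} {m : ℤ} (h : |x - m| < 1 / 2) : round x = m := by
  rw [abs_lt] at h
  rw [round_eq, Int.floor_eq_iff]
  constructor <;> linarith

lemma floor_off {x : ℝ} (h : ∀ m : ℤ, x ≠ m) : (⌊x⌋ : ℝ) < x ∧ x < ⌊x⌋ + 1 :=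
  ⟨lt_of_le_of_ne (Int.floor_le x) (h _).symm, Int.lt_floor_add_one x⟩

lemma mT_loc (g : ℕ) (T : Fin 3) (z : QQ) (hz : z ∈ STy g T) : ∀ᶠ w in 𝓝 z, w ∈ STy g T ∧ mT g T w = mT g T z := by
  have hy : ContinuousAt (yy g) z := (yy_cont g).continuousAt
  have h1 : ContinuousAt (fun z : QQ => (z.1 : ℝ)) z := by fun_prop
  rcases T3c T with rfl | rfl | rfl
  · rw [STy0] at hz
    filter_upwards [h1.eventually (gt_mem_nhds hz)] with w hw
    rw [STy0, mT0, mT0]; exact ⟨hw, rfl⟩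
  · rw [STy1] at hz
    obtain ⟨h0, m, hm⟩ := hz
    have h2 : ContinuousAt (fun z : QQ => |yy g z - m|) z := by fun_prop
    filter_upwards [h1.eventually (lt_mem_nhds h0), h2.eventually (gt_mem_nhds hm)] with w hw hw2
    rw [STy1, mT1, mT1, round_eq' hm, round_eq' hw2]
    exact ⟨⟨hw, m, hw2⟩, rfl⟩
  · rw [STy2] at hz
    obtain ⟨h0, hm⟩ := hz
    obtain ⟨f1, f2⟩ := floor_off hm
    filter_upwards [h1.eventually (lt_mem_nhds h0), hy.eventually (gt_mem_nhds f2), hy.eventually (lt_mem_nhds f1)] with w hw hw1 hw2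
    have : ⌊yy g w⌋ = ⌊yy g z⌋ := Int.floor_eq_iff.2 ⟨hw2.le, hw1⟩
    rw [STy2, mT2, mT2, this]
    refine ⟨⟨hw, fun m' e => ?_⟩, rfl⟩
    rw [e] at hw1 hw2
    have a1 : ⌊yy g z⌋ < m' := by exact_mod_cast hw2
    have a2 : m' < ⌊yy g z⌋ + 1 := by exact_mod_cast hw1
    omega

lemma STy_open (g : ℕ) (T : Fin 3) : IsOpen (STy g T) := by
  rw [isOpen_iff_mem_nhds]
  intro z hz
  filter_upwards [mT_loc g T z hz] with w h using h.1

lemma mT_bd (g : ℕ) (T : Fin 3) (z : QQ) (hz : z ∈ STy g T) : 0 ≤ mT g T z ∧ mT g T z ≤ 4 * g := by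
  have hy := yy_mem g z
  rcases T3c T with rfl | rfl | rfl
  · rw [mT0]; constructor
    · exact le_rfl
    · positivity
  · rw [STy1] at hz
    obtain ⟨h0, m, hm⟩ := hz
    rw [mT1, round_eq' hm]
    rw [abs_lt] at hm
    have a1 : (-1 : ℝ) < m := by linarith
    have a2 : (m : ℝ) < 4 * g + 1 := by linarith
    have a3 : (-1 : ℤ) < m := by exact_mod_cast a1
    have a4 : m < 4 * g + 1 := by exact_mod_cast a2
    omega
  · rw [STy2] at hz
    obtain ⟨f1, f2⟩ := floor_off hz.2
    have a1 : (-1 : ℝ) < ⌊yy g z⌋ := by linarith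
    have a2 : (⌊yy g z⌋ : ℝ) < 4 * g := by linarith
    have a3 : (-1 : ℤ) < ⌊yy g z⌋ := by exact_mod_cast a1
    have a4 : ⌊yy g z⌋ < 4 * g := by exact_mod_cast a2
    rw [mT2]; split_ifs <;> omega

lemma STy_sat (g : ℕ) (T : Fin 3) : SatQ g (STy g T) := by
  intro z w h
  rcases h with ⟨h1, h2⟩ | ⟨h1, h2, h3⟩ | ⟨h1, h2, e, he, he3, hy1, hy2, hy⟩
  · rcases T3c T with rfl | rfl | rfl
    · rw [STy0, STy0, h1, h2]
    · rw [STy1, STy1, h1, h2]; simp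
    · rw [STy2, STy2, h1, h2]; simp
  · have y1 : yy g z = ((0 : ℤ) : ℝ) := by simp [yy, h2]
    have y2 : yy g w = ((4 * g : ℤ) : ℝ) := by simp [yy, h3]
    rcases T3c T with rfl | rfl | rfl
    · rw [STy0, STy0, h1]
    · rw [STy1, STy1, h1, y1, y2]
      refine and_congr_right fun _ => ⟨fun _ => ⟨_, by rw [sub_self]; norm_num⟩, fun _ => ⟨_, by rw [sub_self]; norm_num⟩⟩
    · rw [STy2, STy2, h1, y1, y2]
      refine and_congr_right fun _ => ⟨fun h => (h _ rfl).elim, fun h => (h _ rfl).elim⟩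
  · rcases T3c T with rfl | rfl | rfl
    · rw [STy0, STy0, h1, h2]
    · rw [STy1, STy1, h1, h2, hy]
      refine and_congr_right fun _ => ⟨fun ⟨m, hm⟩ => ⟨2 * e + 3 - m, ?_⟩, fun ⟨m, hm⟩ => ⟨2 * e + 3 - m, ?_⟩⟩
      · rw [← abs_neg]; convert hm using 2; push_cast; ring
      · rw [← abs_neg]; convert hm using 2; push_cast; ring
    · rw [STy2, STy2, h1, h2, hy]
      refine and_congr_right fun _ => ⟨fun h m hm => h (2 * e + 3 - m) (by push_cast; linarith), fun h m hm => h (2 * e + 3 - m) (by push_cast; linarith)⟩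

/-- reflection of the target index on the rim -/
lemma mT_refl {g : ℕ} {T : Fin 3} (hT : T ≠ 0) {z w : QQ} (hz : z ∈ STy g T) {e : ℕ} (he : e % 4 < 2) (hy1 : (e : ℝ) ≤ yy g z) (hy2 : yy g z ≤ e + 1)
    (hy : yy g w = 2 * e + 3 - yy g z) : mT g T w = 2 * e + 3 - mT g T z ∧ (e : ℤ) ≤ mT g T z ∧ mT g T z ≤ e + 1 := by
  rcases T3c T with rfl | rfl | rfl
  · exact absurd rfl hT
  · rw [STy1] at hz
    obtain ⟨h0, m, hm⟩ := hz
    have hm2 : |yy g w - ((2 * e + 3 - m : ℤ) : ℝ)| < 1 / 2 := by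
      rw [hy, ← abs_neg]; convert hm using 2; push_cast; ring
    rw [mT1, mT1, round_eq' hm, round_eq' hm2]
    rw [abs_lt] at hm
    have a1 : ((e : ℤ) : ℝ) - 1 < m := by push_cast; linarith
    have a2 : (m : ℝ) < (e : ℤ) + 2 := by push_cast; linarith
    have a3 : (e : ℤ) - 1 < m := by exact_mod_cast a1
    have a4 : m < (e : ℤ) + 2 := by exact_mod_cast a2
    omega
  · rw [STy2] at hz
    have b1 : (e : ℝ) < yy g z := lt_of_le_of_ne hy1 (by have := hz.2 e; push_cast at this; exact this.symm)
    have b2 : yy g z < e + 1 := lt_of_le_of_ne hy2 (by have := hz.2 (e + 1); push_cast at this; exact this)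
    have f1 : ⌊yy g z⌋ = e := Int.floor_eq_iff.2 ⟨by push_cast; linarith, by push_cast; linarith⟩
    have f2 : ⌊yy g w⌋ = e + 2 := Int.floor_eq_iff.2 ⟨by push_cast; linarith, by push_cast; linarith⟩
    rw [mT2, mT2, f1, f2, if_neg (by omega), if_pos (by omega)]
    omega

lemma prj_refl {g : ℕ} (hg : 1 ≤ g) {e : ℕ} (he : e % 4 < 2) (he3 : e + 3 ≤ 4 * g) {Z : ℝ} (h1 : (e : ℝ) ≤ Z) (h2 : Z ≤ e + 1) :
    prj g (nodeD (Z / (4 * g))) = prj g (nodeD ((2 * e + 3 - Z) / (4 * g))) := by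
  obtain ⟨g, rfl⟩ : ∃ g', g = g' + 1 := ⟨g - 1, by omega⟩
  refine Quot.sound ⟨⟨e / 4, by omega⟩, ⟨e % 4, he⟩, Z - e, by linarith, by linarith, ?_, ?_⟩
  · rw [polyBP_eq]
    show ex _ = ex _
    have : 4 * (e / 4) + e % 4 = e := Nat.div_add_mod e 4
    simp only [this]
    congr 1; push_cast; ring
  · rw [polyBP_eq]
    show ex _ = ex _
    have : 4 * (e / 4) + e % 4 = e := Nat.div_add_mod e 4
    simp only [this]
    congr 1; push_cast; ring
end

section

def ATm (g : ℕ) (T : Fin 3) (m : ℤ) (z : QQ) (t : ℝ) : Disc :=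
  if T = 0 then cv t (polar z) (nodeD 0) else dp g (z.1 + (1 - z.1) * cl t) (yy g z + (m - yy g z) * cl t)
def dSm (g : ℕ) (T T' : Fin 3) (m m' : ℤ) (z : QQ) (h t : ℝ) : Disc :=
  if T = 0 ∨ T' = 0 then cv h (ATm g T m z t) (ATm g T' m' z t)
  else dp g (z.1 + (1 - z.1) * cl t) (yy g z + ((1 - cl h) * m + cl h * m' - yy g z) * cl t)

lemma ATm_cont (g : ℕ) (T : Fin 3) (m : ℤ) : Continuous (fun p : QQ × ℝ => ATm g T m p.1 p.2) := by
  unfold ATm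
  have h1 := cl_cont
  have h2 := yy_cont g
  have h3 := polar_cont
  split_ifs
  · exact cv_cont.comp (f := fun p : QQ × ℝ => (p.2, polar p.1, nodeD 0)) (by fun_prop)
  · exact (dp_cont g).comp (f := fun p : QQ × ℝ => ((p.1.1 + (1 - p.1.1) * cl p.2 : ℝ), yy g p.1 + (m - yy g p.1) * cl p.2)) (by fun_prop)

lemma dSm_cont (g : ℕ) (T T' : Fin 3) (m m' : ℤ) : Continuous (fun p : QQ × ℝ × ℝ => dSm g T T' m m' p.1 p.2.1 p.2.2) := by
  unfold dSm
  have h1 := cl_cont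
  have h2 := yy_cont g
  split_ifs
  · exact cv_cont.comp (f := fun p : QQ × ℝ × ℝ => (p.2.1, ATm g T m p.1 p.2.2, ATm g T' m' p.1 p.2.2))
      (by
        refine Continuous.prodMk (by fun_prop) (Continuous.prodMk ?_ ?_)
        · exact (ATm_cont g T m).comp (f := fun p : QQ × ℝ × ℝ => (p.1, p.2.2)) (by fun_prop)
        · exact (ATm_cont g T' m').comp (f := fun p : QQ × ℝ × ℝ => (p.1, p.2.2)) (by fun_prop))
  · exact (dp_cont g).comp (f := fun p : QQ × ℝ × ℝ => ((p.1.1 + (1 - p.1.1) * cl p.2.2 : ℝ),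
      yy g p.1 + ((1 - cl p.2.1) * m + cl p.2.1 * m' - yy g p.1) * cl p.2.2)) (by fun_prop)

lemma ATm_0 {g : ℕ} (hg : 1 ≤ g) (T : Fin 3) (m : ℤ) (z : QQ) : ATm g T m z 0 = polar z := by
  unfold ATm
  split_ifs
  · rw [cv_le0 le_rfl]
  · rw [cl_le0 le_rfl, polar_dp hg]; simp
lemma ATm_1 (g : ℕ) {T : Fin 3} {m : ℤ} (hm : T = 0 → m = 0) (z : QQ) : ATm g T m z 1 = nodeD (m / (4 * g)) := by
  unfold ATm
  split_ifs with h
  · rw [cv_ge1 le_rfl, hm h]; simp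
  · rw [cl_ge1 le_rfl, dp_one _ (by linarith)]; congr 2; ring
lemma dSm_l (g : ℕ) (T T' : Fin 3) (m m' : ℤ) (z : QQ) {h : ℝ} (hh : h ≤ 0) (t : ℝ) : dSm g T T' m m' z h t = ATm g T m z t := by
  unfold dSm
  split_ifs with H
  · rw [cv_le0 hh]
  · push Not at H
    rw [cl_le0 hh, ATm, if_neg H.1]; simp
lemma dSm_r (g : ℕ) (T T' : Fin 3) (m m' : ℤ) (z : QQ) {h : ℝ} (hh : 1 ≤ h) (t : ℝ) : dSm g T T' m m' z h t = ATm g T' m' z t := by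
  unfold dSm
  split_ifs with H
  · rw [cv_ge1 hh]
  · push Not at H
    rw [cl_ge1 hh, ATm, if_neg H.2]; simp
lemma dSm_self (g : ℕ) (T : Fin 3) (m : ℤ) (z : QQ) (h t : ℝ) : dSm g T T m m z h t = ATm g T m z t := by
  unfold dSm
  split_ifs with H
  · rw [cv_self]
  · push Not at H
    rw [ATm, if_neg H.1]; congr 2; ring
lemma dSm_0 {g : ℕ} (hg : 1 ≤ g) (T T' : Fin 3) (m m' : ℤ) (z : QQ) (h : ℝ) : dSm g T T' m m' z h 0 = polar z := by
  unfold dSm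
  split_ifs with H
  · rw [ATm_0 hg, ATm_0 hg, cv_self]
  · rw [cl_le0 le_rfl, polar_dp hg]; simp
lemma dSm_1 (g : ℕ) {T T' : Fin 3} {m m' : ℤ} (hm : T = 0 → m = 0) (hm' : T' = 0 → m' = 0) (z w : QQ) (h : ℝ) :
    dSm g T T' m m' z h 1 = dSm g T T' m m' w h 1 := by
  unfold dSm
  split_ifs with H
  · rw [ATm_1 g hm, ATm_1 g hm', ATm_1 g hm, ATm_1 g hm']
  · rw [cl_ge1 le_rfl, dp_one _ (by linarith), dp_one _ (by linarith)]; congr 2; ring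

def dS (g : ℕ) (T T' : Fin 3) (z : QQ) (h t : ℝ) : Disc := dSm g T T' (mT g T z) (mT g T' z) z h t
def SQ (g : ℕ) (T T' : Fin 3) (z : QQ) (p : ℝ × ℝ) : Mg g := prj g (dS g T T' z p.1 p.2)
lemma mT00 (g : ℕ) {T : Fin 3} (z : QQ) : T = 0 → mT g T z = 0 := by rintro rfl; exact mT0 g z

lemma SQ_cont (g : ℕ) (T T' : Fin 3) : ContinuousOn (fun p : QQ × ℝ × ℝ => SQ g T T' p.1 p.2) ((STy g T ∩ STy g T') ×ˢ Set.univ) := by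
  rintro ⟨z, p⟩ ⟨⟨hz, hz'⟩, -⟩
  refine ContinuousAt.continuousWithinAt ?_
  have h := ((prj_cont g).comp (dSm_cont g T T' (mT g T z) (mT g T' z))).continuousAt (x := (z, p))
  refine h.congr ?_
  have e := ((mT_loc g T z hz).and (mT_loc g T' z hz'))
  filter_upwards [(continuous_fst.continuousAt (x := (z, p))).eventually e] with q hq
  show prj g (dSm _ _ _ _ _ _ _ _) = prj g (dSm _ _ _ _ _ _ _ _)
  rw [hq.1.2, hq.2.2]

lemma polar_eq' {g : ℕ} {z w : QQ} (h1 : z.1 = w.1) (h2 : z.2 = 0) (h3 : w.2 = 1) : polar z = polar w := by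
  apply Subtype.ext
  show ((z.1 : ℝ) : ℂ) * ex z.2 = ((w.1 : ℝ) : ℂ) * ex w.2
  have e : ex ((1 : ℤ) : ℝ) = 1 := ex_int 1
  rw [h1, h2, h3]; simp only [Set.Icc.coe_zero, Set.Icc.coe_one, ex_zero]; push_cast at e; rw [e]

lemma yy_0 (g : ℕ) {z : QQ} (h : z.2 = 0) : yy g z = 0 := by simp [yy, h]
lemma yy_1 (g : ℕ) {z : QQ} (h : z.2 = 1) : yy g z = 4 * g := by simp [yy, h]

lemma mT_r1 (g : ℕ) {T : Fin 3} {z w : QQ} (hz : z ∈ STy g T) (h2 : z.2 = 0) (h3 : w.2 = 1) :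
    T = 0 ∨ (T = 1 ∧ mT g T z = 0 ∧ mT g T w = 4 * g) := by
  rcases T3c T with rfl | rfl | rfl
  · exact Or.inl rfl
  · refine Or.inr ⟨rfl, ?_, ?_⟩
    · rw [mT1, yy_0 g h2]; simp
    · rw [mT1, yy_1 g h3]
      have : (4 * (g : ℝ)) = ((4 * g : ℤ) : ℝ) := by push_cast; rfl
      rw [this, round_intCast]
  · rw [STy2] at hz
    exact (hz.2 0 (by rw [yy_0 g h2]; simp)).elim

lemma AT_r1 {g : ℕ} (hg : 1 ≤ g) {T : Fin 3} {z w : QQ} (hz : z ∈ STy g T) (h1 : z.1 = w.1) (h2 : z.2 = 0) (h3 : w.2 = 1) (t : ℝ) :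
    ATm g T (mT g T z) z t = ATm g T (mT g T w) w t := by
  rcases mT_r1 g hz h2 h3 with rfl | ⟨rfl, e1, e2⟩
  · unfold ATm; rw [if_pos rfl, if_pos rfl, polar_eq' (g := g) h1 h2 h3]
  · unfold ATm; rw [if_neg (by decide), if_neg (by decide), e1, e2, yy_0 g h2, yy_1 g h3, h1]
    apply Subtype.ext
    show _ * ex _ = _ * ex _
    congr 1
    have : (g : ℝ) ≠ 0 := by positivity
    rw [ex_eq_iff]
    refine ⟨-1, ?_⟩
    push_cast; field_simp; ring

lemma SQ_inv {g : ℕ} (hg : 1 ≤ g) (T T' : Fin 3) : InvQ g (STy g T ∩ STy g T') (SQ g T T') := by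
  rintro z w hr ⟨hz, hz'⟩
  funext p
  obtain ⟨h, t⟩ := p
  show prj g (dS g T T' z h t) = prj g (dS g T T' w h t)
  rcases hr with ⟨h1, h2⟩ | ⟨h1, h2, h3⟩ | ⟨h1, h2, e, he, he3, hy1, hy2, hy⟩
  · have key : ∀ T, z ∈ STy g T → T = 0 := by
      intro T hT
      rcases T3c T with rfl | rfl | rfl
      · rfl
      · rw [STy1, h1] at hT; simp at hT
      · rw [STy2, h1] at hT; simp at hT
    obtain rfl := key T hz
    obtain rfl := key T' hz'
    unfold dS dSm ATm
    simp only [true_or, if_true]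
    have : polar z = polar w := by
      apply Subtype.ext
      show ((z.1 : ℝ) : ℂ) * ex z.2 = ((w.1 : ℝ) : ℂ) * ex w.2
      rw [h1, h2]; simp
    rw [this]
  · congr 1
    by_cases H : T = 0 ∨ T' = 0
    · unfold dS dSm
      rw [if_pos H, if_pos H, AT_r1 hg hz h1 h2 h3, AT_r1 hg hz' h1 h2 h3]
    · push Not at H
      have a := (mT_r1 g hz h2 h3).resolve_left H.1
      have a' := (mT_r1 g hz' h2 h3).resolve_left H.2
      obtain rfl := a.1
      obtain rfl := a'.1
      unfold dS
      rw [dSm_self, dSm_self]; exact AT_r1 hg hz h1 h2 h3 t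
  · have key : ∀ T, z ∈ STy g T → T ≠ 0 := by
      rintro T hT rfl
      rw [STy0, h1] at hT; simp at hT
    have k1 := key T hz
    have k2 := key T' hz'
    obtain ⟨a1, a2, a3⟩ := mT_refl k1 hz he hy1 hy2 hy
    obtain ⟨b1, b2, b3⟩ := mT_refl k2 hz' he hy1 hy2 hy
    unfold dS dSm
    rw [if_neg (by tauto), if_neg (by tauto), a1, b1, hy, h1, h2, dp_one _ (by simp), dp_one _ (by simp)]
    have r2 : (e : ℝ) ≤ mT g T z := by exact_mod_cast a2
    have r3 : (mT g T z : ℝ) ≤ e + 1 := by exact_mod_cast a3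
    have s2 : (e : ℝ) ≤ mT g T' z := by exact_mod_cast b2
    have s3 : (mT g T' z : ℝ) ≤ e + 1 := by exact_mod_cast b3
    have c0 := cl_nn h; have c1 := cl_l1 h
    have d0 := cl_nn t; have d1 := cl_l1 t
    have u0 : (e : ℝ) ≤ (1 - cl h) * (mT g T z) + cl h * (mT g T' z) := by nlinarith
    have u1 : (1 - cl h) * (mT g T z) + cl h * (mT g T' z) ≤ (e : ℝ) + 1 := by nlinarith
    rw [prj_refl hg he he3 (Z := yy g z + ((1 - cl h) * (mT g T z) + cl h * (mT g T' z) - yy g z) * cl t) (by nlinarith) (by nlinarith)]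
    congr 3
    push_cast; ring

lemma pw_glue (c e : ℕ) (hc : c % 4 < 2) (he : e % 4 < 2) : ∃ d : ℝ, ∀ Y : ℝ, (e : ℝ) ≤ Y → Y ≤ e + 1 → pw c (2 * e + 3 - Y) = pw c Y + d := by
  have hcase : e = c ∨ e = c + 1 ∨ c = e + 1 ∨ c + 3 ≤ e ∨ e + 3 ≤ c := by omega
  rcases hcase with rfl | rfl | rfl | h | h
  · exact ⟨0, fun Y h1 h2 => by rw [pw_up h1 h2, pw_down (by linarith) (by linarith)]; ring⟩
  · exact ⟨-1, fun Y h1 h2 => by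
      push_cast at *
      rw [pw_one h1 (by linarith), pw_ge (by linarith)]; ring⟩
  · exact ⟨1, fun Y h1 h2 => by
      rw [pw_one (by push_cast; linarith) (by push_cast; linarith), pw_le (by push_cast; linarith)]; ring⟩
  · have h' : (c : ℝ) + 3 ≤ e := by exact_mod_cast h
    exact ⟨0, fun Y h1 h2 => by rw [pw_ge (by linarith), pw_ge (by linarith)]; ring⟩
  · have h' : (e : ℝ) + 3 ≤ c := by exact_mod_cast h
    exact ⟨0, fun Y h1 h2 => by rw [pw_le (by linarith), pw_le (by linarith)]; ring⟩

def cc {g : ℕ} (x : Fin g × Fin 2) : ℕ := 4 * x.1.1 + x.2.1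
lemma cc4 {g : ℕ} (x : Fin g × Fin 2) : cc x % 4 < 2 := by unfold cc; have := x.2.2; omega
lemma cc0 {g : ℕ} (x : Fin g × Fin 2) : pw (cc x) 0 = 0 := pw_le (by positivity)
lemma ccg {g : ℕ} (x : Fin g × Fin 2) : pw (cc x) (4 * g) = 0 := pw_end g x.1.1 x.2
def lT (g : ℕ) (T : Fin 3) (z : QQ) (x : Fin g × Fin 2) : ℝ := z.1 * pw (cc x) (yy g z) - pw (cc x) (mT g T z)

lemma lT_cont (g : ℕ) (T : Fin 3) (x : Fin g × Fin 2) : ContinuousOn (fun z => lT g T z x) (STy g T) := by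
  intro z hz
  refine ContinuousAt.continuousWithinAt ?_
  have h1 := pw_cont (cc x)
  have h2 := yy_cont g
  have : Continuous (fun w : QQ => (w.1 : ℝ) * pw (cc x) (yy g w) - pw (cc x) (mT g T z)) := by fun_prop
  refine this.continuousAt.congr ?_
  filter_upwards [mT_loc g T z hz] with w hw
  show _ = lT g T w x
  rw [lT, hw.2]

lemma lT_inv (g : ℕ) (T : Fin 3) : InvQ g (STy g T) (lT g T) := by
  rintro z w hr hz
  funext x
  unfold lT
  rcases hr with ⟨h1, h2⟩ | ⟨h1, h2, h3⟩ | ⟨h1, h2, e, he, he3, hy1, hy2, hy⟩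
  · rcases T3c T with rfl | rfl | rfl
    · rw [h1, h2, mT0, mT0]; simp
    · rw [STy1, h1] at hz; simp at hz
    · rw [STy2, h1] at hz; simp at hz
  · rw [yy_0 g h2, yy_1 g h3, cc0, ccg, mul_zero, mul_zero]
    rcases mT_r1 g hz h2 h3 with rfl | ⟨rfl, e1, e2⟩
    · rw [mT0, mT0]
    · rw [e1, e2]; push_cast; rw [cc0, ccg]
  · have k1 : T ≠ 0 := by
      rintro rfl
      rw [STy0, h1] at hz; simp at hz
    obtain ⟨a1, a2, a3⟩ := mT_refl k1 hz he hy1 hy2 hy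
    obtain ⟨d, hd⟩ := pw_glue (cc x) e (cc4 x) he
    have r2 : (e : ℝ) ≤ mT g T z := by exact_mod_cast a2
    have r3 : (mT g T z : ℝ) ≤ e + 1 := by exact_mod_cast a3
    rw [h1, h2, hy, hd _ hy1 hy2, a1]
    push_cast
    rw [hd _ r2 r3]; ring

lemma lT_int {g : ℕ} {T T' : Fin 3} {z : QQ} (hz : z ∈ STy g T) (hz' : z ∈ STy g T') (x : Fin g × Fin 2) : ∃ k : ℤ, lT g T' z x - lT g T z x = k := by
  have key : ∀ T, z ∈ STy g T → ∃ k : ℤ, pw (cc x) (mT g T z) = k := by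
    intro T hT
    obtain ⟨i, hi⟩ := Int.eq_ofNat_of_zero_le (mT_bd g T z hT).1
    rw [hi]
    exact ⟨_, pw_vv g i x⟩
  obtain ⟨k, hk⟩ := key T hz
  obtain ⟨k', hk'⟩ := key T' hz'
  refine ⟨k - k', ?_⟩
  unfold lT; rw [hk, hk']; push_cast; ring

lemma node_b {g : ℕ} (hg : 1 ≤ g) : ∀ i : ℕ, i ≤ 4 * g → prj g (nodeD (i / (4 * g))) = prj g (nodeD 0) := by
  have A : ∀ k : ℕ, 4 * k + 4 ≤ 4 * g → prj g (nodeD ((4 * k : ℕ) / (4 * g))) = prj g (nodeD ((4 * k + 3 : ℕ) / (4 * g))) ∧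
      prj g (nodeD ((4 * k + 1 : ℕ) / (4 * g))) = prj g (nodeD ((4 * k + 2 : ℕ) / (4 * g))) ∧
      prj g (nodeD ((4 * k + 1 : ℕ) / (4 * g))) = prj g (nodeD ((4 * k + 4 : ℕ) / (4 * g))) ∧
      prj g (nodeD ((4 * k + 2 : ℕ) / (4 * g))) = prj g (nodeD ((4 * k + 3 : ℕ) / (4 * g))) := by
    intro k hk
    have a1 := prj_refl hg (e := 4 * k) (by omega) (by omega) (Z := (4 * k : ℕ)) le_rfl (by linarith)
    have a2 := prj_refl hg (e := 4 * k) (by omega) (by omega) (Z := (4 * k + 1 : ℕ)) (by push_cast; linarith) (by push_cast; linarith)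
    have a3 := prj_refl hg (e := 4 * k + 1) (by omega) (by omega) (Z := (4 * k + 1 : ℕ)) le_rfl (by linarith)
    have a4 := prj_refl hg (e := 4 * k + 1) (by omega) (by omega) (Z := (4 * k + 2 : ℕ)) (by push_cast; linarith) (by push_cast; linarith)
    refine ⟨?_, ?_, ?_, ?_⟩
    · rw [a1]; congr 3; push_cast; ring
    · rw [a2]; congr 3; push_cast; ring
    · rw [a3]; congr 3; push_cast; ring
    · rw [a4]; congr 3; push_cast; ring
  have B : ∀ k : ℕ, k ≤ g → prj g (nodeD ((4 * k : ℕ) / (4 * g))) = prj g (nodeD 0) := by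
    intro k
    induction k with
    | zero => intro _; simp
    | succ k ih =>
        intro hk
        obtain ⟨b1, b2, b3, b4⟩ := A k (by omega)
        rw [← ih (by omega), b1, ← b4, ← b2, b3]; congr 3
  intro i hi
  obtain ⟨k, r, hr, rfl⟩ : ∃ k r, r < 4 ∧ i = 4 * k + r := ⟨i / 4, i % 4, Nat.mod_lt _ (by norm_num), by omega⟩
  by_cases h0 : r = 0
  · subst h0; exact B k (by omega)
  · obtain ⟨b1, b2, b3, b4⟩ := A k (by omega)
    have b0 := B k (by omega)
    have : r = 1 ∨ r = 2 ∨ r = 3 := by omega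
    rcases this with rfl | rfl | rfl
    · rw [b2, b4, ← b1, b0]
    · rw [b4, ← b1, b0]
    · rw [← b1, b0]
end

section

section mk
variable {K : Type*} [Fintype K] [DecidableEq K] {g n : ℕ}

def bM (g : ℕ) : Mg g := prj g (nodeD 0)
def pQ (g : ℕ) (τ : K → Fin 3) (q : K) (x : Mg g) (t : ℝ) : Mg g := SQ g (τ q) (τ q) (secQ g x) (0, t)
def sQ (g : ℕ) (τ : K → Fin 3) (q q' : K) (x : Mg g) (h t : ℝ) : Mg g := SQ g (τ q) (τ q') (secQ g x) (cl (3 * h - 1), t)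

lemma STy_sat2 (g : ℕ) (T T' : Fin 3) : SatQ g (STy g T ∩ STy g T') := fun z w h =>
  and_congr (STy_sat g T z w h) (STy_sat g T' z w h)

lemma SQ_desc (hg : 1 ≤ g) (T T' : Fin 3) :
    ContinuousOn (fun p : Mg g × ℝ × ℝ => SQ g T T' (secQ g p.1) p.2) (MS g (STy g T ∩ STy g T') ×ˢ Set.univ) :=
  desc_cont hg (STy_sat2 g T T') ((STy_open g T).inter (STy_open g T')) (SQ g T T') (SQ_cont g T T') (SQ_inv hg T T')

lemma pQ_cont (hg : 1 ≤ g) (τ : K → Fin 3) (q : K) :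
    ContinuousOn (fun z : Mg g × ℝ => pQ g τ q z.1 z.2) (MS g (STy g (τ q)) ×ˢ Set.univ) := by
  refine (SQ_desc hg (τ q) (τ q)).comp (f := fun z : Mg g × ℝ => (z.1, ((0 : ℝ), z.2))) (by fun_prop) ?_
  rintro z ⟨hz, -⟩
  exact ⟨⟨hz, hz⟩, trivial⟩

lemma pQ_AT (τ : K → Fin 3) (q : K) (x : Mg g) (t : ℝ) :
    pQ g τ q x t = prj g (ATm g (τ q) (mT g (τ q) (secQ g x)) (secQ g x) t) := by
  unfold pQ SQ dS; rw [dSm_self]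

lemma pQ_0 (hg : 1 ≤ g) (τ : K → Fin 3) (q : K) (x : Mg g) : pQ g τ q x 0 = x := by
  rw [pQ_AT, ATm_0 hg]; exact PP_secQ g x

lemma pQ_1 (hg : 1 ≤ g) (τ : K → Fin 3) (q : K) (x : Mg g) (hx : secQ g x ∈ STy g (τ q)) : pQ g τ q x 1 = bM g := by
  rw [pQ_AT, ATm_1 g (mT00 g _)]
  have h := mT_bd g _ _ hx
  obtain ⟨i, hi⟩ := Int.eq_ofNat_of_zero_le h.1
  rw [hi]
  exact node_b hg i (by omega)

theorem U1mk (hg : 1 ≤ g) [Nonempty K] {F : K → Mg g → ℝ} (C : CD F 2) (τ : K → Fin 3) (hτ : ∀ q x, 0 < F q x → secQ g x ∈ STy g (τ q)) :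
    NW (spq fun _ : Fin n => bM g) (2 * n) := by
  refine U1 C (bM g) (pQ g τ) (fun q => (pQ_cont hg τ q).mono (Set.prod_mono_left fun x hx => hτ q x hx)) (fun q x _ => pQ_0 hg τ q x)
    fun q x hx => pQ_1 hg τ q x (hτ q x hx)

theorem UDmk (hg : 1 ≤ g) (hn : 2 ≤ n) [Nonempty K] {F : K → Mg g → ℝ} (C : CD F 2) (τ : K → Fin 3) (hτ : ∀ q x, 0 < F q x → secQ g x ∈ STy g (τ q))
    (lo : ∀ q x y, 0 < F q x → 0 < F q y → ∀ e, |lT g (τ q) (secQ g x) e - lT g (τ q) (secQ g y) e| * (2 * n) < 1) :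
    NW (spq fun _ : Fin n => bM g) (n + g) := by
  classical
  let s0 : Fin n := ⟨0, by omega⟩
  let s1 : Fin n := ⟨1, by omega⟩
  have h01 : s0 ≠ s1 := by intro h; have := congrArg Fin.val h; simp [s0, s1] at this
  have hsw : ∀ (s s' : Fin n) (m : Mg g), spq (Function.update (fun _ : Fin n => bM g) s m) = spq (Function.update (fun _ : Fin n => bM g) s' m) := by
    intro s s' m
    rw [← spq_perm (Function.update (fun _ : Fin n => bM g) s' m) (Equiv.swap s s')]
    congr 1
    funext j
    rcases eq_or_ne j s with rfl | h
    · simp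
    · rw [Function.update_of_ne h, Function.update_of_ne]
      intro h2
      exact h ((Equiv.swap s s').injective (h2.trans (Equiv.swap_apply_left s s').symm))
  let ι : Mg g → SP n (Mg g) := fun m => spq (Function.update (fun _ => bM g) s0 m)
  let μ : Mg g × Mg g → SP n (Mg g) := fun p => spq (Function.update (Function.update (fun _ => bM g) s0 p.1) s1 p.2)
  have hι : Continuous ι := spq_cont.comp (continuous_const.update _ continuous_id)
  have hμ : Continuous μ := by
    refine spq_cont.comp ?_
    have a : Continuous fun p : Mg g × Mg g => Function.update (fun _ : Fin n => bM g) s0 p.1 := continuous_const.update _ continuous_fst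
    exact a.update _ continuous_snd
  have hμ1 : ∀ m, μ (m, bM g) = ι m := by
    intro m
    show spq _ = spq _
    congr 1
    rw [Function.update_eq_self_iff, Function.update_of_ne h01.symm]
  have hμ2 : ∀ m, μ (bM g, m) = ι m := by
    intro m
    show spq (Function.update (Function.update (fun _ => bM g) s0 (bM g)) s1 m) = ι m
    rw [Function.update_eq_self_iff.2 rfl]
    exact hsw _ _ _
  have h0 : ι (bM g) = spq fun _ => bM g := by
    show spq _ = spq _
    rw [Function.update_eq_self_iff.2 rfl]
  have hG : ((4 * g : ℕ) : ℝ) = 4 * g := by push_cast; rfl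
  obtain ⟨Lm, lmc, lm0, lm1, hΓ⟩ := main16 g (prj_cont g) (b := bM g) (fun i hi => by rw [hG]; exact node_b hg i hi)
    (fun i hi hi4 t => by
      rw [hG, prj_refl hg (e := i) hi4 (by omega) (Z := i + t) (by linarith [t.2.1]) (by linarith [t.2.2])]
      congr 3; push_cast; ring) hι μ hμ hμ1 hμ2 h0
  have U : UD F n (bM g) (pQ g τ) (fun q x => lT g (τ q) (secQ g x)) (sQ g τ) Lm :=
    { C := C
      pc := fun q => (pQ_cont hg τ q).mono (Set.prod_mono_left fun x hx => hτ q x hx)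
      p0 := fun q x _ => pQ_0 hg τ q x
      p1 := fun q x hx => pQ_1 hg τ q x (hτ q x hx)
      lc := fun q e => by
        have := desc_cont1 hg (STy_sat g (τ q)) (STy_open g (τ q)) (fun z => lT g (τ q) z e) (lT_cont g (τ q) e)
          (fun z w h hz => congrFun (lT_inv g (τ q) z w h hz) e)
        exact this.mono fun x hx => hτ q x hx
      li := fun q q' x h h' e => lT_int (hτ q x h) (hτ q' x h') e
      lo := lo
      sc := fun q q' => by
        have h3 := cl_cont
        refine (SQ_desc hg (τ q) (τ q')).comp (f := fun z : Mg g × ℝ × ℝ => (z.1, (cl (3 * z.2.1 - 1), z.2.2))) (by fun_prop) ?_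
        rintro z ⟨⟨hz, hz'⟩, -⟩
        exact ⟨⟨hτ q _ hz, hτ q' _ hz'⟩, trivial⟩
      sl := fun q q' x h h' t => by
        rw [pQ_AT]; unfold sQ SQ dS; rw [dSm_l]
        simp only; rw [cl_le0 (by norm_num)]
      sr := fun q q' x h h' t => by
        rw [pQ_AT]; unfold sQ SQ dS; rw [dSm_r]
        simp only; rw [cl_ge1 (by norm_num)]
      s0 := fun q q' x h h' t => by
        unfold sQ SQ dS; rw [dSm_0 hg]; exact PP_secQ g x
      ss := fun q x hx h t => by
        rw [pQ_AT]; unfold sQ SQ dS; rw [dSm_self]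
      s1 := fun q q' x h h' => by
        have := desc_const hg (STy_sat2 g (τ q) (τ q')) ((STy_open g (τ q)).inter (STy_open g (τ q')))
          (fun z => fun h : ℝ => SQ g (τ q) (τ q') z (h, 1)) (fun z hz => by
            filter_upwards [mT_loc g _ z hz.1, mT_loc g _ z hz.2] with w hw hw'
            funext h
            show prj g (dSm g _ _ (mT g (τ q) w) (mT g (τ q') w) w h 1) = prj g (dSm g _ _ (mT g (τ q) z) (mT g (τ q') z) z h 1)
            rw [hw.2, hw'.2, dSm_1 g (mT00 g z) (mT00 g z) w z]) (fun z w hr hz => by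
              funext h; exact congrFun (SQ_inv hg _ _ z w hr hz) (h, 1)) x ⟨hτ q x h, hτ q' x h'⟩
        filter_upwards [this] with x' hx' h
        exact congrFun hx' _
      lmc := lmc
      lm0 := lm0
      lm1 := lm1
      gam := fun q q' x h h' a a' haa s => by
        have hz := hτ q x h
        have hz' := hτ q' x h'
        obtain ⟨i, hi⟩ := Int.eq_ofNat_of_zero_le (mT_bd g _ _ hz).1
        obtain ⟨j, hj⟩ := Int.eq_ofNat_of_zero_le (mT_bd g _ _ hz').1
        have hi4 := (mT_bd g _ _ hz).2
        have hj4 := (mT_bd g _ _ hz').2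
        obtain ⟨Γ, hh⟩ := hΓ (fun h => dS g (τ q) (τ q') (secQ g x) h 1)
          ((dSm_cont g (τ q) (τ q') _ _).comp (f := fun h : ℝ => (secQ g x, h, (1 : ℝ))) (by fun_prop)) i j (by omega) (by omega)
          (by show dSm _ _ _ _ _ _ _ _ = _
              rw [dSm_l _ _ _ _ _ _ le_rfl, ATm_1 g (mT00 g _), hi, hG]; simp)
          (by show dSm _ _ _ _ _ _ _ _ = _
              rw [dSm_r _ _ _ _ _ _ le_rfl, ATm_1 g (mT00 g _), hj, hG]; simp) a a'
          (fun e => by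
            rw [haa e]; unfold lT; rw [hi, hj]
            show _ = pw (cc e) i - pw (cc e) j
            push_cast; ring)
        refine ⟨Γ, ?_⟩
        have e : (fun h => spq (Function.update (fun _ => bM g) s (sQ g τ q q' x h 1))) = fun h => ι (prj g (dS g (τ q) (τ q') (secQ g x) (cl (3 * h - 1)) 1)) := by
          funext h
          exact hsw _ _ _
        rw [e]; exact hh }
  refine U.nw (by omega) ?_
  simp only [Fintype.card_prod, Fintype.card_fin]; omega
end mk
end

section

section CDm
variable {M A C : Type*} [TopologicalSpace M] [Fintype C] [DecidableEq C]
open Classical in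
def Fmk (col : C → M → ℝ) (κ : C → M → A) (R : Set A) (q : C × R) (x : M) : ℝ := if κ q.1 x = q.2.1 then col q.1 x else 0

lemma Fmk_pos {col : C → M → ℝ} {κ : C → M → A} {R : Set A} {q : C × R} {x : M} (h : 0 < Fmk col κ R q x) : κ q.1 x = q.2.1 ∧ 0 < col q.1 x := by
  unfold Fmk at h
  split_ifs at h with h1
  · exact ⟨h1, h⟩
  · exact (lt_irrefl _ h).elim

open Classical in
lemma CD_mk {d : ℕ} (col : C → M → ℝ) (hc : ∀ c, Continuous (col c)) (nn : ∀ c x, 0 ≤ col c x) (le : ∀ c x, col c x ≤ 1)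
    (cov : ∀ x, ∃ c, col c x = 1) (dim : ∀ x (T : Finset C), (∀ q ∈ T, 0 < col q x) → T.card ≤ d + 1)
    (κ : C → M → A) (loc : ∀ c x, 0 < col c x → ∀ᶠ x' in 𝓝 x, κ c x' = κ c x) (R : Set A) [Fintype R]
    (hR : ∀ c x, 0 < col c x → κ c x ∈ R) : CD (Fmk col κ R) d := by
  refine ⟨?_, ?_, ?_, ?_, ?_⟩
  · rintro q
    rw [continuous_iff_continuousAt]
    intro x
    rcases (nn q.1 x).lt_or_eq with h | h
    · by_cases h2 : κ q.1 x = q.2.1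
      · refine (hc q.1).continuousAt.congr ?_
        filter_upwards [loc q.1 x h] with x' hx'
        rw [Fmk, if_pos (hx'.trans h2)]
      · refine (continuousAt_const (y := (0 : ℝ))).congr ?_
        filter_upwards [loc q.1 x h] with x' hx'
        rw [Fmk, if_neg (by rw [hx']; exact h2)]
    · have e : Fmk col κ R q x = 0 := by unfold Fmk; split_ifs; exacts [h.symm, rfl]
      unfold ContinuousAt
      rw [e]
      have h3 : Filter.Tendsto (col q.1) (𝓝 x) (𝓝 0) := by have := (hc q.1).continuousAt (x := x); unfold ContinuousAt at this; rwa [← h] at this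
      refine squeeze_zero (fun y => ?_) (fun y => ?_) h3
      · unfold Fmk; split_ifs; exacts [nn _ _, le_rfl]
      · unfold Fmk; split_ifs; exacts [le_rfl, nn _ _]
  · intro q x; unfold Fmk; split_ifs; exacts [nn _ _, le_rfl]
  · intro q x; unfold Fmk; split_ifs; exacts [le _ _, zero_le_one]
  · intro x
    obtain ⟨c, hx⟩ := cov x
    refine ⟨(c, ⟨κ c x, hR c x (by rw [hx]; exact one_pos)⟩), ?_⟩
    rw [Fmk, if_pos rfl, hx]
  · intro x T hT
    have : (T.image Prod.fst).card = T.card := by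
      refine Finset.card_image_of_injOn ?_
      intro q hq q' hq' h
      have h1 := (Fmk_pos (hT q hq)).1
      have h2 := (Fmk_pos (hT q' hq')).1
      refine Prod.ext h (Subtype.ext ?_)
      rw [← h1, ← h2]; rw [show q.1 = q'.1 from h]
    rw [← this]
    refine dim x _ fun c hcT => ?_
    obtain ⟨q, hq, hqc⟩ := Finset.mem_image.1 hcT
    rw [← hqc]; exact (Fmk_pos (hT q hq)).2
end CDm

def dI (x : ℝ) : ℝ := ‖(x : UnitAddCircle)‖
lemma dI_cont : Continuous dI := continuous_norm.comp (AddCircle.continuous_mk' 1)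
lemma dI_eq (x : ℝ) : dI x = |x - round x| := UnitAddCircle.norm_eq
lemma dI_nn (x : ℝ) : 0 ≤ dI x := norm_nonneg _
lemma dI_le (x : ℝ) : dI x ≤ 1 / 2 := by rw [dI_eq]; exact abs_sub_round x
lemma dI_int (k : ℤ) : dI k = 0 := by rw [dI_eq]; simp
lemma dI_refl (k : ℤ) (x : ℝ) : dI (k - x) = dI x := by
  rw [dI_eq, dI_eq]
  have : (k - x : ℝ) = k + (-x) := by ring
  rw [← dI_eq, ← dI_eq, this]
  unfold dI
  have e : ((k : ℝ) : UnitAddCircle) = 0 := by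
    rw [AddCircle.coe_eq_zero_iff]; exact ⟨k, by simp⟩
  rw [AddCircle.coe_add, e, zero_add, AddCircle.coe_neg, norm_neg]
lemma dI_pos {x : ℝ} (h : 0 < dI x) (m : ℤ) : x ≠ m := by
  rintro rfl; rw [dI_int] at h; exact lt_irrefl _ h

def lab (nr : Bool) (x : ℝ) : ℤ := if nr then 2 * round x else 2 * ⌊x⌋ + 1
def okL (nr : Bool) (x : ℝ) : Prop := if nr then dI x < 1 / 2 else 0 < dI x

lemma lab_near {nr : Bool} {x : ℝ} (h : okL nr x) : |2 * x - lab nr x| < 1 := by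
  cases nr
  · simp only [okL, Bool.false_eq_true, if_false] at h
    obtain ⟨h1, h2⟩ := floor_off (dI_pos h)
    simp only [lab, Bool.false_eq_true, if_false]
    push_cast
    rw [abs_lt]; constructor <;> linarith
  · simp only [okL, if_true] at h
    rw [dI_eq, abs_lt] at h
    simp only [lab, if_true]
    push_cast
    rw [abs_lt]; constructor <;> linarith

lemma lab_loc {nr : Bool} {x : ℝ} (h : okL nr x) : ∀ᶠ x' in 𝓝 x, lab nr x' = lab nr x := by
  cases nr
  · simp only [okL, Bool.false_eq_true, if_false] at h
    obtain ⟨h1, h2⟩ := floor_off (dI_pos h)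
    filter_upwards [lt_mem_nhds h1, gt_mem_nhds h2] with y a1 a2
    simp only [lab, Bool.false_eq_true, if_false]
    rw [Int.floor_eq_iff.2 ⟨a1.le, a2⟩]
  · simp only [okL, if_true] at h
    rw [dI_eq] at h
    have : ContinuousAt (fun y : ℝ => |y - round x|) x := by fun_prop
    filter_upwards [this.eventually (gt_mem_nhds h)] with y a1
    simp only [lab, if_true]
    rw [round_eq' a1]

lemma lab_refl {nr : Bool} {x : ℝ} (h : okL nr x) (k : ℤ) : lab nr (k - x) = 2 * k - lab nr x := by
  cases nr
  · simp only [okL, Bool.false_eq_true, if_false] at h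
    obtain ⟨h1, h2⟩ := floor_off (dI_pos h)
    simp only [lab, Bool.false_eq_true, if_false]
    have : ⌊(k : ℝ) - x⌋ = k - 1 - ⌊x⌋ := Int.floor_eq_iff.2 ⟨by push_cast; linarith, by push_cast; linarith⟩
    rw [this]; ring
  · simp only [okL, if_true] at h
    rw [dI_eq] at h
    simp only [lab, if_true]
    have : |(k - x) - ((k - round x : ℤ) : ℝ)| < 1 / 2 := by
      rw [← abs_neg]; convert h using 2; push_cast; ring
    rw [round_eq' this]; ring

lemma lab_int {nr : Bool} {k : ℤ} (h : okL nr k) : lab nr k = 2 * k := by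
  cases nr
  · simp only [okL, Bool.false_eq_true, if_false] at h
    exact (dI_pos h k rfl).elim
  · simp [lab]

def nx : Fin 4 → Bool := ![true, false, true, false]
def ny : Fin 4 → Bool := ![true, false, false, true]
def cfun (a b : ℝ) : Fin 4 → ℝ := ![max 0 (3 / 8 - max a b), max 0 (min a b - 1 / 8), max 0 (b - a - 1 / 8), max 0 (a - b - 1 / 8)]
lemma cfun_cont (c : Fin 4) : Continuous (fun p : ℝ × ℝ => cfun p.1 p.2 c) := by
  fin_cases c <;> simp only [cfun, Matrix.cons_val] <;> fun_prop
lemma cfun_nn (a b : ℝ) (c : Fin 4) : 0 ≤ cfun a b c := by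
  fin_cases c <;> exact le_max_left _ _
lemma cfun_ok {a b : ℝ} (hb : b ≤ 1 / 2) (ha : a ≤ 1 / 2) (hb0 : 0 ≤ b) (ha0 : 0 ≤ a) {c : Fin 4} (h : 0 < cfun a b c) :
    (if nx c then a < 1 / 2 else 0 < a) ∧ (if ny c then b < 1 / 2 else 0 < b) := by
  fin_cases c
  · have h' : 0 < max 0 (3 / 8 - max a b) := h
    have h1 := (lt_max_iff.1 h').resolve_left (lt_irrefl _)
    have := le_max_left a b; have := le_max_right a b
    show a < 1 / 2 ∧ b < 1 / 2
    constructor <;> linarith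
  · have h' : 0 < max 0 (min a b - 1 / 8) := h
    have h1 := (lt_max_iff.1 h').resolve_left (lt_irrefl _)
    have := min_le_left a b; have := min_le_right a b
    show 0 < a ∧ 0 < b
    constructor <;> linarith
  · have h' : 0 < max 0 (b - a - 1 / 8) := h
    have h1 := (lt_max_iff.1 h').resolve_left (lt_irrefl _)
    show a < 1 / 2 ∧ 0 < b
    constructor <;> linarith
  · have h' : 0 < max 0 (a - b - 1 / 8) := h
    have h1 := (lt_max_iff.1 h').resolve_left (lt_irrefl _)
    show 0 < a ∧ b < 1 / 2
    constructor <;> linarith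
lemma cfun_cov (a b : ℝ) : ∃ c, 0 < cfun a b c := by
  by_contra h
  push Not at h
  have h0 : max 0 (3 / 8 - max a b) ≤ 0 := h 0
  have h1 : max 0 (min a b - 1 / 8) ≤ 0 := h 1
  have h2 : max 0 (b - a - 1 / 8) ≤ 0 := h 2
  have h3 : max 0 (a - b - 1 / 8) ≤ 0 := h 3
  have h0' := (max_le_iff.1 h0).2
  have h1' := (max_le_iff.1 h1).2
  have h2' := (max_le_iff.1 h2).2
  have h3' := (max_le_iff.1 h3).2
  rcases le_total a b with hab | hab
  · rw [max_eq_right hab] at h0'; rw [min_eq_left hab] at h1'; linarith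
  · rw [max_eq_left hab] at h0'; rw [min_eq_right hab] at h1'; linarith
lemma cfun_dim (a b : ℝ) (T : Finset (Fin 4)) (hT : ∀ c ∈ T, 0 < cfun a b c) : T.card ≤ 3 := by
  by_contra h
  have hu : T = Finset.univ := by
    refine Finset.eq_univ_of_card T ?_
    have := Finset.card_le_univ T
    simp only [Fintype.card_fin] at *; omega
  subst hu
  have h2 : 0 < max 0 (b - a - 1 / 8) := hT 2 (Finset.mem_univ _)
  have h3 : 0 < max 0 (a - b - 1 / 8) := hT 3 (Finset.mem_univ _)
  have h2' := (lt_max_iff.1 h2).resolve_left (lt_irrefl _)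
  have h3' := (lt_max_iff.1 h3).resolve_left (lt_irrefl _)
  linarith

def cS (a b : ℝ) : ℝ := max (max (cfun a b 0) (cfun a b 1)) (max (cfun a b 2) (cfun a b 3))
lemma cS_le (a b : ℝ) (c : Fin 4) : cfun a b c ≤ cS a b := by
  unfold cS; fin_cases c <;> simp
lemma cS_pos (a b : ℝ) : 0 < cS a b := by
  obtain ⟨c, hc⟩ := cfun_cov a b
  exact hc.trans_le (cS_le a b c)
lemma cS_eq (a b : ℝ) : ∃ c, cfun a b c = cS a b := by
  unfold cS
  rcases max_choice (max (cfun a b 0) (cfun a b 1)) (max (cfun a b 2) (cfun a b 3)) with h | h <;> rw [h]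
  · rcases max_choice (cfun a b 0) (cfun a b 1) with h | h <;> rw [h] <;> exact ⟨_, rfl⟩
  · rcases max_choice (cfun a b 2) (cfun a b 3) with h | h <;> rw [h] <;> exact ⟨_, rfl⟩
def cN (c : Fin 4) (a b : ℝ) : ℝ := cfun a b c / cS a b
lemma cN_cont (c : Fin 4) : Continuous (fun p : ℝ × ℝ => cN c p.1 p.2) := by
  refine (cfun_cont c).div ?_ fun p => (cS_pos _ _).ne'
  exact ((cfun_cont 0).max (cfun_cont 1)).max ((cfun_cont 2).max (cfun_cont 3))
lemma cN_pos {c : Fin 4} {a b : ℝ} : 0 < cN c a b ↔ 0 < cfun a b c := div_pos_iff_of_pos_right (cS_pos a b)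
lemma cN_nn (c : Fin 4) (a b : ℝ) : 0 ≤ cN c a b := div_nonneg (cfun_nn _ _ _) (cS_pos a b).le
lemma cN_le (c : Fin 4) (a b : ℝ) : cN c a b ≤ 1 := div_le_one_of_le₀ (cS_le a b c) (cS_pos a b).le
lemma cN_cov (a b : ℝ) : ∃ c, cN c a b = 1 := by
  obtain ⟨c, hc⟩ := cS_eq a b
  exact ⟨c, by rw [cN, hc, div_self (cS_pos a b).ne']⟩
end

section

def xx (N : ℕ) (z : QQ) : ℝ := N * z.1
def yN (N g : ℕ) (z : QQ) : ℝ := N * yy g z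
def bb (N g : ℕ) (z : QQ) : ℝ := dI (yN N g z) * cl (2 * xx N z - 2)
def colQ (N g : ℕ) (c : Fin 4) (z : QQ) : ℝ := cN c (dI (xx N z)) (bb N g z)
def lx (N : ℕ) (c : Fin 4) (z : QQ) : ℤ := lab (nx c) (xx N z)
def ly (N g : ℕ) (c : Fin 4) (z : QQ) : ℤ := if lx N c z ≤ 3 then 0 else lab (ny c) (yN N g z)
def typ (N : ℕ) (i j : ℤ) : Fin 3 := if i < 2 * N then 0 else if (2 * N : ℤ) ∣ j then 1 else 2
def vpt (N g : ℕ) (i j : ℤ) : Mg g := prj g (dp g (i / (2 * N)) (j / (2 * N)))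
def kQ (N g : ℕ) (c : Fin 4) (z : QQ) : Fin 3 × Mg g := (typ N (lx N c z) (ly N g c z), vpt N g (lx N c z) (ly N g c z))

lemma xx_cont (N : ℕ) : Continuous (xx N) := by unfold xx; fun_prop
lemma yN_cont (N g : ℕ) : Continuous (yN N g) := by have := yy_cont g; unfold yN; fun_prop
lemma bb_cont (N g : ℕ) : Continuous (bb N g) := by
  have := xx_cont N
  exact (dI_cont.comp (yN_cont N g)).mul (cl_cont.comp (by fun_prop))
lemma colQ_cont (N g : ℕ) (c : Fin 4) : Continuous (colQ N g c) :=
  (cN_cont c).comp ((dI_cont.comp (xx_cont N)).prodMk (bb_cont N g))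

lemma colQ_inv (N g : ℕ) (c : Fin 4) {z w : QQ} (h : ReQ g z w) : colQ N g c z = colQ N g c w := by
  unfold colQ bb
  rcases h with ⟨h1, h2⟩ | ⟨h1, h2, h3⟩ | ⟨h1, h2, e, he, he3, hy1, hy2, hy⟩
  · have e1 : xx N z = 0 := by simp [xx, h1]
    have e2 : xx N w = 0 := by simp [xx, h2]
    rw [e1, e2, cl_le0 (by norm_num), mul_zero, mul_zero]
  · have e1 : xx N z = xx N w := by simp [xx, h1]
    have e2 : yN N g z = ((0 : ℤ) : ℝ) := by simp [yN, yy_0 g h2]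
    have e3 : yN N g w = ((N * (4 * g) : ℤ) : ℝ) := by simp [yN, yy_1 g h3]
    rw [e1, e2, e3, dI_int, dI_int]
  · have e1 : xx N z = xx N w := by simp [xx, h1, h2]
    have e2 : yN N g w = ((N * (2 * e + 3) : ℤ) : ℝ) - yN N g z := by unfold yN; rw [hy]; push_cast; ring
    rw [e1, e2, dI_refl]

section facts
variable {N g : ℕ} {c : Fin 4} {z : QQ}

lemma col_okx (h : 0 < colQ N g c z) : okL (nx c) (xx N z) := by
  have hb0 : 0 ≤ bb N g z := mul_nonneg (dI_nn _) (cl_nn _)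
  have hb1 : bb N g z ≤ 1 / 2 := (mul_le_of_le_one_right (dI_nn _) (cl_l1 _)).trans (dI_le _)
  exact (cfun_ok hb1 (dI_le _) hb0 (dI_nn _) (cN_pos.1 h)).1

lemma lx_near (h : 0 < colQ N g c z) : |2 * xx N z - lx N c z| < 1 := lab_near (col_okx h)

lemma col_oky (h : 0 < colQ N g c z) (hl : ¬ lx N c z ≤ 3) : okL (ny c) (yN N g z) := by
  have hb0 : 0 ≤ bb N g z := mul_nonneg (dI_nn _) (cl_nn _)
  have hb1 : bb N g z ≤ 1 / 2 := (mul_le_of_le_one_right (dI_nn _) (cl_l1 _)).trans (dI_le _)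
  have h1 := (cfun_ok hb1 (dI_le _) hb0 (dI_nn _) (cN_pos.1 h)).2
  have h2 := lx_near h
  rw [abs_lt] at h2
  have h3 : (4 : ℝ) ≤ lx N c z := by exact_mod_cast (show 4 ≤ lx N c z by omega)
  have e : bb N g z = dI (yN N g z) := by
    unfold bb; rw [cl_ge1 (by linarith), mul_one]
  rw [e] at h1
  exact h1

lemma ly_near (h : 0 < colQ N g c z) (hl : ¬ lx N c z ≤ 3) : |2 * yN N g z - ly N g c z| < 1 := by
  unfold ly; rw [if_neg hl]; exact lab_near (col_oky h hl)

lemma lx_bd (h : 0 < colQ N g c z) : 0 ≤ lx N c z ∧ lx N c z ≤ 2 * N := by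
  have h2 := lx_near h
  rw [abs_lt] at h2
  have z0 := z.1.2.1; have z1 := z.1.2.2
  have n0 : (0 : ℝ) ≤ N := Nat.cast_nonneg N
  have a1 : 0 ≤ xx N z := mul_nonneg n0 z0
  have a2 : xx N z ≤ N := by unfold xx; nlinarith
  have b1 : (-1 : ℝ) < lx N c z := by linarith
  have b2 : (lx N c z : ℝ) < 2 * N + 1 := by linarith
  have b3 : (-1 : ℤ) < lx N c z := by exact_mod_cast b1
  have b4 : lx N c z < 2 * N + 1 := by exact_mod_cast b2
  omega

lemma ly_bd (h : 0 < colQ N g c z) : 0 ≤ ly N g c z ∧ ly N g c z ≤ 8 * g * N := by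
  by_cases hl : lx N c z ≤ 3
  · unfold ly; rw [if_pos hl]; exact ⟨le_rfl, by positivity⟩
  have h2 := ly_near h hl
  rw [abs_lt] at h2
  obtain ⟨z0, z1⟩ := yy_mem g z
  have n0 : (0 : ℝ) ≤ N := Nat.cast_nonneg N
  have a1 : 0 ≤ yN N g z := mul_nonneg n0 z0
  have a2 : yN N g z ≤ N * (4 * g) := by unfold yN; nlinarith
  have b1 : (-1 : ℝ) < ly N g c z := by linarith
  have b2 : (ly N g c z : ℝ) < 8 * g * N + 1 := by linarith
  have b3 : (-1 : ℤ) < ly N g c z := by exact_mod_cast b1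
  have b4 : ly N g c z < 8 * g * N + 1 := by exact_mod_cast b2
  omega

lemma kQ_loc (h : 0 < colQ N g c z) : ∀ᶠ w in 𝓝 z, kQ N g c w = kQ N g c z := by
  have h1 : ∀ᶠ w in 𝓝 z, lx N c w = lx N c z := (xx_cont N).continuousAt.eventually (lab_loc (col_okx h))
  by_cases hl : lx N c z ≤ 3
  · filter_upwards [h1] with w hw
    have : ly N g c w = ly N g c z := by unfold ly; rw [hw, if_pos hl, if_pos hl]
    unfold kQ; rw [hw, this]
  · have h2 := (yN_cont N g).continuousAt.eventually (lab_loc (col_oky h hl))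
    filter_upwards [h1, h2] with w hw hw2
    have : ly N g c w = ly N g c z := by unfold ly; rw [hw, if_neg hl, if_neg hl, hw2]
    unfold kQ; rw [hw, this]

lemma kQ_inv (hg : 1 ≤ g) (hN : 2 ≤ N) {w : QQ} (hr : ReQ g z w) (h : 0 < colQ N g c z) : kQ N g c z = kQ N g c w := by
  have hw : 0 < colQ N g c w := by rw [← colQ_inv N g c hr]; exact h
  have hN0 : (N : ℝ) ≠ 0 := by positivity
  have hg0 : (g : ℝ) ≠ 0 := by positivity
  rcases hr with ⟨h1, h2⟩ | ⟨h1, h2, h3⟩ | ⟨h1, h2, e, he, he3, hy1, hy2, hy⟩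
  · have e1 : xx N z = ((0 : ℤ) : ℝ) := by simp [xx, h1]
    have e2 : xx N w = ((0 : ℤ) : ℝ) := by simp [xx, h2]
    have l1 : lx N c z = 0 := by
      have := col_okx h; rw [e1] at this
      unfold lx; rw [e1, lab_int this]; rfl
    have l2 : lx N c w = 0 := by unfold lx at *; rw [e1] at l1; rw [e2]; exact l1
    have l3 : ly N g c z = 0 := by unfold ly; rw [l1]; rfl
    have l4 : ly N g c w = 0 := by unfold ly; rw [l2]; rfl
    unfold kQ; rw [l1, l2, l3, l4]
  · have e1 : xx N z = xx N w := by simp [xx, h1]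
    have l1 : lx N c z = lx N c w := by unfold lx; rw [e1]
    by_cases hl : lx N c z ≤ 3
    · have : ly N g c w = ly N g c z := by unfold ly; rw [← l1, if_pos hl, if_pos hl]
      unfold kQ; rw [l1, this]
    · have e2 : yN N g z = ((0 : ℤ) : ℝ) := by simp [yN, yy_0 g h2]
      have e3 : yN N g w = ((N * (4 * g) : ℤ) : ℝ) := by simp [yN, yy_1 g h3]
      have o1 := col_oky h hl
      have o2 := col_oky hw (by rw [← l1]; exact hl)
      have l3 : ly N g c z = 0 := by
        unfold ly; rw [if_neg hl]
        rw [e2] at o1 ⊢; rw [lab_int o1]; rfl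
      have l4 : ly N g c w = 2 * N * (4 * g) := by
        unfold ly; rw [if_neg (by rw [← l1]; exact hl)]
        rw [e3] at o2 ⊢; rw [lab_int o2]; ring
      unfold kQ; rw [← l1, l3, l4]
      have t1 : typ N (lx N c z) 0 = typ N (lx N c z) (2 * N * (4 * g)) := by
        unfold typ
        rw [if_pos (dvd_zero (2 * N : ℤ)), if_pos (Dvd.intro _ rfl : (2 * N : ℤ) ∣ 2 * N * (4 * g))]
      rw [t1]
      congr 1
      unfold vpt
      congr 1
      apply Subtype.ext
      show _ * ex _ = _ * ex _
      congr 1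
      rw [ex_eq_iff]
      refine ⟨-1, ?_⟩
      push_cast; field_simp; ring
  · have e1 : xx N z = ((N : ℤ) : ℝ) := by simp [xx, h1]
    have e2 : xx N w = ((N : ℤ) : ℝ) := by simp [xx, h2]
    have l1 : lx N c z = 2 * N := by
      have := col_okx h; rw [e1] at this
      unfold lx; rw [e1, lab_int this]
    have l2 : lx N c w = 2 * N := by unfold lx at *; rw [e1] at l1; rw [e2]; exact l1
    have hl : ¬ lx N c z ≤ 3 := by rw [l1]; omega
    have o1 := col_oky h hl
    have e3 : yN N g w = ((N * (2 * e + 3) : ℤ) : ℝ) - yN N g z := by unfold yN; rw [hy]; push_cast; ring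
    have l4 : ly N g c w = 2 * N * (2 * e + 3) - ly N g c z := by
      unfold ly; rw [if_neg hl, if_neg (by rw [l2]; omega), e3, lab_refl o1]; ring
    have n1 := ly_near h hl
    rw [abs_lt] at n1
    have n0 : (0 : ℝ) < N := by positivity
    have y1 : (N : ℝ) * e ≤ yN N g z := by unfold yN; gcongr
    have y2 : yN N g z ≤ N * (e + 1) := by unfold yN; gcongr
    have b1 : (2 * N * e : ℝ) - 1 < ly N g c z := by linarith
    have b2 : (ly N g c z : ℝ) < 2 * N * (e + 1) + 1 := by linarith
    have b3 : 2 * (N : ℤ) * e - 1 < ly N g c z := by exact_mod_cast b1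
    have b4 : ly N g c z < 2 * (N : ℤ) * (e + 1) + 1 := by exact_mod_cast b2
    have b5 : ((2 * (N : ℤ) * e : ℤ) : ℝ) ≤ ly N g c z := by exact_mod_cast (show 2 * (N : ℤ) * e ≤ ly N g c z by omega)
    have b6 : (ly N g c z : ℝ) ≤ ((2 * (N : ℤ) * (e + 1) : ℤ) : ℝ) := by exact_mod_cast (show ly N g c z ≤ 2 * (N : ℤ) * (e + 1) by omega)
    push_cast at b5 b6
    unfold kQ; rw [l1, l2, l4]
    have t1 : typ N (2 * N) (ly N g c z) = typ N (2 * N) (2 * N * (2 * e + 3) - ly N g c z) := by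
      unfold typ
      have : ((2 * N : ℤ) ∣ 2 * N * (2 * e + 3) - ly N g c z) ↔ (2 * N : ℤ) ∣ ly N g c z := by
        rw [dvd_sub_right (Dvd.intro _ rfl)]
      simp only [this]
    rw [t1]
    congr 1
    unfold vpt
    have hone : (1 : ℝ) ≤ ((2 * N : ℤ) : ℝ) / (2 * N) := by push_cast; rw [div_self (by positivity)]
    rw [dp_one _ hone, dp_one _ hone, prj_refl hg he he3 (by rw [le_div_iff₀ (by positivity)]; linarith) (by rw [div_le_iff₀ (by positivity)]; linarith)]
    congr 3
    push_cast
    field_simp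

lemma kQ_ST (hN : 2 ≤ N) (h : 0 < colQ N g c z) : z ∈ STy g (typ N (lx N c z) (ly N g c z)) := by
  have n2 : (2 : ℝ) ≤ N := by exact_mod_cast hN
  have h1 := lx_near h
  rw [abs_lt] at h1
  unfold xx at h1
  unfold typ
  by_cases hl : lx N c z < 2 * N
  · rw [if_pos hl, STy0]
    have : (lx N c z : ℝ) ≤ 2 * N - 1 := by exact_mod_cast (show lx N c z ≤ 2 * N - 1 by omega)
    nlinarith
  · rw [if_neg hl]
    have e := lx_bd h
    have e1 : lx N c z = 2 * N := by omega
    have hl3 : ¬ lx N c z ≤ 3 := by omega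
    rw [e1] at h1
    push_cast at h1
    have z0 : (0 : ℝ) < z.1 := by nlinarith
    have h2 := ly_near h hl3
    rw [abs_lt] at h2
    unfold yN at h2
    split_ifs with hd
    · obtain ⟨m, hm⟩ := hd
      rw [hm] at h2
      push_cast at h2
      rw [STy1]
      refine ⟨z0, m, ?_⟩
      rw [abs_lt]; constructor <;> nlinarith
    · rw [STy2]
      refine ⟨z0, fun m hm => hd ⟨m, ?_⟩⟩
      rw [hm] at h2
      have a1 : (2 * N * m : ℝ) - 1 < ly N g c z := by linarith
      have a2 : (ly N g c z : ℝ) < 2 * N * m + 1 := by linarith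
      have a3 : 2 * (N : ℤ) * m - 1 < ly N g c z := by exact_mod_cast a1
      have a4 : ly N g c z < 2 * (N : ℤ) * m + 1 := by exact_mod_cast a2
      omega
end facts

lemma cl_lip (x y : ℝ) : |cl x - cl y| ≤ |x - y| := by
  unfold cl
  refine (abs_max_sub_max_le_max _ _ _ _).trans ?_
  rw [sub_self, abs_zero]
  refine max_le (abs_nonneg _) ?_
  refine (abs_min_sub_min_le_max _ _ _ _).trans ?_
  rw [sub_self, abs_zero]
  exact max_le le_rfl (abs_nonneg _)
lemma pw_lip (c : ℕ) (x y : ℝ) : |pw c x - pw c y| ≤ 2 * |x - y| := by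
  unfold pw
  have h1 := cl_lip (x - c) (y - c)
  have h2 := cl_lip (x - c - 2) (y - c - 2)
  have e1 : x - c - (y - c) = x - y := by ring
  have e2 : x - c - 2 - (y - c - 2) = x - y := by ring
  rw [e1] at h1; rw [e2] at h2
  rw [abs_le] at *
  constructor <;> linarith [h1.1, h1.2, h2.1, h2.2]
lemma pw_abs (c : ℕ) (x : ℝ) : |pw c x| ≤ 1 := by
  unfold pw
  have := cl_nn (x - c); have := cl_l1 (x - c); have := cl_nn (x - c - 2); have := cl_l1 (x - c - 2)
  rw [abs_le]; constructor <;> linarith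
end

section

def zL (N g : ℕ) (i j : ℤ) : QQ := (clI (i / (2 * N)), clI (j / (8 * g * N)))

section zLs
variable {N g : ℕ} {i j : ℤ}
lemma zL_1 (hN : 2 ≤ N) (h0 : 0 ≤ i) (h1 : i ≤ 2 * N) : ((zL N g i j).1 : ℝ) = i / (2 * N) := by
  have n0 : (0 : ℝ) < N := by positivity
  have a0 : (0 : ℝ) ≤ i := by exact_mod_cast h0
  have a1 : (i : ℝ) ≤ 2 * N := by exact_mod_cast h1
  exact cl_mid (by positivity) (by rw [div_le_one (by positivity)]; exact a1)
lemma zL_y (hg : 1 ≤ g) (hN : 2 ≤ N) (h0 : 0 ≤ j) (h1 : j ≤ 8 * g * N) : yy g (zL N g i j) = j / (2 * N) := by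
  have n0 : (0 : ℝ) < N := by positivity
  have g0 : (0 : ℝ) < g := by positivity
  have a0 : (0 : ℝ) ≤ j := by exact_mod_cast h0
  have a1 : (j : ℝ) ≤ 8 * g * N := by exact_mod_cast h1
  have : ((zL N g i j).2 : ℝ) = j / (8 * g * N) := cl_mid (by positivity) (by rw [div_le_one (by positivity)]; exact a1)
  unfold yy; rw [this]; field_simp; ring
lemma zL_PP (hg : 1 ≤ g) (hN : 2 ≤ N) (h0 : 0 ≤ i) (h1 : i ≤ 2 * N) (k0 : 0 ≤ j) (k1 : j ≤ 8 * g * N) : PP g (zL N g i j) = vpt N g i j := by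
  unfold PP vpt
  rw [polar_dp hg, zL_1 hN h0 h1, zL_y hg hN k0 k1]
lemma zL_ST (hg : 1 ≤ g) (hN : 2 ≤ N) (h0 : 0 ≤ i) (h1 : i ≤ 2 * N) (k0 : 0 ≤ j) (k1 : j ≤ 8 * g * N) : zL N g i j ∈ STy g (typ N i j) := by
  have n0 : (0 : ℝ) < N := by positivity
  unfold typ
  split_ifs with hi hd
  · rw [STy0, zL_1 hN h0 h1, div_lt_one (by positivity)]; exact_mod_cast hi
  · obtain rfl : i = 2 * N := by omega
    obtain ⟨m, rfl⟩ := hd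
    rw [STy1, zL_1 hN h0 h1, zL_y hg hN k0 k1]
    refine ⟨by push_cast; positivity, m, ?_⟩
    have : ((2 * N * m : ℤ) : ℝ) / (2 * N) - m = 0 := by push_cast; field_simp; ring
    rw [this]; norm_num
  · obtain rfl : i = 2 * N := by omega
    rw [STy2, zL_1 hN h0 h1, zL_y hg hN k0 k1]
    refine ⟨by push_cast; positivity, fun m hm => hd ⟨m, ?_⟩⟩
    rw [div_eq_iff (by positivity)] at hm
    have : (j : ℝ) = 2 * N * m := by rw [hm]; ring
    exact_mod_cast this

lemma mT_zL (hg : 1 ≤ g) (hN : 2 ≤ N) (h0 : 0 ≤ i) (h1 : i ≤ 2 * N) (k0 : 0 ≤ j) (k1 : j ≤ 8 * g * N) {z : QQ}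
    (hy : ¬ i ≤ 3 → |2 * yN N g z - j| < 1) : mT g (typ N i j) z = mT g (typ N i j) (zL N g i j) := by
  have n2 : (2 : ℝ) ≤ N := by exact_mod_cast hN
  unfold typ
  split_ifs with hi hd
  · rw [mT0, mT0]
  · have hy' := hy (by omega)
    obtain ⟨m, rfl⟩ := hd
    rw [mT1, mT1, zL_y hg hN k0 k1]
    have : ((2 * N * m : ℤ) : ℝ) / (2 * N) = m := by push_cast; field_simp
    rw [this, round_intCast]
    apply round_eq'
    unfold yN at hy'
    push_cast at hy'
    rw [abs_lt] at *
    constructor <;> nlinarith [hy'.1, hy'.2]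
  · have hy' := hy (by omega)
    rw [mT2, mT2, zL_y hg hN k0 k1]
    have hf : ⌊yy g z⌋ = ⌊(j : ℝ) / (2 * N)⌋ := by
      set m := ⌊(j : ℝ) / (2 * N)⌋ with hm
      have f1 : (m : ℝ) ≤ j / (2 * N) := Int.floor_le _
      have f2 : (j : ℝ) / (2 * N) < m + 1 := Int.lt_floor_add_one _
      rw [le_div_iff₀ (by positivity)] at f1
      rw [div_lt_iff₀ (by positivity)] at f2
      have f3 : m * (2 * N) ≤ j := by exact_mod_cast f1
      have f4 : j < (m + 1) * (2 * N) := by exact_mod_cast f2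
      have f5 : j ≠ m * (2 * N) := fun h => hd ⟨m, by rw [h]; ring⟩
      have f6 : ((m * (2 * N) + 1 : ℤ) : ℝ) ≤ j := by exact_mod_cast (show m * (2 * N) + 1 ≤ j by omega)
      have f7 : (j : ℝ) ≤ (((m + 1) * (2 * N) - 1 : ℤ) : ℝ) := by exact_mod_cast (show j ≤ (m + 1) * (2 * N) - 1 by omega)
      push_cast at f6 f7
      unfold yN at hy'
      rw [abs_lt] at hy'
      have n0 : (0 : ℝ) < N := by linarith
      refine Int.floor_eq_iff.2 ⟨?_, ?_⟩
      · by_contra hcon; push Not at hcon; nlinarith [mul_lt_mul_of_pos_left hcon n0]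
      · by_contra hcon; push Not at hcon; nlinarith [mul_le_mul_of_nonneg_left hcon n0.le]
    rw [hf]
end zLs

lemma pw_nn (c : ℕ) (x : ℝ) : 0 ≤ pw c x := by
  unfold pw cl
  have : min (x - c - 2) 1 ≤ min (x - c) 1 := min_le_min (by linarith) le_rfl
  have := max_le_max (le_refl (0 : ℝ)) this
  linarith

lemma lT_close {N g : ℕ} (hg : 1 ≤ g) (hN : 2 ≤ N) {c : Fin 4} {z : QQ} (h : 0 < colQ N g c z) (x : Fin g × Fin 2) :
    |lT g (typ N (lx N c z) (ly N g c z)) z x -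
      lT g (typ N (lx N c z) (ly N g c z)) (secQ g (vpt N g (lx N c z) (ly N g c z))) x| ≤ 2 / N := by
  obtain ⟨h0, h1⟩ := lx_bd h
  obtain ⟨k0, k1⟩ := ly_bd h
  have hm := mT_zL hg hN h0 h1 k0 k1 (z := z) (fun hl => ly_near h hl)
  have hs := sec_inv hg (STy_sat g _) (lT_inv g _) (zL_ST hg hN h0 h1 k0 k1)
  rw [zL_PP hg hN h0 h1 k0 k1] at hs
  rw [hs]
  have hx := lx_near h
  have hy := ly_near h
  unfold lT
  rw [← hm, zL_1 hN h0 h1, zL_y hg hN k0 k1]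
  have n0 : (0 : ℝ) < N := by positivity
  have z0 := z.1.2.1; have z1 := z.1.2.2
  set i := lx N c z with hi
  set j := ly N g c z
  have i0 : (0 : ℝ) ≤ i := by exact_mod_cast h0
  set A := pw (cc x) (yy g z)
  set B := pw (cc x) (j / (2 * N))
  set ρ : ℝ := (z.1).1
  have hA : |A| ≤ 1 := pw_abs _ _
  have hB : |B| ≤ 1 := pw_abs _ _
  have hL : |A - B| ≤ 2 * |yy g z - j / (2 * N)| := pw_lip _ _ _
  have e : ρ * A - pw (cc x) (mT g (typ N i j) z) - (i / (2 * N) * B - pw (cc x) (mT g (typ N i j) z)) = ρ * A - i / (2 * N) * B := by ring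
  rw [e]
  have hx1 : |ρ - i / (2 * N)| ≤ 1 / (2 * N) := by
    have : ρ - i / (2 * N) = (2 * xx N z - i) / (2 * N) := by unfold xx; field_simp; show z.1.1 * 2 * (N:ℝ) - i = 2 * N * z.1.1 - i; ring
    rw [this, abs_div, abs_of_pos (show (0 : ℝ) < 2 * N by positivity)]
    gcongr
  by_cases hl : i ≤ 3
  · have i3 : (i : ℝ) ≤ 3 := by exact_mod_cast hl
    rw [abs_le] at hx1
    set r : ℝ := i / (2 * N)
    have r0 : 0 ≤ r := by positivity
    have r1 : r ≤ 3 / (2 * N) := by unfold r; gcongr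
    have e3 : 3 / (2 * N : ℝ) + 1 / (2 * N) = 2 / N := by field_simp; norm_num
    rw [abs_le] at hA hB
    have : 0 < 1 / (2 * N : ℝ) := by positivity
    have q1 : ρ ≤ 2 / N := by linarith [hx1.2]
    have q2 : r ≤ 2 / N := by linarith
    -- both products lie in an interval of the right size; use the sign of the coordinates
    have hA0 : 0 ≤ A := pw_nn _ _
    have hB0 : 0 ≤ B := pw_nn _ _
    rw [abs_le]; constructor <;> nlinarith
  · have hy' := hy hl
    have hy1 : |yy g z - j / (2 * N)| ≤ 1 / (2 * N) := by
      have : yy g z - j / (2 * N) = (2 * yN N g z - j) / (2 * N) := by unfold yN; field_simp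
      rw [this, abs_div, abs_of_pos (show (0 : ℝ) < 2 * N by positivity)]
      gcongr
    have e2 : ρ * A - i / (2 * N) * B = (ρ - i / (2 * N)) * B + ρ * (A - B) := by ring
    rw [e2]
    calc _ ≤ |(ρ - i / (2 * N)) * B| + |ρ * (A - B)| := abs_add_le _ _
      _ = |ρ - i / (2 * N)| * |B| + ρ * |A - B| := by rw [abs_mul, abs_mul, abs_of_nonneg z0]
      _ ≤ 1 / (2 * N) * 1 + 1 * (2 * (1 / (2 * N))) := by
          have := abs_nonneg B; have := abs_nonneg (A - B)
          have h5 : |A - B| ≤ 2 * (1 / (2 * N)) := hL.trans (by linarith)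
          gcongr
      _ ≤ 2 / N := by
          have : 2 / (N : ℝ) - (1 / (2 * N) * 1 + 1 * (2 * (1 / (2 * N)))) = 1 / (2 * N) := by field_simp; norm_num
          have : 0 < 1 / (2 * N : ℝ) := by positivity
          linarith

section cover
variable {N g : ℕ}
def colM (N g : ℕ) (c : Fin 4) (x : Mg g) : ℝ := colQ N g c (secQ g x)
def kM (N g : ℕ) (c : Fin 4) (x : Mg g) : Fin 3 × Mg g := kQ N g c (secQ g x)
def RM (N g : ℕ) : Set (Fin 3 × Mg g) :=
  Set.range fun p : Fin 3 × Fin (2 * N + 1) × Fin (8 * g * N + 1) => (p.1, vpt N g (p.2.1.1 : ℤ) (p.2.2.1 : ℤ))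
instance : Finite (RM N g) := Set.finite_range _
instance : Fintype (RM N g) := Fintype.ofFinite _
instance : Nonempty (RM N g) := ⟨⟨_, (0, 0, 0), rfl⟩⟩

lemma cover_CD (hg : 1 ≤ g) (hN : 2 ≤ N) : CD (Fmk (colM N g) (kM N g) (RM N g)) 2 := by
  refine CD_mk (colM N g) ?_ (fun c x => cN_nn _ _ _) (fun c x => cN_le _ _ _) (fun x => cN_cov _ _) ?_ (kM N g) ?_ (RM N g) ?_
  · intro c
    have h := desc_cont1 hg (S := Set.univ) (fun _ _ _ => Iff.rfl) isOpen_univ (colQ N g c) (colQ_cont N g c).continuousOn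
      (fun z w h _ => colQ_inv N g c h)
    exact continuousOn_univ.1 (h.mono fun x _ => trivial)
  · intro x T hT
    exact cfun_dim _ _ T fun c hc => cN_pos.1 (hT c hc)
  · intro c x hx
    exact desc_const hg (S := {z | 0 < colQ N g c z}) (fun z w h => by simp only [Set.mem_setOf_eq]; rw [colQ_inv N g c h])
      (isOpen_lt continuous_const (colQ_cont N g c)) (kQ N g c) (fun z hz => kQ_loc hz) (fun z w h hz => kQ_inv hg hN h hz) x hx
  · intro c x hx
    obtain ⟨h0, h1⟩ := lx_bd hx
    obtain ⟨k0, k1⟩ := ly_bd hx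
    obtain ⟨i, hi⟩ := Int.eq_ofNat_of_zero_le h0
    obtain ⟨j, hj⟩ := Int.eq_ofNat_of_zero_le k0
    refine ⟨(typ N (lx N c (secQ g x)) (ly N g c (secQ g x)), ⟨i, by omega⟩, ⟨j, ?_⟩), ?_⟩
    · rw [hj] at k1
      have : j ≤ 8 * g * N := by exact_mod_cast k1
      omega
    · show (_, vpt N g (i : ℤ) (j : ℤ)) = kQ N g c (secQ g x)
      unfold kQ
      congr 1
      rw [hi, hj]

lemma cover_ST (hN : 2 ≤ N) (q : Fin 4 × RM N g) (x : Mg g) (h : 0 < Fmk (colM N g) (kM N g) (RM N g) q x) : secQ g x ∈ STy g q.2.1.1 := by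
  obtain ⟨h1, h2⟩ := Fmk_pos h
  rw [← h1]; exact kQ_ST hN h2

lemma cover_close (hg : 1 ≤ g) (hN : 2 ≤ N) (q : Fin 4 × RM N g) (x : Mg g) (h : 0 < Fmk (colM N g) (kM N g) (RM N g) q x) (e : Fin g × Fin 2) :
    |lT g q.2.1.1 (secQ g x) e - lT g q.2.1.1 (secQ g q.2.1.2) e| ≤ 2 / N := by
  obtain ⟨h1, h2⟩ := Fmk_pos h
  rw [← h1]; exact lT_close hg hN h2 e

theorem nw_small (hg : 1 ≤ g) (n : ℕ) : NW (spq fun _ : Fin n => bM g) (2 * n) := by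
  classical
  exact U1mk hg (cover_CD (N := 2) hg le_rfl) (fun q => q.2.1.1) (fun q x h => cover_ST le_rfl q x h)

theorem nw_large (hg : 1 ≤ g) (n : ℕ) (hn : 2 ≤ n) : NW (spq fun _ : Fin n => bM g) (n + g) := by
  classical
  have hN : 2 ≤ 8 * n + 8 := by omega
  refine UDmk hg hn (cover_CD (N := 8 * n + 8) hg hN) (fun q => q.2.1.1) (fun q x h => cover_ST hN q x h) ?_
  intro q x y hx hy e
  have h1 := cover_close hg hN q x hx e
  have h2 := cover_close hg hN q y hy e
  have h3 : |lT g q.2.1.1 (secQ g x) e - lT g q.2.1.1 (secQ g y) e| ≤ 4 / ((8 * n + 8 : ℕ) : ℝ) := by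
    have : 4 / ((8 * n + 8 : ℕ) : ℝ) = 2 / ((8 * n + 8 : ℕ) : ℝ) + 2 / ((8 * n + 8 : ℕ) : ℝ) := by ring
    rw [this]
    rw [abs_le] at *
    constructor <;> linarith [h1.1, h1.2, h2.1, h2.2]
  calc _ ≤ 4 / ((8 * n + 8 : ℕ) : ℝ) * (2 * n) := by gcongr
    _ < 1 := by
        push_cast
        rw [div_mul_eq_mul_div, div_lt_one (by positivity)]; linarith
end cover
end

section

lemma nw_sph (n : ℕ) : ∃ b : Sp 2, NW (spq fun _ : Fin n => b) (1 * n) := by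
  obtain ⟨v⟩ : Nonempty (Sp 2) := (NormedSpace.sphere_nonempty.2 zero_le_one).to_subtype
  have hn : ∀ y : Sp 2, ‖y.1‖ = 1 := fun y => mem_sphere_zero_iff_norm.1 y.2
  let w : Sp 2 := ⟨-v.1, by rw [mem_sphere_zero_iff_norm, norm_neg, hn]⟩
  have hpc : IsPathConnected (Metric.sphere (0 : EuclideanSpace ℝ (Fin (2 + 1))) 1) := by
    apply isPathConnected_sphere _ _ zero_le_one
    rw [← Module.finrank_eq_rank, finrank_euclideanSpace_fin]
    exact_mod_cast (by omega : 1 < 2 + 1)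
  haveI := isPathConnected_iff_pathConnectedSpace.1 hpc
  obtain ⟨γ⟩ := PathConnectedSpace.joined w v
  let F : Bool → Sp 2 → ℝ := fun q y => max 0 (min 1 (1 + (if q then 1 else -1) * inner ℝ y.1 v.1))
  have hN : ∀ q, NullOn v {y | 0 < F q y} := by
    intro q
    have hp : ∀ y, 0 < F q y → -1 < (if q then (1 : ℝ) else -1) * inner ℝ y.1 v.1 := by
      intro y hy
      simp only [F, lt_max_iff, lt_self_iff_false, false_or, lt_min_iff] at hy
      linarith [hy.2]
    cases q
    · refine NullOn.move ((sphere_null w).mono fun y hy => ?_) γ.extend γ.continuous_extend (by simp) (by simp)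
      show -1 < inner ℝ y.1 (-v.1)
      have := hp y hy
      simp at this
      rw [inner_neg_right]; linarith
    · refine (sphere_null v).mono fun y hy => ?_
      have := hp y hy
      simpa using this
  choose H Hc H0 H1 using hN
  have C : CD F 1 := by
    refine ⟨fun q => ?_, fun q x => le_max_left _ _, fun q x => max_le zero_le_one (min_le_left _ _), fun x => ?_, fun x T _ => ?_⟩
    · simp only [F]; fun_prop
    · rcases le_total 0 (inner ℝ x.1 v.1) with h | h
      · refine ⟨true, ?_⟩
        simp only [F, if_true]
        rw [min_eq_left (by linarith), max_eq_right zero_le_one]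
      · refine ⟨false, ?_⟩
        simp only [F]
        rw [min_eq_left (by simp; linarith), max_eq_right zero_le_one]
    · exact T.card_le_univ
  exact ⟨v, U1 C v H Hc (fun q x h => H0 q x h) (fun q x h => H1 q x h)⟩

lemma nw_zero (n : ℕ) : ∃ b : SP n (Mg 0), NW b n := by
  obtain ⟨b, h⟩ := nw_sph n
  rw [one_mul] at h
  exact ⟨_, h⟩

lemma nw_all (n g : ℕ) : ∃ b : SP n (Mg g), NW b (n + min n g) := by
  rcases Nat.eq_zero_or_pos g with rfl | hg
  · simpa using nw_zero n
  · by_cases h : n ≤ g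
    · rw [min_eq_left h, ← two_mul]
      exact ⟨_, nw_small hg n⟩
    · rw [min_eq_right (by omega)]
      exact ⟨_, nw_large hg n (by omega)⟩

lemma catLE_mono {X : Type*} [TopologicalSpace X] {r s : ℕ} (hrs : r ≤ s) (h : catLE X r) : catLE X s := by
  obtain ⟨U, ho, hc, hU⟩ := h
  refine ⟨fun i => U ⟨min i.1 r, by omega⟩, fun i => ho _, ?_, fun i => hU _⟩
  rw [Set.eq_univ_iff_forall] at hc ⊢
  intro x
  obtain ⟨i, hi⟩ := Set.mem_iUnion.1 (hc x)
  refine Set.mem_iUnion.2 ⟨⟨i.1, by omega⟩, ?_⟩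
  have : (⟨min i.1 r, by omega⟩ : Fin (r + 1)) = i := Fin.ext (min_eq_left (by omega))
  simpa only [this] using hi

lemma LScat_eq {X : Type*} [TopologicalSpace X] {m : ℕ} (h : catLE X m) (hl : ∀ r, r + 1 = m → ¬ catLE X r) : LScat X = m := by
  refine le_antisymm (sInf_le ⟨m, h, rfl⟩) (le_sInf ?_)
  rintro c ⟨r, hr, rfl⟩
  by_contra hh
  have hlt : r < m := by
    by_contra h2
    exact hh (by exact_mod_cast not_lt.1 h2)
  exact hl (m - 1) (by omega) (catLE_mono (by omega) hr)

theorem LScat_SP_orientableSurface_prod_sphere (n g k : ℕ) (hn : 1 ≤ n) (hk : 1 ≤ k) :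
    LScat (SP n (Mg g) × (Metric.sphere (0 : EuclideanSpace ℝ (Fin (k + 1))) 1)) = LScat (SP n (Mg g)) + 1 ∧
    LScat (SP n (Mg g) × (Metric.sphere (0 : EuclideanSpace ℝ (Fin (k + 1))) 1))
      = (if n ≤ g then ((2 * n + 1 : ℕ) : ℕ∞) else ((n + g + 1 : ℕ) : ℕ∞)) := by
  obtain ⟨b, h⟩ := nw_all n g
  have e1 : LScat (SP n (Mg g)) = ((n + min n g : ℕ) : ℕ∞) := LScat_eq h.catLE fun r hr => lb_plain n g r hr
  have e2 : LScat (SP n (Mg g) × (Metric.sphere (0 : EuclideanSpace ℝ (Fin (k + 1))) 1)) = ((n + min n g + 1 : ℕ) : ℕ∞) :=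
    LScat_eq (h.sphere k hk) fun r hr => by
      obtain rfl : r = n + min n g := by omega
      exact lb_sphere n g k hk
  refine ⟨by rw [e1, e2]; push_cast; rfl, ?_⟩
  rw [e2]
  split_ifs with hg
  · rw [min_eq_left hg, two_mul]
  · rw [min_eq_right (by omega)]

end

end
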